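/- Let n ≥ 2, p ∈ [2,∞), q ∈ [p,∞), s,t ∈ (0,1) with t ≤ s, 1/p' ≤ tq/(sp) ≤ 1, sp < n, and a measurable symmetric with 0 ≤ a ≤ M. Let ε < 1−s with ε ∈ (0, min{ s(tq/(sp) − 1/p'), s/p }), let η = (np+εp²)/(n+sp+εp), and let B = B_R(x₀) with R ≤ 1 and 𝓑 = B×B. Then there exists C depending only on n,p,q,s,t,M,‖u‖_{L^∞} such that for every bounded weak solution u ∈ W^{s,p}(ℝⁿ) ∩ L^∞(ℝⁿ) of the nonlocal double phase equation with data f and for every σ ∈ (0,1): ( ⨍_{(1/4)𝓑} G(x,y,U) dν )^{1/p} ≤ C ε^{−(1/η−1/p)} [ σ^{−1} ( ⨍_{𝓑} U^η dν )^{1/η} + σ Σ_{k=0}^∞ ( 2^{−k(sp/(p−1) − s − ε)} + 2^{−k(tq/(p−1) − s − ε)} ) ( ⨍_{2^k 𝓑} U^η dν )^{1/η} ] + C [ε ν(𝓑)]^{θ/(p−1)} ε^{−(1/p_* − 1/p')/(p−1)} [ ( ⨍_{𝓑} F^{p_*} dν )^{1/p_*} ]^{1/(p−1)}, where θ = (s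 − ε(p−1))/(n + εp) > 0. -/

import Mathlib

open MeasureTheory Metric Set
open scoped ENNReal

noncomputable section

/-- `ℝⁿ` as a Euclidean space. -/
abbrev En (n : ℕ) := EuclideanSpace ℝ (Fin n)

/-- The Hölder conjugate `p' = p/(p−1)`. -/
def pC (p : ℝ) : ℝ := p / (p - 1)

/-- The lower Sobolev exponent `p_* = np'/(n+sp')`. -/
def pStar (n : ℕ) (p s : ℝ) : ℝ := (n : ℝ) * pC p / ((n : ℝ) + s * pC p)

/-- The integrand `P(x,y,u)` of the double phase energy `ℰ(u,u)`:
`|u(x)−u(y)|^p/|x−y|^{n+sp} + a(x,y)|u(x)−u(y)|^q/|x−y|^{n+tq}`. -/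
def energyIntegrand (n : ℕ) (p q s t : ℝ) (a : En n × En n → ℝ) (u : En n → ℝ)
    (z : En n × En n) : ℝ :=
  |u z.1 - u z.2| ^ p / ‖z.1 - z.2‖ ^ ((n : ℝ) + s * p)
    + a z * |u z.1 - u z.2| ^ q / ‖z.1 - z.2‖ ^ ((n : ℝ) + t * q)

/-- The integrand of the double phase form `ℰ(u,φ)`. -/
def formIntegrand (n : ℕ) (p q s t : ℝ) (a : En n × En n → ℝ) (u φ : En n → ℝ)
    (z : En n × En n) : ℝ :=
  |u z.1 - u z.2| ^ (p - 2) * (u z.1 - u z.2) * (φ z.1 - φ z.2)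
      / ‖z.1 - z.2‖ ^ ((n : ℝ) + s * p)
    + a z * (|u z.1 - u z.2| ^ (q - 2) * (u z.1 - u z.2) * (φ z.1 - φ z.2))
        / ‖z.1 - z.2‖ ^ ((n : ℝ) + t * q)

/-- `u ∈ W^{s,p}(ℝⁿ)`: `u` is measurable, `u ∈ L^p(ℝⁿ)`, and the Gagliardo seminorm
`∬ |u(x)−u(y)|^p/|x−y|^{n+sp} dy dx` is finite. -/
def MemWsp (n : ℕ) (s p : ℝ) (u : En n → ℝ) : Prop :=
  Measurable u ∧ (∫⁻ x, ENNReal.ofReal (|u x| ^ p)) < ⊤ ∧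
    (∫⁻ z : En n × En n,
      ENNReal.ofReal (|u z.1 - u z.2| ^ p / ‖z.1 - z.2‖ ^ ((n : ℝ) + s * p))) < ⊤

/-- `u` is a bounded weak solution of `ℒu = f`: the double phase energy `ℰ(u,u)` is finite
and `ℰ(u,φ) = ∫ fφ` for every test function `φ ∈ C_c^∞(ℝⁿ)`. -/
def IsBoundedWeakSolution (n : ℕ) (p q s t : ℝ) (a : En n × En n → ℝ)
    (u f : En n → ℝ) : Prop :=
  (∫⁻ z : En n × En n, ENNReal.ofReal (energyIntegrand n p q s t a u z)) < ⊤ ∧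
  ∀ φ : En n → ℝ, ContDiff ℝ (⊤ : ℕ∞) φ → HasCompactSupport φ →
    (∫ z : En n × En n, formIntegrand n p q s t a u φ z) = ∫ x, f x * φ x

/-- The dual-pair measure `ν` on `ℝⁿ × ℝⁿ`, with density `|x−y|^{−(n−εp)}`. -/
def nu (n : ℕ) (p ε : ℝ) : Measure (En n × En n) :=
  volume.withDensity fun z => ENNReal.ofReal (‖z.1 - z.2‖ ^ (ε * p - n))

/-- The diagonal ball `𝓑(x₀,R) = B(x₀,R) × B(x₀,R) ⊂ ℝ^{2n}`. -/
def bB (n : ℕ) (x₀ : En n) (R : ℝ) : Set (En n × En n) := ball x₀ R ×ˢ ball x₀ R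

/-- The exponent `η = (np + εp²)/(n + sp + εp)`. -/
def etaEx (n : ℕ) (p s ε : ℝ) : ℝ := ((n : ℝ) * p + ε * p ^ 2) / ((n : ℝ) + s * p + ε * p)

/-- The exponent `γ = η/(p−1) = p'(n+εp)/(n+sp+εp)`. -/
def gammaEx (n : ℕ) (p s ε : ℝ) : ℝ :=
  pC p * (((n : ℝ) + ε * p) / ((n : ℝ) + s * p + ε * p))

/-- The exponent `θ = (s − ε(p−1))/(n + εp)`. -/
def thetaEx (n : ℕ) (p s ε : ℝ) : ℝ := (s - ε * (p - 1)) / ((n : ℝ) + ε * p)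

/-- `U(x,y) = |u(x)−u(y)|/|x−y|^{s+ε}`. -/
def Ufun (n : ℕ) (s ε : ℝ) (u : En n → ℝ) (z : En n × En n) : ℝ :=
  |u z.1 - u z.2| / ‖z.1 - z.2‖ ^ (s + ε)

/-- `A(x,y) = a(x,y)|x−y|^{(s−t)q+ε(q−p)}`. -/
def Afun (n : ℕ) (p q s t ε : ℝ) (a : En n × En n → ℝ) (z : En n × En n) : ℝ :=
  a z * ‖z.1 - z.2‖ ^ ((s - t) * q + ε * (q - p))

/-- `G(x,y,U) = U^p + A(x,y) U^q`. -/
def Gfun (n : ℕ) (p q s t ε : ℝ) (a : En n × En n → ℝ) (u : En n → ℝ)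
    (z : En n × En n) : ℝ :=
  Ufun n s ε u z ^ p + Afun n p q s t ε a z * Ufun n s ε u z ^ q

/-- `H(x,y,U) = G(x,y,U)^{(p−1)/p}`. -/
def Hfun (n : ℕ) (p q s t ε : ℝ) (a : En n × En n → ℝ) (u : En n → ℝ)
    (z : En n × En n) : ℝ :=
  Gfun n p q s t ε a u z ^ ((p - 1) / p)

/-- kernel `|x-y|^b` -/
def kk {n : ℕ} (b : ℝ) (x y : En n) : ℝ≥0∞ := ENNReal.ofReal (‖x - y‖ ^ b)

/-- volume of the unit ball -/
def m0 (n : ℕ) : ℝ := (volume (ball (0 : En n) 1)).toReal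

lemma m0_pos (n : ℕ) : 0 < m0 n :=
  ENNReal.toReal_pos (measure_ball_pos volume _ one_pos).ne' measure_ball_lt_top.ne

lemma vol_ball {n : ℕ} (x : En n) {r : ℝ} (hr : 0 < r) :
    volume (ball x r) = ENNReal.ofReal (m0 n * r ^ (n : ℝ)) := by
  rw [Measure.addHaar_ball_of_pos _ _ hr, m0, mul_comm, ENNReal.ofReal_mul ENNReal.toReal_nonneg,
    ENNReal.ofReal_toReal measure_ball_lt_top.ne, finrank_euclideanSpace_fin, Real.rpow_natCast]

lemma kk_comm {n : ℕ} (b : ℝ) (x y : En n) : kk b x y = kk b y x := by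
  simp only [kk, norm_sub_rev]

lemma kk_ne_top {n : ℕ} (b : ℝ) (x y : En n) : kk b x y ≠ ⊤ := ENNReal.ofReal_ne_top

@[fun_prop]
lemma kk_meas {n : ℕ} {α : Type*} [MeasurableSpace α] (b : ℝ) {f g : α → En n}
    (hf : Measurable f) (hg : Measurable g) : Measurable fun a => kk b (f a) (g a) := by
  unfold kk; fun_prop

lemma jensen {α : Type*} [MeasurableSpace α] (μ : Measure α) {f : α → ℝ≥0∞}
    (hf : AEMeasurable f μ) {r : ℝ} (hr : 1 ≤ r) :
    (∫⁻ x, f x ∂μ) ^ r ≤ μ univ ^ (r - 1) * ∫⁻ x, f x ^ r ∂μ := by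
  have hr0 : 0 < r := by linarith
  have h := ENNReal.lintegral_mul_norm_pow_le (μ := μ) (hf.pow_const r)
    (aemeasurable_const (b := (1 : ℝ≥0∞))) (p := 1 / r) (q := 1 - 1 / r) (by positivity)
    (by rw [sub_nonneg, div_le_one hr0]; exact hr) (by ring)
  simp only [← ENNReal.rpow_mul, mul_one_div_cancel hr0.ne', ENNReal.rpow_one,
    ENNReal.one_rpow, mul_one, lintegral_one] at h
  calc (∫⁻ x, f x ∂μ) ^ r ≤ ((∫⁻ a, f a ^ r ∂μ) ^ (1 / r) * μ univ ^ (1 - 1 / r)) ^ r := by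
        gcongr
    _ = _ := by
        rw [ENNReal.mul_rpow_of_nonneg _ _ hr0.le, ← ENNReal.rpow_mul, ← ENNReal.rpow_mul,
          one_div_mul_cancel hr0.ne', ENNReal.rpow_one, mul_comm, sub_mul,
          one_div_mul_cancel hr0.ne', one_mul]

lemma kk_integral_ball {n : ℕ} (hn : 1 ≤ n) (x : En n) {ρ β : ℝ} (hρ : 0 < ρ) (hβ : 0 < β) :
    ∫⁻ y in ball x ρ, kk (β - n) x y = ENNReal.ofReal (n * m0 n * ρ ^ β / β) := by
  have : NeZero n := ⟨by omega⟩
  have hnt : Nontrivial (En n) := inferInstance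
  have key : ∫⁻ y in ball x ρ, kk (β - n) x y
      = ∫⁻ y : En n, ENNReal.ofReal ((Ioo (0:ℝ) ρ).indicator (fun r => r ^ (β - n)) ‖y‖) := by
    rw [← lintegral_indicator measurableSet_ball]
    rw [← lintegral_add_right_eq_self _ x]
    apply lintegral_congr_ae
    have h2 : ∀ᵐ y : En n, y ≠ 0 := by
      simp [ae_iff, measure_singleton]
    filter_upwards [h2] with y hy
    simp only [indicator, mem_ball, mem_Ioo, norm_pos_iff, dist_eq_norm, kk]
    rw [add_sub_cancel_right, norm_sub_rev x (y + x), add_sub_cancel_right]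
    simp only [ne_eq, hy, not_false_eq_true, true_and]
    split_ifs <;> simp
  rw [key]
  have hint : IntegrableOn (fun r : ℝ => r ^ (n - 1) • (Ioo (0:ℝ) ρ).indicator (fun r => r ^ (β - n)) r) (Ioi 0) ∧
     ∫ r in Ioi (0:ℝ), r ^ (n - 1) • (Ioo (0:ℝ) ρ).indicator (fun r => r ^ (β - n)) r = ρ ^ β / β := by
    have e : (fun r : ℝ => r ^ (n - 1) • (Ioo (0:ℝ) ρ).indicator (fun r => r ^ (β - n)) r)
       = (Ioo (0:ℝ) ρ).indicator (fun r => r ^ (β - 1)) := by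
      ext r
      simp only [indicator]
      split_ifs with h
      · rw [smul_eq_mul, ← Real.rpow_natCast, ← Real.rpow_add h.1]
        congr 1
        rw [Nat.cast_sub hn]; simp
      · simp
    rw [e]
    constructor
    · apply IntegrableOn.integrable_indicator _ measurableSet_Ioo |>.integrableOn
      rw [intervalIntegral.integrableOn_Ioo_rpow_iff hρ]; linarith
    · rw [setIntegral_indicator measurableSet_Ioo]
      have : Ioi (0:ℝ) ∩ Ioo 0 ρ = Ioo 0 ρ := by ext; simp
      rw [this, ← integral_Ioc_eq_integral_Ioo, ← intervalIntegral.integral_of_le hρ.le,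
        integral_rpow (by left; linarith)]
      simp [Real.zero_rpow hβ.ne']
  rw [← ofReal_integral_eq_lintegral_ofReal]
  · rw [integral_fun_norm_addHaar volume (fun r => (Ioo (0:ℝ) ρ).indicator (fun r => r ^ (β - n)) r)]
    rw [finrank_euclideanSpace_fin, hint.2]
    congr 1
    simp only [smul_eq_mul, nsmul_eq_mul, m0, Measure.real]
    ring
  · rw [integrable_fun_norm_addHaar volume (f := fun r => (Ioo (0:ℝ) ρ).indicator (fun r => r ^ (β - n)) r)]
    rw [finrank_euclideanSpace_fin]; exact hint.1
  · refine Filter.Eventually.of_forall fun y => ?_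
    apply indicator_nonneg
    intro r hr
    exact Real.rpow_nonneg hr.1.le _

lemma kk_ext {n : ℕ} {b : ℝ} (hb : 0 < b) :
    ∫⁻ y in (ball (0 : En n) 1)ᶜ, kk (-(n + b)) 0 y < ⊤ := by
  have h := finite_integral_one_add_norm (E := En n) (μ := volume) (r := n + b)
    (by rw [finrank_euclideanSpace_fin]; linarith)
  calc ∫⁻ y in (ball (0 : En n) 1)ᶜ, kk (-(n + b)) 0 y
      ≤ ∫⁻ y in (ball (0 : En n) 1)ᶜ, ENNReal.ofReal (2 ^ (n + b : ℝ)) * ENNReal.ofReal ((1 + ‖y‖) ^ (-(n + b))) := by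
        apply setLIntegral_mono' measurableSet_ball.compl
        intro y hy
        have hy1 : 1 ≤ ‖y‖ := by simpa using hy
        rw [← ENNReal.ofReal_mul (by positivity)]
        apply ENNReal.ofReal_le_ofReal
        rw [zero_sub, norm_neg, Real.rpow_neg (by positivity), Real.rpow_neg (by positivity),
          ← div_eq_mul_inv, ← one_div, div_le_div_iff₀ (by positivity) (by positivity), one_mul,
          ← Real.mul_rpow (by positivity) (by positivity)]
        apply Real.rpow_le_rpow (by positivity) (by linarith) (by positivity)
    _ ≤ ∫⁻ y : En n, ENNReal.ofReal (2 ^ (n + b : ℝ)) * ENNReal.ofReal ((1 + ‖y‖) ^ (-(n + b))) :=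
        setLIntegral_le_lintegral _ _
    _ < ⊤ := by
        rw [lintegral_const_mul' _ _ ENNReal.ofReal_ne_top]
        exact ENNReal.mul_lt_top ENNReal.ofReal_lt_top h

lemma rpow_tsum_le {g : ℕ → ℝ≥0∞} {r : ℝ} (hr0 : 0 < r) (hr1 : r ≤ 1) :
    (∑' i, g i) ^ r ≤ ∑' i, g i ^ r := by
  have hfin : ∀ s : Finset ℕ, (∑ i ∈ s, g i) ^ r ≤ ∑ i ∈ s, g i ^ r := by
    intro s
    induction s using Finset.induction with
    | empty => simp [hr0]
    | insert a s ha ih =>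
      rw [Finset.sum_insert ha, Finset.sum_insert ha]
      exact (ENNReal.rpow_add_le_add_rpow _ _ hr0.le hr1).trans (by gcongr)
  have h1 : Filter.Tendsto (fun s : Finset ℕ => (∑ i ∈ s, g i) ^ r) Filter.atTop
      (nhds ((∑' i, g i) ^ r)) :=
    (ENNReal.continuous_rpow_const.tendsto _).comp ENNReal.summable.hasSum
  exact le_of_tendsto h1 (Filter.Eventually.of_forall fun s =>
    (hfin s).trans (ENNReal.sum_le_tsum s))

lemma mean_le {α : Type*} [MeasurableSpace α] {μ : Measure α} {f : α → ℝ≥0∞}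
    (hf : Measurable f) (D : Set α) (h0 : μ D ≠ 0) (ht : μ D ≠ ⊤) {r : ℝ} (hr : 1 ≤ r) :
    (μ D)⁻¹ * ∫⁻ x in D, f x ∂μ ≤ ((μ D)⁻¹ * ∫⁻ x in D, f x ^ r ∂μ) ^ (1 / r) := by
  have h := jensen ((μ D)⁻¹ • μ.restrict D) hf.aemeasurable hr
  simp only [lintegral_smul_measure, smul_eq_mul, Measure.smul_apply, Measure.restrict_apply_univ,
    ENNReal.inv_mul_cancel h0 ht, ENNReal.one_rpow, one_mul] at h
  rw [one_div, ENNReal.le_rpow_inv_iff (by linarith)]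
  exact h

lemma avgA {n : ℕ} {u : En n → ℝ} (hu : Measurable u) {D B : Set (En n)} (hD : MeasurableSet D)
    (hDB : D ⊆ B) {x : En n} {r η τ : ℝ} (hr : 0 < r) (hη : 1 ≤ η) (hτ : 0 ≤ τ)
    (hV : ENNReal.ofReal (m0 n * (r / 4) ^ (n : ℝ)) ≤ volume D) (ht : volume D ≠ ⊤)
    (hDr : ∀ y ∈ D, ‖x - y‖ ≤ r) :
    (volume D)⁻¹ * ∫⁻ y in D, ‖u x - u y‖ₑ ≤
      (ENNReal.ofReal (4 ^ (n : ℝ) / m0 n * r ^ (τ * η)) *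
        ∫⁻ y in B, ‖u x - u y‖ₑ ^ η * kk (-(n + τ * η)) x y) ^ (1 / η) := by
  have hm := m0_pos n
  have hV0 : volume D ≠ 0 := by
    refine ne_of_gt (lt_of_lt_of_le ?_ hV)
    rw [ENNReal.ofReal_pos]; positivity
  refine (mean_le (by fun_prop) D hV0 ht hη).trans ?_
  gcongr ?_ ^ _
  calc (volume D)⁻¹ * ∫⁻ y in D, ‖u x - u y‖ₑ ^ η
      ≤ (ENNReal.ofReal (m0 n * (r / 4) ^ (n : ℝ)))⁻¹ *
        ∫⁻ y in D, ENNReal.ofReal (r ^ (n + τ * η)) * (‖u x - u y‖ₑ ^ η * kk (-(n + τ * η)) x y) := by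
        gcongr ?_ * ?_
        · exact ENNReal.inv_le_inv.2 hV
        · apply setLIntegral_mono' hD
          intro y hy
          rcases eq_or_ne x y with rfl | hxy
          · simp [show (0:ℝ) < η by linarith]
          rw [mul_comm (‖u x - u y‖ₑ ^ η), ← mul_assoc]
          refine le_mul_of_one_le_left (by simp) ?_
          rw [kk, ← ENNReal.ofReal_mul (by positivity), ← ENNReal.ofReal_one]
          apply ENNReal.ofReal_le_ofReal
          have hxy' : 0 < ‖x - y‖ := norm_pos_iff.2 (sub_ne_zero.2 hxy)
          rw [Real.rpow_neg hxy'.le, ← div_eq_mul_inv, one_le_div (by positivity)]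
          exact Real.rpow_le_rpow hxy'.le (hDr y hy) (by positivity)
    _ ≤ _ := by
        rw [lintegral_const_mul' _ _ ENNReal.ofReal_ne_top, ← mul_assoc]
        gcongr ?_ * ?_
        · rw [← ENNReal.ofReal_inv_of_pos (by positivity), ← ENNReal.ofReal_mul (by positivity)]
          apply ENNReal.ofReal_le_ofReal
          apply le_of_eq
          rw [Real.rpow_add hr, Real.div_rpow hr.le (by norm_num)]
          field_simp
        · exact lintegral_mono_set hDB

lemma avgB {n : ℕ} {v : En n → ℝ} (hv : Measurable v) {D B : Set (En n)}
    (hDB : D ⊆ B) {r P : ℝ} (hr : 0 < r) (hP : 1 ≤ P)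
    (hV : ENNReal.ofReal (m0 n * (r / 4) ^ (n : ℝ)) ≤ volume D) (ht : volume D ≠ ⊤) :
    (volume D)⁻¹ * ∫⁻ y in D, ‖v y‖ₑ ≤
      (ENNReal.ofReal (4 ^ (n : ℝ) / m0 n * r ^ (-(n:ℝ))) * ∫⁻ y in B, ‖v y‖ₑ ^ P) ^ (1 / P) := by
  have hm := m0_pos n
  have hV0 : volume D ≠ 0 := by
    refine ne_of_gt (lt_of_lt_of_le ?_ hV)
    rw [ENNReal.ofReal_pos]; positivity
  refine (mean_le (by fun_prop) D hV0 ht hP).trans ?_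
  gcongr ?_ ^ _
  gcongr ?_ * ?_
  · refine (ENNReal.inv_le_inv.2 hV).trans ?_
    rw [← ENNReal.ofReal_inv_of_pos (by positivity)]
    apply ENNReal.ofReal_le_ofReal
    apply le_of_eq
    rw [Real.rpow_neg hr.le, Real.div_rpow hr.le (by norm_num)]
    field_simp
  · exact lintegral_mono_set hDB

lemma opt_real {N1 G V c n P η τ R : ℝ} (hn : 0 < n) (hN : 0 < N1) (hG : 0 ≤ G) (hV0 : 0 ≤ V)
    (hc : 1 ≤ c)
    (hη : 1 ≤ η) (hηP : η ≤ P) (hτ : 0 ≤ τ) (hrel : n / η = τ + n / P) (hR : 0 < R)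
    (h1 : ∀ r, 0 < r → r ≤ 2 * R → V ≤ c * r ^ τ * G + c * r ^ (-(n / P)) * N1)
    (h2 : V ≤ c * (2 * R) ^ τ * G) :
    V ^ P ≤ (2 * c) ^ P * (G ^ η * N1 ^ (P - η)) := by
  have hP : 1 ≤ P := hη.trans hηP
  have hη0 : 0 < η := by linarith
  have hP0 : 0 < P := by linarith
  rcases hG.eq_or_lt with rfl | hG
  · have : V = 0 := by
      apply le_antisymm _ hV0; simpa using h2
    rw [this, Real.zero_rpow hP0.ne', Real.zero_rpow hη0.ne']; simp
  set r := (N1 / G) ^ (η / n) with hr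
  have hr0 : 0 < r := by positivity
  have hτ' : τ = n / η - n / P := by linarith
  have e1 : (r ^ τ * G) ^ P = G ^ η * N1 ^ (P - η) := by
    rw [Real.mul_rpow (by positivity) hG.le, hr, ← Real.rpow_mul (by positivity),
      ← Real.rpow_mul (by positivity), Real.div_rpow hN.le hG.le]
    have : η / n * (τ * P) = P - η := by rw [hτ']; field_simp
    rw [this, Real.rpow_sub hG]
    field_simp
  have e2 : r ^ (-(n / P)) * N1 = r ^ τ * G := by
    have : r ^ τ = r ^ (n / η) * r ^ (-(n/P)) := by rw [← Real.rpow_add hr0]; congr 1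
    rw [this]
    have : r ^ (n / η) = N1 / G := by
      rw [hr, ← Real.rpow_mul (by positivity)]
      have : η / n * (n / η) = 1 := by field_simp
      rw [this, Real.rpow_one]
    rw [this]; field_simp
  have hb : V ≤ 2 * c * (r ^ τ * G) := by
    rcases le_total r (2 * R) with h | h
    · have := h1 r hr0 h
      rw [mul_assoc c (r ^ (-(n / P))), e2] at this
      linarith
    · have h3 : (2 * R) ^ τ ≤ r ^ τ := Real.rpow_le_rpow (by positivity) h hτ
      have : c * (2 * R) ^ τ * G ≤ c * r ^ τ * G := by gcongr
      have h5 : 0 ≤ c * r ^ τ * G := by positivity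
      linarith
  calc V ^ P ≤ (2 * c * (r ^ τ * G)) ^ P := Real.rpow_le_rpow hV0 hb hP0.le
    _ = _ := by rw [Real.mul_rpow (by positivity) (by positivity), e1]

/-- local seminorm -/
def gag {n : ℕ} (u : En n → ℝ) (η b : ℝ) (B : Set (En n)) : ℝ≥0∞ :=
  ∫⁻ x in B, ∫⁻ y in B, ‖u x - u y‖ₑ ^ η * kk b x y

lemma bdd_intOn {n : ℕ} {u : En n → ℝ} (hu : Measurable u) {Λ : ℝ} (hb : ∀ x, |u x| ≤ Λ)
    {B : Set (En n)} (ht : volume B ≠ ⊤) : IntegrableOn u B := by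
  refine Measure.integrableOn_of_bounded (M := Λ) ht hu.aestronglyMeasurable ?_
  exact Filter.Eventually.of_forall fun x => by simpa using hb x

lemma sub_av_le {n : ℕ} {u : En n → ℝ} (hu : Measurable u) {Λ : ℝ} (hb : ∀ x, |u x| ≤ Λ)
    {B : Set (En n)} (h0 : volume B ≠ 0) (ht : volume B ≠ ⊤) (c : ℝ) :
    ‖c - ⨍ y in B, u y‖ₑ ≤ (volume B)⁻¹ * ∫⁻ y in B, ‖c - u y‖ₑ := by
  have hfm : IsFiniteMeasure (volume.restrict B) := ⟨by simpa using ht.lt_top⟩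
  have : c - ⨍ y in B, u y = ⨍ y in B, (c - u y) := by
    rw [setAverage_eq, setAverage_eq, integral_sub (by exact integrable_const c) (bdd_intOn hu hb ht)]
    rw [setIntegral_const, smul_sub, smul_smul]
    congr 1
    rw [inv_mul_cancel₀]
    · simp
    · exact (ENNReal.toReal_pos h0 ht).ne'
  rw [this, average_eq']
  refine (enorm_integral_le_lintegral_enorm _).trans ?_
  simp

lemma const_le_avg {n : ℕ} {u v : En n → ℝ} (hu : Measurable u) (hv : Measurable v) {x : En n}
    {D : Set (En n)} (h0 : volume D ≠ 0) (ht : volume D ≠ ⊤) (huv : ∀ y, v x - v y = u x - u y) :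
    ‖v x‖ₑ ≤ (volume D)⁻¹ * (∫⁻ y in D, ‖u x - u y‖ₑ) + (volume D)⁻¹ * ∫⁻ y in D, ‖v y‖ₑ := by
  rw [← mul_add, ← lintegral_add_left (by fun_prop)]
  calc ‖v x‖ₑ = (volume D)⁻¹ * ∫⁻ y in D, ‖v x‖ₑ := by
        rw [setLIntegral_const, mul_comm ‖v x‖ₑ, ← mul_assoc, ENNReal.inv_mul_cancel h0 ht, one_mul]
    _ ≤ _ := by
        gcongr with y
        rw [← huv y]
        calc ‖v x‖ₑ = ‖(v x - v y) + v y‖ₑ := by ring_nf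
          _ ≤ _ := enorm_add_le _ _

lemma enn_root {c r G n P : ℝ} (hc : 0 ≤ c) (hr : 0 < r) {g : ℝ≥0∞} (hg : g ≠ ⊤) {P : ℝ} (hP : 1 ≤ P)
    (e : ℝ) :
    (ENNReal.ofReal (c * r ^ e) * g) ^ (1 / P) ≤
      ENNReal.ofReal (max 1 c * r ^ (e / P) * g.toReal ^ (1 / P)) := by
  have hP0 : 0 < P := by linarith
  rw [← ENNReal.ofReal_toReal hg, ← ENNReal.ofReal_mul (by positivity),
    ENNReal.ofReal_rpow_of_nonneg (by positivity) (by positivity)]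
  apply ENNReal.ofReal_le_ofReal
  rw [Real.mul_rpow (by positivity) (by positivity), Real.mul_rpow hc (by positivity),
    ← Real.rpow_mul hr.le, mul_one_div]
  simp only [ENNReal.toReal_ofReal ENNReal.toReal_nonneg]
  gcongr
  calc c ^ (1 / P) ≤ (max 1 c) ^ (1 / P) := by gcongr; exact le_max_right _ _
    _ ≤ (max 1 c) ^ (1:ℝ) := by
      apply Real.rpow_le_rpow_of_exponent_le (le_max_left _ _)
      rw [div_le_one hP0]; exact hP
    _ = _ := Real.rpow_one _

lemma sp_ball {n : ℕ} {x₀ x : En n} {R r : ℝ} (hR : 0 < R) (hr : 0 < r) (hr2 : r ≤ 2 * R)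
    (hx : x ∈ ball x₀ R) : ∃ x', ball x' (r / 4) ⊆ ball x₀ R ∧ ∀ y ∈ ball x' (r / 4), ‖x - y‖ ≤ r := by
  have hx' : ‖x - x₀‖ < R := by rwa [mem_ball, dist_eq_norm] at hx
  have hq : r / (4 * R) ≤ 1 / 2 := by rw [div_le_div_iff₀ (by positivity) (by positivity)]; linarith
  have hq0 : 0 < r / (4 * R) := by positivity
  refine ⟨x - (r / (4 * R)) • (x - x₀), ?_, ?_⟩
  · apply ball_subset_ball'
    rw [dist_eq_norm]
    have : x - (r / (4 * R)) • (x - x₀) - x₀ = (1 - r / (4 * R)) • (x - x₀) := by module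
    rw [this, norm_smul, Real.norm_eq_abs, abs_of_nonneg (by linarith)]
    have : (1 - r / (4 * R)) * ‖x - x₀‖ ≤ (1 - r / (4 * R)) * R := by
      apply mul_le_mul_of_nonneg_left hx'.le; linarith
    have e : (1 - r / (4 * R)) * R = R - r / 4 := by field_simp
    linarith
  · intro y hy
    rw [mem_ball, dist_eq_norm] at hy
    have e : x - y = -(y - (x - (r / (4 * R)) • (x - x₀))) + (r / (4 * R)) • (x - x₀) := by module
    rw [e]
    refine (norm_add_le _ _).trans ?_
    rw [norm_neg, norm_smul, Real.norm_eq_abs, abs_of_pos hq0]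
    have : r / (4 * R) * ‖x - x₀‖ ≤ r / (4 * R) * R := mul_le_mul_of_nonneg_left hx'.le hq0.le
    have e : r / (4 * R) * R = r / 4 := by field_simp
    linarith

theorem SP (n : ℕ) (hn : 1 ≤ n) (P : ℝ) (hP : 1 ≤ P) :
    ∃ C : ℝ, 1 ≤ C ∧ ∀ (η τ : ℝ), 1 ≤ η → η ≤ P → 0 ≤ τ → (n : ℝ) / η = τ + n / P →
      ∀ (u : En n → ℝ), Measurable u → ∀ Λ : ℝ, (∀ x, |u x| ≤ Λ) → ∀ (x₀ : En n) (R : ℝ), 0 < R →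
      ∫⁻ x in ball x₀ R, ‖u x - ⨍ y in ball x₀ R, u y‖ₑ ^ P ≤
        ENNReal.ofReal C * (gag u η (-(n + τ * η)) (ball x₀ R)) ^ (P / η) := by
  set c : ℝ := max 1 (4 ^ (n : ℝ) / m0 n) with hc
  have hm := m0_pos n
  have hc1 : 1 ≤ c := le_max_left _ _
  have hP0 : 0 < P := by linarith
  refine ⟨((2 * c) ^ P) ^ P, ?_, ?_⟩
  · apply Real.one_le_rpow _ hP0.le
    apply Real.one_le_rpow _ hP0.le
    linarith
  intro η τ hη hηP hτ hrel u hu Λ hb x₀ R hR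
  have hη0 : 0 < η := by linarith
  have hn0 : (0:ℝ) < n := by exact_mod_cast hn
  set B := ball x₀ R with hB
  set ub := ⨍ y in B, u y with hub
  set v : En n → ℝ := fun x => u x - ub with hv
  have hvm : Measurable v := by fun_prop
  have hvB : volume B = ENNReal.ofReal (m0 n * R ^ (n : ℝ)) := vol_ball x₀ hR
  have hB0 : volume B ≠ 0 := (measure_ball_pos volume _ hR).ne'
  have hBt : volume B ≠ ⊤ := measure_ball_lt_top.ne
  set N := ∫⁻ x in B, ‖v x‖ₑ ^ P with hN
  change N ≤ _
  have hNt : N ≠ ⊤ := by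
    refine ne_of_lt (lt_of_le_of_lt (b := ∫⁻ x in B, ENNReal.ofReal (Λ + |ub|) ^ P) ?_ ?_)
    · apply lintegral_mono; intro x
      simp only
      gcongr
      rw [Real.enorm_eq_ofReal_abs]
      apply ENNReal.ofReal_le_ofReal
      exact (abs_sub _ _).trans (by linarith [hb x])
    · rw [setLIntegral_const]
      exact ENNReal.mul_lt_top (ENNReal.rpow_lt_top_of_nonneg hP0.le ENNReal.ofReal_ne_top) hBt.lt_top
  rcases eq_or_ne N 0 with hN0 | hN0
  · rw [hN0]; exact zero_le
  set N1 : ℝ := N.toReal ^ (1 / P) with hN1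
  have hNr : 0 < N.toReal := ENNReal.toReal_pos hN0 hNt
  have hN1p : 0 < N1 := by positivity
  set g : En n → ℝ≥0∞ := fun x => ∫⁻ y in B, ‖u x - u y‖ₑ ^ η * kk (-(n + τ * η)) x y with hg
  have hgm : Measurable g := by
    apply Measurable.lintegral_prod_right'
      (f := fun z : En n × En n => ‖u z.1 - u z.2‖ₑ ^ η * kk (-(n + τ * η)) z.1 z.2)
    fun_prop
  have hpt : ∀ x ∈ B, ‖v x‖ₑ ^ P ≤ ENNReal.ofReal ((2 * c) ^ P * N.toReal ^ (1 - η / P)) * g x := by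
    intro x hx
    rcases eq_or_ne (g x) ⊤ with hgt | hgt
    · rw [hgt, ENNReal.mul_top]
      · exact le_top
      · apply ne_of_gt; rw [ENNReal.ofReal_pos]; positivity
    have hcc : (0:ℝ) ≤ 4 ^ (n : ℝ) / m0 n := by positivity
    have key := opt_real (N1 := N1) (G := (g x).toReal ^ (1 / η)) (V := |v x|) (c := c) (n := n)
      (P := P) (η := η) (τ := τ) (R := R) hn0 hN1p (by positivity) (abs_nonneg _) hc1 hη hηP hτ hrel hR
      ?_ ?_
    · have e1 : ((g x).toReal ^ (1 / η)) ^ η = (g x).toReal := by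
        rw [← Real.rpow_mul ENNReal.toReal_nonneg, one_div_mul_cancel hη0.ne', Real.rpow_one]
      have e2 : N1 ^ (P - η) = N.toReal ^ (1 - η / P) := by
        rw [hN1, ← Real.rpow_mul ENNReal.toReal_nonneg]
        congr 1; field_simp
      rw [e1, e2] at key
      rw [Real.enorm_eq_ofReal_abs, ENNReal.ofReal_rpow_of_nonneg (abs_nonneg _) hP0.le]
      rw [← ENNReal.ofReal_toReal hgt, ← ENNReal.ofReal_mul (by positivity)]
      apply ENNReal.ofReal_le_ofReal
      refine key.trans (le_of_eq ?_)
      ring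
    · intro r hr hr2
      obtain ⟨x', hD1, hD2⟩ := sp_ball hR hr hr2 hx
      have hVD : volume (ball x' (r / 4)) = ENNReal.ofReal (m0 n * (r / 4) ^ (n : ℝ)) :=
        vol_ball x' (by positivity)
      have hD0 : volume (ball x' (r / 4)) ≠ 0 := (measure_ball_pos volume _ (by positivity)).ne'
      have hDt : volume (ball x' (r / 4)) ≠ ⊤ := measure_ball_lt_top.ne
      have h := const_le_avg hu hvm (x := x) hD0 hDt (by intro y; simp [hv])
      have hA := avgA hu measurableSet_ball hD1 (x := x) (η := η) (τ := τ) hr hη hτ hVD.ge hDt hD2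
      have hB' := avgB hvm hD1 hr hP hVD.ge hDt
      have hA' := hA.trans (enn_root (G := 0) (n := 0) (P := 0) hcc hr hgt hη (τ * η))
      have hB'' := hB'.trans (enn_root (G := 0) (n := 0) (P := 0) hcc hr hNt hP (-(n:ℝ)))
      have hh := h.trans (add_le_add hA' hB'')
      rw [← ENNReal.ofReal_add (by positivity) (by positivity), Real.enorm_eq_ofReal_abs,
        ENNReal.ofReal_le_ofReal_iff (by positivity), mul_div_cancel_right₀ _ hη0.ne', neg_div] at hh
      exact hh
    · have h := sub_av_le hu hb hB0 hBt (u x)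
      have hle : ENNReal.ofReal (m0 n * (2 * R / 4) ^ (n : ℝ)) ≤ volume B := by
        rw [hvB]
        apply ENNReal.ofReal_le_ofReal
        gcongr; linarith
      have hA := avgA hu measurableSet_ball (subset_refl B) (x := x) (r := 2 * R) (η := η) (τ := τ)
        (by positivity) hη hτ hle hBt (by
          intro y hy
          rw [← dist_eq_norm]
          have h1 := mem_ball.1 hx
          have h2 := mem_ball.1 hy
          have := dist_triangle_right x y x₀
          linarith)
      have hA' := (h.trans hA).trans (enn_root (G := 0) (n := 0) (P := 0) hcc (by positivity) hgt hη (τ * η))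
      rw [Real.enorm_eq_ofReal_abs,
        ENNReal.ofReal_le_ofReal_iff (by positivity), mul_div_cancel_right₀ _ hη0.ne'] at hA'
      exact hA'
  have hI : N ≤ ENNReal.ofReal ((2 * c) ^ P * N.toReal ^ (1 - η / P)) *
      gag u η (-(n + τ * η)) B := by
    rw [gag, ← lintegral_const_mul _ hgm]
    exact setLIntegral_mono' measurableSet_ball hpt
  set I := gag u η (-(n + τ * η)) B with hIdef
  rcases eq_or_ne I ⊤ with hIt | hIt
  · rw [hIt, ENNReal.top_rpow_of_pos (by positivity), ENNReal.mul_top]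
    · exact le_top
    · apply ne_of_gt; rw [ENNReal.ofReal_pos]; positivity
  have hreal : N.toReal ≤ (2 * c) ^ P * N.toReal ^ (1 - η / P) * I.toReal := by
    rw [← ENNReal.ofReal_toReal hNt, ← ENNReal.ofReal_toReal hIt, ← ENNReal.ofReal_mul (by simp; positivity)] at hI
    rw [ENNReal.ofReal_le_ofReal_iff (by simp; positivity)] at hI
    simpa using hI
  have h2 : N.toReal ^ (η / P) ≤ (2 * c) ^ P * I.toReal := by
    have e : N.toReal = N.toReal ^ (η / P) * N.toReal ^ (1 - η / P) := by
      rw [← Real.rpow_add hNr]; simp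
    have hp : 0 < N.toReal ^ (1 - η / P) := by positivity
    rw [← mul_le_mul_iff_left₀ hp, ← e]
    linarith
  have h3 : N.toReal ≤ ((2 * c) ^ P) ^ (P / η) * I.toReal ^ (P / η) := by
    rw [← Real.mul_rpow (by positivity) ENNReal.toReal_nonneg]
    have := Real.rpow_le_rpow (by positivity) h2 (z := P / η) (by positivity)
    rw [← Real.rpow_mul hNr.le] at this
    have e : η / P * (P / η) = 1 := by field_simp
    rwa [e, Real.rpow_one] at this
  rw [← ENNReal.ofReal_toReal hNt, ← ENNReal.ofReal_toReal hIt,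
    ENNReal.ofReal_rpow_of_nonneg ENNReal.toReal_nonneg (by positivity), ← ENNReal.ofReal_mul (by positivity)]
  apply ENNReal.ofReal_le_ofReal
  refine h3.trans ?_
  gcongr ?_ * _
  apply Real.rpow_le_rpow_of_exponent_le
  · exact Real.one_le_rpow (by linarith) hP0.le
  · exact div_le_self hP0.le hη

lemma pow_sub_le {α β : ℝ} (m : ℕ) (hβ : 0 ≤ β) (hab : β ≤ α) :
    α ^ m - β ^ m ≤ m * α ^ (m - 1) * (α - β) := by
  have h := Commute.geom_sum₂_mul (Commute.all α β) m
  rw [← h]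
  refine mul_le_mul_of_nonneg_right ?_ (by linarith)
  calc ∑ i ∈ Finset.range m, α ^ i * β ^ (m - 1 - i) ≤ ∑ i ∈ Finset.range m, α ^ (m - 1) := by
        apply Finset.sum_le_sum
        intro i hi
        have hi' : i ≤ m - 1 := by have := Finset.mem_range.1 hi; omega
        calc α ^ i * β ^ (m - 1 - i) ≤ α ^ i * α ^ (m - 1 - i) := by
              have : 0 ≤ α := hβ.trans hab
              gcongr
          _ = α ^ (m - 1) := by rw [← pow_add]; congr 1; omega
    _ = _ := by simp

lemma cacc_aux {a b α β r : ℝ} {m : ℕ} (hr : 2 ≤ r) (hm : r ≤ m) (hβ : 0 ≤ β) (hab : β ≤ α)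
    (hα : α ≤ 1) :
    1 / 2 * |a - b| ^ r * α ^ m - 2 ^ (r - 1) * (m : ℝ) ^ r * (|a| + |b|) ^ r * |α - β| ^ r ≤
    |a - b| ^ (r - 2) * (a - b) * (a * α ^ m - b * β ^ m) := by
  have hα0 : 0 ≤ α := hβ.trans hab
  have hm1 : 1 ≤ m := by
    have : (2:ℝ) ≤ m := hr.trans hm
    have : 2 ≤ m := by exact_mod_cast this
    omega
  set D := |a - b| with hD
  have hD0 : 0 ≤ D := abs_nonneg _
  have e1 : D ^ (r - 2) * (a - b) * (a - b) = D ^ r := by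
    rw [mul_assoc, ← abs_mul_abs_self (a - b), ← hD]
    rcases hD0.eq_or_lt with h | h
    · rw [← h, Real.zero_rpow (by linarith : r ≠ 0)]; simp
    · rw [← sq, ← Real.rpow_natCast, ← Real.rpow_add h]; congr 1; push_cast; ring
  have e2 : D ^ (r - 2) * D = D ^ (r - 1) := by
    rcases hD0.eq_or_lt with h | h
    · rw [← h, Real.zero_rpow (by linarith : r - 1 ≠ 0)]; simp
    · nth_rewrite 2 [← Real.rpow_one D]
      rw [← Real.rpow_add h]; congr 1; ring
  set Y := m * |b| * (α - β) with hY
  have hY0 : 0 ≤ Y := by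
    have : 0 ≤ α - β := by linarith
    positivity
  have hsplit : D ^ (r - 2) * (a - b) * (a * α ^ m - b * β ^ m)
      = D ^ r * α ^ m + D ^ (r - 2) * (a - b) * (b * (α ^ m - β ^ m)) := by
    rw [← e1]; ring
  have hcross : |D ^ (r - 2) * (a - b) * (b * (α ^ m - β ^ m))| ≤ D ^ (r - 1) * α ^ (m - 1) * Y := by
    rw [abs_mul, abs_mul, abs_mul, ← hD, abs_of_nonneg (Real.rpow_nonneg hD0 _), e2,
      abs_of_nonneg (sub_nonneg.2 (pow_le_pow_left₀ hβ hab m))]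
    have := pow_sub_le m hβ hab
    calc D ^ (r - 1) * (|b| * (α ^ m - β ^ m)) ≤ D ^ (r - 1) * (|b| * (m * α ^ (m - 1) * (α - β))) := by
          gcongr
      _ = _ := by rw [hY]; ring
  have hyoung : D ^ (r - 1) * α ^ (m - 1) * Y ≤ 1 / 2 * D ^ r * α ^ m + 2 ^ (r - 1) * Y ^ r := by
    have hpm : α ^ (m - 1) * α = α ^ m := by rw [← pow_succ]; congr 1; omega
    have hDr : D ^ (r - 1) * D = D ^ r := by
      rcases hD0.eq_or_lt with h | h
      · rw [← h, Real.zero_rpow (by linarith : r ≠ 0)]; simp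
      · nth_rewrite 2 [← Real.rpow_one D]
        rw [← Real.rpow_add h]; congr 1; ring
    rcases le_total Y (1 / 2 * (D * α)) with h | h
    · have h0 : 0 ≤ 2 ^ (r - 1) * Y ^ r := by positivity
      calc D ^ (r - 1) * α ^ (m - 1) * Y ≤ D ^ (r - 1) * α ^ (m - 1) * (1 / 2 * (D * α)) := by gcongr
        _ = 1 / 2 * (D ^ (r - 1) * D) * (α ^ (m - 1) * α) := by ring
        _ = 1 / 2 * D ^ r * α ^ m := by rw [hpm, hDr]
        _ ≤ _ := by linarith
    · have h0 : 0 ≤ 1 / 2 * D ^ r * α ^ m := by positivity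
      have h3 : α ^ (m - 1) ≤ α ^ (r - 1) := by
        rcases hα0.eq_or_lt with h | h
        · rw [← h, Real.zero_rpow (by linarith), zero_pow]
          have : (2:ℝ) ≤ m := hr.trans hm
          have : 2 ≤ m := by exact_mod_cast this
          omega
        · rw [← Real.rpow_natCast]
          apply Real.rpow_le_rpow_of_exponent_ge h hα
          rw [Nat.cast_sub hm1]; simpa using hm
      calc D ^ (r - 1) * α ^ (m - 1) * Y ≤ D ^ (r - 1) * α ^ (r - 1) * Y := by gcongr
        _ = (D * α) ^ (r - 1) * Y := by rw [Real.mul_rpow hD0 hα0]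
        _ ≤ (2 * Y) ^ (r - 1) * Y := by
            gcongr ?_ * _
            apply Real.rpow_le_rpow (by positivity) (by linarith) (by linarith)
        _ = 2 ^ (r - 1) * Y ^ r := by
            rw [Real.mul_rpow (by norm_num) hY0, mul_assoc]
            congr 1
            rcases hY0.eq_or_lt with h | h
            · rw [← h, Real.zero_rpow (by linarith : r ≠ 0)]; simp
            · nth_rewrite 2 [← Real.rpow_one Y]
              rw [← Real.rpow_add h]; congr 1; ring
        _ ≤ _ := by linarith
  have hYr : Y ^ r ≤ (m : ℝ) ^ r * (|a| + |b|) ^ r * |α - β| ^ r := by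
    rw [hY, Real.mul_rpow (by positivity) (by linarith), Real.mul_rpow (by positivity) (by positivity),
      abs_of_nonneg (by linarith : 0 ≤ α - β)]
    gcongr
    linarith [abs_nonneg a]
  have h5 := neg_abs_le (D ^ (r - 2) * (a - b) * (b * (α ^ m - β ^ m)))
  have h6 : 2 ^ (r - 1) * Y ^ r ≤ 2 ^ (r - 1) * ((m : ℝ) ^ r * (|a| + |b|) ^ r * |α - β| ^ r) := by gcongr
  rw [hsplit]
  linarith

lemma cacc {a b α β r : ℝ} {m : ℕ} (hr : 2 ≤ r) (hm : r ≤ m) (hβ : 0 ≤ β) (hα0 : 0 ≤ α)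
    (hα : α ≤ 1) (hβ1 : β ≤ 1) :
    1 / 2 * |a - b| ^ r * max α β ^ m - 2 ^ (r - 1) * (m : ℝ) ^ r * (|a| + |b|) ^ r * |α - β| ^ r ≤
    |a - b| ^ (r - 2) * (a - b) * (a * α ^ m - b * β ^ m) := by
  rcases le_total β α with h | h
  · rw [max_eq_left h]; exact cacc_aux hr hm hβ h hα
  · rw [max_eq_right h]
    have := cacc_aux (a := b) (b := a) hr hm hα0 h hβ1
    rw [abs_sub_comm b a, abs_sub_comm β α, add_comm |b| |a|] at this
    refine this.trans (le_of_eq ?_)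
    ring

/-- product difference bound -/
lemma prod_sub_le {a b α β : ℝ} {m : ℕ} (hβ : 0 ≤ β) (hα0 : 0 ≤ α) :
    |a * α ^ m - b * β ^ m| ≤ |a - b| * max α β ^ m + m * (|a| + |b|) * max α β ^ (m - 1) * |α - β| := by
  have aux : ∀ {a b α β : ℝ}, 0 ≤ β → β ≤ α → |a * α ^ m - b * β ^ m| ≤
      |a - b| * α ^ m + m * (|a| + |b|) * α ^ (m - 1) * |α - β| := by
    intro a b α β hβ h
    have hα0 : 0 ≤ α := hβ.trans h
    have e : a * α ^ m - b * β ^ m = (a - b) * α ^ m + b * (α ^ m - β ^ m) := by ring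
    rw [e]
    refine (abs_add_le _ _).trans ?_
    rw [abs_mul, abs_mul, abs_of_nonneg (pow_nonneg hα0 m),
      abs_of_nonneg (sub_nonneg.2 (pow_le_pow_left₀ hβ h m)), abs_of_nonneg (sub_nonneg.2 h)]
    have h1 := pow_sub_le m hβ h
    have h2 : |b| * (α ^ m - β ^ m) ≤ (|a| + |b|) * (m * α ^ (m - 1) * (α - β)) := by
      apply mul_le_mul _ h1 (sub_nonneg.2 (pow_le_pow_left₀ hβ h m)) (by positivity)
      linarith [abs_nonneg a]
    nlinarith
  rcases le_total β α with h | h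
  · rw [max_eq_left h]; exact aux hβ h
  · rw [max_eq_right h]
    have := aux (a := b) (b := a) hα0 h
    rw [abs_sub_comm b a, abs_sub_comm β α, add_comm |b| |a|, abs_sub_comm (b * β ^ m)] at this
    exact this

/-- the flux -/
def Wf (n : ℕ) (p q s t : ℝ) (a : En n × En n → ℝ) (u : En n → ℝ) (z : En n × En n) : ℝ :=
  |u z.1 - u z.2| ^ (p - 2) * (u z.1 - u z.2) / ‖z.1 - z.2‖ ^ ((n : ℝ) + s * p)
    + a z * (|u z.1 - u z.2| ^ (q - 2) * (u z.1 - u z.2)) / ‖z.1 - z.2‖ ^ ((n : ℝ) + t * q)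

lemma form_eq (n : ℕ) (p q s t : ℝ) (a : En n × En n → ℝ) (u φ : En n → ℝ) (z : En n × En n) :
    formIntegrand n p q s t a u φ z = Wf n p q s t a u z * (φ z.1 - φ z.2) := by
  simp only [formIntegrand, Wf]; ring

structure Par (n : ℕ) (p q s t M Λ : ℝ) : Prop where
  hn : 2 ≤ n
  hp : 2 ≤ p
  hpq : p ≤ q
  hs0 : 0 < s
  hs1 : s < 1
  ht0 : 0 < t
  ht1 : t < 1
  htq : t * q ≤ s * p
  hspn : s * p < n
  hM : 0 ≤ M
  hΛ : 0 ≤ Λ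

structure Sol (n : ℕ) (p q s t M Λ : ℝ) (a : En n × En n → ℝ) (u f : En n → ℝ) : Prop where
  am : Measurable a
  a0 : ∀ z, 0 ≤ a z
  aM : ∀ z, a z ≤ M
  asym : ∀ x y, a (x, y) = a (y, x)
  um : Measurable u
  ub : ∀ x, |u x| ≤ Λ
  fm : Measurable f
  ff : ∫⁻ x in ball (0 : En n) 1, ‖f x‖ₑ ^ pStar n p s < ⊤
  fi : IntegrableOn f (ball (0 : En n) 1)
  gf : ∫⁻ z : En n × En n, ‖u z.1 - u z.2‖ₑ ^ p * kk (-(n + s * p)) z.1 z.2 < ⊤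
  ef : ∫⁻ z : En n × En n, ENNReal.ofReal (energyIntegrand n p q s t a u z) < ⊤
  weak : ∀ φ : En n → ℝ, ContDiff ℝ (⊤ : ℕ∞) φ → HasCompactSupport φ →
    (∫ z : En n × En n, formIntegrand n p q s t a u φ z) = ∫ x, f x * φ x

lemma rp_mul {D : ℝ} (hD : 0 ≤ D) {r : ℝ} (hr : 0 < r) : D ^ (r - 1) * D = D ^ r := by
  rcases hD.eq_or_lt with h | h
  · rw [← h, Real.zero_rpow hr.ne']; simp
  · nth_rewrite 2 [← Real.rpow_one D]
    rw [← Real.rpow_add h]; congr 1; ring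

lemma Wf_meas {n : ℕ} {p q s t : ℝ} {a : En n × En n → ℝ} {u : En n → ℝ} (ha : Measurable a)
    (hu : Measurable u) : Measurable (Wf n p q s t a u) := by
  unfold Wf; fun_prop

lemma Wf_anti {n : ℕ} {p q s t : ℝ} {a : En n × En n → ℝ} {u : En n → ℝ}
    (ha : ∀ x y, a (x, y) = a (y, x)) (x y : En n) :
    Wf n p q s t a u (y, x) = - Wf n p q s t a u (x, y) := by
  simp only [Wf, ha y x, abs_sub_comm (u y), norm_sub_rev y]; ring

lemma Wf_abs {n : ℕ} {p q s t M Λ : ℝ} (H : Par n p q s t M Λ) {a : En n × En n → ℝ} {u : En n → ℝ}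
    (a0 : ∀ z, 0 ≤ a z) (z : En n × En n) :
    |Wf n p q s t a u z| ≤ |u z.1 - u z.2| ^ (p - 1) * ‖z.1 - z.2‖ ^ (-((n : ℝ) + s * p)) +
      a z * |u z.1 - u z.2| ^ (q - 1) * ‖z.1 - z.2‖ ^ (-((n : ℝ) + t * q)) := by
  have hp := H.hp
  have hpq := H.hpq
  unfold Wf
  refine (abs_add_le _ _).trans ?_
  have e : ∀ r : ℝ, 2 ≤ r → |(|u z.1 - u z.2| ^ (r - 2) * (u z.1 - u z.2))| = |u z.1 - u z.2| ^ (r - 1) := by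
    intro r hr
    rw [abs_mul, abs_of_nonneg (Real.rpow_nonneg (abs_nonneg _) _),
      ← rp_mul (abs_nonneg _) (by linarith : 0 < r - 1)]
    congr 2; ring
  rw [abs_div, abs_div, abs_mul (a z), e p hp, e q (by linarith), abs_of_nonneg (a0 z),
    abs_of_nonneg (Real.rpow_nonneg (norm_nonneg _) _), abs_of_nonneg (Real.rpow_nonneg (norm_nonneg _) _),
    Real.rpow_neg (norm_nonneg _), Real.rpow_neg (norm_nonneg _), ← div_eq_mul_inv, ← div_eq_mul_inv]

lemma du_le {n : ℕ} {Λ : ℝ} {u : En n → ℝ} (hb : ∀ x, |u x| ≤ Λ) (x y : En n) :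
    |u x - u y| ≤ 2 * Λ := (abs_sub _ _).trans (by linarith [hb x, hb y])

lemma rpow_exp_le {D L a b : ℝ} (hD : 0 ≤ D) (hDL : D ≤ L) (ha : 0 < a) (hab : a ≤ b) :
    D ^ b ≤ L ^ (b - a) * D ^ a := by
  rcases hD.eq_or_lt with h | h
  · rw [← h, Real.zero_rpow ha.ne', Real.zero_rpow (by linarith)]; simp
  · have : D ^ b = D ^ (b - a) * D ^ a := by rw [← Real.rpow_add h]; congr 1; ring
    rw [this]
    gcongr

lemma Wf_near {n : ℕ} {p q s t M Λ : ℝ} (H : Par n p q s t M Λ) {a : En n × En n → ℝ} {u : En n → ℝ}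
    (a0 : ∀ z, 0 ≤ a z) (aM : ∀ z, a z ≤ M) (ub : ∀ x, |u x| ≤ Λ) (z : En n × En n)
    (hz : ‖z.1 - z.2‖ ≤ 2) :
    |Wf n p q s t a u z| ≤ (1 + M * (2 * Λ) ^ (q - p) * 2 ^ (s * p - t * q)) *
      (|u z.1 - u z.2| ^ (p - 1) * ‖z.1 - z.2‖ ^ (-((n : ℝ) + s * p))) := by
  have hp := H.hp
  have hpq := H.hpq
  have hM := H.hM
  have hΛ := H.hΛ
  have htq := H.htq
  refine (Wf_abs H a0 z).trans ?_
  rw [add_mul, one_mul]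
  gcongr ?_ + ?_
  · exact le_rfl
  rcases eq_or_ne z.1 z.2 with h | h
  · rw [h]; simp [show p - 1 ≠ 0 by linarith, show q - 1 ≠ 0 by linarith]
  have hd : 0 < ‖z.1 - z.2‖ := norm_pos_iff.2 (sub_ne_zero.2 h)
  have h1 : |u z.1 - u z.2| ^ (q - 1) ≤ (2 * Λ) ^ (q - p) * |u z.1 - u z.2| ^ (p - 1) := by
    have := rpow_exp_le (abs_nonneg _) (du_le ub z.1 z.2) (a := p - 1) (b := q - 1) (by linarith) (by linarith)
    convert this using 3; ring
  have h2 : ‖z.1 - z.2‖ ^ (-((n : ℝ) + t * q)) ≤ 2 ^ (s * p - t * q) * ‖z.1 - z.2‖ ^ (-((n : ℝ) + s * p)) := by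
    have : ‖z.1 - z.2‖ ^ (-((n : ℝ) + t * q)) = ‖z.1 - z.2‖ ^ (s * p - t * q) * ‖z.1 - z.2‖ ^ (-((n : ℝ) + s * p)) := by
      rw [← Real.rpow_add hd]; congr 1; ring
    rw [this]
    gcongr
  calc _ ≤ M * ((2 * Λ) ^ (q - p) * |u z.1 - u z.2| ^ (p - 1)) *
      (2 ^ (s * p - t * q) * ‖z.1 - z.2‖ ^ (-((n : ℝ) + s * p))) := by
        gcongr; exact aM z
    _ = _ := by ring

lemma two_pow_add {a b r : ℝ} (ha : 0 ≤ a) (hb : 0 ≤ b) (hr : 0 ≤ r) :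
    (a + b) ^ r ≤ 2 ^ r * (a ^ r + b ^ r) := by
  rcases le_total a b with h | h
  · calc (a + b) ^ r ≤ (2 * b) ^ r := Real.rpow_le_rpow (by positivity) (by linarith) hr
      _ = 2 ^ r * b ^ r := Real.mul_rpow (by norm_num) hb
      _ ≤ _ := by gcongr; linarith [Real.rpow_nonneg ha r]
  · calc (a + b) ^ r ≤ (2 * a) ^ r := Real.rpow_le_rpow (by positivity) (by linarith) hr
      _ = 2 ^ r * a ^ r := Real.mul_rpow (by norm_num) ha
      _ ≤ _ := by gcongr; linarith [Real.rpow_nonneg hb r]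

/-- constant in the far estimate -/
def Cfar (n : ℕ) (p q s t M Λ : ℝ) : ℝ :=
  2 ^ (p - 1) * (4 ^ ((n : ℝ) + s * p) + M * (2 * Λ) ^ (q - p) * 4 ^ ((n : ℝ) + t * q))

lemma Wf_far {n : ℕ} {p q s t M Λ : ℝ} (H : Par n p q s t M Λ) {a : En n × En n → ℝ} {u : En n → ℝ}
    (a0 : ∀ z, 0 ≤ a z) (aM : ∀ z, a z ≤ M) (ub : ∀ x, |u x| ≤ Λ) (c : ℝ) (x y : En n)
    (hx : ‖x‖ ≤ 3 / 4) (hy : 1 ≤ ‖y‖) :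
    |Wf n p q s t a u (x, y)| ≤ Cfar n p q s t M Λ *
      ((|u x - c| ^ (p - 1) + |u y - c| ^ (p - 1)) * ‖y‖ ^ (-((n : ℝ) + t * q))) := by
  have hp := H.hp
  have hpq := H.hpq
  have hM := H.hM
  have hΛ := H.hΛ
  have htq := H.htq
  have ht0 := H.ht0
  have hs0 := H.hs0
  have hq0 : 0 < q := by linarith
  refine (Wf_abs H a0 (x, y)).trans ?_
  simp only
  have hd : ‖y‖ / 4 ≤ ‖x - y‖ := by
    have := norm_sub_norm_le y x
    rw [norm_sub_rev] at this
    linarith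
  have hy0 : 0 < ‖y‖ := by linarith
  have hk : ∀ e : ℝ, 0 ≤ e → ‖x - y‖ ^ (-e) ≤ 4 ^ e * ‖y‖ ^ (-e) := by
    intro e he
    calc ‖x - y‖ ^ (-e) ≤ (‖y‖ / 4) ^ (-e) := Real.rpow_le_rpow_of_nonpos (by positivity) hd (by linarith)
      _ = _ := by rw [Real.div_rpow hy0.le (by norm_num), Real.rpow_neg (by norm_num : (0:ℝ) ≤ 4)]; field_simp
  have h1 : |u x - u y| ^ (q - 1) ≤ (2 * Λ) ^ (q - p) * |u x - u y| ^ (p - 1) := by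
    have := rpow_exp_le (abs_nonneg _) (du_le ub x y) (a := p - 1) (b := q - 1) (by linarith) (by linarith)
    convert this using 3; ring
  have h2 : |u x - u y| ^ (p - 1) ≤ 2 ^ (p - 1) * (|u x - c| ^ (p - 1) + |u y - c| ^ (p - 1)) := by
    refine le_trans ?_ (two_pow_add (abs_nonneg _) (abs_nonneg _) (by linarith))
    apply Real.rpow_le_rpow (abs_nonneg _) _ (by linarith)
    have : u x - u y = (u x - c) - (u y - c) := by ring
    rw [this]; exact abs_sub _ _
  have h3 : ‖x - y‖ ^ (-((n : ℝ) + s * p)) ≤ 4 ^ ((n : ℝ) + s * p) * ‖y‖ ^ (-((n : ℝ) + t * q)) := by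
    refine (hk _ (by positivity)).trans ?_
    gcongr
  have h4 := hk ((n : ℝ) + t * q) (by positivity)
  calc _ ≤ |u x - u y| ^ (p - 1) * (4 ^ ((n : ℝ) + s * p) * ‖y‖ ^ (-((n : ℝ) + t * q))) +
      M * ((2 * Λ) ^ (q - p) * |u x - u y| ^ (p - 1)) * (4 ^ ((n : ℝ) + t * q) * ‖y‖ ^ (-((n : ℝ) + t * q))) := by
        gcongr; exact aM _
    _ = |u x - u y| ^ (p - 1) * ((4 ^ ((n : ℝ) + s * p) + M * (2 * Λ) ^ (q - p) * 4 ^ ((n : ℝ) + t * q))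
          * ‖y‖ ^ (-((n : ℝ) + t * q))) := by ring
    _ ≤ (2 ^ (p - 1) * (|u x - c| ^ (p - 1) + |u y - c| ^ (p - 1))) * ((4 ^ ((n : ℝ) + s * p) + M * (2 * Λ) ^ (q - p) * 4 ^ ((n : ℝ) + t * q))
          * ‖y‖ ^ (-((n : ℝ) + t * q))) := by gcongr
    _ = _ := by rw [Cfar]; ring

/-- uniform kernel bound -/
lemma kk_min {n : ℕ} (hn : 1 ≤ n) {r b : ℝ} (hb : 0 < b) (hbr : b < r) :
    ∃ C : ℝ≥0∞, C < ⊤ ∧ ∀ x : En n, ∫⁻ y, ENNReal.ofReal (min 1 ‖x - y‖ ^ r) * kk (-(n + b)) x y ≤ C := by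
  refine ⟨ENNReal.ofReal (n * m0 n * 1 ^ (r - b) / (r - b)) + ∫⁻ y in (ball (0 : En n) 1)ᶜ, kk (-(n + b)) 0 y,
    ENNReal.add_lt_top.2 ⟨ENNReal.ofReal_lt_top, kk_ext hb⟩, ?_⟩
  intro x
  rw [← lintegral_add_compl _ (measurableSet_ball (x := x) (ε := 1))]
  gcongr ?_ + ?_
  · rw [← kk_integral_ball hn x one_pos (by linarith : 0 < r - b)]
    apply setLIntegral_mono' measurableSet_ball
    intro y hy
    rw [kk, kk, ← ENNReal.ofReal_mul (by positivity)]
    apply ENNReal.ofReal_le_ofReal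
    rcases eq_or_ne x y with h | h
    · rw [h]; simp [show r ≠ 0 by linarith]; positivity
    have hd : 0 < ‖x - y‖ := norm_pos_iff.2 (sub_ne_zero.2 h)
    rw [mem_ball, dist_eq_norm, norm_sub_rev] at hy
    rw [min_eq_right hy.le, ← Real.rpow_add hd]
    apply le_of_eq; congr 1; ring
  · calc ∫⁻ y in (ball x 1)ᶜ, ENNReal.ofReal (min 1 ‖x - y‖ ^ r) * kk (-(n + b)) x y
        ≤ ∫⁻ y in (ball x 1)ᶜ, kk (-(n + b)) x y := by
          apply lintegral_mono
          intro y
          refine mul_le_of_le_one_left (by simp) ?_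
          rw [← ENNReal.ofReal_one]
          apply ENNReal.ofReal_le_ofReal
          exact Real.rpow_le_one (by positivity) (min_le_left _ _) (by linarith)
      _ = ∫⁻ y in (ball (0 : En n) 1)ᶜ, kk (-(n + b)) 0 y := by
          rw [← lintegral_indicator measurableSet_ball.compl, ← lintegral_indicator measurableSet_ball.compl,
            ← lintegral_add_right_eq_self _ x]
          apply lintegral_congr
          intro y
          simp only [indicator, mem_compl_iff, mem_ball, dist_eq_norm, kk, sub_zero, zero_sub, norm_neg,
            add_sub_cancel_right]
          rw [norm_sub_rev x, add_sub_cancel_right]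
      _ ≤ _ := le_rfl

lemma gagfin {n : ℕ} (hn : 1 ≤ n) {φ : En n → ℝ} (hm : Measurable φ) {L ρ : ℝ}
    (hL : ∀ x y, |φ x - φ y| ≤ L * min 1 ‖x - y‖) (hz : ∀ x, x ∉ ball (0 : En n) ρ → φ x = 0)
    {r b : ℝ} (hb : 0 < b) (hbr : b < r) :
    ∫⁻ z : En n × En n, ‖φ z.1 - φ z.2‖ₑ ^ r * kk (-(n + b)) z.1 z.2 < ⊤ := by
  obtain ⟨C, hC, hk⟩ := kk_min hn (n := n) hb hbr
  have hr0 : 0 < r := by linarith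
  set F : En n × En n → ℝ≥0∞ := fun z => ENNReal.ofReal (min 1 ‖z.1 - z.2‖ ^ r) * kk (-(n + b)) z.1 z.2
  have hFm : Measurable F := by fun_prop
  have hFs : ∀ z : En n × En n, F z.swap = F z := by
    intro z; simp only [F, Prod.fst_swap, Prod.snd_swap, norm_sub_rev z.2, kk_comm _ z.2]
  set G : En n × En n → ℝ≥0∞ := fun z => (ball (0 : En n) ρ).indicator 1 z.1 * F z
  have hGm : Measurable G := by
    apply Measurable.mul _ hFm
    exact (measurable_one.indicator measurableSet_ball).comp measurable_fst
  have hG : ∫⁻ z, G z < ⊤ := by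
    rw [Measure.volume_eq_prod, lintegral_prod _ hGm.aemeasurable]
    calc ∫⁻ x, ∫⁻ y, G (x, y) ≤ ∫⁻ x, (ball (0 : En n) ρ).indicator 1 x * C := by
          apply lintegral_mono
          intro x
          simp only [G]
          rw [lintegral_const_mul _ (by fun_prop)]
          gcongr
          exact hk x
      _ = volume (ball (0 : En n) ρ) * C := by
          rw [lintegral_mul_const _ (measurable_one.indicator measurableSet_ball), lintegral_indicator_one measurableSet_ball]
      _ < ⊤ := ENNReal.mul_lt_top measure_ball_lt_top hC
  have hG2 : ∫⁻ z : En n × En n, G z.swap = ∫⁻ z, G z := by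
    rw [Measure.volume_eq_prod]
    exact lintegral_prod_swap _
  calc ∫⁻ z : En n × En n, ‖φ z.1 - φ z.2‖ₑ ^ r * kk (-(n + b)) z.1 z.2
      ≤ ∫⁻ z : En n × En n, ENNReal.ofReal (L ^ r) * (G z + G z.swap) := by
        apply lintegral_mono
        intro z
        simp only
        by_cases h : z.1 ∈ ball (0 : En n) ρ ∨ z.2 ∈ ball (0 : En n) ρ
        · have h1 : F z ≤ G z + G z.swap := by
            simp only [G, hFs]
            rcases h with h | h
            · simp [indicator_of_mem h]
            · simp [indicator_of_mem h]
          calc _ ≤ ENNReal.ofReal (L ^ r) * F z := by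
                rw [Real.enorm_eq_ofReal_abs, ENNReal.ofReal_rpow_of_nonneg (abs_nonneg _) hr0.le]
                simp only [F]
                rw [← mul_assoc]
                gcongr
                rcases lt_or_ge L 0 with hL0 | hL0
                · have h0 := hL z.1 z.2
                  have : L * min 1 ‖z.1 - z.2‖ ≤ 0 := mul_nonpos_of_nonpos_of_nonneg hL0.le (by positivity)
                  have : |φ z.1 - φ z.2| = 0 := le_antisymm (by linarith) (abs_nonneg _)
                  rw [this, Real.zero_rpow hr0.ne']; simp
                rw [← ENNReal.ofReal_mul (by positivity), ← Real.mul_rpow hL0 (by positivity)]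
                apply ENNReal.ofReal_le_ofReal
                exact Real.rpow_le_rpow (abs_nonneg _) (hL _ _) hr0.le
            _ ≤ _ := by gcongr
        · push Not at h
          rw [hz _ h.1, hz _ h.2]; simp [hr0]
    _ = ENNReal.ofReal (L ^ r) * ((∫⁻ z, G z) + ∫⁻ z, G z) := by
        rw [lintegral_const_mul' _ _ ENNReal.ofReal_ne_top, lintegral_add_left hGm, hG2]
    _ < ⊤ := ENNReal.mul_lt_top ENNReal.ofReal_lt_top (ENNReal.add_lt_top.2 ⟨hG, hG⟩)

lemma smooth_lip {n : ℕ} {φ : En n → ℝ} (h1 : ContDiff ℝ (⊤ : ℕ∞) φ) (h2 : HasCompactSupport φ) :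
    ∃ L, 0 ≤ L ∧ (∀ x, |φ x| ≤ L) ∧ ∀ x y, |φ x - φ y| ≤ L * min 1 ‖x - y‖ := by
  obtain ⟨K, hK⟩ := (h1.of_le (by norm_cast) : ContDiff ℝ 1 φ).lipschitzWith_of_hasCompactSupport h2 (by norm_num)
  obtain ⟨A, hA⟩ := h1.continuous.bounded_above_of_compact_support h2
  have hA0 : 0 ≤ A := (norm_nonneg _).trans (hA 0)
  refine ⟨K + 2 * A, by positivity, fun x => ?_, fun x y => ?_⟩
  · have := hA x
    rw [Real.norm_eq_abs] at this
    have := K.2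
    simp only [NNReal.val_eq_coe] at this
    linarith
  · have hl := hK.dist_le_mul x y
    rw [dist_eq_norm, dist_eq_norm, Real.norm_eq_abs] at hl
    have hx := hA x
    have hy := hA y
    rw [Real.norm_eq_abs] at hx hy
    have h3 := abs_sub (φ x) (φ y)
    have hK0 : (0:ℝ) ≤ K := K.2
    rcases le_total 1 ‖x - y‖ with h | h
    · rw [min_eq_left h]; linarith
    · rw [min_eq_right h]; nlinarith [norm_nonneg (x - y)]

/-- tail function -/
def hh (n : ℕ) (p q s t : ℝ) (a : En n × En n → ℝ) (u : En n → ℝ) (x : En n) : ℝ :=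
  -2 * ∫ y in (ball (0 : En n) 1)ᶜ, Wf n p q s t a u (x, y)

lemma young_triv {D E r : ℝ} (hD : 0 ≤ D) (hE : 0 ≤ E) (hr : 1 < r) : D ^ (r - 1) * E ≤ D ^ r + E ^ r := by
  rcases le_total D E with h | h
  · calc D ^ (r - 1) * E ≤ E ^ (r - 1) * E := by
          gcongr
      _ = E ^ r := rp_mul hE (by linarith)
      _ ≤ _ := by linarith [Real.rpow_nonneg hD r]
  · calc D ^ (r - 1) * E ≤ D ^ (r - 1) * D := by gcongr
      _ = D ^ r := rp_mul hD (by linarith)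
      _ ≤ _ := by linarith [Real.rpow_nonneg hE r]

lemma energy_nonneg {n : ℕ} {p q s t : ℝ} {a : En n × En n → ℝ} (a0 : ∀ z, 0 ≤ a z) (u : En n → ℝ) (z) :
    0 ≤ energyIntegrand n p q s t a u z := by
  have := a0 z
  unfold energyIntegrand; positivity

lemma energy_meas {n : ℕ} {p q s t : ℝ} {a : En n × En n → ℝ} (am : Measurable a) {u : En n → ℝ} (hu : Measurable u) :
    Measurable (energyIntegrand n p q s t a u) := by
  unfold energyIntegrand; fun_prop

lemma energy_int {n : ℕ} {p q s t : ℝ} {a : En n × En n → ℝ} (am : Measurable a) (a0 : ∀ z, 0 ≤ a z)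
    {u : En n → ℝ} (hu : Measurable u)
    (h : ∫⁻ z : En n × En n, ENNReal.ofReal (energyIntegrand n p q s t a u z) < ⊤) :
    Integrable (energyIntegrand n p q s t a u) := by
  rw [← lintegral_ofReal_ne_top_iff_integrable (energy_meas am hu).aestronglyMeasurable
    (Filter.Eventually.of_forall (energy_nonneg a0 u))]
  exact h.ne

lemma form_int {n : ℕ} {p q s t M Λ : ℝ} (H : Par n p q s t M Λ) {a : En n × En n → ℝ} {u f : En n → ℝ}
    (S : Sol n p q s t M Λ a u f) {φ : En n → ℝ} (h1 : ContDiff ℝ (⊤ : ℕ∞) φ) (h2 : HasCompactSupport φ)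
    (hz : ∀ x, x ∉ ball (0 : En n) (3 / 4) → φ x = 0) :
    Integrable (fun z : En n × En n => Wf n p q s t a u z * (φ z.1 - φ z.2)) := by
  have hp := H.hp
  have hpq := H.hpq
  have hM := H.hM
  have hs0 := H.hs0
  have hs1 := H.hs1
  have ht0 := H.ht0
  have ht1 := H.ht1
  have hn1 : 1 ≤ n := by have := H.hn; omega
  have hφm : Measurable φ := h1.continuous.measurable
  obtain ⟨L, hL0, -, hL⟩ := smooth_lip h1 h2
  have g1 := gagfin hn1 hφm hL hz (r := p) (b := s * p) (by positivity) (by nlinarith)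
  have g2 := gagfin hn1 hφm hL hz (r := q) (b := t * q) (by nlinarith) (by nlinarith)
  have eφ : ∫⁻ z : En n × En n, ENNReal.ofReal (energyIntegrand n p q s t a φ z) < ⊤ := by
    calc ∫⁻ z : En n × En n, ENNReal.ofReal (energyIntegrand n p q s t a φ z)
        ≤ ∫⁻ z : En n × En n, (‖φ z.1 - φ z.2‖ₑ ^ p * kk (-(n + s * p)) z.1 z.2
          + ENNReal.ofReal M * (‖φ z.1 - φ z.2‖ₑ ^ q * kk (-(n + t * q)) z.1 z.2)) := by
          apply lintegral_mono
          intro z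
          simp only [energyIntegrand, Real.enorm_eq_ofReal_abs, kk]
          have := S.a0 z
          rw [ENNReal.ofReal_rpow_of_nonneg (abs_nonneg _) (by linarith),
            ENNReal.ofReal_rpow_of_nonneg (abs_nonneg _) (by linarith),
            ← ENNReal.ofReal_mul (by positivity), ← ENNReal.ofReal_mul (by positivity), 
            ← ENNReal.ofReal_mul (by positivity), ← ENNReal.ofReal_add (by positivity) (by positivity)]
          apply ENNReal.ofReal_le_ofReal
          rw [Real.rpow_neg (norm_nonneg _), Real.rpow_neg (norm_nonneg _), ← div_eq_mul_inv, ← div_eq_mul_inv,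
            mul_div_assoc]
          gcongr
          exact S.aM z
      _ < ⊤ := by
          rw [lintegral_add_left (by fun_prop), lintegral_const_mul' _ _ ENNReal.ofReal_ne_top]
          exact ENNReal.add_lt_top.2 ⟨g1, ENNReal.mul_lt_top ENNReal.ofReal_lt_top g2⟩
  have i1 := energy_int S.am S.a0 S.um S.ef
  have i2 := energy_int S.am S.a0 hφm eφ
  refine (i1.add i2).mono' ?_ ?_
  · have := Wf_meas (p := p) (q := q) (s := s) (t := t) S.am S.um
    exact Measurable.aestronglyMeasurable (by fun_prop)
  · refine Filter.Eventually.of_forall fun z => ?_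
    rw [Real.norm_eq_abs, abs_mul]
    simp only [Pi.add_apply, energyIntegrand]
    have h0 := S.a0 z
    calc _ ≤ (|u z.1 - u z.2| ^ (p - 1) * ‖z.1 - z.2‖ ^ (-((n : ℝ) + s * p)) +
      a z * |u z.1 - u z.2| ^ (q - 1) * ‖z.1 - z.2‖ ^ (-((n : ℝ) + t * q))) * |φ z.1 - φ z.2| := by
          gcongr; exact Wf_abs H S.a0 z
      _ = (|u z.1 - u z.2| ^ (p - 1) * |φ z.1 - φ z.2|) * ‖z.1 - z.2‖ ^ (-((n : ℝ) + s * p)) +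
      a z * (|u z.1 - u z.2| ^ (q - 1) * |φ z.1 - φ z.2|) * ‖z.1 - z.2‖ ^ (-((n : ℝ) + t * q)) := by ring
      _ ≤ (|u z.1 - u z.2| ^ p + |φ z.1 - φ z.2| ^ p) * ‖z.1 - z.2‖ ^ (-((n : ℝ) + s * p)) +
      a z * (|u z.1 - u z.2| ^ q + |φ z.1 - φ z.2| ^ q) * ‖z.1 - z.2‖ ^ (-((n : ℝ) + t * q)) := by
          gcongr
          · exact young_triv (abs_nonneg _) (abs_nonneg _) (by linarith)
          · exact young_triv (abs_nonneg _) (abs_nonneg _) (by linarith)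
      _ = _ := by
          rw [Real.rpow_neg (norm_nonneg _), Real.rpow_neg (norm_nonneg _)]; ring

/-- exterior kernel integrable -/
lemma ext_int {n : ℕ} {b : ℝ} (hb : 0 < b) :
    IntegrableOn (fun y : En n => ‖y‖ ^ (-((n : ℝ) + b))) (ball (0 : En n) 1)ᶜ := by
  unfold IntegrableOn
  rw [← lintegral_ofReal_ne_top_iff_integrable]
  · have := (kk_ext (n := n) hb).ne
    simpa [kk] using this
  · exact Measurable.aestronglyMeasurable (by fun_prop)
  · exact Filter.Eventually.of_forall fun y => by positivity

lemma far_bound {n : ℕ} {p q s t M Λ : ℝ} (H : Par n p q s t M Λ) {a : En n × En n → ℝ} {u f : En n → ℝ}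
    (S : Sol n p q s t M Λ a u f) : ∃ K, 0 ≤ K ∧ ∀ x y : En n, ‖x‖ ≤ 3 / 4 → 1 ≤ ‖y‖ →
      |Wf n p q s t a u (x, y)| ≤ K * ‖y‖ ^ (-((n : ℝ) + t * q)) := by
  have hM := H.hM
  have hΛ := H.hΛ
  have hp := H.hp
  have hC : 0 ≤ Cfar n p q s t M Λ := by unfold Cfar; positivity
  refine ⟨Cfar n p q s t M Λ * (Λ ^ (p - 1) + Λ ^ (p - 1)), by positivity, fun x y hx hy => ?_⟩
  refine (Wf_far H S.a0 S.aM S.ub 0 x y hx hy).trans ?_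
  rw [mul_assoc]
  simp only [sub_zero]
  gcongr
  · linarith
  · exact S.ub x
  · linarith
  · exact S.ub y

lemma hh_bound {n : ℕ} {p q s t M Λ : ℝ} (H : Par n p q s t M Λ) {a : En n × En n → ℝ} {u f : En n → ℝ}
    (S : Sol n p q s t M Λ a u f) : ∃ K, 0 ≤ K ∧ ∀ x : En n, ‖x‖ ≤ 3 / 4 → |hh n p q s t a u x| ≤ K := by
  obtain ⟨K, hK0, hK⟩ := far_bound H S
  have hb : 0 < t * q := mul_pos H.ht0 (by linarith [H.hp, H.hpq])
  have hi := ext_int (n := n) hb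
  refine ⟨2 * (K * ∫ y in (ball (0 : En n) 1)ᶜ, ‖y‖ ^ (-((n : ℝ) + t * q))), ?_, fun x hx => ?_⟩
  · have : 0 ≤ ∫ y in (ball (0 : En n) 1)ᶜ, ‖y‖ ^ (-((n : ℝ) + t * q)) :=
      integral_nonneg fun y => by positivity
    positivity
  · rw [hh, abs_mul, abs_neg, abs_two]
    gcongr
    rw [← integral_const_mul, ← Real.norm_eq_abs]
    apply norm_integral_le_of_norm_le (hi.const_mul K)
    filter_upwards [self_mem_ae_restrict measurableSet_ball.compl] with y hy
    exact hK x y hx (by simpa using hy)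

lemma hh_meas {n : ℕ} {p q s t : ℝ} {a : En n × En n → ℝ} {u : En n → ℝ} (ha : Measurable a)
    (hu : Measurable u) : Measurable (hh n p q s t a u) := by
  unfold hh
  apply Measurable.const_mul
  exact (StronglyMeasurable.integral_prod_right' (Wf_meas ha hu).stronglyMeasurable).measurable

lemma weak_smooth {n : ℕ} {p q s t M Λ : ℝ} (H : Par n p q s t M Λ) {a : En n × En n → ℝ} {u f : En n → ℝ}
    (S : Sol n p q s t M Λ a u f) {φ : En n → ℝ} (h1 : ContDiff ℝ (⊤ : ℕ∞) φ) (h2 : HasCompactSupport φ)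
    (hz : ∀ x, x ∉ ball (0 : En n) (3 / 4) → φ x = 0) :
    ∫ z in ball (0 : En n) 1 ×ˢ ball (0 : En n) 1, Wf n p q s t a u z * (φ z.1 - φ z.2) =
      (∫ x, hh n p q s t a u x * φ x) + ∫ x, f x * φ x := by
  set B := ball (0 : En n) 1 with hB
  have hI := form_int H S h1 h2 hz
  have hφm : Measurable φ := h1.continuous.measurable
  have hWm := Wf_meas (p := p) (q := q) (s := s) (t := t) S.am S.um
  obtain ⟨L, hL0, hLb, hL⟩ := smooth_lip h1 h2
  obtain ⟨K, hK0, hK⟩ := far_bound H S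
  have hb : 0 < t * q := mul_pos H.ht0 (by linarith [H.hp, H.hpq])
  set T : En n × En n → ℝ := fun z => φ z.1 * (Bᶜ).indicator (fun y => Wf n p q s t a u (z.1, y)) z.2 with hT
  have hzB : ∀ x, x ∉ B → φ x = 0 := fun x hx => hz x fun h => hx (ball_subset_ball (by norm_num) h)
  have hTm : Measurable T := by
    have : T = fun z => φ z.1 * (Prod.snd ⁻¹' Bᶜ).indicator (Wf n p q s t a u) z := by
      ext z; simp only [hT, indicator, mem_preimage]; rfl
    rw [this]
    exact (hφm.comp measurable_fst).mul (hWm.indicator (measurable_snd measurableSet_ball.compl))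
  have hTi : Integrable T := by
    have hd : Integrable (fun z : En n × En n => (ball (0:En n) (3/4)).indicator (fun _ => L) z.1 *
        (Bᶜ).indicator (fun y => K * ‖y‖ ^ (-((n : ℝ) + t * q))) z.2) := by
      rw [Measure.volume_eq_prod]
      apply Integrable.mul_prod
      · exact (integrable_indicator_iff measurableSet_ball).2 (integrableOn_const measure_ball_lt_top.ne)
      · exact (integrable_indicator_iff measurableSet_ball.compl).2 ((ext_int hb).const_mul K)
    refine hd.mono' hTm.aestronglyMeasurable (Filter.Eventually.of_forall fun z => ?_)
    simp only [hT, norm_mul, indicator]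
    by_cases hx : z.1 ∈ ball (0:En n) (3/4)
    · by_cases hy : z.2 ∈ Bᶜ
      · simp only [hx, hy, if_true]
        gcongr
        · exact hLb _
        · exact hK _ _ (by rw [mem_ball_zero_iff] at hx; exact hx.le) (by simpa [hB] using hy)
      · simp [hy]
    · simp [hz _ hx, hx]
  have hdecomp : ∀ z : En n × En n, Wf n p q s t a u z * (φ z.1 - φ z.2) =
      (B ×ˢ B).indicator (fun z => Wf n p q s t a u z * (φ z.1 - φ z.2)) z + (T z + T z.swap) := by
    rintro ⟨x, y⟩
    simp only [hT, indicator, mem_prod, mem_compl_iff, Prod.fst_swap, Prod.snd_swap]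
    by_cases hx : x ∈ B <;> by_cases hy : y ∈ B
    · simp [hx, hy]
    · simp [hx, hy, hzB y hy]; ring
    · simp [hx, hy, hzB x hx, Wf_anti S.asym x y]; ring
    · simp [hx, hy, hzB x hx, hzB y hy]
  have hTs : Integrable (fun z : En n × En n => T z.swap) := by
    rw [Measure.volume_eq_prod] at hTi ⊢; exact hTi.swap
  have hTsi : ∫ z : En n × En n, T z.swap = ∫ z, T z := by
    rw [Measure.volume_eq_prod]; exact integral_prod_swap T
  have hTval : ∫ z, T z = ∫ x, φ x * ∫ y in Bᶜ, Wf n p q s t a u (x, y) := by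
    rw [Measure.volume_eq_prod] at hTi ⊢
    rw [integral_prod _ hTi]
    congr 1; ext x
    simp only [hT]
    rw [integral_const_mul, integral_indicator measurableSet_ball.compl]
  have hw := S.weak φ h1 h2
  simp only [form_eq] at hw
  have : ∫ z : En n × En n, Wf n p q s t a u z * (φ z.1 - φ z.2) =
     (∫ z in B ×ˢ B, Wf n p q s t a u z * (φ z.1 - φ z.2)) + ((∫ z, T z) + ∫ z, T z) := by
    rw [integral_congr_ae (Filter.Eventually.of_forall hdecomp)]
    have hm : MeasurableSet (B ×ˢ B) := measurableSet_ball.prod measurableSet_ball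
    have hTT : Integrable (fun z => T z + T z.swap) := hTi.add hTs
    rw [integral_add (hI.indicator hm) hTT, integral_indicator hm, integral_add hTi hTs, hTsi]
  have hhT : ∫ x, hh n p q s t a u x * φ x = -2 * ∫ z, T z := by
    rw [hTval, ← integral_const_mul]
    congr 1; ext x
    simp only [hh]; ring
  rw [hhT, ← hw, this]
  ring

def rho0 (n : ℕ) (x : En n) : ℝ := (⟨1/2, 1, by norm_num, by norm_num⟩ : ContDiffBump (0 : En n)).normed volume x

lemma rho0_smooth (n : ℕ) : ContDiff ℝ (⊤ : ℕ∞) (rho0 n) := ContDiffBump.contDiff_normed _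
lemma rho0_cpt (n : ℕ) : HasCompactSupport (rho0 n) := ContDiffBump.hasCompactSupport_normed _
lemma rho0_nonneg (n : ℕ) (x) : 0 ≤ rho0 n x := ContDiffBump.nonneg_normed _ _
lemma rho0_even (n : ℕ) (x) : rho0 n (-x) = rho0 n x := ContDiffBump.normed_neg _ _
lemma rho0_int (n : ℕ) : ∫ x, rho0 n x = 1 := ContDiffBump.integral_normed _
lemma rho0_zero (n : ℕ) (x) (hx : 1 ≤ ‖x‖) : rho0 n x = 0 := by
  by_contra h
  have : x ∈ Function.support (rho0 n) := h
  unfold rho0 at this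
  rw [ContDiffBump.support_normed_eq] at this
  simp at this; linarith

def rho (n : ℕ) (δ : ℝ) (x : En n) : ℝ := δ ^ (-(n : ℝ)) * rho0 n (δ⁻¹ • x)

lemma rho_smooth (n : ℕ) (δ : ℝ) : ContDiff ℝ (⊤ : ℕ∞) (rho n δ) :=
  contDiff_const.mul ((rho0_smooth n).comp (contDiff_const_smul δ⁻¹))
@[fun_prop] lemma rho_meas (n : ℕ) (δ : ℝ) : Measurable (rho n δ) := (rho_smooth n δ).continuous.measurable
lemma rho_nonneg (n : ℕ) {δ : ℝ} (h : 0 < δ) (x) : 0 ≤ rho n δ x := by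
  have := rho0_nonneg n (δ⁻¹ • x)
  unfold rho; positivity
lemma rho_even (n : ℕ) (δ : ℝ) (x) : rho n δ (-x) = rho n δ x := by
  unfold rho; rw [smul_neg, rho0_even]
lemma rho_zero (n : ℕ) {δ : ℝ} (h : 0 < δ) (x) (hx : δ ≤ ‖x‖) : rho n δ x = 0 := by
  unfold rho; rw [rho0_zero, mul_zero]
  rw [norm_smul, norm_inv, Real.norm_of_nonneg h.le, ← div_eq_inv_mul, one_le_div h]; exact hx
lemma rho_cpt (n : ℕ) {δ : ℝ} (h : 0 < δ) : HasCompactSupport (rho n δ) := by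
  apply HasCompactSupport.intro (isCompact_closedBall (0 : En n) δ)
  intro x hx
  apply rho_zero n h
  simp at hx; exact hx.le
lemma rho_int (n : ℕ) {δ : ℝ} (h : 0 < δ) : ∫ x, rho n δ x = 1 := by
  unfold rho
  rw [integral_const_mul, Measure.integral_comp_inv_smul_of_nonneg _ _ h.le, rho0_int]
  simp [Real.rpow_neg h.le, (pow_pos h n).ne']
lemma rho_integrable (n : ℕ) {δ : ℝ} (h : 0 < δ) : Integrable (rho n δ) :=
  (rho_smooth n δ).continuous.integrable_of_hasCompactSupport (rho_cpt n h)
lemma rho_lint (n : ℕ) {δ : ℝ} (h : 0 < δ) : ∫⁻ x, ‖rho n δ x‖ₑ = 1 := by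
  have := ofReal_integral_eq_lintegral_ofReal (rho_integrable n h) (Filter.Eventually.of_forall (rho_nonneg n h))
  rw [rho_int n h] at this
  rw [ENNReal.ofReal_one] at this
  rw [this]
  congr 1; ext x
  rw [Real.enorm_eq_ofReal (rho_nonneg n h x)]

lemma exists_Lr (n : ℕ) : ∃ L, 1 ≤ L ∧ (∀ δ : ℝ, 0 < δ → ∀ x, |rho n δ x| ≤ L * δ ^ (-(n : ℝ))) ∧
    ∀ δ : ℝ, 0 < δ → ∀ x y, |rho n δ x - rho n δ y| ≤ L * δ ^ (-(n : ℝ)) * min 1 (‖x - y‖ / δ) := by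
  obtain ⟨L, h0, h1, h2⟩ := smooth_lip (rho0_smooth n) (rho0_cpt n)
  refine ⟨max 1 L, le_max_left _ _, fun δ h x => ?_, fun δ h x y => ?_⟩
  · unfold rho
    rw [abs_mul, abs_of_nonneg (by positivity), mul_comm]
    gcongr
    exact (h1 _).trans (le_max_right _ _)
  · unfold rho
    rw [← mul_sub, abs_mul, abs_of_nonneg (by positivity)]
    have := h2 (δ⁻¹ • x) (δ⁻¹ • y)
    rw [← smul_sub, norm_smul, norm_inv, Real.norm_of_nonneg h.le, ← div_eq_inv_mul] at this
    have h3 : 0 ≤ min 1 (‖x - y‖ / δ) := by positivity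
    calc _ ≤ δ ^ (-(n:ℝ)) * (max 1 L * min 1 (‖x - y‖ / δ)) := by
          gcongr; exact this.trans (by gcongr; exact le_max_right _ _)
      _ = _ := by ring

/-- mollification -/
def PP (n : ℕ) (δ : ℝ) (g : En n → ℝ) (x : En n) : ℝ := ∫ y, rho n δ (x - y) * g y

lemma PP_eq (n : ℕ) (δ : ℝ) (g : En n → ℝ) (x : En n) : PP n δ g x = ∫ w, rho n δ w * g (x - w) := by
  unfold PP
  rw [← integral_sub_left_eq_self _ volume x]
  simp

lemma PP_intg {n : ℕ} {δ : ℝ} (h : 0 < δ) {g : En n → ℝ} (hg : Measurable g) {K : ℝ} (hK : ∀ x, |g x| ≤ K) (x : En n) :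
    Integrable (fun y => rho n δ (x - y) * g y) := by
  apply Integrable.mul_bdd (c := K) ((rho_integrable n h).comp_sub_left x) hg.aestronglyMeasurable
  exact Filter.Eventually.of_forall hK

lemma PP_intg' {n : ℕ} {δ : ℝ} (h : 0 < δ) {g : En n → ℝ} (hg : Measurable g) {K : ℝ} (hK : ∀ x, |g x| ≤ K) (x : En n) :
    Integrable (fun w => rho n δ w * g (x - w)) := by
  apply Integrable.mul_bdd (c := K) (rho_integrable n h) (Measurable.aestronglyMeasurable (by fun_prop))
  exact Filter.Eventually.of_forall fun w => hK _

lemma PP_meas {n : ℕ} {δ : ℝ} {g : En n → ℝ} (hg : Measurable g) : Measurable (PP n δ g) := by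
  unfold PP
  apply StronglyMeasurable.measurable
  apply StronglyMeasurable.integral_prod_right' (f := fun z : En n × En n => rho n δ (z.1 - z.2) * g z.2)
  exact Measurable.stronglyMeasurable (by fun_prop)

lemma PP_bdd {n : ℕ} {δ : ℝ} (h : 0 < δ) {g : En n → ℝ} {K : ℝ} (hK : ∀ x, |g x| ≤ K) (x : En n) :
    |PP n δ g x| ≤ K := by
  rw [PP_eq, ← Real.norm_eq_abs]
  calc ‖∫ w, rho n δ w * g (x - w)‖ ≤ ∫ w, rho n δ w * K := by
        apply norm_integral_le_of_norm_le ((rho_integrable n h).mul_const K)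
        refine Filter.Eventually.of_forall fun w => ?_
        rw [norm_mul, Real.norm_of_nonneg (rho_nonneg n h w)]
        gcongr
        · exact rho_nonneg n h w
        · exact hK _
    _ = K := by rw [integral_mul_const, rho_int n h, one_mul]

lemma PP_smooth {n : ℕ} {δ : ℝ} (h : 0 < δ) {g : En n → ℝ} (hg : Measurable g) {K : ℝ} (hK : ∀ x, |g x| ≤ K) :
    ContDiff ℝ (⊤ : ℕ∞) (PP n δ g) := by
  have hl : LocallyIntegrable g := by
    intro x
    refine ⟨ball x 1, ball_mem_nhds x one_pos, bdd_intOn hg hK measure_ball_lt_top.ne⟩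
  have := HasCompactSupport.contDiff_convolution_right (ContinuousLinearMap.mul ℝ ℝ) (rho_cpt n h) hl (rho_smooth n δ)
  convert this using 1
  ext x
  simp only [PP, convolution, ContinuousLinearMap.mul_apply', mul_comm]

lemma PP_zero {n : ℕ} {δ r : ℝ} (h : 0 < δ) {g : En n → ℝ} (hg : ∀ x, x ∉ ball (0 : En n) r → g x = 0)
    (x : En n) (hx : x ∉ ball (0 : En n) (r + δ)) : PP n δ g x = 0 := by
  unfold PP
  apply integral_eq_zero_of_ae
  refine Filter.Eventually.of_forall fun y => ?_
  simp only [Pi.zero_apply, mul_eq_zero]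
  by_cases hy : y ∈ ball (0 : En n) r
  · left
    apply rho_zero n h
    simp only [mem_ball_zero_iff, not_lt] at hx hy
    have := norm_sub_norm_le x y
    linarith
  · right; exact hg y hy

lemma PP_sub {n : ℕ} {δ : ℝ} (h : 0 < δ) {g : En n → ℝ} (hg : Measurable g) {K : ℝ} (hK : ∀ x, |g x| ≤ K)
    (x : En n) (c : ℝ) : PP n δ g x - c = ∫ y, rho n δ (x - y) * (g y - c) := by
  simp only [mul_sub]
  rw [integral_sub (PP_intg h hg hK x) (((rho_integrable n h).comp_sub_left x).mul_const c),
    integral_mul_const, integral_sub_left_eq_self _ volume x, rho_int n h, one_mul]; rfl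

lemma PP_sub_le {n : ℕ} {δ L : ℝ} (h : 0 < δ) (hL : ∀ δ : ℝ, 0 < δ → ∀ x, |rho n δ x| ≤ L * δ ^ (-(n : ℝ)))
    {g : En n → ℝ} (hg : Measurable g) {K : ℝ} (hK : ∀ x, |g x| ≤ K)
    (x : En n) (c : ℝ) : ‖PP n δ g x - c‖ₑ ≤ ENNReal.ofReal (L * δ ^ (-(n:ℝ))) * ∫⁻ y in ball x δ, ‖g y - c‖ₑ := by
  rw [PP_sub h hg hK x c]
  refine (enorm_integral_le_lintegral_enorm _).trans ?_
  rw [← lintegral_const_mul' _ _ ENNReal.ofReal_ne_top, ← lintegral_indicator measurableSet_ball]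
  apply lintegral_mono
  intro y
  simp only [indicator]
  split_ifs with hy
  · rw [enorm_mul]
    gcongr
    rw [Real.enorm_eq_ofReal_abs]
    exact ENNReal.ofReal_le_ofReal (hL δ h _)
  · rw [rho_zero n h]; · simp
    rw [mem_ball, dist_eq_norm, not_lt, norm_sub_rev] at hy; exact hy

/-- scales -/
def dl (j : ℕ) : ℝ := (1 / 2) ^ j / 4
lemma dl_pos (j : ℕ) : 0 < dl j := by unfold dl; positivity
lemma dl_le (j : ℕ) : dl j ≤ 1 / 4 := by
  unfold dl
  have : ((1:ℝ) / 2) ^ j ≤ 1 := pow_le_one₀ (by norm_num) (by norm_num)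
  linarith
lemma dl_tendsto : Filter.Tendsto dl Filter.atTop (nhds 0) := by
  have := (tendsto_pow_atTop_nhds_zero_of_lt_one (r := (1/2:ℝ)) (by norm_num) (by norm_num)).div_const 4
  rw [zero_div] at this
  exact this

lemma PP_tendsto {n : ℕ} (hn : 1 ≤ n) {g : En n → ℝ} (hg : Measurable g) {K : ℝ} (hK : ∀ x, |g x| ≤ K) :
    ∀ᵐ x, Filter.Tendsto (fun j => PP n (dl j) g x) Filter.atTop (nhds (g x)) := by
  have hl : LocallyIntegrable g := by
    intro x
    refine ⟨ball x 1, ball_mem_nhds x one_pos, bdd_intOn hg hK measure_ball_lt_top.ne⟩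
  obtain ⟨L, hL1, hL, -⟩ := exists_Lr n
  filter_upwards [IsUnifLocDoublingMeasure.ae_tendsto_average_norm_sub (μ := volume) hl 1] with x hx
  have h1 := hx (fun _ : ℕ => x) dl (tendsto_nhdsWithin_iff.2 ⟨dl_tendsto, Filter.Eventually.of_forall dl_pos⟩)
    (Filter.Eventually.of_forall fun j => by simp [(dl_pos j).le])
  rw [tendsto_iff_norm_sub_tendsto_zero]
  have h2 := h1.const_mul (L * m0 n)
  rw [mul_zero] at h2
  refine squeeze_zero (fun _ => norm_nonneg _) (fun j => ?_) h2
  have hd := dl_pos j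
  have hm := m0_pos n
  have hv : volume.real (closedBall x (dl j)) = m0 n * dl j ^ (n:ℝ) := by
    haveI : Nontrivial (En n) := by
      haveI : Nonempty (Fin n) := ⟨⟨0, hn⟩⟩
      infer_instance
    rw [Measure.real, Measure.addHaar_closedBall_eq_addHaar_ball, vol_ball x hd, ENNReal.toReal_ofReal (by positivity)]
  rw [setAverage_eq, hv, PP_sub hd hg hK]
  have hib : IntegrableOn (fun y => ‖g y - g x‖) (closedBall x (dl j)) :=
    ((bdd_intOn hg hK measure_closedBall_lt_top.ne).sub (integrableOn_const measure_closedBall_lt_top.ne)).norm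
  have : L * m0 n * ((m0 n * dl j ^ (n:ℝ))⁻¹ • ∫ y in closedBall x (dl j), ‖g y - g x‖) =
     ∫ y, (closedBall x (dl j)).indicator (fun y => L * dl j ^ (-(n:ℝ)) * ‖g y - g x‖) y := by
    rw [integral_indicator measurableSet_closedBall, integral_const_mul, smul_eq_mul, Real.rpow_neg hd.le]
    field_simp
  rw [this]
  apply norm_integral_le_of_norm_le
  · exact (integrable_indicator_iff measurableSet_closedBall).2 (hib.const_mul _)
  · refine Filter.Eventually.of_forall fun y => ?_
    simp only [indicator]
    split_ifs with hy
    · rw [norm_mul]; gcongr; exact hL _ hd _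
    · rw [rho_zero n hd]; · simp
      rw [mem_closedBall, dist_eq_norm, not_le, norm_sub_rev] at hy; exact hy.le

lemma vitali {α : Type*} [MeasurableSpace α] {μ : Measure α} [IsFiniteMeasure μ] {F : ℕ → α → ℝ} {F0 : α → ℝ}
    (hF : ∀ j, Measurable (F j)) (hF0 : Measurable F0)
    (hl : ∀ᵐ z ∂μ, Filter.Tendsto (fun j => F j z) Filter.atTop (nhds (F0 z)))
    {X : α → ℝ≥0∞} {Y : ℕ → α → ℝ≥0∞} (hX : Measurable X) (hY : ∀ j, Measurable (Y j))
    {a b : ℝ} (ha : 0 < a) (hb : 0 ≤ b) (hab : a + b = 1) {K : ℝ≥0∞} (hK : K < ⊤)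
    (hXf : ∫⁻ z, X z ∂μ < ⊤) (hYf : ∀ j, ∫⁻ z, Y j z ∂μ ≤ K)
    (hle : ∀ j, ∀ᵐ z ∂μ, ‖F j z‖ₑ ≤ X z ^ a * Y j z ^ b) :
    Integrable F0 μ ∧ Filter.Tendsto (fun j => ∫ z, F j z ∂μ) Filter.atTop (nhds (∫ z, F0 z ∂μ)) := by
  have key : ∀ j (s : Set α), ∫⁻ z in s, ‖F j z‖ₑ ∂μ ≤ (∫⁻ z in s, X z ∂μ) ^ a * K ^ b := by
    intro j s
    calc ∫⁻ z in s, ‖F j z‖ₑ ∂μ ≤ ∫⁻ z in s, X z ^ a * Y j z ^ b ∂μ :=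
          lintegral_mono_ae (ae_restrict_of_ae (hle j))
      _ ≤ (∫⁻ z in s, X z ∂μ) ^ a * (∫⁻ z in s, Y j z ∂μ) ^ b :=
          ENNReal.lintegral_mul_norm_pow_le hX.aemeasurable (hY j).aemeasurable ha.le hb hab
      _ ≤ _ := by
          gcongr
          exact (setLIntegral_le_lintegral _ _).trans (hYf j)
  have hfin : (∫⁻ z, X z ∂μ) ^ a * K ^ b < ⊤ :=
    ENNReal.mul_lt_top (ENNReal.rpow_lt_top_of_nonneg ha.le hXf.ne) (ENNReal.rpow_lt_top_of_nonneg hb hK.ne)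
  have hj : ∀ j, ∫⁻ z, ‖F j z‖ₑ ∂μ ≤ (∫⁻ z, X z ∂μ) ^ a * K ^ b := fun j => by simpa using key j univ
  have hint : ∀ j, Integrable (F j) μ := fun j => ⟨(hF j).aestronglyMeasurable, (hj j).trans_lt hfin⟩
  have hint0 : Integrable F0 μ := by
    refine ⟨hF0.aestronglyMeasurable, ?_⟩
    calc ∫⁻ z, ‖F0 z‖ₑ ∂μ = ∫⁻ z, Filter.liminf (fun j => ‖F j z‖ₑ) Filter.atTop ∂μ := by
          apply lintegral_congr_ae
          filter_upwards [hl] with z hz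
          exact (Filter.Tendsto.liminf_eq ((continuous_enorm.tendsto _).comp hz)).symm
      _ ≤ Filter.liminf (fun j => ∫⁻ z, ‖F j z‖ₑ ∂μ) Filter.atTop :=
          lintegral_liminf_le fun j => (hF j).enorm
      _ ≤ (∫⁻ z, X z ∂μ) ^ a * K ^ b := by
          apply Filter.liminf_le_of_frequently_le'
          exact Filter.Frequently.of_forall hj
      _ < ⊤ := hfin
  refine ⟨hint0, ?_⟩
  apply tendsto_integral_of_L1' _ hint0.1 (Filter.Eventually.of_forall hint)
  apply tendsto_Lp_finite_of_tendsto_ae le_rfl (by simp) (fun j => (hint j).1) (memLp_one_iff_integrable.2 hint0) _ hl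
  intro ε hε
  -- choose threshold
  have hlim : Filter.Tendsto (fun r : ℝ≥0∞ => r ^ a * K ^ b) (nhds 0) (nhds 0) := by
    have h1 : Filter.Tendsto (fun r : ℝ≥0∞ => r ^ a) (nhds 0) (nhds 0) := by
      have := (ENNReal.continuous_rpow_const (y := a)).tendsto 0
      rwa [ENNReal.zero_rpow_of_pos ha] at this
    have := ENNReal.Tendsto.mul_const (b := K ^ b) h1 (Or.inr (ENNReal.rpow_lt_top_of_nonneg hb hK.ne).ne)
    rwa [zero_mul] at this
  have hev := hlim (Iic_mem_nhds (ENNReal.ofReal_pos.2 hε))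
  obtain ⟨e, he0, he⟩ := ENNReal.nhds_zero_basis_Iic.mem_iff.1 hev
  obtain ⟨d, hd0, hd⟩ := exists_pos_setLIntegral_lt_of_measure_lt hXf.ne he0.ne'
  obtain ⟨d', hd'0, hd'⟩ := ENNReal.lt_iff_exists_real_btwn.1 hd0
  refine ⟨d', ENNReal.ofReal_pos.1 hd'.1, fun i s hs hμ => ?_⟩
  rw [eLpNorm_one_eq_lintegral_enorm]
  have : ∫⁻ z, ‖s.indicator (F i) z‖ₑ ∂μ = ∫⁻ z in s, ‖F i z‖ₑ ∂μ := by
    rw [← lintegral_indicator hs]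
    congr 1; ext z
    simp only [indicator]; split_ifs <;> simp
  rw [this]
  refine (key i s).trans ?_
  exact he (hd s (hμ.trans_lt hd'.2)).le

lemma PP_gag {n : ℕ} {δ p b : ℝ} (h : 0 < δ) (hp : 1 ≤ p) {g : En n → ℝ} (hg : Measurable g) {K : ℝ} (hK : ∀ x, |g x| ≤ K) :
    ∫⁻ z : En n × En n, ‖PP n δ g z.1 - PP n δ g z.2‖ₑ ^ p * kk b z.1 z.2 ≤
     ∫⁻ z : En n × En n, ‖g z.1 - g z.2‖ₑ ^ p * kk b z.1 z.2 := by
  set μ : Measure (En n) := volume.withDensity (fun w => ‖rho n δ w‖ₑ) with hμ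
  have hmρ : Measurable (fun w => ‖rho n δ w‖ₑ) := by fun_prop
  have hm1 : μ univ = 1 := by
    rw [hμ, withDensity_apply _ MeasurableSet.univ, Measure.restrict_univ, rho_lint n h]
  have : IsFiniteMeasure μ := ⟨by rw [hm1]; simp⟩
  have h1 : ∀ z : En n × En n, ‖PP n δ g z.1 - PP n δ g z.2‖ₑ ^ p * kk b z.1 z.2 ≤
      ∫⁻ w, ‖g (z.1 - w) - g (z.2 - w)‖ₑ ^ p * kk b z.1 z.2 ∂μ := by
    intro z
    rw [lintegral_mul_const' _ _ (kk_ne_top _ _ _)]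
    gcongr
    have e : PP n δ g z.1 - PP n δ g z.2 = ∫ w, rho n δ w * (g (z.1 - w) - g (z.2 - w)) := by
      rw [PP_eq, PP_eq, ← integral_sub (PP_intg' h hg hK _) (PP_intg' h hg hK _)]
      simp only [mul_sub]
    have : ‖PP n δ g z.1 - PP n δ g z.2‖ₑ ≤ ∫⁻ w, ‖g (z.1 - w) - g (z.2 - w)‖ₑ ∂μ := by
      rw [e, hμ, lintegral_withDensity_eq_lintegral_mul _ hmρ (by fun_prop)]
      refine (enorm_integral_le_lintegral_enorm _).trans (le_of_eq ?_)
      simp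
    calc _ ≤ (∫⁻ w, ‖g (z.1 - w) - g (z.2 - w)‖ₑ ∂μ) ^ p := by gcongr
      _ ≤ _ := jensen μ (Measurable.aemeasurable (by fun_prop)) hp
      _ = _ := by rw [hm1, ENNReal.one_rpow, one_mul]
  calc _ ≤ ∫⁻ z : En n × En n, ∫⁻ w, ‖g (z.1 - w) - g (z.2 - w)‖ₑ ^ p * kk b z.1 z.2 ∂μ := lintegral_mono h1
    _ = ∫⁻ w, (∫⁻ z : En n × En n, ‖g (z.1 - w) - g (z.2 - w)‖ₑ ^ p * kk b z.1 z.2) ∂μ := by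
        rw [lintegral_lintegral_swap]
        exact Measurable.aemeasurable (by unfold Function.uncurry; fun_prop)
    _ = ∫⁻ w, (∫⁻ z : En n × En n, ‖g z.1 - g z.2‖ₑ ^ p * kk b z.1 z.2) ∂μ := by
        congr 1; ext w
        have : (volume : Measure (En n × En n)).IsAddRightInvariant := by
          rw [Measure.volume_eq_prod]; infer_instance
        rw [← lintegral_sub_right_eq_self (fun z : En n × En n => ‖g z.1 - g z.2‖ₑ ^ p * kk b z.1 z.2) (w, w)]
        simp [kk]
    _ = _ := by rw [lintegral_const, hm1, mul_one]

lemma kk_split {n : ℕ} {b : ℝ} {x y : En n} {D E : ℝ≥0∞} {p : ℝ} (hp : 1 < p) :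
    D ^ (p - 1) * kk b x y * E = (D ^ p * kk b x y) ^ ((p - 1) / p) * (E ^ p * kk b x y) ^ (1 / p) := by
  have hp0 : 0 < p := by linarith
  rw [ENNReal.mul_rpow_of_nonneg _ _ (by apply div_nonneg <;> linarith), ENNReal.mul_rpow_of_nonneg _ _ (by positivity),
    ← ENNReal.rpow_mul, ← ENNReal.rpow_mul, mul_div_cancel₀ _ hp0.ne', mul_one_div_cancel hp0.ne', ENNReal.rpow_one]
  have : kk b x y = kk b x y ^ ((p - 1) / p) * kk b x y ^ (1 / p) := by
    rw [← ENNReal.rpow_add_of_nonneg _ _ (by apply div_nonneg <;> linarith) (by positivity), ← add_div]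
    simp [hp0.ne']
  nth_rewrite 1 [this]; ring

lemma Wf_enorm {n : ℕ} {p q s t M Λ : ℝ} (H : Par n p q s t M Λ) {a : En n × En n → ℝ} {u f : En n → ℝ}
    (S : Sol n p q s t M Λ a u f) (z : En n × En n) (hz : ‖z.1 - z.2‖ ≤ 2) :
    ‖Wf n p q s t a u z‖ₑ ≤ ENNReal.ofReal (1 + M * (2 * Λ) ^ (q - p) * 2 ^ (s * p - t * q)) *
      (‖u z.1 - u z.2‖ₑ ^ (p - 1) * kk (-(n + s * p)) z.1 z.2) := by
  have := Wf_near H S.a0 S.aM S.ub z hz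
  have hM := H.hM
  have hΛ := H.hΛ
  rw [Real.enorm_eq_ofReal_abs, Real.enorm_eq_ofReal_abs, kk, ENNReal.ofReal_rpow_of_nonneg (abs_nonneg _) (by linarith [H.hp]),
    ← ENNReal.ofReal_mul (by positivity), ← ENNReal.ofReal_mul (by positivity)]
  exact ENNReal.ofReal_le_ofReal this

lemma weak_ext {n : ℕ} {p q s t M Λ : ℝ} (H : Par n p q s t M Λ) {a : En n × En n → ℝ} {u f : En n → ℝ}
    (S : Sol n p q s t M Λ a u f) {φ : En n → ℝ} (hφ : Measurable φ) {K : ℝ} (hK : ∀ x, |φ x| ≤ K)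
    (hz : ∀ x, x ∉ ball (0 : En n) (1 / 2) → φ x = 0)
    (hg : ∫⁻ z : En n × En n, ‖φ z.1 - φ z.2‖ₑ ^ p * kk (-(n + s * p)) z.1 z.2 < ⊤) :
    IntegrableOn (fun z => Wf n p q s t a u z * (φ z.1 - φ z.2)) (ball (0 : En n) 1 ×ˢ ball (0 : En n) 1) ∧
    ∫ z in ball (0 : En n) 1 ×ˢ ball (0 : En n) 1, Wf n p q s t a u z * (φ z.1 - φ z.2) =
      (∫ x, hh n p q s t a u x * φ x) + ∫ x, f x * φ x := by
  have hn1 : 1 ≤ n := by have := H.hn; omega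
  have hp := H.hp
  have hp0 : 0 < p := by linarith
  have hWm := Wf_meas (p := p) (q := q) (s := s) (t := t) S.am S.um
  have hhm := hh_meas (p := p) (q := q) (s := s) (t := t) S.am S.um
  have hPm : ∀ j, Measurable (PP n (dl j) φ) := fun j => PP_meas hφ
  have hz' : ∀ j x, x ∉ ball (0 : En n) (3 / 4) → PP n (dl j) φ x = 0 := fun j x hx =>
    PP_zero (dl_pos j) hz x fun h => hx (ball_subset_ball (by linarith [dl_le j]) h)
  have hz0 : ∀ x, x ∉ ball (0 : En n) (3 / 4) → φ x = 0 := fun x hx => hz x fun h => hx (ball_subset_ball (by norm_num) h)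
  have hweak : ∀ j, _ := fun j => weak_smooth H S (PP_smooth (dl_pos j) hφ hK)
    (HasCompactSupport.intro (isCompact_closedBall (0 : En n) (3/4)) fun x hx => hz' j x fun h => hx (ball_subset_closedBall h))
    (hz' j)
  have hae := PP_tendsto hn1 hφ hK
  have hKn : 0 ≤ K := (abs_nonneg _).trans (hK 0)
  set B := ball (0 : En n) 1 with hB
  -- left side
  have hfm : IsFiniteMeasure ((volume : Measure (En n × En n)).restrict (B ×ˢ B)) := by
    refine ⟨?_⟩
    rw [Measure.restrict_apply_univ, Measure.volume_eq_prod, Measure.prod_prod]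
    exact ENNReal.mul_lt_top measure_ball_lt_top measure_ball_lt_top
  have hlim2 : ∀ᵐ z ∂((volume : Measure (En n × En n)).restrict (B ×ˢ B)), Filter.Tendsto
      (fun j => Wf n p q s t a u z * (PP n (dl j) φ z.1 - PP n (dl j) φ z.2)) Filter.atTop
      (nhds (Wf n p q s t a u z * (φ z.1 - φ z.2))) := by
    apply ae_restrict_of_ae
    rw [Measure.volume_eq_prod]
    filter_upwards [Measure.quasiMeasurePreserving_fst.ae hae, Measure.quasiMeasurePreserving_snd.ae hae] with z h1 h2
    exact (h1.sub h2).const_mul _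
  set c0 := ENNReal.ofReal (1 + M * (2 * Λ) ^ (q - p) * 2 ^ (s * p - t * q)) with hc0
  have hap : 0 < (p - 1) / p := by apply div_pos <;> linarith
  have hV := vitali (μ := (volume : Measure (En n × En n)).restrict (B ×ˢ B)) 
    (F := fun j z => Wf n p q s t a u z * (PP n (dl j) φ z.1 - PP n (dl j) φ z.2))
    (F0 := fun z => Wf n p q s t a u z * (φ z.1 - φ z.2)) 
    (fun j => by have := hPm j; fun_prop) (by fun_prop) hlim2 
    (X := fun z => c0 ^ (p / (p - 1)) * (‖u z.1 - u z.2‖ₑ ^ p * kk (-(n + s * p)) z.1 z.2)) 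
    (Y := fun j z => ‖PP n (dl j) φ z.1 - PP n (dl j) φ z.2‖ₑ ^ p * kk (-(n + s * p)) z.1 z.2)
    (by have := S.um; fun_prop) (fun j => by have := hPm j; fun_prop)
    (a := (p - 1) / p) (b := 1 / p) hap (by positivity) (by field_simp; ring)
    hg ?_ (fun j => (setLIntegral_le_lintegral _ _).trans (PP_gag (dl_pos j) (by linarith) hφ hK)) ?_
  · refine ⟨hV.1, ?_⟩
    refine tendsto_nhds_unique hV.2 ?_
    simp only [hweak]
    obtain ⟨Kh, hKh0, hKh⟩ := hh_bound H S
    apply Filter.Tendsto.add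
    · apply tendsto_integral_of_dominated_convergence (fun x => (ball (0:En n) (3/4)).indicator (fun _ => Kh * K) x)
      · intro j
        have := hPm j
        exact Measurable.aestronglyMeasurable (by fun_prop)
      · exact (integrable_indicator_iff measurableSet_ball).2 (integrableOn_const measure_ball_lt_top.ne)
      · intro j
        refine Filter.Eventually.of_forall fun x => ?_
        by_cases hx : x ∈ ball (0 : En n) (3/4)
        · simp only [indicator, hx, if_true, norm_mul]
          gcongr
          · exact hKh x (by rw [mem_ball_zero_iff] at hx; exact hx.le)
          · exact PP_bdd (dl_pos j) hK x
        · simp [hx, hz' j x hx]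
      · filter_upwards [hae] with x hx
        exact hx.const_mul _
    · apply tendsto_integral_of_dominated_convergence (fun x => B.indicator (fun x => ‖f x‖ * K) x)
      · intro j
        have := hPm j
        have := S.fm
        exact Measurable.aestronglyMeasurable (by fun_prop)
      · exact (integrable_indicator_iff measurableSet_ball).2 (S.fi.norm.mul_const K)
      · intro j
        refine Filter.Eventually.of_forall fun x => ?_
        by_cases hx : x ∈ B
        · simp only [indicator, hx, if_true, norm_mul]
          gcongr
          exact PP_bdd (dl_pos j) hK x
        · simp [hx, hz' j x fun h => hx (ball_subset_ball (by norm_num) h)]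
      · filter_upwards [hae] with x hx
        exact hx.const_mul _
  · rw [lintegral_const_mul _ (by have := S.um; fun_prop)]
    refine ENNReal.mul_lt_top (ENNReal.rpow_lt_top_of_nonneg (by apply div_nonneg <;> linarith) ENNReal.ofReal_ne_top) ?_
    exact (setLIntegral_le_lintegral _ _).trans_lt S.gf
  · intro j
    filter_upwards [self_mem_ae_restrict (measurableSet_ball.prod measurableSet_ball)] with z hz
    rw [enorm_mul]
    have hzz : ‖z.1 - z.2‖ ≤ 2 := by
      have h1 := mem_ball_zero_iff.1 hz.1
      have h2 := mem_ball_zero_iff.1 hz.2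
      linarith [norm_sub_le z.1 z.2]
    rw [ENNReal.mul_rpow_of_nonneg _ _ hap.le, ← ENNReal.rpow_mul,
      show p / (p - 1) * ((p - 1) / p) = 1 by field_simp [show p - 1 ≠ 0 by linarith], ENNReal.rpow_one, mul_assoc, ← kk_split (by linarith),
      ← mul_assoc]
    gcongr
    exact Wf_enorm H S z hzz

def eT (n : ℕ) (p η τ : ℝ) (u : En n → ℝ) (k : ℕ) : ℝ≥0∞ :=
  ENNReal.ofReal (2 ^ (-(k : ℝ) * (n / p))) * (gag u η (-(n + τ * η)) (ball 0 (2 ^ k))) ^ (1 / η)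

def STl (n : ℕ) (p b η τ : ℝ) (u : En n → ℝ) : ℝ≥0∞ :=
  ∑' k : ℕ, ENNReal.ofReal (2 ^ (-(k : ℝ) * (b / (p - 1)))) * eT n p η τ u k

/-- average over unit ball -/
def avu {n : ℕ} (u : En n → ℝ) (r : ℝ) : ℝ := ⨍ y in ball (0 : En n) r, u y

lemma Lp_tri {n : ℕ} {p : ℝ} (hp : 1 ≤ p) {f g h : En n → ℝ} (hf : Measurable f) (hg : Measurable g)
    (hle : ∀ x, ‖h x‖ₑ ≤ ‖f x‖ₑ + ‖g x‖ₑ) (D : Set (En n)) :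
    (∫⁻ x in D, ‖h x‖ₑ ^ p) ^ (1 / p) ≤ (∫⁻ x in D, ‖f x‖ₑ ^ p) ^ (1 / p) + (∫⁻ x in D, ‖g x‖ₑ ^ p) ^ (1 / p) := by
  have := ENNReal.lintegral_Lp_add_le (μ := volume.restrict D) (f := fun x => ‖f x‖ₑ) (g := fun x => ‖g x‖ₑ)
    (by fun_prop) (by fun_prop) hp
  refine le_trans ?_ this
  gcongr with x
  exact hle x

lemma two_pow_pos' (k : ℕ) : (0:ℝ) < 2 ^ k := by positivity

lemma osc_rec {n : ℕ} (hn : 2 ≤ n) {p : ℝ} (hp : 2 ≤ p) : ∃ C : ℝ≥0∞, C < ⊤ ∧ 1 ≤ C ∧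
    ∀ η τ, 1 ≤ η → η ≤ p → 0 ≤ τ → n / η = τ + n / p → ∀ u : En n → ℝ, Measurable u → ∀ Λ, (∀ x, |u x| ≤ Λ) → ∀ k : ℕ,
    ENNReal.ofReal (2 ^ (-(k : ℝ) * (n / p))) * (∫⁻ x in ball (0 : En n) (2 ^ k), ‖u x - avu u 1‖ₑ ^ p) ^ (1 / p)
      ≤ C * ∑ j ∈ Finset.range (k + 1), eT n p η τ u j := by
  obtain ⟨C, hC1, hC⟩ := SP n (by omega) p (by linarith)
  have hp0 : 0 < p := by linarith
  set C1 : ℝ≥0∞ := ENNReal.ofReal C ^ (1 / p) with hC1d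
  have hC1f : C1 < ⊤ := ENNReal.rpow_lt_top_of_nonneg (by positivity) ENNReal.ofReal_ne_top
  have hC11 : 1 ≤ C1 := by
    apply ENNReal.one_le_rpow _ (by positivity)
    simpa using hC1
  set N : ℝ≥0∞ := ENNReal.ofReal (2 ^ ((n : ℝ) / p)) with hN
  refine ⟨C1 * (1 + N), ENNReal.mul_lt_top hC1f (ENNReal.add_lt_top.2 ⟨by simp, ENNReal.ofReal_lt_top⟩), 
    by calc (1:ℝ≥0∞) = 1 * 1 := by simp
        _ ≤ _ := by gcongr; simp, ?_⟩
  intro η τ h1 h2 h3 h4 u hu Λ hΛ k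
  have hη : 0 < η := by linarith
  have ho : ∀ k : ℕ, (∫⁻ x in ball (0 : En n) (2 ^ k), ‖u x - avu u (2 ^ k)‖ₑ ^ p) ^ (1 / p) ≤
      C1 * gag u η (-(n + τ * η)) (ball 0 (2 ^ k)) ^ (1 / η) := by
    intro k
    have := hC η τ h1 h2 h3 h4 u hu Λ hΛ 0 (2 ^ k) (by positivity)
    calc _ ≤ (ENNReal.ofReal C * gag u η (-(n + τ * η)) (ball 0 (2 ^ k)) ^ (p / η)) ^ (1 / p) := by
          gcongr; exact this
      _ = _ := by
          rw [ENNReal.mul_rpow_of_nonneg _ _ (by positivity), ← ENNReal.rpow_mul]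
          congr 2; field_simp
  have hw : ∀ k : ℕ, ENNReal.ofReal (2 ^ (-((k + 1 : ℕ) : ℝ) * (n / p))) * N = ENNReal.ofReal (2 ^ (-(k : ℝ) * (n / p))) := by
    intro k
    rw [hN, ← ENNReal.ofReal_mul (by positivity), ← Real.rpow_add (by norm_num)]
    congr 2; push_cast; ring
  induction k with
  | zero =>
    simp only [Finset.range_one, Finset.sum_singleton, eT, zero_add]
    have := ho 0
    simp only [pow_zero] at this ⊢
    calc _ ≤ ENNReal.ofReal (2 ^ (-((0:ℕ):ℝ) * (n / p))) * (C1 * gag u η (-(n + τ * η)) (ball 0 1) ^ (1 / η)) := by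
          gcongr
      _ = C1 * 1 * (ENNReal.ofReal (2 ^ (-((0:ℕ):ℝ) * (n / p))) * gag u η (-(n + τ * η)) (ball 0 1) ^ (1 / η)) := by ring
      _ ≤ _ := by gcongr; simp
  | succ k ih =>
    rw [Finset.sum_range_succ, mul_add]
    have hr : (0:ℝ) < 2 ^ k := by positivity
    have hr' : (0:ℝ) < 2 ^ (k + 1) := by positivity
    have hcst : ∀ (c : ℝ) (m : ℕ), (∫⁻ x in ball (0 : En n) (2 ^ m), ‖c‖ₑ ^ p) ^ (1 / p) = ‖c‖ₑ * ENNReal.ofReal (m0 n) ^ (1 / p) * ENNReal.ofReal (2 ^ ((m:ℝ) * (n / p))) := by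
      intro c m
      have hm0 := m0_pos n
      rw [setLIntegral_const, vol_ball _ (by positivity), ENNReal.mul_rpow_of_nonneg _ _ (by positivity), ← ENNReal.rpow_mul,
        mul_one_div_cancel hp0.ne', ENNReal.rpow_one, ENNReal.ofReal_mul hm0.le, ENNReal.mul_rpow_of_nonneg _ _ (by positivity), mul_assoc]
      congr 2
      rw [ENNReal.ofReal_rpow_of_nonneg (by positivity) (by positivity)]
      congr 1
      rw [← Real.rpow_natCast, ← Real.rpow_mul (by norm_num), ← Real.rpow_mul (by norm_num)]
      congr 1; field_simp
    have hsub : ball (0 : En n) (2 ^ k) ⊆ ball 0 (2 ^ (k + 1)) := ball_subset_ball (by gcongr <;> norm_num)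
    set O := (∫⁻ x in ball (0 : En n) (2 ^ (k + 1)), ‖u x - avu u (2 ^ (k + 1))‖ₑ ^ p) ^ (1 / p) with hO
    set d := (∫⁻ x in ball (0 : En n) (2 ^ k), ‖u x - avu u 1‖ₑ ^ p) ^ (1 / p) with hd
    have e1 : (∫⁻ x in ball (0 : En n) (2 ^ (k + 1)), ‖u x - avu u 1‖ₑ ^ p) ^ (1 / p) ≤
       O + (∫⁻ x in ball (0 : En n) (2 ^ (k + 1)), ‖avu u (2 ^ (k + 1)) - avu u 1‖ₑ ^ p) ^ (1 / p) := by
      apply Lp_tri (by linarith) (by fun_prop) (by fun_prop)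
      intro x
      calc _ = ‖(u x - avu u (2 ^ (k + 1))) + (avu u (2 ^ (k + 1)) - avu u 1)‖ₑ := by ring_nf
        _ ≤ _ := enorm_add_le _ _
    have e2 : (∫⁻ x in ball (0 : En n) (2 ^ k), ‖avu u (2 ^ (k + 1)) - avu u 1‖ₑ ^ p) ^ (1 / p) ≤ O + d := by
      calc _ ≤ (∫⁻ x in ball (0 : En n) (2 ^ k), ‖u x - avu u (2 ^ (k + 1))‖ₑ ^ p) ^ (1 / p) + d := by
            apply Lp_tri (by linarith) (by fun_prop) (by fun_prop)
            intro x
            calc _ = ‖(u x - avu u 1) - (u x - avu u (2 ^ (k + 1)))‖ₑ := by ring_nf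
              _ ≤ ‖u x - avu u 1‖ₑ + ‖u x - avu u (2 ^ (k + 1))‖ₑ := enorm_sub_le
              _ = _ := add_comm _ _
        _ ≤ _ := by
            gcongr ?_ + _
            exact ENNReal.rpow_le_rpow (lintegral_mono_set hsub) (by positivity)
    have e3 : (∫⁻ x in ball (0 : En n) (2 ^ (k + 1)), ‖avu u (2 ^ (k + 1)) - avu u 1‖ₑ ^ p) ^ (1 / p) =
      N * (∫⁻ x in ball (0 : En n) (2 ^ k), ‖avu u (2 ^ (k + 1)) - avu u 1‖ₑ ^ p) ^ (1 / p) := by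
      rw [hcst, hcst, hN]
      have : ENNReal.ofReal (2 ^ (((k + 1 : ℕ) : ℝ) * (n / p))) = ENNReal.ofReal (2 ^ ((n : ℝ) / p)) * ENNReal.ofReal (2 ^ ((k : ℝ) * (n / p))) := by
        rw [← ENNReal.ofReal_mul (by positivity), ← Real.rpow_add (by norm_num)]
        congr 2; push_cast; ring
      rw [this]; ring
    set W := ENNReal.ofReal (2 ^ (-((k + 1 : ℕ) : ℝ) * (n / p))) with hW
    calc W * (∫⁻ x in ball (0 : En n) (2 ^ (k + 1)), ‖u x - avu u 1‖ₑ ^ p) ^ (1 / p)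
        ≤ W * (O + N * (O + d)) := by
          gcongr; exact e1.trans (by rw [e3]; gcongr)
      _ = ENNReal.ofReal (2 ^ (-(k : ℝ) * (n / p))) * d + (1 + N) * (W * O) := by
          rw [← hw k]; ring
      _ ≤ _ := by
          refine add_le_add ih ?_
          · calc (1 + N) * (W * O) ≤ (1 + N) * (W * (C1 * gag u η (-(n + τ * η)) (ball 0 (2 ^ (k + 1))) ^ (1 / η))) := by
                  gcongr; exact ho (k + 1)
              _ = _ := by unfold eT; rw [← hW]; ring

lemma ext_cover (n : ℕ) : (ball (0 : En n) 1)ᶜ ⊆ ⋃ k : ℕ, ball (0 : En n) (2 ^ (k + 1)) \ ball 0 (2 ^ k) := by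
  intro x hx
  have h1 : 1 ≤ ‖x‖ := by simpa using hx
  obtain ⟨k, hk1, hk2⟩ := exists_nat_pow_near h1 (by norm_num : (1:ℝ) < 2)
  refine mem_iUnion.2 ⟨k, ?_, ?_⟩
  · simpa using hk2
  · simpa using hk1

lemma geo_tail {g : ℝ} (hg0 : 0 ≤ g) (hg1 : g < 1) {w : ℕ → ℝ≥0∞} (hwg : ∀ k, w k = ENNReal.ofReal g ^ k) (j : ℕ)
    {e : ℝ≥0∞} : ∑' k : ℕ, (if j ≤ k then w k * e else 0) = ENNReal.ofReal ((1 - g)⁻¹) * (w j * e) := by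
  have : ∑' k : ℕ, (if j ≤ k then w k * e else 0) = ∑' i : ℕ, w (i + j) * e := by
    rw [← Summable.sum_add_tsum_nat_add' (k := j) (f := fun k : ℕ => (if j ≤ k then w k * e else 0)) ENNReal.summable]
    rw [Finset.sum_eq_zero, zero_add]
    · congr 1; ext i; rw [if_pos (by omega)]
    · intro i hi; rw [if_neg (by simp at hi; omega)]
  rw [this, ENNReal.tsum_mul_right, ← mul_assoc]
  congr 1
  simp only [hwg, pow_add]
  rw [ENNReal.tsum_mul_right, ENNReal.tsum_geometric, ENNReal.ofReal_inv_of_pos (by linarith),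
    ENNReal.ofReal_sub _ hg0, ENNReal.ofReal_one]

set_option maxHeartbeats 1000000 in
lemma tail_sum {n : ℕ} (hn : 2 ≤ n) {p b : ℝ} (hp : 2 ≤ p) (hb : 0 < b) : ∃ C : ℝ≥0∞, C < ⊤ ∧
    ∀ η τ, 1 ≤ η → η ≤ p → 0 ≤ τ → n / η = τ + n / p → ∀ u : En n → ℝ, Measurable u → ∀ Λ, (∀ x, |u x| ≤ Λ) →
    ∫⁻ y in (ball (0 : En n) 1)ᶜ, ‖u y - avu u 1‖ₑ ^ (p - 1) * ENNReal.ofReal (‖y‖ ^ (-((n:ℝ) + b)))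
      ≤ C * STl n p b η τ u ^ (p - 1) := by
  obtain ⟨C, hCt, hC1, hC⟩ := osc_rec hn hp
  have hp0 : 0 < p := by linarith
  have hp1 : 0 < p - 1 := by linarith
  set g : ℝ := 2 ^ (-(b / (p - 1))) with hg
  have hg0 : 0 < g := by positivity
  have hg1 : g < 1 := Real.rpow_lt_one_of_one_lt_of_neg (by norm_num) (by have := div_pos hb hp1; linarith)
  have hm0 := m0_pos n
  set V : ℝ≥0∞ := ENNReal.ofReal (m0 n) ^ (1 / p) with hV
  set Q : ℝ≥0∞ := ENNReal.ofReal (2 ^ ((n:ℝ) + b)) with hQ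
  set G : ℝ≥0∞ := ENNReal.ofReal ((1 - g)⁻¹) with hG
  refine ⟨Q * V * (C * G) ^ (p - 1), ?_, ?_⟩
  · refine ENNReal.mul_lt_top (ENNReal.mul_lt_top ENNReal.ofReal_lt_top ?_) ?_
    · exact ENNReal.rpow_lt_top_of_nonneg (by positivity) ENNReal.ofReal_ne_top
    · exact ENNReal.rpow_lt_top_of_nonneg (by linarith) (ENNReal.mul_lt_top hCt ENNReal.ofReal_lt_top).ne
  intro η τ h1 h2 h3 h4 u hu Λ hΛ
  have hC' := hC η τ h1 h2 h3 h4 u hu Λ hΛ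
  set d : ℕ → ℝ≥0∞ := fun k => ENNReal.ofReal (2 ^ (-(k : ℝ) * (n / p))) * (∫⁻ x in ball (0 : En n) (2 ^ k), ‖u x - avu u 1‖ₑ ^ p) ^ (1 / p) with hd
  set w : ℕ → ℝ≥0∞ := fun k => ENNReal.ofReal (2 ^ (-(k : ℝ) * (b / (p - 1)))) with hw
  have hwg : ∀ k, w k = ENNReal.ofReal g ^ k := by
    intro k
    rw [hw, hg, ← ENNReal.ofReal_pow (by positivity), ← Real.rpow_natCast, ← Real.rpow_mul (by norm_num)]
    congr 2; ring
  -- single annulus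
  have hann : ∀ k : ℕ, ∫⁻ y in ball (0 : En n) (2 ^ (k + 1)) \ ball 0 (2 ^ k), ‖u y - avu u 1‖ₑ ^ (p - 1) * ENNReal.ofReal (‖y‖ ^ (-((n:ℝ) + b))) ≤
      Q * V * (w (k + 1) * d (k + 1)) ^ (p - 1) := by
    intro k
    have hhol : ∫⁻ y in ball (0 : En n) (2 ^ (k + 1)), ‖u y - avu u 1‖ₑ ^ (p - 1) ≤ 
        (∫⁻ x in ball (0 : En n) (2 ^ (k + 1)), ‖u x - avu u 1‖ₑ ^ p) ^ ((p - 1) / p) * volume (ball (0 : En n) (2 ^ (k + 1))) ^ (1 / p) := by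
      have := ENNReal.lintegral_mul_norm_pow_le (μ := volume.restrict (ball (0 : En n) (2 ^ (k + 1))))
        (f := fun x => ‖u x - avu u 1‖ₑ ^ p) (g := fun _ => 1) (by fun_prop) (by fun_prop) (p := (p - 1) / p) (q := 1 / p)
        (by positivity) (by positivity) (by field_simp; ring)
      simp only [ENNReal.one_rpow, mul_one, lintegral_one, Measure.restrict_apply_univ, ← ENNReal.rpow_mul] at this
      rwa [mul_div_cancel₀ _ hp0.ne'] at this
    calc _ ≤ ∫⁻ y in ball (0 : En n) (2 ^ (k + 1)) \ ball 0 (2 ^ k), ‖u y - avu u 1‖ₑ ^ (p - 1) * ENNReal.ofReal ((2 ^ k) ^ (-((n:ℝ) + b))) := by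
          apply setLIntegral_mono' (measurableSet_ball.diff measurableSet_ball)
          intro y hy
          refine mul_le_mul_right (ENNReal.ofReal_le_ofReal ?_) _
          have : (2:ℝ) ^ k ≤ ‖y‖ := by simpa using hy.2
          apply Real.rpow_le_rpow_of_nonpos (by positivity) this
          have : (0:ℝ) ≤ n := by positivity
          linarith
      _ ≤ ∫⁻ y in ball (0 : En n) (2 ^ (k + 1)), ‖u y - avu u 1‖ₑ ^ (p - 1) * ENNReal.ofReal ((2 ^ k) ^ (-((n:ℝ) + b))) :=
          lintegral_mono_set sdiff_subset
      _ = (∫⁻ y in ball (0 : En n) (2 ^ (k + 1)), ‖u y - avu u 1‖ₑ ^ (p - 1)) * ENNReal.ofReal ((2 ^ k) ^ (-((n:ℝ) + b))) :=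
          lintegral_mul_const' _ _ ENNReal.ofReal_ne_top
      _ ≤ ((∫⁻ x in ball (0 : En n) (2 ^ (k + 1)), ‖u x - avu u 1‖ₑ ^ p) ^ ((p - 1) / p) * volume (ball (0 : En n) (2 ^ (k + 1))) ^ (1 / p)) * ENNReal.ofReal ((2 ^ k) ^ (-((n:ℝ) + b))) := by
          gcongr
      _ = _ := by
          simp only [hd, hw]
          rw [vol_ball _ (by positivity), ENNReal.ofReal_mul hm0.le, ENNReal.mul_rpow_of_nonneg _ _ (by positivity), ← hV,
            ENNReal.mul_rpow_of_nonneg _ _ hp1.le, ENNReal.mul_rpow_of_nonneg _ _ hp1.le, ← ENNReal.rpow_mul _ (1 / p),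
            one_div_mul_eq_div]
          rw [ENNReal.ofReal_rpow_of_nonneg (by positivity) (by positivity), ENNReal.ofReal_rpow_of_nonneg (by positivity) (by positivity),
            ENNReal.ofReal_rpow_of_nonneg (by positivity) (by positivity), hQ]
          set X := (∫⁻ x in ball (0 : En n) (2 ^ (k + 1)), ‖u x - avu u 1‖ₑ ^ p) ^ ((p - 1) / p)
          have hq : ENNReal.ofReal (((2 ^ (k + 1)) ^ (n:ℝ)) ^ (1 / p)) * ENNReal.ofReal ((2 ^ k) ^ (-((n:ℝ) + b))) =
            ENNReal.ofReal (2 ^ ((n:ℝ) + b)) * ENNReal.ofReal ((2 ^ (-((k+1 : ℕ) : ℝ) * (b / (p - 1)))) ^ (p - 1)) * ENNReal.ofReal ((2 ^ (-((k+1 : ℕ) : ℝ) * (n / p))) ^ (p - 1)) := by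
            rw [← ENNReal.ofReal_mul (by positivity), ← ENNReal.ofReal_mul (by positivity), ← ENNReal.ofReal_mul (by positivity)]
            congr 1
            rw [← Real.rpow_natCast, ← Real.rpow_natCast, ← Real.rpow_mul (by norm_num <;> positivity), ← Real.rpow_mul (by norm_num <;> positivity), ← Real.rpow_mul (by norm_num <;> positivity),
              ← Real.rpow_mul (by norm_num), ← Real.rpow_mul (by norm_num), ← Real.rpow_add (by norm_num), ← Real.rpow_add (by norm_num), ← Real.rpow_add (by norm_num)]
            congr 1
            all_goals try positivity
            · push_cast
              field_simp
              ring
            all_goals positivity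
          calc _ = V * X * (ENNReal.ofReal (((2 ^ (k + 1)) ^ (n:ℝ)) ^ (1 / p)) * ENNReal.ofReal ((2 ^ k) ^ (-((n:ℝ) + b)))) := by ring
            _ = _ := by rw [hq]; ring
  calc _ ≤ ∑' k : ℕ, ∫⁻ y in ball (0 : En n) (2 ^ (k + 1)) \ ball 0 (2 ^ k), ‖u y - avu u 1‖ₑ ^ (p - 1) * ENNReal.ofReal (‖y‖ ^ (-((n:ℝ) + b))) :=
        (lintegral_mono_set (ext_cover n)).trans (lintegral_iUnion_le _ _)
    _ ≤ ∑' k : ℕ, Q * V * (w (k + 1) * d (k + 1)) ^ (p - 1) := ENNReal.tsum_le_tsum hann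
    _ = Q * V * ∑' k : ℕ, (w (k + 1) * d (k + 1)) ^ (p - 1) := ENNReal.tsum_mul_left
    _ ≤ Q * V * (∑' k : ℕ, w (k + 1) * d (k + 1)) ^ (p - 1) := by
        gcongr
        have : (∑' k : ℕ, (w (k + 1) * d (k + 1)) ^ (p - 1)) ^ (1 / (p - 1)) ≤ ∑' k : ℕ, ((w (k + 1) * d (k + 1)) ^ (p - 1)) ^ (1 / (p - 1)) :=
          rpow_tsum_le (by positivity) (by rw [div_le_one hp1]; linarith)
        simp only [← ENNReal.rpow_mul, mul_one_div_cancel hp1.ne', ENNReal.rpow_one] at this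
        calc _ = ((∑' k : ℕ, (w (k + 1) * d (k + 1)) ^ (p - 1)) ^ (1 / (p - 1))) ^ (p - 1) := by
              rw [← ENNReal.rpow_mul, one_div_mul_cancel hp1.ne', ENNReal.rpow_one]
          _ ≤ _ := by gcongr
    _ ≤ Q * V * (C * G * STl n p b η τ u) ^ (p - 1) := by
        gcongr
        calc ∑' k : ℕ, w (k + 1) * d (k + 1) ≤ ∑' k : ℕ, w k * d k := 
              ENNReal.tsum_comp_le_tsum_of_injective (f := fun k : ℕ => k + 1) (fun _ _ => by simp) (fun k => w k * d k)
          _ ≤ ∑' k : ℕ, ∑' j : ℕ, C * (if j ≤ k then w k * eT n p η τ u j else 0) := by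
              apply ENNReal.tsum_le_tsum
              intro k
              rw [ENNReal.tsum_mul_left]
              calc w k * d k ≤ w k * (C * ∑ j ∈ Finset.range (k + 1), eT n p η τ u j) := by gcongr; exact hC' k
                _ = C * ∑ j ∈ Finset.range (k + 1), (if j ≤ k then w k * eT n p η τ u j else 0) := by
                    rw [mul_left_comm, Finset.mul_sum]
                    congr 1
                    apply Finset.sum_congr rfl
                    intro j hj
                    rw [if_pos (by simp at hj; omega)]
                _ ≤ _ := by gcongr; exact ENNReal.sum_le_tsum _
          _ = ∑' j : ℕ, ∑' k : ℕ, C * (if j ≤ k then w k * eT n p η τ u j else 0) := ENNReal.tsum_comm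
          _ = ∑' j : ℕ, C * G * (w j * eT n p η τ u j) := by
              congr 1; ext j
              rw [ENNReal.tsum_mul_left, mul_assoc C G, geo_tail hg0.le hg1 hwg j]
          _ = C * G * STl n p b η τ u := by rw [ENNReal.tsum_mul_left]; rfl
    _ = _ := by rw [ENNReal.mul_rpow_of_nonneg _ _ hp1.le]; ring

structure Cut (n : ℕ) (ψ : En n → ℝ) (L : ℝ) : Prop where
  sm : ContDiff ℝ (⊤ : ℕ∞) ψ
  cp : HasCompactSupport ψ
  nn : ∀ x, 0 ≤ ψ x
  le : ∀ x, ψ x ≤ 1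
  one : ∀ x ∈ ball (0 : En n) (1 / 4), ψ x = 1
  zero : ∀ x, x ∉ ball (0 : En n) (1 / 2) → ψ x = 0
  L0 : 0 ≤ L
  lip : ∀ x y, |ψ x - ψ y| ≤ L * min 1 ‖x - y‖

lemma exists_cut (n : ℕ) : ∃ ψ L, Cut n ψ L := by
  let b : ContDiffBump (0 : En n) := ⟨1 / 4, 1 / 2, by norm_num, by norm_num⟩
  obtain ⟨L, hL0, _, hL⟩ := smooth_lip (n := n) (φ := b) b.contDiff b.hasCompactSupport
  refine ⟨b, L, b.contDiff, b.hasCompactSupport, fun x => b.nonneg, fun x => b.le_one, fun x hx => b.one_of_mem_closedBall (ball_subset_closedBall hx), ?_, hL0, hL⟩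
  intro x hx
  have : x ∉ Function.support b := by rw [b.support_eq]; exact hx
  simpa using this

/-- localized energy -/
def EE (n : ℕ) (p s : ℝ) (m : ℕ) (ψ u : En n → ℝ) : ℝ≥0∞ :=
  ∫⁻ z in ball (0 : En n) 1 ×ˢ ball (0 : En n) 1,
    ‖u z.1 - u z.2‖ₑ ^ p * kk (-(n + s * p)) z.1 z.2 * ENNReal.ofReal (max (ψ z.1) (ψ z.2) ^ m)

def VV (n : ℕ) (p : ℝ) (u : En n → ℝ) (c : ℝ) : ℝ≥0∞ :=
  ∫⁻ x in ball (0 : En n) 1, ‖u x - c‖ₑ ^ p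

lemma lint_prod_set {n : ℕ} {A B : Set (En n)} {F : En n × En n → ℝ≥0∞} (hF : Measurable F) :
    ∫⁻ z in A ×ˢ B, F z = ∫⁻ x in A, ∫⁻ y in B, F (x, y) := by
  rw [Measure.volume_eq_prod, ← Measure.prod_restrict, lintegral_prod _ hF.aemeasurable]

lemma ball_sub_two {n : ℕ} {x : En n} (hx : x ∈ ball (0 : En n) 1) : ball (0 : En n) 1 ⊆ ball x 2 := by
  intro y hy
  simp only [mem_ball, dist_zero_right] at *
  calc dist y x ≤ ‖y‖ + ‖x‖ := by rw [dist_eq_norm]; exact norm_sub_le _ _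
    _ < 2 := by linarith

lemma kk_BB {n : ℕ} (hn : 1 ≤ n) {β : ℝ} (hβ : 0 < β) {x : En n} (hx : x ∈ ball (0 : En n) 1) :
    ∫⁻ y in ball (0 : En n) 1, kk (β - n) x y ≤ ENNReal.ofReal (n * m0 n * 2 ^ β / β) :=
  (lintegral_mono_set (ball_sub_two hx)).trans (kk_integral_ball hn x (by norm_num) hβ).le

lemma kerV {n : ℕ} (hn : 1 ≤ n) {β : ℝ} (hβ : 0 < β) {g : En n → ℝ≥0∞} (hg : Measurable g) :
    ∫⁻ z in ball (0 : En n) 1 ×ˢ ball (0 : En n) 1, (g z.1 + g z.2) * kk (β - n) z.1 z.2 ≤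
      2 * ENNReal.ofReal (n * m0 n * 2 ^ β / β) * ∫⁻ x in ball (0 : En n) 1, g x := by
  have h1 : ∫⁻ x in ball (0 : En n) 1, ∫⁻ y in ball (0 : En n) 1, g x * kk (β - n) x y ≤
      ENNReal.ofReal (n * m0 n * 2 ^ β / β) * ∫⁻ x in ball (0 : En n) 1, g x := by
    rw [← lintegral_const_mul' _ _ ENNReal.ofReal_ne_top]
    apply setLIntegral_mono' measurableSet_ball
    intro x hx
    rw [lintegral_const_mul _ (by fun_prop), mul_comm]
    gcongr
    exact kk_BB hn hβ hx
  have h2 : ∫⁻ x in ball (0 : En n) 1, ∫⁻ y in ball (0 : En n) 1, g y * kk (β - n) x y ≤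
      ENNReal.ofReal (n * m0 n * 2 ^ β / β) * ∫⁻ x in ball (0 : En n) 1, g x := by
    rw [lintegral_lintegral_swap (by fun_prop)]
    simp_rw [kk_comm (β - n)]
    exact h1
  simp_rw [add_mul]
  rw [lintegral_add_left (by fun_prop), lint_prod_set (by fun_prop), lint_prod_set (by fun_prop)]
  calc _ ≤ _ := add_le_add h1 h2
    _ = _ := by ring

def phi {n : ℕ} (m : ℕ) (ψ u : En n → ℝ) (c : ℝ) (x : En n) : ℝ := (u x - c) * ψ x ^ m

lemma Cut.meas {n : ℕ} {ψ : En n → ℝ} {L : ℝ} (K : Cut n ψ L) : Measurable ψ := K.sm.continuous.measurable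

lemma phi_diff {n : ℕ} {ψ : En n → ℝ} {L : ℝ} (K : Cut n ψ L) (m : ℕ) {p : ℝ} (hp : 1 ≤ p) (hm : 1 ≤ m) (u : En n → ℝ) (c : ℝ) (x y : En n) :
    |phi m ψ u c x - phi m ψ u c y| ^ p ≤ 2 ^ p * (|u x - u y| ^ p * max (ψ x) (ψ y) ^ m) +
      4 ^ p * (m * L) ^ p * ((|u x - c| ^ p + |u y - c| ^ p) * ‖x - y‖ ^ p) := by
  have hL := K.L0
  have hmx0 : 0 ≤ max (ψ x) (ψ y) := le_max_of_le_left (K.nn x)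
  have hmx1 : max (ψ x) (ψ y) ≤ 1 := max_le (K.le x) (K.le y)
  have h1 : |phi m ψ u c x - phi m ψ u c y| ≤ |u x - u y| * max (ψ x) (ψ y) ^ m + m * (|u x - c| + |u y - c|) * (L * ‖x - y‖) := by
    have := prod_sub_le (a := u x - c) (b := u y - c) (m := m) (K.nn y) (K.nn x)
    rw [show u x - c - (u y - c) = u x - u y by ring] at this
    refine this.trans (add_le_add le_rfl ?_)
    calc (m:ℝ) * (|u x - c| + |u y - c|) * max (ψ x) (ψ y) ^ (m - 1) * |ψ x - ψ y|
        ≤ m * (|u x - c| + |u y - c|) * 1 * (L * ‖x - y‖) := by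
          gcongr
          · exact pow_le_one₀ hmx0 hmx1
          · exact (K.lip x y).trans (by gcongr; exact min_le_right _ _)
      _ = _ := by ring
  calc _ ≤ (|u x - u y| * max (ψ x) (ψ y) ^ m + m * (|u x - c| + |u y - c|) * (L * ‖x - y‖)) ^ p := by gcongr
    _ ≤ 2 ^ p * ((|u x - u y| * max (ψ x) (ψ y) ^ m) ^ p + (m * (|u x - c| + |u y - c|) * (L * ‖x - y‖)) ^ p) :=
        two_pow_add (by positivity) (by positivity) (by linarith)
    _ ≤ 2 ^ p * (|u x - u y| ^ p * max (ψ x) (ψ y) ^ m + 2 ^ p * (m * L) ^ p * ((|u x - c| ^ p + |u y - c| ^ p) * ‖x - y‖ ^ p)) := by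
        gcongr
        · rw [Real.mul_rpow (by positivity) (by positivity)]
          gcongr
          calc (max (ψ x) (ψ y) ^ m) ^ p ≤ (max (ψ x) (ψ y) ^ m) ^ (1:ℝ) :=
                Real.rpow_le_rpow_of_exponent_ge_of_imp (by positivity) (pow_le_one₀ hmx0 hmx1) hp (by intro _ h; linarith)
            _ = _ := Real.rpow_one _
        · rw [show (m:ℝ) * (|u x - c| + |u y - c|) * (L * ‖x - y‖) = (m * L) * ((|u x - c| + |u y - c|) * ‖x - y‖) by ring,
            Real.mul_rpow (x := m * L) (by positivity) (by positivity), Real.mul_rpow (y := ‖x - y‖) (by positivity) (by positivity)]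
          have := two_pow_add (abs_nonneg (u x - c)) (abs_nonneg (u y - c)) (r := p) (by linarith)
          calc _ ≤ (m * L) ^ p * ((2 ^ p * (|u x - c| ^ p + |u y - c| ^ p)) * ‖x - y‖ ^ p) := by gcongr
            _ = _ := by ring
    _ = _ := by
        have e4 : (4:ℝ) ^ p = 2 ^ p * 2 ^ p := by rw [← Real.mul_rpow (by norm_num) (by norm_num)]; norm_num
        rw [e4]; ring

lemma ofReal_abs_rpow {x p : ℝ} (hp : 0 ≤ p) : ENNReal.ofReal (|x| ^ p) = ‖x‖ₑ ^ p := by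
  rw [← ENNReal.ofReal_rpow_of_nonneg (abs_nonneg _) hp, ← Real.norm_eq_abs, ofReal_norm]

lemma kk_shift {n : ℕ} {b p : ℝ} (hp : 0 < p) (x y : En n) : ENNReal.ofReal (‖x - y‖ ^ p) * kk b x y ≤ kk (p + b) x y := by
  unfold kk
  rw [← ENNReal.ofReal_mul (by positivity)]
  apply ENNReal.ofReal_le_ofReal
  rcases (norm_nonneg (x - y)).eq_or_lt with h | h
  · rw [← h, Real.zero_rpow hp.ne', zero_mul]; positivity
  · rw [← Real.rpow_add h]

lemma phi_gag {n : ℕ} {p q s t M Λ : ℝ} (H : Par n p q s t M Λ) {ψ : En n → ℝ} {L : ℝ} (K : Cut n ψ L) {m : ℕ} (hm : 1 ≤ m) :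
    ∃ C : ℝ≥0∞, C < ⊤ ∧ ∀ (u : En n → ℝ) (c : ℝ), Measurable u →
     ∫⁻ z in ball (0 : En n) 1 ×ˢ ball (0 : En n) 1, ‖phi m ψ u c z.1 - phi m ψ u c z.2‖ₑ ^ p * kk (-(n + s * p)) z.1 z.2 ≤
      C * (EE n p s m ψ u + VV n p u c) := by
  have hp := H.hp
  have hs1 := H.hs1
  have hp0 : 0 < p := by linarith
  have hβ : 0 < p - s * p := by nlinarith
  set K1 : ℝ≥0∞ := ENNReal.ofReal (2 ^ p)
  set K2 : ℝ≥0∞ := ENNReal.ofReal (4 ^ p * (m * L) ^ p)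
  set K3 : ℝ≥0∞ := 2 * ENNReal.ofReal (n * m0 n * 2 ^ (p - s * p) / (p - s * p))
  refine ⟨K1 + K2 * K3, by
    simp only [K1, K2, K3]; exact ENNReal.add_lt_top.2 ⟨ENNReal.ofReal_lt_top, ENNReal.mul_lt_top ENNReal.ofReal_lt_top (ENNReal.mul_lt_top (by simp) ENNReal.ofReal_lt_top)⟩, ?_⟩
  intro u c hu
  have hψ := K.meas
  have hL := K.L0
  calc _ ≤ ∫⁻ z in ball (0 : En n) 1 ×ˢ ball (0 : En n) 1, (K1 * (‖u z.1 - u z.2‖ₑ ^ p * kk (-(n + s * p)) z.1 z.2 * ENNReal.ofReal (max (ψ z.1) (ψ z.2) ^ m)) +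
        K2 * ((‖u z.1 - c‖ₑ ^ p + ‖u z.2 - c‖ₑ ^ p) * kk ((p - s * p) - n) z.1 z.2)) := by
        apply lintegral_mono
        rintro ⟨x, y⟩
        simp only
        have h := ENNReal.ofReal_le_ofReal (phi_diff K m (by linarith : 1 ≤ p) hm u c x y)
        have hmx0 : 0 ≤ max (ψ x) (ψ y) := le_max_of_le_left (K.nn x)
        rw [ENNReal.ofReal_add (by positivity) (by positivity), ENNReal.ofReal_mul (by positivity), ENNReal.ofReal_mul (by positivity),
          ENNReal.ofReal_mul (p := 4 ^ p * (m * L) ^ p) (by positivity), ENNReal.ofReal_mul (p := |u x - c| ^ p + |u y - c| ^ p) (by positivity), ENNReal.ofReal_add (by positivity) (by positivity)] at h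
        simp only [ofReal_abs_rpow hp0.le] at h
        calc _ ≤ _ := mul_le_mul_left h _
          _ = K1 * (‖u x - u y‖ₑ ^ p * kk (-(n + s * p)) x y * ENNReal.ofReal (max (ψ x) (ψ y) ^ m)) +
            K2 * ((‖u x - c‖ₑ ^ p + ‖u y - c‖ₑ ^ p) * (ENNReal.ofReal (‖x - y‖ ^ p) * kk (-(n + s * p)) x y)) := by ring
          _ ≤ _ := by
            gcongr
            refine (kk_shift hp0 x y).trans (le_of_eq ?_)
            congr 1; ring
    _ = K1 * EE n p s m ψ u + K2 * ∫⁻ z in ball (0 : En n) 1 ×ˢ ball (0 : En n) 1, ((‖u z.1 - c‖ₑ ^ p + ‖u z.2 - c‖ₑ ^ p) * kk ((p - s * p) - n) z.1 z.2) := by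
        rw [lintegral_add_left (by fun_prop), lintegral_const_mul _ (by fun_prop), lintegral_const_mul _ (by fun_prop)]; rfl
    _ ≤ K1 * EE n p s m ψ u + K2 * (K3 * VV n p u c) := by
        gcongr
        exact kerV (by have := H.hn; omega) hβ (g := fun x => ‖u x - c‖ₑ ^ p) (by fun_prop)
    _ ≤ (K1 + K2 * K3) * EE n p s m ψ u + (K1 + K2 * K3) * VV n p u c := by
        rw [← mul_assoc]; gcongr <;> simp
    _ = _ := by ring

lemma enorm_two_add {a b : ℝ} {p : ℝ} (hp : 0 ≤ p) : ‖a + b‖ₑ ^ p ≤ ENNReal.ofReal (2 ^ p) * (‖a‖ₑ ^ p + ‖b‖ₑ ^ p) := by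
  rw [← ofReal_abs_rpow hp, ← ofReal_abs_rpow hp, ← ofReal_abs_rpow hp, ← ENNReal.ofReal_add (by positivity) (by positivity),
    ← ENNReal.ofReal_mul (by positivity)]
  apply ENNReal.ofReal_le_ofReal
  exact (Real.rpow_le_rpow (abs_nonneg _) (abs_add_le a b) hp).trans (two_pow_add (abs_nonneg _) (abs_nonneg _) hp)

lemma phi_gfin {n : ℕ} {p q s t M Λ : ℝ} (H : Par n p q s t M Λ) {ψ : En n → ℝ} {L : ℝ} (K : Cut n ψ L) (m : ℕ) (hm : 1 ≤ m)
   {a : En n × En n → ℝ} {u f : En n → ℝ} (S : Sol n p q s t M Λ a u f) {c : ℝ} (hc : |c| ≤ Λ) :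
    ∫⁻ z : En n × En n, ‖phi m ψ u c z.1 - phi m ψ u c z.2‖ₑ ^ p * kk (-(n + s * p)) z.1 z.2 < ⊤ := by
  have hp := H.hp
  have hs0 := H.hs0
  have hs1 := H.hs1
  have hΛ := H.hΛ
  have hp0 : 0 < p := by linarith
  have hψ := K.meas
  have hu := S.um
  have h1 : ContDiff ℝ (⊤ : ℕ∞) (fun x => ψ x ^ m) := K.sm.pow m
  have h2 : HasCompactSupport (fun x => ψ x ^ m) := K.cp.comp_left (g := fun x => x ^ m) (by simp; omega)
  obtain ⟨L', hL0, hL1, hL2⟩ := smooth_lip h1 h2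
  have hg := gagfin (n := n) (by have := H.hn; omega) (φ := fun x => ψ x ^ m) (by fun_prop) hL2 (ρ := 1 / 2) (by
    intro x hx; rw [K.zero x hx]; simp; omega) (r := p) (b := s * p) (by positivity) (by nlinarith)
  have key : ∀ z : En n × En n, ‖phi m ψ u c z.1 - phi m ψ u c z.2‖ₑ ^ p * kk (-(n + s * p)) z.1 z.2 ≤
     ENNReal.ofReal (2 ^ p) * (‖u z.1 - u z.2‖ₑ ^ p * kk (-(n + s * p)) z.1 z.2) +
     ENNReal.ofReal (2 ^ p * (2 * Λ) ^ p) * (‖ψ z.1 ^ m - ψ z.2 ^ m‖ₑ ^ p * kk (-(n + s * p)) z.1 z.2) := by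
    rintro ⟨x, y⟩
    simp only
    have e : phi m ψ u c x - phi m ψ u c y = (u x - u y) * ψ x ^ m + (u y - c) * (ψ x ^ m - ψ y ^ m) := by unfold phi; ring
    rw [e]
    have b1 : ‖(u x - u y) * ψ x ^ m‖ₑ ≤ ‖u x - u y‖ₑ := by
      rw [enorm_mul]
      calc _ ≤ ‖u x - u y‖ₑ * 1 := by
            gcongr
            rw [← ofReal_norm, Real.norm_eq_abs, abs_of_nonneg (pow_nonneg (K.nn x) m)]
            exact ENNReal.ofReal_le_one.2 (pow_le_one₀ (K.nn x) (K.le x))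
        _ = _ := mul_one _
    have b2 : ‖u y - c‖ₑ ≤ ENNReal.ofReal (2 * Λ) := by
      rw [← ofReal_norm, Real.norm_eq_abs]
      apply ENNReal.ofReal_le_ofReal
      calc _ ≤ |u y| + |c| := abs_sub _ _
        _ ≤ _ := by linarith [S.ub y]
    calc _ ≤ ENNReal.ofReal (2 ^ p) * (‖(u x - u y) * ψ x ^ m‖ₑ ^ p + ‖(u y - c) * (ψ x ^ m - ψ y ^ m)‖ₑ ^ p) * kk (-(n + s * p)) x y := by
          gcongr; exact enorm_two_add hp0.le
      _ ≤ ENNReal.ofReal (2 ^ p) * (‖u x - u y‖ₑ ^ p + ENNReal.ofReal (2 * Λ) ^ p * ‖ψ x ^ m - ψ y ^ m‖ₑ ^ p) * kk (-(n + s * p)) x y := by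
          rw [enorm_mul (u y - c), ENNReal.mul_rpow_of_nonneg _ _ hp0.le]
          gcongr
      _ = _ := by
          rw [ENNReal.ofReal_mul (p := 2 ^ p) (by positivity), ← ENNReal.ofReal_rpow_of_nonneg (by positivity : 0 ≤ 2 * Λ) hp0.le]; ring
  refine (lintegral_mono key).trans_lt ?_
  rw [lintegral_add_left (by fun_prop), lintegral_const_mul _ (by fun_prop), lintegral_const_mul _ (by fun_prop)]
  exact ENNReal.add_lt_top.2 ⟨ENNReal.mul_lt_top ENNReal.ofReal_lt_top S.gf, ENNReal.mul_lt_top ENNReal.ofReal_lt_top hg⟩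

def Kcac (n : ℕ) (p q s t M Λ L : ℝ) (m : ℕ) : ℝ :=
  2 ^ p * L ^ p * (2 ^ (p - 1) * (m : ℝ) ^ p + M * (2 ^ (q - 1) * (m : ℝ) ^ q) * (4 * Λ) ^ (q - p) * 2 ^ (s * p - t * q))

lemma cac_pt {n : ℕ} {p q s t M Λ : ℝ} (H : Par n p q s t M Λ) {ψ : En n → ℝ} {L : ℝ} (K : Cut n ψ L) {m : ℕ} (hm : q ≤ m)
   {a : En n × En n → ℝ} {u f : En n → ℝ} (S : Sol n p q s t M Λ a u f) {c : ℝ} (hc : |c| ≤ Λ) (x y : En n)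
   (hxy : ‖x - y‖ ≤ 2) :
    1 / 2 * (|u x - u y| ^ p * ‖x - y‖ ^ (-((n:ℝ) + s * p)) * max (ψ x) (ψ y) ^ m) ≤
      Wf n p q s t a u (x, y) * (phi m ψ u c x - phi m ψ u c y) +
      Kcac n p q s t M Λ L m * ((|u x - c| ^ p + |u y - c| ^ p) * (‖x - y‖ ^ p * ‖x - y‖ ^ (-((n:ℝ) + s * p)))) := by
  have hp := H.hp
  have hpq := H.hpq
  have hΛ := H.hΛ
  have hM := H.hM
  have htq := H.htq
  have hL := K.L0
  have ha0 := S.a0 (x, y)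
  have haM := S.aM (x, y)
  have hKc : 0 ≤ Kcac n p q s t M Λ L m := by unfold Kcac; positivity
  rcases (norm_nonneg (x - y)).eq_or_lt with h | hD
  · have : x = y := by rw [← sub_eq_zero, ← norm_eq_zero]; exact h.symm
    subst this
    simp [Real.zero_rpow (by linarith : p ≠ 0)]
  set D := ‖x - y‖ with hDd
  set A := |u x - c| + |u y - c| with hA
  have hA0 : 0 ≤ A := by positivity
  have hA4 : A ≤ 4 * Λ := by
    have h1 : |u x - c| ≤ |u x| + |c| := abs_sub _ _
    have h2 : |u y - c| ≤ |u y| + |c| := abs_sub _ _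
    linarith [S.ub x, S.ub y]
  have hAp : A ^ p ≤ 2 ^ p * (|u x - c| ^ p + |u y - c| ^ p) := two_pow_add (abs_nonneg _) (abs_nonneg _) (by linarith)
  have hAq : A ^ q ≤ (4 * Λ) ^ (q - p) * A ^ p := by
    rcases hA0.eq_or_lt with h0 | h0
    · rw [← h0, Real.zero_rpow (by linarith), Real.zero_rpow (by linarith)]; simp
    · calc A ^ q = A ^ (q - p) * A ^ p := by rw [← Real.rpow_add h0]; congr 1; ring
        _ ≤ _ := by gcongr
  have hψ1 : |ψ x - ψ y| ≤ 1 := by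
    rw [abs_le]; constructor <;> linarith [K.nn x, K.nn y, K.le x, K.le y]
  have hψp : |ψ x - ψ y| ^ p ≤ L ^ p * D ^ p := by
    rw [← Real.mul_rpow hL hD.le]
    exact Real.rpow_le_rpow (abs_nonneg _) ((K.lip x y).trans (by gcongr; exact min_le_right _ _)) (by linarith)
  have hψq : |ψ x - ψ y| ^ q ≤ |ψ x - ψ y| ^ p :=
    Real.rpow_le_rpow_of_exponent_ge_of_imp (abs_nonneg _) hψ1 hpq (by intro _ h; linarith)
  have c1 := cacc (a := u x - c) (b := u y - c) (m := m) hp (by linarith : p ≤ m) (K.nn y) (K.nn x) (K.le x) (K.le y)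
  have c2 := cacc (a := u x - c) (b := u y - c) (m := m) (by linarith : 2 ≤ q) hm (K.nn y) (K.nn x) (K.le x) (K.le y)
  have hmx : 0 ≤ max (ψ x) (ψ y) := le_max_of_le_left (K.nn x)
  rw [show u x - c - (u y - c) = u x - u y by ring, ← hA] at c1 c2
  have eφ : (u x - c) * ψ x ^ m - (u y - c) * ψ y ^ m = phi m ψ u c x - phi m ψ u c y := rfl
  rw [eφ] at c1 c2
  set dφ := phi m ψ u c x - phi m ψ u c y with hdφ
  set k1 := D ^ (-((n:ℝ) + s * p)) with hk1
  set k2 := D ^ (-((n:ℝ) + t * q)) with hk2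
  have hk1p : 0 < k1 := Real.rpow_pos_of_pos hD _
  have hk2p : 0 < k2 := Real.rpow_pos_of_pos hD _
  have hk21 : k2 ≤ 2 ^ (s * p - t * q) * k1 := by
    calc k2 = D ^ (s * p - t * q) * k1 := by rw [hk1, hk2, ← Real.rpow_add hD]; congr 1; ring
      _ ≤ _ := by gcongr
  set X := |u x - c| ^ p + |u y - c| ^ p with hX
  have hX0 : 0 ≤ X := by positivity
  have eW : Wf n p q s t a u (x, y) * dφ = |u x - u y| ^ (p - 2) * (u x - u y) * dφ * k1 + a (x, y) * (|u x - u y| ^ (q - 2) * (u x - u y) * dφ) * k2 := by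
    rw [hk1, hk2, Real.rpow_neg hD.le, Real.rpow_neg hD.le, hDd]; simp only [Wf]; ring
  have d1 : 1 / 2 * (|u x - u y| ^ p * k1 * max (ψ x) (ψ y) ^ m) - (2 ^ (p - 1) * (m : ℝ) ^ p) * (2 ^ p * X) * (L ^ p * D ^ p) * k1 ≤
      |u x - u y| ^ (p - 2) * (u x - u y) * dφ * k1 := by
    calc _ = (1 / 2 * |u x - u y| ^ p * max (ψ x) (ψ y) ^ m - 2 ^ (p - 1) * (m : ℝ) ^ p * (2 ^ p * X) * (L ^ p * D ^ p)) * k1 := by ring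
      _ ≤ (1 / 2 * |u x - u y| ^ p * max (ψ x) (ψ y) ^ m - 2 ^ (p - 1) * (m : ℝ) ^ p * A ^ p * |ψ x - ψ y| ^ p) * k1 := by
          gcongr
      _ ≤ _ := by gcongr
  have d2 : - (M * (2 ^ (q - 1) * (m : ℝ) ^ q) * ((4 * Λ) ^ (q - p) * (2 ^ p * X)) * (L ^ p * D ^ p) * (2 ^ (s * p - t * q) * k1)) ≤
      a (x, y) * (|u x - u y| ^ (q - 2) * (u x - u y) * dφ) * k2 := by
    have e1 : - (2 ^ (q - 1) * (m : ℝ) ^ q * A ^ q * |ψ x - ψ y| ^ q) ≤ |u x - u y| ^ (q - 2) * (u x - u y) * dφ := by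
      refine le_trans ?_ c2
      have : 0 ≤ 1 / 2 * |u x - u y| ^ q * max (ψ x) (ψ y) ^ m := by positivity
      linarith
    calc _ ≤ - (a (x, y) * (2 ^ (q - 1) * (m : ℝ) ^ q) * A ^ q * |ψ x - ψ y| ^ q * k2) := by
          apply neg_le_neg
          gcongr
          · exact hAq.trans (by gcongr)
          · exact hψq.trans hψp
      _ = a (x, y) * - (2 ^ (q - 1) * (m : ℝ) ^ q * A ^ q * |ψ x - ψ y| ^ q) * k2 := by ring
      _ ≤ _ := by gcongr
  rw [eW]
  have e : Kcac n p q s t M Λ L m * (X * (D ^ p * k1)) = (2 ^ (p - 1) * (m : ℝ) ^ p) * (2 ^ p * X) * (L ^ p * D ^ p) * k1 +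
    (M * (2 ^ (q - 1) * (m : ℝ) ^ q) * ((4 * Λ) ^ (q - p) * (2 ^ p * X)) * (L ^ p * D ^ p) * (2 ^ (s * p - t * q) * k1)) := by
    unfold Kcac; ring
  rw [e]
  linarith

lemma EE_fin {n : ℕ} {p q s t M Λ : ℝ} {ψ : En n → ℝ} {L : ℝ} (K : Cut n ψ L) (m : ℕ)
   {a : En n × En n → ℝ} {u f : En n → ℝ} (S : Sol n p q s t M Λ a u f) : EE n p s m ψ u < ⊤ := by
  refine lt_of_le_of_lt ?_ S.gf
  refine (setLIntegral_le_lintegral _ _).trans (lintegral_mono fun z => ?_)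
  calc _ ≤ _ * 1 := mul_le_mul_right (ENNReal.ofReal_le_one.2 (pow_le_one₀ (le_max_of_le_left (K.nn _)) (max_le (K.le _) (K.le _)))) _
    _ = _ := mul_one _

lemma VV_fin {n : ℕ} {p q s t M Λ : ℝ} (H : Par n p q s t M Λ)
   {a : En n × En n → ℝ} {u f : En n → ℝ} (S : Sol n p q s t M Λ a u f) {c : ℝ} (hc : |c| ≤ Λ) : VV n p u c < ⊤ := by
  have hp := H.hp
  have : ∀ x, ‖u x - c‖ₑ ^ p ≤ ENNReal.ofReal (2 * Λ) ^ p := by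
    intro x
    gcongr
    rw [← ofReal_norm, Real.norm_eq_abs]
    apply ENNReal.ofReal_le_ofReal
    have h2 : |u x - c| ≤ |u x| + |c| := abs_sub _ _
    linarith [S.ub x]
  refine (lintegral_mono this).trans_lt ?_
  simp only [lintegral_const, Measure.restrict_apply_univ]
  exact ENNReal.mul_lt_top (ENNReal.rpow_lt_top_of_nonneg (by linarith) ENNReal.ofReal_ne_top) measure_ball_lt_top

lemma cac_int {n : ℕ} {p q s t M Λ : ℝ} (H : Par n p q s t M Λ) {ψ : En n → ℝ} {L : ℝ} (K : Cut n ψ L) {m : ℕ} (hm : q ≤ m) :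
   ∃ C : ℝ≥0∞, C < ⊤ ∧ ∀ (a : En n × En n → ℝ) (u f : En n → ℝ), Sol n p q s t M Λ a u f → ∀ c : ℝ, |c| ≤ Λ →
     EE n p s m ψ u ≤ C * (VV n p u c + ENNReal.ofReal (∫ x, hh n p q s t a u x * phi m ψ u c x)
       + ENNReal.ofReal (∫ x, f x * phi m ψ u c x)) := by
  have hp := H.hp
  have hpq := H.hpq
  have hs1 := H.hs1
  have hp0 : 0 < p := by linarith
  have hβ : 0 < p - s * p := by nlinarith
  have hKc : 0 ≤ Kcac n p q s t M Λ L m := by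
    have := H.hM; have := H.hΛ; have := K.L0
    unfold Kcac; positivity
  have hm1 : 1 ≤ m := by
    have : (1:ℝ) ≤ m := by linarith
    exact_mod_cast this
  set K3 : ℝ≥0∞ := 2 * ENNReal.ofReal (n * m0 n * 2 ^ (p - s * p) / (p - s * p)) with hK3
  have hK3t : K3 < ⊤ := ENNReal.mul_lt_top (by simp) ENNReal.ofReal_lt_top
  set Kc := Kcac n p q s t M Λ L m with hKcd
  refine ⟨2 * (ENNReal.ofReal Kc * K3 + 1), ENNReal.mul_lt_top (by simp) (ENNReal.add_lt_top.2 ⟨ENNReal.mul_lt_top ENNReal.ofReal_lt_top hK3t, by simp⟩), ?_⟩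
  intro a u f S c hc
  have hu := S.um
  have hψ := K.meas
  have hΛ := H.hΛ
  set BB := ball (0 : En n) 1 ×ˢ ball (0 : En n) 1 with hBB
  have hBm : MeasurableSet BB := measurableSet_ball.prod measurableSet_ball
  have hV := VV_fin H S hc
  have hE := EE_fin K m S
  obtain ⟨hWi, hWe⟩ := weak_ext H S (φ := phi m ψ u c) (by unfold phi; fun_prop) (K := 2 * Λ) (by
    intro x
    unfold phi
    rw [abs_mul, abs_of_nonneg (pow_nonneg (K.nn x) m)]
    calc _ ≤ |u x - c| * 1 := by gcongr; exact pow_le_one₀ (K.nn x) (K.le x)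
      _ ≤ |u x| + |c| := by rw [mul_one]; exact abs_sub _ _
      _ ≤ _ := by linarith [S.ub x]) (by
    intro x hx; unfold phi; rw [K.zero x hx]; simp; omega) (phi_gfin H K m hm1 S hc)
  set X : En n × En n → ℝ := fun z => |u z.1 - u z.2| ^ p * ‖z.1 - z.2‖ ^ (-((n:ℝ) + s * p)) * max (ψ z.1) (ψ z.2) ^ m with hX
  set Y : En n × En n → ℝ := fun z => (|u z.1 - c| ^ p + |u z.2 - c| ^ p) * (‖z.1 - z.2‖ ^ p * ‖z.1 - z.2‖ ^ (-((n:ℝ) + s * p))) with hY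
  have hmx : ∀ z : En n × En n, 0 ≤ max (ψ z.1) (ψ z.2) := fun z => le_max_of_le_left (K.nn _)
  have hX0 : ∀ z, 0 ≤ X z := fun z => by have := hmx z; positivity
  have hY0 : ∀ z, 0 ≤ Y z := fun z => by positivity
  have hXm : Measurable X := by fun_prop
  have hYm : Measurable Y := by fun_prop
  have hXl : ∫⁻ z in BB, ENNReal.ofReal (X z) = EE n p s m ψ u := by
    apply lintegral_congr
    intro z
    simp only [hX]
    rw [ENNReal.ofReal_mul (by positivity), ENNReal.ofReal_mul (by positivity), ofReal_abs_rpow hp0.le]; rfl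
  have hYl : ∫⁻ z in BB, ENNReal.ofReal (Y z) ≤ K3 * VV n p u c := by
    refine le_trans (lintegral_mono fun z => ?_) (kerV (by have := H.hn; omega) hβ (g := fun x => ‖u x - c‖ₑ ^ p) (by fun_prop))
    simp only [hY]
    rw [ENNReal.ofReal_mul (by positivity), ENNReal.ofReal_mul (by positivity), ENNReal.ofReal_add (by positivity) (by positivity),
      ofReal_abs_rpow hp0.le, ofReal_abs_rpow hp0.le]
    gcongr
    refine (kk_shift hp0 z.1 z.2).trans (le_of_eq ?_)
    congr 1; ring
  have hXi : IntegrableOn X BB := ⟨hXm.aestronglyMeasurable, by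
    rw [hasFiniteIntegral_iff_ofReal (Filter.Eventually.of_forall hX0), hXl]; exact hE⟩
  have hYi : IntegrableOn Y BB := ⟨hYm.aestronglyMeasurable, by
    rw [hasFiniteIntegral_iff_ofReal (Filter.Eventually.of_forall hY0)]; exact hYl.trans_lt (ENNReal.mul_lt_top hK3t hV)⟩
  have hmain : ∫ z in BB, 1 / 2 * X z ≤ ∫ z in BB, (Wf n p q s t a u z * (phi m ψ u c z.1 - phi m ψ u c z.2) + Kc * Y z) := by
    apply setIntegral_mono_on (hXi.const_mul _) (hWi.add (hYi.const_mul _)) hBm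
    rintro ⟨x, y⟩ ⟨hx, hy⟩
    refine cac_pt H K hm S hc x y ?_
    simp only [mem_ball, dist_zero_right] at hx hy
    exact (norm_sub_le _ _).trans (by linarith)
  rw [integral_const_mul, integral_add hWi (hYi.const_mul _), integral_const_mul, hWe] at hmain
  have h1 : EE n p s m ψ u = ENNReal.ofReal (∫ z in BB, X z) := by
    rw [ofReal_integral_eq_lintegral_ofReal hXi (Filter.Eventually.of_forall hX0), hXl]
  have h2 : ENNReal.ofReal (∫ z in BB, Y z) ≤ K3 * VV n p u c := by
    rw [ofReal_integral_eq_lintegral_ofReal hYi (Filter.Eventually.of_forall hY0)]; exact hYl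
  set I1 := ∫ x, hh n p q s t a u x * phi m ψ u c x
  set I2 := ∫ x, f x * phi m ψ u c x
  calc EE n p s m ψ u = ENNReal.ofReal (∫ z in BB, X z) := h1
    _ ≤ ENNReal.ofReal (2 * (I1 + I2 + Kc * ∫ z in BB, Y z)) := ENNReal.ofReal_le_ofReal (by linarith)
    _ ≤ 2 * (ENNReal.ofReal I1 + ENNReal.ofReal I2 + ENNReal.ofReal Kc * (K3 * VV n p u c)) := by
        rw [ENNReal.ofReal_mul (by norm_num), ENNReal.ofReal_ofNat]
        gcongr
        refine ENNReal.ofReal_add_le.trans (add_le_add ENNReal.ofReal_add_le ?_)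
        rw [ENNReal.ofReal_mul hKc]; gcongr
    _ ≤ 2 * ((ENNReal.ofReal Kc * K3 + 1) * ENNReal.ofReal I1 + (ENNReal.ofReal Kc * K3 + 1) * ENNReal.ofReal I2 + (ENNReal.ofReal Kc * K3 + 1) * VV n p u c) := by
        rw [← mul_assoc (ENNReal.ofReal Kc)]
        gcongr
        · exact le_mul_of_one_le_left (by simp) (by simp)
        · exact le_mul_of_one_le_left (by simp) (by simp)
        · simp
    _ = _ := by ring

def tailA (n : ℕ) (p b : ℝ) (u : En n → ℝ) (c : ℝ) : ℝ≥0∞ :=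
  ∫⁻ y in (ball (0 : En n) 1)ᶜ, ‖u y - c‖ₑ ^ (p - 1) * ENNReal.ofReal (‖y‖ ^ (-((n:ℝ) + b)))

lemma hsplit {n : ℕ} {p q s t M Λ : ℝ} (H : Par n p q s t M Λ) : ∃ C : ℝ, 0 ≤ C ∧ 
   ∀ (a : En n × En n → ℝ) (u f : En n → ℝ), Sol n p q s t M Λ a u f → ∀ c : ℝ, |c| ≤ Λ →
    tailA n p (t * q) u c < ⊤ ∧ ∃ h1 : En n → ℝ, Measurable h1 ∧ (∀ x, |h1 x| ≤ C * (tailA n p (t * q) u c).toReal) ∧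
      ∀ x, ‖x‖ ≤ 3 / 4 → |hh n p q s t a u x - h1 x| ≤ C * |u x - c| ^ (p - 1) := by
  have hp := H.hp
  have hpq := H.hpq
  have hΛ := H.hΛ
  have hM := H.hM
  have ht0 := H.ht0
  have htq : 0 < t * q := by have : 0 < q := by linarith
                             positivity
  set k : En n → ℝ := fun y => ‖y‖ ^ (-((n : ℝ) + t * q)) with hk
  have hki : IntegrableOn k (ball (0 : En n) 1)ᶜ := ext_int htq
  set Kx := ∫ y in (ball (0 : En n) 1)ᶜ, k y with hKx
  have hKx0 : 0 ≤ Kx := integral_nonneg fun y => by positivity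
  have hcf : 0 ≤ Cfar n p q s t M Λ := by unfold Cfar; positivity
  set cf := Cfar n p q s t M Λ with hcfd
  refine ⟨2 * cf * (1 + Kx), by positivity, ?_⟩
  intro a u f S c hc
  have hu := S.um
  have hvb : ∀ y, |u y - c| ≤ 2 * Λ := fun y => by
    have : |u y - c| ≤ |u y| + |c| := abs_sub _ _
    linarith [S.ub y]
  set w : En n → ℝ := fun y => |u y - c| ^ (p - 1) * k y with hw
  have hw0 : ∀ y, 0 ≤ w y := fun y => by positivity
  have hwi : IntegrableOn w (ball (0 : En n) 1)ᶜ := by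
    refine Integrable.mono' (hki.const_mul ((2 * Λ) ^ (p - 1))) (by fun_prop) (Filter.Eventually.of_forall fun y => ?_)
    rw [Real.norm_of_nonneg (hw0 y)]
    simp only [hw]
    gcongr
    · linarith
    · exact hvb y
  have hA : tailA n p (t * q) u c = ENNReal.ofReal (∫ y in (ball (0 : En n) 1)ᶜ, w y) := by
    rw [ofReal_integral_eq_lintegral_ofReal hwi (Filter.Eventually.of_forall hw0)]
    apply lintegral_congr
    intro y
    simp only [hw, hk]
    rw [ENNReal.ofReal_mul (by positivity), ofReal_abs_rpow (by linarith)]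
  have hA0 : 0 ≤ ∫ y in (ball (0 : En n) 1)ᶜ, w y := integral_nonneg hw0
  have hAr : (tailA n p (t * q) u c).toReal = ∫ y in (ball (0 : En n) 1)ᶜ, w y := by rw [hA, ENNReal.toReal_ofReal hA0]
  refine ⟨by rw [hA]; exact ENNReal.ofReal_lt_top, ?_⟩
  rw [hAr]
  set A := ∫ y in (ball (0 : En n) 1)ᶜ, w y
  set Q := 2 * cf * A with hQ
  have hQ0 : 0 ≤ Q := by positivity
  have hbd : ∀ x, ‖x‖ ≤ 3 / 4 → |hh n p q s t a u x| ≤ 2 * cf * Kx * |u x - c| ^ (p - 1) + Q := by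
    intro x hx
    have h1 : |∫ y in (ball (0 : En n) 1)ᶜ, Wf n p q s t a u (x, y)| ≤ ∫ y in (ball (0 : En n) 1)ᶜ, cf * (|u x - c| ^ (p - 1) * k y + w y) := by
      rw [← Real.norm_eq_abs]
      apply norm_integral_le_of_norm_le
      · exact ((hki.const_mul _).add hwi).const_mul _
      · refine (ae_restrict_iff' measurableSet_ball.compl).2 (Filter.Eventually.of_forall fun y hy => ?_)
        have hy1 : 1 ≤ ‖y‖ := by simpa using hy
        have := Wf_far H S.a0 S.aM S.ub c x y hx hy1
        rw [Real.norm_eq_abs]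
        refine this.trans (le_of_eq ?_)
        simp only [hw, hk]; ring
    rw [integral_const_mul, integral_add (hki.const_mul _) hwi, integral_const_mul] at h1
    unfold hh
    rw [abs_mul]
    norm_num
    calc _ ≤ 2 * (cf * (|u x - c| ^ (p - 1) * Kx + A)) := by gcongr
      _ = _ := by rw [hQ]; ring
  refine ⟨fun x => max (-Q) (min Q (hh n p q s t a u x)), ?_, ?_, ?_⟩
  · exact measurable_const.max (measurable_const.min (hh_meas S.am hu))
  · intro x
    have : Q ≤ 2 * cf * (1 + Kx) * A := by
      rw [hQ]; have : 0 ≤ 2 * cf * Kx * A := by positivity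
      nlinarith
    refine le_trans ?_ this
    rw [abs_le]
    exact ⟨le_max_left _ _, max_le (by linarith) (min_le_left _ _)⟩
  · intro x hx
    have h := hbd x hx
    have hz : 0 ≤ |u x - c| ^ (p - 1) := by positivity
    have : 2 * cf * Kx * |u x - c| ^ (p - 1) ≤ 2 * cf * (1 + Kx) * |u x - c| ^ (p - 1) := by gcongr; linarith
    refine le_trans ?_ this
    have h3 : 0 ≤ 2 * cf * Kx * |u x - c| ^ (p - 1) := by positivity
    rw [abs_le] at h ⊢
    simp only
    rcases le_total Q (hh n p q s t a u x) with h4 | h4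
    · rw [min_eq_left h4, max_eq_right (by linarith)]; constructor <;> linarith
    · rw [min_eq_right h4]
      rcases le_total (-Q) (hh n p q s t a u x) with h5 | h5
      · rw [max_eq_right h5]; constructor <;> linarith
      · rw [max_eq_left h5]; constructor <;> linarith

def Fn (n : ℕ) (p s : ℝ) (f : En n → ℝ) : ℝ≥0∞ :=
  (∫⁻ x in ball (0 : En n) (1 / 2), ‖f x‖ₑ ^ pStar n p s) ^ (1 / pStar n p s)

lemma pStar_inv {n : ℕ} {p q s t M Λ : ℝ} (H : Par n p q s t M Λ) : 1 / pStar n p s = (p - 1) / p + s / n := by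
  have hp := H.hp
  have hs := H.hs0
  have hn : (0:ℝ) < n := by have := H.hn; exact_mod_cast (by omega : 0 < n)
  have : 0 < p - 1 := by linarith
  have : n * (p-1) + s * p ≠ 0 := by positivity
  unfold pStar pC
  field_simp

lemma pStar_gt {n : ℕ} {p q s t M Λ : ℝ} (H : Par n p q s t M Λ) : 1 < pStar n p s := by
  have hp := H.hp
  have hs := H.hs0
  have hn : (0:ℝ) < n := by have := H.hn; exact_mod_cast (by omega : 0 < n)
  have h0 : 0 < p - 1 := by linarith
  have h1 : 1 / pStar n p s < 1 := by
    rw [pStar_inv H, div_add_div _ _ (by linarith) hn.ne', div_lt_one (by positivity)]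
    nlinarith [H.hspn]
  have h2 : 0 < 1 / pStar n p s := by rw [pStar_inv H]; positivity
  have h3 : 0 < pStar n p s := by simpa using h2
  rwa [div_lt_one h3] at h1

lemma fterm {n : ℕ} {p q s t M Λ : ℝ} (H : Par n p q s t M Λ) {ψ : En n → ℝ} {L : ℝ} (K : Cut n ψ L) {m : ℕ} (hm : 1 ≤ m) :
   ∃ C : ℝ≥0∞, C < ⊤ ∧ ∀ (a : En n × En n → ℝ) (u f : En n → ℝ), Sol n p q s t M Λ a u f → ∀ c : ℝ, |c| ≤ Λ →
     ENNReal.ofReal (∫ x, f x * phi m ψ u c x) ≤ C * (Fn n p s f * (EE n p s m ψ u + VV n p u c) ^ (1 / p)) := by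
  have hp := H.hp
  have hs := H.hs0
  have hp0 : 0 < p := by linarith
  have hn1 : 1 ≤ n := by have := H.hn; omega
  have hn : (0:ℝ) < n := by exact_mod_cast (by omega : 0 < n)
  set r := pStar n p s with hr
  have hr1 : 1 < r := pStar_gt H
  have hspn := H.hspn
  set P := n * p / (n - s * p) with hP
  have hns : 0 < n - s * p := by linarith
  have hP0 : 0 < P := by positivity
  have hPp : p ≤ P := by
    rw [hP, le_div_iff₀ hns]; nlinarith [mul_pos hs hp0]
  have hPi : 1 / P = 1 / p - s / n := by rw [hP]; field_simp
  have hconj : r.HolderConjugate P := by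
    rw [Real.holderConjugate_iff]
    refine ⟨hr1, ?_⟩
    rw [inv_eq_one_div, inv_eq_one_div, hPi, hr, pStar_inv H]
    field_simp; ring
  obtain ⟨Cs, hCs1, hCs⟩ := SP n hn1 P (by linarith)
  obtain ⟨Cg, hCgt, hCg⟩ := phi_gag H K hm
  set B := ball (0 : En n) 1 with hB
  have hBt : volume B ≠ ⊤ := measure_ball_lt_top.ne
  have hB0 : volume B ≠ 0 := (measure_ball_pos _ _ one_pos).ne'
  set C1 : ℝ≥0∞ := ENNReal.ofReal Cs ^ (1 / P) * Cg ^ (1 / p) with hC1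
  set C2 : ℝ≥0∞ := volume B ^ (1 / P) * (volume B)⁻¹ ^ (1 / p) with hC2
  refine ⟨C1 + C2, ?_, ?_⟩
  · refine ENNReal.add_lt_top.2 ⟨ENNReal.mul_lt_top ?_ ?_, ENNReal.mul_lt_top ?_ ?_⟩ <;>
      refine ENNReal.rpow_lt_top_of_nonneg (by positivity) ?_
    · exact ENNReal.ofReal_ne_top
    · exact hCgt.ne
    · exact hBt
    · exact ENNReal.inv_ne_top.2 hB0
  intro a u f S c hc
  have hu := S.um
  have hψ := K.meas
  have hΛ := H.hΛ
  set φ := phi m ψ u c with hφ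
  have hφm : Measurable φ := by rw [hφ]; unfold phi; fun_prop
  have hφv : ∀ x, |φ x| ≤ |u x - c| := by
    intro x
    simp only [hφ, phi]
    rw [abs_mul, abs_of_nonneg (pow_nonneg (K.nn x) m)]
    calc _ ≤ |u x - c| * 1 := by gcongr; exact pow_le_one₀ (K.nn x) (K.le x)
      _ = _ := mul_one _
  have hφb : ∀ x, |φ x| ≤ 2 * Λ := fun x => (hφv x).trans (by
    have : |u x - c| ≤ |u x| + |c| := abs_sub _ _
    linarith [S.ub x])
  have hφz : ∀ x, x ∉ ball (0 : En n) (1 / 2) → φ x = 0 := by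
    intro x hx; simp only [hφ, phi]; rw [K.zero x hx]; simp; omega
  have hfm := S.fm
  set av := ⨍ y in B, φ y with hav
  have s1 : (∫⁻ x in B, ‖φ x - av‖ₑ ^ P) ^ (1 / P) ≤ C1 * (EE n p s m ψ u + VV n p u c) ^ (1 / p) := by
    have h := hCs p s (by linarith) hPp hs.le (by rw [div_eq_mul_one_div, div_eq_mul_one_div (n:ℝ) P, hPi]; field_simp; ring) φ hφm _ hφb 0 1 one_pos
    have hg : gag φ p (-(n + s * p)) B ≤ Cg * (EE n p s m ψ u + VV n p u c) := by
      unfold gag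
      rw [← lint_prod_set (F := fun z => ‖φ z.1 - φ z.2‖ₑ ^ p * kk (-(n + s * p)) z.1 z.2) (by fun_prop)]
      exact hCg u c hu
    calc _ ≤ (ENNReal.ofReal Cs * (Cg * (EE n p s m ψ u + VV n p u c)) ^ (P / p)) ^ (1 / P) := by
          gcongr
          refine h.trans ?_
          gcongr
      _ = _ := by
          rw [ENNReal.mul_rpow_of_nonneg _ _ (by positivity), ← ENNReal.rpow_mul, ENNReal.mul_rpow_of_nonneg _ _ (by positivity),
            show P / p * (1 / P) = 1 / p by field_simp, hC1]; ring
  have s2 : (∫⁻ x in B, ‖av‖ₑ ^ P) ^ (1 / P) ≤ C2 * (EE n p s m ψ u + VV n p u c) ^ (1 / p) := by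
    have h1 : ‖av‖ₑ ≤ ((volume B)⁻¹ * VV n p u c) ^ (1 / p) := by
      have := sub_av_le hφm hφb hB0 hBt 0
      simp only [zero_sub, enorm_neg] at this
      refine this.trans ((mean_le (by fun_prop) B hB0 hBt (by linarith : 1 ≤ p)).trans ?_)
      gcongr with x
      unfold VV
      gcongr with x
      rw [← ofReal_norm, ← ofReal_norm]
      exact ENNReal.ofReal_le_ofReal (hφv x)
    rw [lintegral_const, Measure.restrict_apply_univ, ENNReal.mul_rpow_of_nonneg _ _ (by positivity), ← ENNReal.rpow_mul,
      mul_one_div_cancel hP0.ne', ENNReal.rpow_one]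
    calc _ ≤ ((volume B)⁻¹ * VV n p u c) ^ (1 / p) * volume B ^ (1 / P) := by gcongr
      _ ≤ ((volume B)⁻¹ * (EE n p s m ψ u + VV n p u c)) ^ (1 / p) * volume B ^ (1 / P) := by gcongr; simp
      _ = _ := by rw [ENNReal.mul_rpow_of_nonneg _ _ (by positivity), hC2]; ring
  have s3 : (∫⁻ x in B, ‖φ x‖ₑ ^ P) ^ (1 / P) ≤ (C1 + C2) * (EE n p s m ψ u + VV n p u c) ^ (1 / p) := by
    rw [add_mul]
    refine (Lp_tri (f := fun x => φ x - av) (g := fun _ => av) (by linarith) (by fun_prop) (by fun_prop) (fun x => ?_) B).trans (add_le_add s1 s2)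
    calc ‖φ x‖ₑ = ‖(φ x - av) + av‖ₑ := by congr 1; ring
      _ ≤ _ := enorm_add_le _ _
  calc ENNReal.ofReal (∫ x, f x * φ x) ≤ ‖∫ x, f x * φ x‖ₑ := by
        rw [← ofReal_norm]; exact ENNReal.ofReal_le_ofReal (le_abs_self _)
    _ ≤ ∫⁻ x, ‖f x * φ x‖ₑ := enorm_integral_le_lintegral_enorm _
    _ = ∫⁻ x in ball (0 : En n) (1 / 2), ‖f x‖ₑ * ‖φ x‖ₑ := by
        rw [← lintegral_indicator measurableSet_ball]
        apply lintegral_congr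
        intro x
        by_cases hx : x ∈ ball (0 : En n) (1 / 2)
        · rw [indicator_of_mem hx, enorm_mul]
        · rw [indicator_of_notMem hx, hφz x hx]; simp
    _ ≤ Fn n p s f * (∫⁻ x in ball (0 : En n) (1 / 2), ‖φ x‖ₑ ^ P) ^ (1 / P) :=
        ENNReal.lintegral_mul_le_Lp_mul_Lq _ hconj (by fun_prop) (by fun_prop)
    _ ≤ Fn n p s f * ((C1 + C2) * (EE n p s m ψ u + VV n p u c) ^ (1 / p)) := by
        gcongr
        refine le_trans ?_ s3
        have : ball (0 : En n) (1 / 2) ⊆ B := ball_subset_ball (by norm_num)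
        gcongr
    _ = _ := by ring

def Mo {n : ℕ} (δ : ℝ) (w : En n → ℝ≥0∞) (x : En n) : ℝ≥0∞ :=
  ENNReal.ofReal (δ ^ (-(n:ℝ))) * ∫⁻ y in ball x δ, w y

lemma Mo_eq {n : ℕ} {δ : ℝ} (h : 0 < δ) (w : En n → ℝ≥0∞) (x : En n) :
    Mo δ w x = ENNReal.ofReal (m0 n) * ((volume (ball x δ))⁻¹ * ∫⁻ y in ball x δ, w y) := by
  unfold Mo
  rw [← mul_assoc]
  congr 1
  have hm := m0_pos n
  rw [vol_ball x h, ← ENNReal.ofReal_inv_of_pos (by positivity), ← ENNReal.ofReal_mul hm.le]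
  congr 1
  rw [Real.rpow_neg h.le]; field_simp

lemma ball_indicator_meas {n : ℕ} (δ : ℝ) {w : En n → ℝ≥0∞} (hw : Measurable w) :
    Measurable (fun z : En n × En n => (ball z.1 δ).indicator w z.2) := by
  have : (fun z : En n × En n => (ball z.1 δ).indicator w z.2) = {z : En n × En n | dist z.2 z.1 < δ}.indicator (fun z => w z.2) := by
    ext z; simp only [indicator, mem_ball, mem_setOf_eq]
  rw [this]
  exact (hw.comp measurable_snd).indicator (measurableSet_lt (measurable_snd.dist measurable_fst) measurable_const)

lemma ball_int_meas {n : ℕ} (δ : ℝ) {w : En n → ℝ≥0∞} (hw : Measurable w) :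
    Measurable (fun x : En n => ∫⁻ y in ball x δ, w y) := by
  simp_rw [← lintegral_indicator measurableSet_ball]
  exact (ball_indicator_meas δ hw).lintegral_prod_right'

lemma Mo_meas {n : ℕ} (δ : ℝ) {w : En n → ℝ≥0∞} (hw : Measurable w) : Measurable (Mo (n := n) δ w) :=
  (ball_int_meas δ hw).const_mul _

lemma ball_swap {n : ℕ} {δ : ℝ} (h : 0 < δ) {w : En n → ℝ≥0∞} (hw : Measurable w) :
    ∫⁻ x : En n, ∫⁻ y in ball x δ, w y = ENNReal.ofReal (m0 n * δ ^ (n:ℝ)) * ∫⁻ y, w y := by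
  simp_rw [← lintegral_indicator measurableSet_ball]
  rw [lintegral_lintegral_swap (ball_indicator_meas δ hw).aemeasurable, ← lintegral_const_mul _ hw]
  apply lintegral_congr
  intro y
  have : ∀ x : En n, (ball x δ).indicator w y = (ball y δ).indicator (fun _ => w y) x := by
    intro x; simp only [indicator, mem_ball, dist_comm]
  simp_rw [this]
  rw [lintegral_indicator measurableSet_ball, setLIntegral_const, vol_ball y h, mul_comm]

lemma Mo_Lr {n : ℕ} {δ r : ℝ} (h : 0 < δ) (hr : 1 ≤ r) {w : En n → ℝ≥0∞} (hw : Measurable w) :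
    ∫⁻ x : En n, Mo δ w x ^ r ≤ ENNReal.ofReal (m0 n) ^ r * ∫⁻ y, w y ^ r := by
  have hm := m0_pos n
  have hr0 : 0 < r := by linarith
  have key : ∀ x : En n, Mo δ w x ^ r ≤ ENNReal.ofReal (m0 n) ^ r * (ENNReal.ofReal (m0 n * δ ^ (n:ℝ)))⁻¹ * ∫⁻ y in ball x δ, w y ^ r := by
    intro x
    rw [Mo_eq h, ENNReal.mul_rpow_of_nonneg _ _ hr0.le, mul_assoc]
    gcongr
    have := mean_le hw (ball x δ) (measure_ball_pos volume x h).ne' measure_ball_lt_top.ne hr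
    calc _ ≤ (((volume (ball x δ))⁻¹ * ∫⁻ y in ball x δ, w y ^ r) ^ (1 / r)) ^ r := by gcongr
      _ = _ := by rw [← ENNReal.rpow_mul, one_div_mul_cancel hr0.ne', ENNReal.rpow_one, vol_ball x h]
  refine (lintegral_mono key).trans ?_
  rw [lintegral_const_mul _ (ball_int_meas δ (by fun_prop)), ball_swap h (by fun_prop), mul_assoc, ← mul_assoc (_)⁻¹,
    ENNReal.inv_mul_cancel (by simp; positivity) ENNReal.ofReal_ne_top, one_mul]

lemma Mo_sup {n : ℕ} {δ r : ℝ} (h : 0 < δ) (hr : 1 ≤ r) {w : En n → ℝ≥0∞} (hw : Measurable w) (x : En n) :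
    Mo δ w x ≤ ENNReal.ofReal (m0 n) * (ENNReal.ofReal (m0 n * δ ^ (n:ℝ)))⁻¹ ^ (1 / r) * (∫⁻ y, w y ^ r) ^ (1 / r) := by
  rw [Mo_eq h, mul_assoc]
  refine mul_le_mul_right ?_ _
  refine (mean_le hw (ball x δ) (measure_ball_pos volume x h).ne' measure_ball_lt_top.ne hr).trans ?_
  rw [ENNReal.mul_rpow_of_nonneg _ _ (by positivity), vol_ball x h]
  gcongr
  exact Measure.restrict_le_self

lemma Mo_imp {n : ℕ} {r P : ℝ} (hr : 1 ≤ r) (hP : r ≤ P) : ∃ C : ℝ≥0∞, C < ⊤ ∧ ∀ δ, 0 < δ → ∀ w : En n → ℝ≥0∞, Measurable w →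
    ∫⁻ x : En n, Mo δ w x ^ P ≤ C * ENNReal.ofReal (δ ^ (-(n * (P / r - 1)))) * (∫⁻ y, w y ^ r) ^ (P / r) := by
  have hm := m0_pos n
  have hr0 : 0 < r := by linarith
  set C : ℝ≥0∞ := ENNReal.ofReal (m0 n) ^ P * ENNReal.ofReal (m0 n ^ (-(P / r - 1)))
  refine ⟨C, ENNReal.mul_lt_top (ENNReal.rpow_lt_top_of_nonneg (by linarith) ENNReal.ofReal_ne_top) ENNReal.ofReal_lt_top, ?_⟩
  intro δ h w hw
  set X := ∫⁻ y, w y ^ r with hX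
  set b := ENNReal.ofReal (m0 n) * (ENNReal.ofReal (m0 n * δ ^ (n:ℝ)))⁻¹ ^ (1 / r) * X ^ (1 / r) with hb
  calc ∫⁻ x : En n, Mo δ w x ^ P ≤ ∫⁻ x : En n, b ^ (P - r) * Mo δ w x ^ r := by
        apply lintegral_mono
        intro x
        calc Mo δ w x ^ P = Mo δ w x ^ (P - r) * Mo δ w x ^ r := by
              rw [← ENNReal.rpow_add_of_nonneg _ _ (by linarith) (by linarith)]; congr 1; ring
          _ ≤ _ := mul_le_mul_left (ENNReal.rpow_le_rpow (Mo_sup h hr hw x) (by linarith)) _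
    _ = b ^ (P - r) * ∫⁻ x : En n, Mo δ w x ^ r := lintegral_const_mul _ ((Mo_meas δ hw).pow_const _)
    _ ≤ b ^ (P - r) * (ENNReal.ofReal (m0 n) ^ r * X) := by gcongr; exact Mo_Lr h hr hw
    _ = _ := by
        have e1 : b ^ (P - r) = ENNReal.ofReal (m0 n) ^ (P - r) * (ENNReal.ofReal (m0 n ^ (-(P / r - 1))) * ENNReal.ofReal (δ ^ (-(n * (P / r - 1))))) * X ^ (P / r - 1) := by
          rw [hb, ENNReal.mul_rpow_of_nonneg _ _ (by linarith), ENNReal.mul_rpow_of_nonneg _ _ (by linarith), ← ENNReal.rpow_mul, ← ENNReal.rpow_mul]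
          have e : 1 / r * (P - r) = P / r - 1 := by field_simp
          rw [e]
          congr 2
          rw [← ENNReal.ofReal_inv_of_pos (by positivity), ENNReal.ofReal_rpow_of_nonneg (by positivity) (by rw [← e]; apply mul_nonneg (by positivity); linarith),
            ← ENNReal.ofReal_mul (by positivity)]
          congr 1
          rw [Real.inv_rpow (by positivity), ← Real.rpow_neg (by positivity), Real.mul_rpow (by positivity) (by positivity), ← Real.rpow_mul h.le]
          congr 2; ring
        have e2 : X ^ (P / r) = X ^ (P / r - 1) * X := by
          nth_rewrite 3 [← ENNReal.rpow_one X]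
          rw [← ENNReal.rpow_add_of_nonneg _ _ (by rw [sub_nonneg, le_div_iff₀ hr0]; linarith) (by norm_num)]; congr 1; ring
        have e3 : ENNReal.ofReal (m0 n) ^ P = ENNReal.ofReal (m0 n) ^ (P - r) * ENNReal.ofReal (m0 n) ^ r := by
          rw [← ENNReal.rpow_add_of_nonneg _ _ (by linarith) (by linarith)]; congr 1; ring
        simp only [C]
        rw [e1, e2, e3]; ring

/-- the inner kernel integral -/
def kin (n : ℕ) (p s s' : ℝ) (m : ℕ) (ψ u : En n → ℝ) (y : En n) : ℝ≥0∞ :=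
  ∫⁻ z in ball (0 : En n) 1, ‖u y - u z‖ₑ ^ (p - 1) * kk (s' - (n + s * p)) y z * ENNReal.ofReal (max (ψ y) (ψ z) ^ (m - 1))

lemma kin_meas {n : ℕ} {p s s' : ℝ} {m : ℕ} {ψ u : En n → ℝ} (hψ : Measurable ψ) (hu : Measurable u) :
    Measurable (kin n p s s' m ψ u) := by
  unfold kin
  apply Measurable.lintegral_prod_right' (f := fun z : En n × En n => ‖u z.1 - u z.2‖ₑ ^ (p - 1) * kk (s' - (n + s * p)) z.1 z.2 * ENNReal.ofReal (max (ψ z.1) (ψ z.2) ^ (m - 1)))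
  fun_prop

lemma kk_rpow_split {n : ℕ} {a b c θ : ℝ} (h0 : 0 < θ) (h1 : θ < 1) (hc : c = θ * a + (1 - θ) * b) (hcn : c ≠ 0) (x y : En n) :
    kk c x y ≤ kk a x y ^ θ * kk b x y ^ (1 - θ) := by
  unfold kk
  rw [ENNReal.ofReal_rpow_of_nonneg (by positivity) h0.le, ENNReal.ofReal_rpow_of_nonneg (by positivity) (by linarith),
    ← ENNReal.ofReal_mul (by positivity)]
  apply ENNReal.ofReal_le_ofReal
  rcases (norm_nonneg (x - y)).eq_or_lt with h | h
  · rw [← h, Real.zero_rpow hcn]; positivity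
  · rw [← Real.rpow_mul h.le, ← Real.rpow_mul h.le, ← Real.rpow_add h, hc]
    apply le_of_eq; congr 1; ring

lemma kin_bound {n : ℕ} {p q s t M Λ : ℝ} (H : Par n p q s t M Λ) {ψ : En n → ℝ} {L : ℝ} (K : Cut n ψ L) {m : ℕ} (hm : q ≤ m)
    {s' : ℝ} (hs' : s < s') (hs1' : s' < 1) :
   ∃ C : ℝ≥0∞, C < ⊤ ∧ ∀ (u : En n → ℝ), Measurable u →
     ∫⁻ y in ball (0 : En n) 1, kin n p s s' m ψ u y ^ (p / (p - 1)) ≤ C * EE n p s m ψ u := by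
  have hp := H.hp
  have hp0 : 0 < p := by linarith
  have hp1 : 0 < p - 1 := by linarith
  have hs0 := H.hs0
  have hn1 : 1 ≤ n := by have := H.hn; omega
  have hnr : (2:ℝ) ≤ n := by exact_mod_cast H.hn
  have hβ : 0 < (s' - s) * p := by apply mul_pos _ hp0; linarith
  set K3 := ENNReal.ofReal (n * m0 n * 2 ^ ((s' - s) * p) / ((s' - s) * p)) with hK3
  refine ⟨K3 ^ (1 / (p - 1)), ENNReal.rpow_lt_top_of_nonneg (by positivity) ENNReal.ofReal_ne_top, ?_⟩
  intro u hu
  have hψ := K.meas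
  set Fe : En n → En n → ℝ≥0∞ := fun y z => ‖u y - u z‖ₑ ^ p * kk (-(n + s * p)) y z * ENNReal.ofReal (max (ψ y) (ψ z) ^ m) with hFe
  have hFm : Measurable (fun z : En n × En n => Fe z.1 z.2) := by fun_prop
  have hk : ∀ y ∈ ball (0 : En n) 1, kin n p s s' m ψ u y ≤ (∫⁻ z in ball (0 : En n) 1, Fe y z) ^ ((p - 1) / p) * K3 ^ (1 / p) := by
    intro y hy
    calc kin n p s s' m ψ u y ≤ ∫⁻ z in ball (0 : En n) 1, Fe y z ^ ((p - 1) / p) * kk ((s' - s) * p - n) y z ^ (1 / p) := by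
          apply lintegral_mono
          intro z
          simp only [hFe]
          have hx0 : 0 ≤ max (ψ y) (ψ z) := le_max_of_le_left (K.nn _)
          have hx1 : max (ψ y) (ψ z) ≤ 1 := max_le (K.le _) (K.le _)
          have e1 : kk (s' - (n + s * p)) y z ≤ kk (-(n + s * p)) y z ^ ((p - 1) / p) * kk ((s' - s) * p - n) y z ^ (1 / p) := by
            have := kk_rpow_split (a := -(n + s * p)) (b := (s' - s) * p - n) (c := s' - (n + s * p)) (θ := (p - 1) / p) (by positivity)
              (by rw [div_lt_one hp0]; linarith) (by field_simp; ring) (by have : 0 < s * p := by positivity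
                                                                           linarith) y z
            rwa [show 1 - (p - 1) / p = 1 / p by field_simp; ring] at this
          have e2 : ENNReal.ofReal (max (ψ y) (ψ z) ^ (m - 1)) ≤ ENNReal.ofReal (max (ψ y) (ψ z) ^ m) ^ ((p - 1) / p) := by
            rw [ENNReal.ofReal_rpow_of_nonneg (by positivity) (by positivity)]
            apply ENNReal.ofReal_le_ofReal
            rw [← Real.rpow_natCast, ← Real.rpow_natCast, ← Real.rpow_mul hx0]
            have hmp : p ≤ m := by linarith [H.hpq]
            have hm1 : 1 ≤ m := by
              have : (1:ℝ) ≤ m := by linarith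
              exact_mod_cast this
            apply Real.rpow_le_rpow_of_exponent_ge_of_imp hx0 hx1
            · push_cast [Nat.cast_sub hm1]
              rw [mul_div_assoc', div_le_iff₀ hp0]; nlinarith
            · intro _ h
              have : (2:ℝ) ≤ m := by linarith
              have h2 : 2 ≤ m := by exact_mod_cast this
              have h3 : m - 1 = 0 := by exact_mod_cast h
              omega
          have e3 : ‖u y - u z‖ₑ ^ (p - 1) = (‖u y - u z‖ₑ ^ p) ^ ((p - 1) / p) := by
            rw [← ENNReal.rpow_mul]; congr 1; field_simp
          rw [ENNReal.mul_rpow_of_nonneg _ _ (by positivity), ENNReal.mul_rpow_of_nonneg _ _ (by positivity), e3]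
          calc _ ≤ (‖u y - u z‖ₑ ^ p) ^ ((p - 1) / p) * (kk (-(n + s * p)) y z ^ ((p - 1) / p) * kk ((s' - s) * p - n) y z ^ (1 / p)) * ENNReal.ofReal (max (ψ y) (ψ z) ^ m) ^ ((p - 1) / p) := by gcongr
            _ = _ := by ring
      _ ≤ (∫⁻ z in ball (0 : En n) 1, Fe y z) ^ ((p - 1) / p) * (∫⁻ z in ball (0 : En n) 1, kk ((s' - s) * p - n) y z) ^ (1 / p) :=
          ENNReal.lintegral_mul_norm_pow_le (hFm.comp measurable_prodMk_left).aemeasurable (by fun_prop) (by positivity) (by positivity) (by field_simp; ring)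
      _ ≤ _ := by gcongr; exact kk_BB hn1 hβ hy
  calc _ ≤ ∫⁻ y in ball (0 : En n) 1, K3 ^ (1 / (p - 1)) * ∫⁻ z in ball (0 : En n) 1, Fe y z := by
        apply setLIntegral_mono' measurableSet_ball
        intro y hy
        calc _ ≤ ((∫⁻ z in ball (0 : En n) 1, Fe y z) ^ ((p - 1) / p) * K3 ^ (1 / p)) ^ (p / (p - 1)) := by gcongr; exact hk y hy
          _ = _ := by
            rw [ENNReal.mul_rpow_of_nonneg _ _ (by positivity), ← ENNReal.rpow_mul, ← ENNReal.rpow_mul, show (p - 1) / p * (p / (p - 1)) = 1 by field_simp,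
              show 1 / p * (p / (p - 1)) = 1 / (p - 1) by field_simp, ENNReal.rpow_one, mul_comm]
    _ = _ := by
        rw [lintegral_const_mul' _ _ (ENNReal.rpow_lt_top_of_nonneg (by positivity) ENNReal.ofReal_ne_top).ne]
        unfold EE
        rw [lint_prod_set (by fun_prop)]

def chi (n : ℕ) (δ : ℝ) (m : ℕ) (ψ : En n → ℝ) (x y : En n) : ℝ := rho n δ (x - y) * ψ y ^ m

lemma min_rpow {r s : ℝ} (hr : 0 ≤ r) (h0 : 0 ≤ s) (h1 : s ≤ 1) : min 1 r ≤ r ^ s := by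
  rcases le_or_gt r 1 with h | h
  · rw [min_eq_right h]
    exact Real.self_le_rpow_of_le_one hr h h1
  · rw [min_eq_left h.le]
    exact Real.one_le_rpow h.le h0

lemma chi_real {n : ℕ} {ψ : En n → ℝ} {L Lr δ s' : ℝ} (K : Cut n ψ L) (hL1 : 1 ≤ Lr)
    (hL : ∀ δ : ℝ, 0 < δ → ∀ x, |rho n δ x| ≤ Lr * δ ^ (-(n : ℝ)))
    (hL2 : ∀ δ : ℝ, 0 < δ → ∀ x y, |rho n δ x - rho n δ y| ≤ Lr * δ ^ (-(n : ℝ)) * min 1 (‖x - y‖ / δ))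
    (h0 : 0 < δ) (h1 : δ ≤ 1) (hs0 : 0 ≤ s') (hs1 : s' ≤ 1) {m : ℕ} (hm : 1 ≤ m) (x y z : En n) :
    |chi n δ m ψ x y - chi n δ m ψ x z| ≤ Lr * (1 + 2 * m * L) * δ ^ (-s') * δ ^ (-(n : ℝ)) *
      (‖y - z‖ ^ s' * max (ψ y) (ψ z) ^ (m - 1)) := by
  unfold chi
  refine (prod_sub_le (K.nn z) (K.nn y)).trans ?_
  set Ψ := max (ψ y) (ψ z) with hΨ
  have hΨ0 : 0 ≤ Ψ := le_max_of_le_left (K.nn y)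
  have hΨ1 : Ψ ≤ 1 := max_le (K.le y) (K.le z)
  have hd : (0:ℝ) < δ ^ (-(n : ℝ)) := by positivity
  have hmin : min 1 (‖y - z‖ / δ) ≤ δ ^ (-s') * ‖y - z‖ ^ s' := by
    refine (min_rpow (by positivity) hs0 hs1).trans (le_of_eq ?_)
    rw [Real.div_rpow (norm_nonneg _) h0.le, Real.rpow_neg h0.le]; field_simp
  have hmin2 : min 1 ‖y - z‖ ≤ min 1 (‖y - z‖ / δ) := by
    apply min_le_min le_rfl
    rw [le_div_iff₀ h0]
    exact mul_le_of_le_one_right (norm_nonneg _) h1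
  have a1 := hL2 δ h0 (x - y) (x - z)
  have e : ‖x - y - (x - z)‖ = ‖y - z‖ := by rw [sub_sub_sub_cancel_left, norm_sub_rev]
  rw [e] at a1
  have a2 := hL δ h0 (x - y)
  have a3 := hL δ h0 (x - z)
  have a4 := (K.lip y z).trans (mul_le_mul_of_nonneg_left hmin2 K.L0)
  set μ := min 1 (‖y - z‖ / δ)
  have hμ : 0 ≤ μ := le_min zero_le_one (by positivity)
  have hΨm : Ψ ^ m ≤ Ψ ^ (m - 1) := pow_le_pow_of_le_one hΨ0 hΨ1 (by omega)
  have hL0 := K.L0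
  calc _ ≤ (Lr * δ ^ (-(n : ℝ)) * μ) * Ψ ^ (m-1) + m * (Lr * δ ^ (-(n : ℝ)) + Lr * δ ^ (-(n : ℝ))) * Ψ ^ (m - 1) * (L * μ) := by
        gcongr
    _ = Lr * (1 + 2 * m * L) * δ ^ (-(n : ℝ)) * Ψ ^ (m - 1) * μ := by ring
    _ ≤ Lr * (1 + 2 * m * L) * δ ^ (-(n : ℝ)) * Ψ ^ (m - 1) * (δ ^ (-s') * ‖y - z‖ ^ s') := by gcongr
    _ = _ := by ring

lemma rho_out {n : ℕ} {δ : ℝ} (h0 : 0 < δ) {x y : En n} (hy : y ∉ ball x δ) : rho n δ (x - y) = 0 := by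
  apply rho_zero n h0
  rw [mem_ball, dist_comm, dist_eq_norm, not_lt] at hy
  exact hy

lemma chi_enn {n : ℕ} {ψ : En n → ℝ} {L Lr δ s' : ℝ} (K : Cut n ψ L) (hL1 : 1 ≤ Lr)
    (hL : ∀ δ : ℝ, 0 < δ → ∀ x, |rho n δ x| ≤ Lr * δ ^ (-(n : ℝ)))
    (hL2 : ∀ δ : ℝ, 0 < δ → ∀ x y, |rho n δ x - rho n δ y| ≤ Lr * δ ^ (-(n : ℝ)) * min 1 (‖x - y‖ / δ))
    (h0 : 0 < δ) (h1 : δ ≤ 1) (hs0 : 0 ≤ s') (hs1 : s' ≤ 1) {m : ℕ} (hm : 1 ≤ m) (x y z : En n) :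
    ‖chi n δ m ψ x y - chi n δ m ψ x z‖ₑ ≤ ENNReal.ofReal (Lr * (1 + 2 * m * L) * δ ^ (-s') * δ ^ (-(n : ℝ))) *
      (ENNReal.ofReal (‖y - z‖ ^ s') * ENNReal.ofReal (max (ψ y) (ψ z) ^ (m - 1))) * 
       ((ball x δ).indicator 1 y + (ball x δ).indicator 1 z) := by
  by_cases hy : y ∈ ball x δ ∨ z ∈ ball x δ
  · have h1 : (1:ℝ≥0∞) ≤ (ball x δ).indicator 1 y + (ball x δ).indicator 1 z := by
      rcases hy with h | h
      · simp [indicator_of_mem h]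
      · simp [indicator_of_mem h]
    refine le_trans ?_ (le_mul_of_one_le_right (zero_le) h1)
    have hL0 := K.L0
    have := le_max_of_le_left (c := ψ z) (K.nn y)
    rw [← ENNReal.ofReal_mul (by positivity), ← ENNReal.ofReal_mul (by positivity), Real.enorm_eq_ofReal_abs]
    apply ENNReal.ofReal_le_ofReal
    exact chi_real K hL1 hL hL2 h0 ‹_› hs0 hs1 hm x y z
  · push Not at hy
    simp [chi, rho_out h0 hy.1, rho_out h0 hy.2]

lemma chi_smooth {n : ℕ} {ψ : En n → ℝ} {L : ℝ} (K : Cut n ψ L) (δ : ℝ) (m : ℕ) (x : En n) :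
    ContDiff ℝ (⊤ : ℕ∞) (chi n δ m ψ x) := by
  unfold chi
  exact ((rho_smooth n δ).comp (contDiff_const.sub contDiff_id)).mul (K.sm.pow m)

lemma chi_cpt {n : ℕ} {ψ : En n → ℝ} {L : ℝ} (K : Cut n ψ L) (δ : ℝ) {m : ℕ} (hm : 1 ≤ m) (x : En n) :
    HasCompactSupport (chi n δ m ψ x) := by
  apply K.cp.mono
  intro y hy h0
  have : m ≠ 0 := by omega
  exact hy (by simp [chi, h0, this])

lemma chi_zero {n : ℕ} {ψ : En n → ℝ} {L : ℝ} (K : Cut n ψ L) (δ : ℝ) {m : ℕ} (hm : 1 ≤ m) (x y : En n)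
    (hy : y ∉ ball (0 : En n) (1/2)) : chi n δ m ψ x y = 0 := by
  have : m ≠ 0 := by omega
  simp [chi, K.zero y hy, this]

lemma chi_le {n : ℕ} {ψ : En n → ℝ} {L Lr δ : ℝ} (K : Cut n ψ L)
    (hL : ∀ δ : ℝ, 0 < δ → ∀ x, |rho n δ x| ≤ Lr * δ ^ (-(n : ℝ))) (h0 : 0 < δ) {m : ℕ} (hm : 1 ≤ m) (x y : En n) :
    ‖chi n δ m ψ x y‖ₑ ≤ ENNReal.ofReal (Lr * δ ^ (-(n:ℝ))) * ((ball x δ).indicator 1 y * (ball 0 (1/2)).indicator 1 y) := by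
  by_cases hy : y ∈ ball x δ
  · by_cases hz : y ∈ ball (0 : En n) (1/2)
    · rw [indicator_of_mem hy, indicator_of_mem hz]
      simp only [Pi.one_apply, mul_one]
      rw [Real.enorm_eq_ofReal_abs]
      apply ENNReal.ofReal_le_ofReal
      unfold chi
      rw [abs_mul, abs_of_nonneg (pow_nonneg (K.nn y) m)]
      exact (mul_le_of_le_one_right (abs_nonneg _) (pow_le_one₀ (K.nn y) (K.le y))).trans (hL δ h0 _)
    · simp [chi_zero K δ hm x y hz]
  · simp [chi, rho_out h0 hy]

lemma chi_meas {n : ℕ} {ψ : En n → ℝ} {L : ℝ} (K : Cut n ψ L) (δ : ℝ) (m : ℕ) (x : En n) :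
    Measurable (chi n δ m ψ x) := (chi_smooth K δ m x).continuous.measurable

lemma int_chi_le {n : ℕ} {ψ : En n → ℝ} {L Lr δ : ℝ} (K : Cut n ψ L) (hL1 : 1 ≤ Lr)
    (hL : ∀ δ : ℝ, 0 < δ → ∀ x, |rho n δ x| ≤ Lr * δ ^ (-(n : ℝ))) (h0 : 0 < δ) {m : ℕ} (hm : 1 ≤ m) (x : En n)
    {g : En n → ℝ} {w : En n → ℝ≥0∞} (hw : ∀ y ∈ ball (0 : En n) (1/2), ‖g y‖ₑ ≤ w y) :
    ‖∫ y, g y * chi n δ m ψ x y‖ₑ ≤ ENNReal.ofReal Lr * Mo δ ((ball 0 (1/2)).indicator w) x := by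
  refine (enorm_integral_le_lintegral_enorm _).trans ?_
  unfold Mo
  rw [← mul_assoc, ← ENNReal.ofReal_mul (by linarith), ← lintegral_const_mul' _ _ (by simp), ← lintegral_indicator measurableSet_ball]
  apply lintegral_mono
  intro y
  simp only []
  rw [enorm_mul]
  refine (mul_le_mul_right (chi_le K hL h0 hm x y) _).trans ?_
  by_cases hy : y ∈ ball x δ
  · by_cases hz : y ∈ ball (0 : En n) (1/2)
    · rw [indicator_of_mem hy, indicator_of_mem hz, indicator_of_mem hy, indicator_of_mem hz]
      simp only [Pi.one_apply, mul_one]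
      rw [mul_comm]
      exact mul_le_mul_right (hw y hz) _
    · rw [indicator_of_notMem hz]; simp
  · rw [indicator_of_notMem hy]; simp

lemma W_chi_le {n : ℕ} {p q s t M Λ : ℝ} (H : Par n p q s t M Λ) {ψ : En n → ℝ} {L Lr : ℝ} (K : Cut n ψ L) {m : ℕ} (hm : 1 ≤ m)
    (hL1 : 1 ≤ Lr)
    (hL : ∀ δ : ℝ, 0 < δ → ∀ x, |rho n δ x| ≤ Lr * δ ^ (-(n : ℝ)))
    (hL2 : ∀ δ : ℝ, 0 < δ → ∀ x y, |rho n δ x - rho n δ y| ≤ Lr * δ ^ (-(n : ℝ)) * min 1 (‖x - y‖ / δ))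
    {s' : ℝ} (hs' : 0 < s') (hs1' : s' < 1) :
    ∃ C : ℝ≥0∞, C < ⊤ ∧ ∀ (a : En n × En n → ℝ) (u f : En n → ℝ), Sol n p q s t M Λ a u f → 
     ∀ δ, 0 < δ → δ ≤ 1 → ∀ x, 
      ‖∫ z in ball (0 : En n) 1 ×ˢ ball (0 : En n) 1, Wf n p q s t a u z * (chi n δ m ψ x z.1 - chi n δ m ψ x z.2)‖ₑ ≤
        C * (ENNReal.ofReal (δ ^ (-s')) * Mo δ ((ball 0 1).indicator (kin n p s s' m ψ u)) x) := by
  set C1 := ENNReal.ofReal (1 + M * (2 * Λ) ^ (q - p) * 2 ^ (s * p - t * q)) with hC1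
  set C2 := ENNReal.ofReal (Lr * (1 + 2 * m * L)) with hC2
  refine ⟨C1 * C2 * 2, by finiteness, fun a u f S δ h0 h1 x => ?_⟩
  have hum := S.um
  have hψ := K.meas
  have hL0 := K.L0
  set B := ball (0 : En n) 1 with hB
  set g : En n → En n → ℝ≥0∞ := fun y z => ‖u y - u z‖ₑ ^ (p - 1) * kk (s' - (n + s * p)) y z * ENNReal.ofReal (max (ψ y) (ψ z) ^ (m - 1)) with hg
  have hgs : ∀ y z, g y z = g z y := by
    intro y z; simp only [hg]
    rw [kk_comm, max_comm, ← enorm_neg (u y - u z), neg_sub]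
  have hgm : Measurable (fun z : En n × En n => g z.1 z.2) := by simp only [hg]; fun_prop
  have hi : Measurable ((ball x δ).indicator (1 : En n → ℝ≥0∞)) := measurable_one.indicator measurableSet_ball
  refine (enorm_integral_le_lintegral_enorm _).trans ?_
  set D := ENNReal.ofReal (δ ^ (-s')) * ENNReal.ofReal (δ ^ (-(n:ℝ))) with hD
  have e1 : ∫⁻ z in B ×ˢ B, g z.1 z.2 * (ball x δ).indicator 1 z.1 = ∫⁻ y in ball x δ, B.indicator (kin n p s s' m ψ u) y := by
    rw [lint_prod_set (F := fun z => g z.1 z.2 * (ball x δ).indicator 1 z.1) (by fun_prop)]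
    rw [← lintegral_indicator measurableSet_ball, ← lintegral_indicator measurableSet_ball]
    congr 1; ext y
    by_cases hy : y ∈ B
    · rw [indicator_of_mem hy]
      simp only [indicator, hy, if_true]
      split_ifs with h
      · simp only [Pi.one_apply, mul_one]; rfl
      · simp
    · rw [hB] at hy
      simp only [indicator, hy, hB, if_false, ite_self]
  have e2 : ∫⁻ z in B ×ˢ B, g z.1 z.2 * (ball x δ).indicator 1 z.2 = ∫⁻ z in B ×ˢ B, g z.1 z.2 * (ball x δ).indicator 1 z.1 := by
    rw [lint_prod_set (F := fun z => g z.1 z.2 * (ball x δ).indicator 1 z.1) (by fun_prop),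
      lint_prod_set (F := fun z => g z.1 z.2 * (ball x δ).indicator 1 z.2) (by fun_prop)]
    rw [lintegral_lintegral_swap (by fun_prop)]
    simp only [fun y z => hgs y z]
  calc _ ≤ ∫⁻ z in B ×ˢ B, (C1 * C2 * D) * (g z.1 z.2 * (ball x δ).indicator 1 z.1 + g z.1 z.2 * (ball x δ).indicator 1 z.2) := by
        apply setLIntegral_mono' (measurableSet_ball.prod measurableSet_ball)
        intro z hz
        rw [enorm_mul]
        have b1 := Wf_enorm H S z (by
          have h1 := mem_ball_zero_iff.1 hz.1
          have h2 := mem_ball_zero_iff.1 hz.2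
          have := norm_sub_le z.1 z.2
          linarith)
        have b2 := chi_enn K hL1 hL hL2 h0 h1 hs'.le hs1'.le hm x z.1 z.2
        refine (mul_le_mul' b1 b2).trans ?_
        have b3 := kk_shift hs' (b := -(n + s * p)) z.1 z.2
        rw [ENNReal.ofReal_mul (p := Lr * (1 + 2 * m * L) * δ ^ (-s')) (by positivity), 
          ENNReal.ofReal_mul (p := Lr * (1 + 2 * m * L)) (by positivity), ← hC2]
        rw [show (s' + -(n + s * p)) = s' - (n + s * p) by ring] at b3
        simp only [hg]
        calc _ = C1 * C2 * D * ((‖u z.1 - u z.2‖ₑ ^ (p - 1) * (ENNReal.ofReal (‖z.1 - z.2‖ ^ s') * kk (-(n + s * p)) z.1 z.2)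
              * ENNReal.ofReal (max (ψ z.1) (ψ z.2) ^ (m - 1))) * ((ball x δ).indicator 1 z.1 + (ball x δ).indicator 1 z.2)) := by
                simp only [hD]; ring
          _ ≤ C1 * C2 * D * ((‖u z.1 - u z.2‖ₑ ^ (p - 1) * (kk (s' - (n + s * p)) z.1 z.2)
              * ENNReal.ofReal (max (ψ z.1) (ψ z.2) ^ (m - 1))) * ((ball x δ).indicator 1 z.1 + (ball x δ).indicator 1 z.2)) := by
                gcongr
          _ = _ := by rw [mul_add (_ * _ * _)]
    _ = (C1 * C2 * D) * ((∫⁻ y in ball x δ, B.indicator (kin n p s s' m ψ u) y) + ∫⁻ y in ball x δ, B.indicator (kin n p s s' m ψ u) y) := by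
        rw [lintegral_const_mul' _ _ (by simp only [hD]; finiteness), lintegral_add_left (by fun_prop), e2, e1]
    _ = _ := by
        unfold Mo; simp only [hD]; ring

lemma N_pt {n : ℕ} {p q s t M Λ : ℝ} (H : Par n p q s t M Λ) {ψ : En n → ℝ} {L : ℝ} (K : Cut n ψ L) {m : ℕ} (hm : 1 ≤ m)
    {s' : ℝ} (hs' : 0 < s') (hs1' : s' < 1) {Ch : ℝ} (hCh : 0 ≤ Ch) :
    ∃ C : ℝ≥0∞, C < ⊤ ∧ ∀ (a : En n × En n → ℝ) (u f : En n → ℝ), Sol n p q s t M Λ a u f → ∀ c : ℝ, 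
     ∀ h1 : En n → ℝ, Measurable h1 → ∀ Q, (∀ x, |h1 x| ≤ Q) → 
      (∀ x, ‖x‖ ≤ 3 / 4 → |hh n p q s t a u x - h1 x| ≤ Ch * |u x - c| ^ (p - 1)) →
     ∀ δ, 0 < δ → δ ≤ 1 → ∀ x, 
      ‖PP n δ (fun y => h1 y * ψ y ^ m) x‖ₑ ≤ C * 
       ((ENNReal.ofReal (δ ^ (-s')) * Mo δ ((ball 0 1).indicator (kin n p s s' m ψ u)) x) + 
       Mo δ ((ball 0 (1/2)).indicator (fun y => ‖u y - c‖ₑ ^ (p - 1))) x + Mo δ ((ball 0 (1/2)).indicator (fun y => ‖f y‖ₑ)) x) := by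
  obtain ⟨Lr, hL1, hL, hL2⟩ := exists_Lr n
  obtain ⟨C, hC, hW⟩ := W_chi_le H K hm hL1 hL hL2 hs' hs1'
  refine ⟨C + ENNReal.ofReal Lr + ENNReal.ofReal Lr * ENNReal.ofReal Ch, by finiteness, fun a u f S c h1 h1m Q hQ hd δ h0 hδ1 x => ?_⟩
  have hp := H.hp
  have hχs := chi_smooth K δ m x
  have hχc := chi_cpt K δ hm x
  have hχm := chi_meas K δ m x
  have hχi : Integrable (chi n δ m ψ x) := hχs.continuous.integrable_of_hasCompactSupport hχc
  have hχ0 : ∀ y, y ∉ ball (0 : En n) (1/2) → chi n δ m ψ x y = 0 := fun y hy => chi_zero K δ hm x y hy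
  obtain ⟨Kb, hKb0, hKb⟩ := hh_bound H S
  have i1 : Integrable (fun y => h1 y * chi n δ m ψ x y) := 
    hχi.bdd_mul (c := Q) h1m.aestronglyMeasurable (Filter.Eventually.of_forall fun y => hQ y)
  have i2 : Integrable (fun y => hh n p q s t a u y * chi n δ m ψ x y) := by
    refine (hχi.norm.const_mul Kb).mono' ((hh_meas S.am S.um).mul hχm).aestronglyMeasurable (Filter.Eventually.of_forall fun y => ?_)
    rw [norm_mul]
    by_cases hy : y ∈ ball (0 : En n) (1/2)
    · gcongr
      exact hKb y (by have := mem_ball_zero_iff.1 hy; linarith)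
    · simp [hχ0 y hy]
  have hws := weak_smooth H S hχs hχc (fun y hy => hχ0 y (fun h => hy (ball_subset_ball (by norm_num) h)))
  have e : PP n δ (fun y => h1 y * ψ y ^ m) x = 
      (∫ z in ball (0 : En n) 1 ×ˢ ball (0 : En n) 1, Wf n p q s t a u z * (chi n δ m ψ x z.1 - chi n δ m ψ x z.2))
       - (∫ y, f y * chi n δ m ψ x y) - ∫ y, (hh n p q s t a u y - h1 y) * chi n δ m ψ x y := by
    rw [hws]
    have : ∫ y, (hh n p q s t a u y - h1 y) * chi n δ m ψ x y = 
      (∫ y, hh n p q s t a u y * chi n δ m ψ x y) - ∫ y, h1 y * chi n δ m ψ x y := by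
      rw [← integral_sub i2 i1]; congr 1; ext y; ring
    rw [this]
    have : PP n δ (fun y => h1 y * ψ y ^ m) x = ∫ y, h1 y * chi n δ m ψ x y := by
      unfold PP chi; congr 1; ext y; ring
    rw [this]; ring
  have b1 := hW a u f S δ h0 hδ1 x
  have b2 := int_chi_le K hL1 hL h0 hm x (g := f) (w := fun y => ‖f y‖ₑ) (fun _ _ => le_rfl)
  have b3 := int_chi_le K hL1 hL h0 hm x (g := fun y => hh n p q s t a u y - h1 y) (w := fun y => ENNReal.ofReal Ch * ‖u y - c‖ₑ ^ (p - 1)) (by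
    intro y hy
    rw [Real.enorm_eq_ofReal_abs, ← ofReal_abs_rpow (by linarith), ← ENNReal.ofReal_mul hCh]
    exact ENNReal.ofReal_le_ofReal (hd y (by have := mem_ball_zero_iff.1 hy; linarith)))
  have e3 : Mo δ ((ball 0 (1/2)).indicator (fun y => ENNReal.ofReal Ch * ‖u y - c‖ₑ ^ (p - 1))) x = 
     ENNReal.ofReal Ch * Mo δ ((ball 0 (1/2)).indicator (fun y => ‖u y - c‖ₑ ^ (p - 1))) x := by
    unfold Mo
    rw [← mul_assoc, mul_comm (ENNReal.ofReal Ch), mul_assoc]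
    congr 1
    rw [← lintegral_const_mul' _ _ (by simp)]
    apply lintegral_congr; intro y
    simp only [indicator]; split_ifs <;> simp
  rw [e3] at b3
  rw [e]
  refine (enorm_sub_le.trans (add_le_add enorm_sub_le le_rfl)).trans ?_
  refine (add_le_add (add_le_add b1 b2) b3).trans ?_
  set X := ENNReal.ofReal (δ ^ (-s')) * Mo δ ((ball 0 1).indicator (kin n p s s' m ψ u)) x
  set Y := Mo δ ((ball 0 (1/2)).indicator (fun y => ‖u y - c‖ₑ ^ (p - 1))) x
  set Z := Mo δ ((ball 0 (1/2)).indicator (fun y => ‖f y‖ₑ)) x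
  set l := ENNReal.ofReal Lr
  set k := ENNReal.ofReal Ch
  calc C * X + l * Z + l * (k * Y) = C * X + l * k * Y + l * Z := by ring
    _ ≤ (C + l + l * k) * X + (C + l + l * k) * Y + (C + l + l * k) * Z := by
      gcongr
      · rw [add_assoc]; exact le_self_add
      · exact le_add_self
      · rw [add_comm C, add_assoc]; exact le_self_add
    _ = _ := by ring

lemma three_pow {a b c : ℝ≥0∞} {r : ℝ} (hr : 1 ≤ r) : (a + b + c) ^ r ≤ (3:ℝ≥0∞) ^ r * (a ^ r + b ^ r + c ^ r) := by
  have h0 : 0 ≤ r := by linarith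
  have : a + b + c ≤ 3 * max (max a b) c := by
    calc a + b + c ≤ max (max a b) c + max (max a b) c + max (max a b) c := by
          gcongr
          · exact le_max_of_le_left (le_max_left _ _)
          · exact le_max_of_le_left (le_max_right _ _)
          · exact le_max_right _ _
      _ = _ := by ring
  refine (ENNReal.rpow_le_rpow this h0).trans ?_
  rw [ENNReal.mul_rpow_of_nonneg _ _ h0]
  gcongr
  rcases max_choice (max a b) c with h | h
  · rw [h]
    rcases max_choice a b with h | h
    · rw [h, add_assoc]; exact le_self_add
    · rw [h, add_comm (a ^ r), add_assoc]; exact le_self_add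
  · rw [h]; exact le_add_self

lemma N_bound {n : ℕ} {p q s t M Λ : ℝ} (H : Par n p q s t M Λ) {ψ : En n → ℝ} {L : ℝ} (K : Cut n ψ L) {m : ℕ} (hm : q ≤ m)
    {s' : ℝ} (hs' : s < s') (hs1' : s' < 1) {Ch : ℝ} (hCh : 0 ≤ Ch) :
    ∃ C : ℝ≥0∞, C < ⊤ ∧ ∀ (a : En n × En n → ℝ) (u f : En n → ℝ), Sol n p q s t M Λ a u f → ∀ c : ℝ, 
     ∀ h1 : En n → ℝ, Measurable h1 → ∀ Q, (∀ x, |h1 x| ≤ Q) → 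
      (∀ x, ‖x‖ ≤ 3 / 4 → |hh n p q s t a u x - h1 x| ≤ Ch * |u x - c| ^ (p - 1)) →
     ∀ δ, 0 < δ → δ ≤ 1 → 
      ∫⁻ x, ‖PP n δ (fun y => h1 y * ψ y ^ m) x‖ₑ ^ (p / (p - 1)) ≤ C * (ENNReal.ofReal (δ ^ (-(s' * (p / (p - 1))))) * 
       (EE n p s m ψ u + VV n p u c + Fn n p s f ^ (p / (p - 1)))) := by
  have hp := H.hp
  have hs0 := H.hs0
  have hn : (0:ℝ) < n := by have := H.hn; exact_mod_cast (by omega : 0 < n)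
  have hp1 : 0 < p - 1 := by linarith
  have hm1 : 1 ≤ m := by
    have : (1:ℝ) ≤ m := by linarith [H.hpq]
    exact_mod_cast this
  set P := p / (p - 1) with hP
  have hP1 : 1 ≤ P := by rw [hP, le_div_iff₀ hp1]; linarith
  have hP0 : 0 < P := by linarith
  have hps := pStar_gt H
  have hpsi := pStar_inv H
  have hPinv : (p - 1) / p = 1 / P := by rw [hP]; field_simp
  have hpsP : pStar n p s ≤ P := by
    rw [← one_div_le_one_div (by linarith) (by linarith), hpsi, hPinv]
    have : 0 < s / n := by positivity
    linarith
  obtain ⟨C1, hC1, h1⟩ := N_pt H K hm1 (hs0.trans hs') hs1' hCh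
  obtain ⟨C2, hC2, h2⟩ := kin_bound H K hm hs' hs1'
  obtain ⟨C3, hC3, h3⟩ := Mo_imp (n := n) hps.le hpsP
  set m1 := ENNReal.ofReal (m0 n) ^ P with hm1'
  have hm1f : m1 < ⊤ := by simp only [hm1']; finiteness
  refine ⟨C1 ^ P * 3 ^ P * (m1 * C2 + m1 + C3), by finiteness, fun a u f S c g gm Q hQ hd δ h0 hδ1 => ?_⟩
  have hum := S.um
  have hfm := S.fm
  have hψ := K.meas
  have hkm := kin_meas (n := n) (p := p) (s := s) (s' := s') (m := m) hψ hum
  set w1 := (ball (0 : En n) 1).indicator (kin n p s s' m ψ u) with hw1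
  set w2 := (ball (0 : En n) (1/2)).indicator (fun y => ‖u y - c‖ₑ ^ (p - 1)) with hw2
  set w3 := (ball (0 : En n) (1/2)).indicator (fun y => ‖f y‖ₑ) with hw3
  have w1m : Measurable w1 := hkm.indicator measurableSet_ball
  have w2m : Measurable w2 := Measurable.indicator (by fun_prop) measurableSet_ball
  have w3m : Measurable w3 := Measurable.indicator (by fun_prop) measurableSet_ball
  set d := ENNReal.ofReal (δ ^ (-(s' * P))) with hdd
  have hd1 : 1 ≤ d := by
    rw [hdd, ← ENNReal.ofReal_one]
    apply ENNReal.ofReal_le_ofReal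
    exact Real.one_le_rpow_of_pos_of_le_one_of_nonpos h0 hδ1 (by have : 0 ≤ s' * P := mul_nonneg (by linarith) hP0.le
                                                                 linarith)
  have ind_pow : ∀ (A : Set (En n)) (w : En n → ℝ≥0∞), MeasurableSet A → ∫⁻ y, (A.indicator w y) ^ P = ∫⁻ y in A, w y ^ P := by
    intro A w hA
    rw [← lintegral_indicator hA]
    congr 1; ext y; simp only [indicator]; split_ifs
    · rfl
    · exact ENNReal.zero_rpow_of_pos hP0
  have A1 : ∫⁻ x, (ENNReal.ofReal (δ ^ (-s')) * Mo δ w1 x) ^ P ≤ d * (m1 * (C2 * EE n p s m ψ u)) := by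
    simp_rw [ENNReal.mul_rpow_of_nonneg _ _ hP0.le]
    rw [lintegral_const_mul' _ _ (by finiteness)]
    have : ENNReal.ofReal (δ ^ (-s')) ^ P = d := by
      rw [ENNReal.ofReal_rpow_of_nonneg (by positivity) hP0.le, ← Real.rpow_mul h0.le, hdd]; congr 2; ring
    rw [this]
    gcongr
    refine (Mo_Lr h0 hP1 w1m).trans ?_
    gcongr
    rw [hw1, ind_pow _ _ measurableSet_ball]
    exact h2 u hum
  have A2 : ∫⁻ x, Mo δ w2 x ^ P ≤ d * (m1 * VV n p u c) := by
    refine le_trans ?_ (le_mul_of_one_le_left zero_le hd1)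
    refine (Mo_Lr h0 hP1 w2m).trans ?_
    gcongr
    rw [hw2, ind_pow _ _ measurableSet_ball]
    unfold VV
    refine (lintegral_mono_set (ball_subset_ball (by norm_num : (1/2:ℝ) ≤ 1))).trans (le_of_eq ?_)
    congr 1; ext y
    rw [← ENNReal.rpow_mul]; congr 1; rw [hP]; field_simp
  have A3 : ∫⁻ x, Mo δ w3 x ^ P ≤ d * (C3 * Fn n p s f ^ P) := by
    refine (h3 δ h0 w3 w3m).trans ?_
    have e1 : (∫⁻ y, w3 y ^ pStar n p s) ^ (P / pStar n p s) = Fn n p s f ^ P := by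
      unfold Fn
      rw [← ENNReal.rpow_mul, hw3, ← lintegral_indicator measurableSet_ball]
      congr 1
      · congr 1; ext y; simp only [indicator]; split_ifs
        · rfl
        · exact ENNReal.zero_rpow_of_pos (by linarith)
      · ring
    rw [e1, mul_comm C3, mul_assoc]
    gcongr
    rw [hdd]
    apply ENNReal.ofReal_le_ofReal
    apply Real.rpow_le_rpow_of_exponent_ge h0 hδ1
    have e2 : n * (P / pStar n p s - 1) = s * P := by
      have : P / pStar n p s = P * (1 / pStar n p s) := by ring
      rw [this, hpsi, hPinv]; field_simp; ring
    rw [e2]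
    have := mul_le_mul_of_nonneg_right hs'.le hP0.le
    linarith
  calc _ ≤ ∫⁻ x, C1 ^ P * 3 ^ P * ((ENNReal.ofReal (δ ^ (-s')) * Mo δ w1 x) ^ P + Mo δ w2 x ^ P + Mo δ w3 x ^ P) := by
        apply lintegral_mono; intro x
        simp only []
        refine (ENNReal.rpow_le_rpow (h1 a u f S c g gm Q hQ hd δ h0 hδ1 x) hP0.le).trans ?_
        rw [ENNReal.mul_rpow_of_nonneg _ _ hP0.le, mul_assoc]
        exact mul_le_mul_right (three_pow hP1) _
    _ = C1 ^ P * 3 ^ P * ((∫⁻ x, (ENNReal.ofReal (δ ^ (-s')) * Mo δ w1 x) ^ P) + (∫⁻ x, Mo δ w2 x ^ P) + ∫⁻ x, Mo δ w3 x ^ P) := by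
        have q1 := Mo_meas δ w1m
        have q2 := Mo_meas δ w2m
        have q3 := Mo_meas δ w3m
        rw [lintegral_const_mul' _ _ (by finiteness), lintegral_add_left (by fun_prop), lintegral_add_left (by fun_prop)]
    _ ≤ C1 ^ P * 3 ^ P * (d * (m1 * (C2 * EE n p s m ψ u)) + d * (m1 * VV n p u c) + d * (C3 * Fn n p s f ^ P)) := by
        gcongr
    _ = C1 ^ P * 3 ^ P * (d * ((m1 * C2) * EE n p s m ψ u + m1 * VV n p u c + C3 * Fn n p s f ^ P)) := by ring
    _ ≤ C1 ^ P * 3 ^ P * (d * ((m1 * C2 + m1 + C3) * EE n p s m ψ u + (m1 * C2 + m1 + C3) * VV n p u c + (m1 * C2 + m1 + C3) * Fn n p s f ^ P)) := by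
        gcongr
        · rw [add_assoc]; exact le_self_add
        · rw [add_comm (m1 * C2), add_assoc]; exact le_self_add
        · exact le_add_self
    _ = _ := by ring

lemma kk_ge {n : ℕ} {δ b : ℝ} (h0 : 0 < δ) (hb : 0 ≤ b) {x y : En n} (hxy : x ≠ y) (hd : ‖x - y‖ ≤ δ) :
    1 ≤ ENNReal.ofReal (δ ^ b) * kk (-b) x y := by
  unfold kk
  have h : 0 < ‖x - y‖ := norm_pos_iff.2 (sub_ne_zero.2 hxy)
  rw [← ENNReal.ofReal_mul (by positivity), ← ENNReal.ofReal_one]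
  apply ENNReal.ofReal_le_ofReal
  rw [Real.rpow_neg h.le, ← div_eq_mul_inv, le_div_iff₀ (by positivity), one_mul]
  exact Real.rpow_le_rpow h.le hd hb

/-- pointwise bound of the mollification error -/
lemma D_pt {n : ℕ} : ∃ C : ℝ≥0∞, C < ⊤ ∧ ∀ η τ : ℝ, 1 ≤ η → 0 ≤ τ → ∀ v : En n → ℝ, Measurable v → ∀ Λ : ℝ, (∀ x, |v x| ≤ Λ) →
    ∀ δ, 0 < δ → δ ≤ 1/4 → ∀ x ∈ ball (0 : En n) (3/4), 
     ‖PP n δ v x - v x‖ₑ ≤ C * (ENNReal.ofReal (δ ^ τ) * (∫⁻ y in ball (0 : En n) 1, ‖v x - v y‖ₑ ^ η * kk (-(n + τ * η)) x y) ^ (1 / η)) := by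
  obtain ⟨Lr, hL1, hL, -⟩ := exists_Lr n
  have hm := m0_pos n
  refine ⟨ENNReal.ofReal Lr * ENNReal.ofReal (m0 n) * ENNReal.ofReal (1 + (m0 n)⁻¹), by finiteness, fun η τ hη hτ v hv Λ hΛ δ h0 h1 x hx => ?_⟩
  have hη0 : 0 < η := by linarith
  have b1 := PP_sub_le h0 hL hv hΛ x (v x)
  have b2 : ENNReal.ofReal (Lr * δ ^ (-(n:ℝ))) * ∫⁻ y in ball x δ, ‖v y - v x‖ₑ = 
    ENNReal.ofReal Lr * Mo δ (fun y => ‖v y - v x‖ₑ) x := by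
    unfold Mo; rw [ENNReal.ofReal_mul (by linarith), mul_assoc]
  rw [b2, Mo_eq h0] at b1
  have hvol0 : volume (ball x δ) ≠ 0 := (measure_ball_pos volume x h0).ne'
  have hvolt : volume (ball x δ) ≠ ⊤ := measure_ball_lt_top.ne
  have b3 := mean_le (μ := volume) (f := fun y => ‖v y - v x‖ₑ) (by fun_prop) (ball x δ) hvol0 hvolt hη
  have b4 : ∫⁻ y in ball x δ, ‖v y - v x‖ₑ ^ η ≤ ENNReal.ofReal (δ ^ (n + τ * η)) * ∫⁻ y in ball (0 : En n) 1, ‖v x - v y‖ₑ ^ η * kk (-(n + τ * η)) x y := by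
    rw [← lintegral_const_mul' _ _ (by simp)]
    have hsub : ball x δ ⊆ ball (0 : En n) 1 := by
      apply ball_subset_ball'
      rw [dist_zero_right]
      have := mem_ball_zero_iff.1 hx
      linarith
    refine le_trans ?_ (lintegral_mono_set hsub)
    apply setLIntegral_mono' measurableSet_ball
    intro y hy
    rw [← enorm_neg (v y - v x), neg_sub]
    by_cases hxy : x = y
    · rw [hxy]; simp [hη0]
    · have := kk_ge (b := n + τ * η) h0 (by positivity) hxy (by rw [mem_ball, dist_comm, dist_eq_norm] at hy; exact hy.le)
      calc ‖v x - v y‖ₑ ^ η = ‖v x - v y‖ₑ ^ η * 1 := by rw [mul_one]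
        _ ≤ ‖v x - v y‖ₑ ^ η * (ENNReal.ofReal (δ ^ (n + τ * η)) * kk (-(n + τ * η)) x y) := mul_le_mul_right this _
        _ = _ := by ring
  set G := ∫⁻ y in ball (0 : En n) 1, ‖v x - v y‖ₑ ^ η * kk (-(n + τ * η)) x y
  have b5 : ((volume (ball x δ))⁻¹ * ∫⁻ y in ball x δ, ‖v y - v x‖ₑ ^ η) ^ (1 / η) ≤ ENNReal.ofReal (1 + (m0 n)⁻¹) * (ENNReal.ofReal (δ ^ τ) * G ^ (1 / η)) := by
    calc _ ≤ ((volume (ball x δ))⁻¹ * (ENNReal.ofReal (δ ^ (n + τ * η)) * G)) ^ (1/η) := by gcongr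
      _ = (ENNReal.ofReal ((m0 n)⁻¹) * ENNReal.ofReal (δ ^ (τ * η)) * G) ^ (1/η) := by
          rw [← mul_assoc, vol_ball x h0, ← ENNReal.ofReal_inv_of_pos (by positivity), ← ENNReal.ofReal_mul (by positivity), ← ENNReal.ofReal_mul (by positivity)]
          congr 3
          rw [Real.rpow_add h0]; field_simp
      _ = ENNReal.ofReal ((m0 n)⁻¹ ^ (1/η)) * (ENNReal.ofReal (δ ^ τ) * G ^ (1 / η)) := by
          rw [ENNReal.mul_rpow_of_nonneg _ _ (by positivity), ENNReal.mul_rpow_of_nonneg _ _ (by positivity), ENNReal.ofReal_rpow_of_nonneg (by positivity) (by positivity),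
            ENNReal.ofReal_rpow_of_nonneg (by positivity) (by positivity), ← Real.rpow_mul h0.le, mul_assoc]
          congr 5; field_simp
      _ ≤ _ := by
          gcongr
          have hi : 0 < (m0 n)⁻¹ := by positivity
          calc (m0 n)⁻¹ ^ (1/η) ≤ (1 + (m0 n)⁻¹) ^ (1/η) := by gcongr; linarith
            _ ≤ (1 + (m0 n)⁻¹) ^ (1:ℝ) := Real.rpow_le_rpow_of_exponent_le (by linarith) (by rw [div_le_one hη0]; exact hη)
            _ = _ := Real.rpow_one _
  refine b1.trans ?_
  rw [mul_assoc, mul_assoc]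
  exact mul_le_mul_right (mul_le_mul_right (b3.trans b5) _) _

lemma D_bound {n : ℕ} {p : ℝ} (hp : 2 ≤ p) : ∃ C : ℝ≥0∞, C < ⊤ ∧ ∀ η τ : ℝ, 1 ≤ η → p / 2 ≤ η → 0 ≤ τ → ∀ v : En n → ℝ, Measurable v → ∀ Λ : ℝ, (∀ x, |v x| ≤ Λ) →
    ∀ δ, 0 < δ → δ ≤ 1/4 → 
     ∫⁻ x in ball (0 : En n) (3/4), ‖PP n δ v x - v x‖ₑ ^ (p/2) ≤ 
      C * (ENNReal.ofReal (δ ^ τ) * gag v η (-(n + τ * η)) (ball 0 1) ^ (1 / η)) ^ (p/2) := by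
  obtain ⟨C, hC, h⟩ := D_pt (n := n)
  set D := ball (0 : En n) (3/4)
  have hD0 : volume D ≠ 0 := (measure_ball_pos volume _ (by norm_num)).ne'
  have hDt : volume D ≠ ⊤ := measure_ball_lt_top.ne
  refine ⟨C ^ (p/2) * (volume D * (1 + (volume D)⁻¹)), by finiteness, fun η τ hη hpη hτ v hv Λ hΛ δ h0 h1 => ?_⟩
  have hη0 : 0 < η := by linarith
  have hp0 : 0 < p := by linarith
  set g : En n → ℝ≥0∞ := fun x => ∫⁻ y in ball (0 : En n) 1, ‖v x - v y‖ₑ ^ η * kk (-(n + τ * η)) x y with hg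
  have hgm : Measurable g := by
    apply Measurable.lintegral_prod_right' (f := fun z : En n × En n => ‖v z.1 - v z.2‖ₑ ^ η * kk (-(n + τ * η)) z.1 z.2)
    fun_prop
  have b1 := mean_le (μ := volume) (f := fun x => (g x ^ (1/η)) ^ (p/2)) (by fun_prop) D hD0 hDt (r := 2 * η / p) (by rw [le_div_iff₀ hp0]; linarith)
  have e1 : ∀ x, ((g x ^ (1/η)) ^ (p/2)) ^ (2 * η / p) = g x := by
    intro x; rw [← ENNReal.rpow_mul, ← ENNReal.rpow_mul]
    rw [show 1 / η * (p/2 * (2 * η / p)) = 1 by field_simp, ENNReal.rpow_one]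
  simp_rw [e1] at b1
  have b2 : ∫⁻ x in D, g x ≤ gag v η (-(n + τ * η)) (ball 0 1) := lintegral_mono_set (ball_subset_ball (by norm_num))
  set W := gag v η (-(n + τ * η)) (ball 0 1)
  have b3 : ∫⁻ x in D, (g x ^ (1/η)) ^ (p/2) ≤ (volume D * (1 + (volume D)⁻¹)) * (W ^ (1/η)) ^ (p/2) := by
    calc _ = volume D * ((volume D)⁻¹ * ∫⁻ x in D, (g x ^ (1/η)) ^ (p/2)) := by
          rw [← mul_assoc, ENNReal.mul_inv_cancel hD0 hDt, one_mul]
      _ ≤ volume D * ((volume D)⁻¹ * W) ^ (1 / (2 * η / p)) := by gcongr; exact b1.trans (by gcongr)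
      _ = volume D * ((volume D)⁻¹ ^ (1 / (2 * η / p)) * (W ^ (1/η)) ^ (p/2)) := by
          rw [ENNReal.mul_rpow_of_nonneg _ _ (by positivity), ← ENNReal.rpow_mul W]
          congr 3; field_simp
      _ ≤ volume D * ((1 + (volume D)⁻¹) * (W ^ (1/η)) ^ (p/2)) := by
          gcongr
          calc (volume D)⁻¹ ^ (1 / (2 * η / p)) ≤ (1 + (volume D)⁻¹) ^ (1 / (2 * η / p)) := by gcongr; exact le_add_self
            _ ≤ (1 + (volume D)⁻¹) ^ (1:ℝ) := ENNReal.rpow_le_rpow_of_exponent_le le_self_add (by rw [one_div_div, div_le_one (by positivity)]; linarith)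
            _ = _ := ENNReal.rpow_one _
      _ = _ := by ring
  calc _ ≤ ∫⁻ x in D, C ^ (p/2) * (ENNReal.ofReal (δ ^ τ) ^ (p/2) * (g x ^ (1/η)) ^ (p/2)) := by
        apply setLIntegral_mono' measurableSet_ball
        intro x hx
        rw [← ENNReal.mul_rpow_of_nonneg _ _ (by positivity), ← ENNReal.mul_rpow_of_nonneg _ _ (by positivity)]
        exact ENNReal.rpow_le_rpow (h η τ hη hτ v hv Λ hΛ δ h0 h1 x hx) (by positivity)
    _ = C ^ (p/2) * (ENNReal.ofReal (δ ^ τ) ^ (p/2) * ∫⁻ x in D, (g x ^ (1/η)) ^ (p/2)) := by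
        rw [lintegral_const_mul' _ _ (by finiteness), lintegral_const_mul' _ _ (by finiteness)]
    _ ≤ C ^ (p/2) * (ENNReal.ofReal (δ ^ τ) ^ (p/2) * ((volume D * (1 + (volume D)⁻¹)) * (W ^ (1/η)) ^ (p/2))) := by gcongr
    _ = _ := by rw [ENNReal.mul_rpow_of_nonneg _ _ (by positivity)]; ring

/-- the dyadic difference -/
lemma Dj_bound {n : ℕ} {p : ℝ} (hp : 2 ≤ p) : ∃ C : ℝ≥0∞, C < ⊤ ∧ ∀ η τ : ℝ, 1 ≤ η → p / 2 ≤ η → 0 ≤ τ → ∀ v : En n → ℝ, Measurable v → ∀ Λ : ℝ, (∀ x, |v x| ≤ Λ) →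
    ∀ j, (∫⁻ x in ball (0 : En n) (3/4), ‖PP n (dl (j+1)) v x - PP n (dl j) v x‖ₑ ^ (p/2)) ^ (2/p) ≤ 
      C * (ENNReal.ofReal (dl j ^ τ) * gag v η (-(n + τ * η)) (ball 0 1) ^ (1 / η)) := by
  obtain ⟨C, hC, h⟩ := D_bound (n := n) hp
  refine ⟨(3 ^ (p/2) * (2 * C)) ^ (2/p), by finiteness, fun η τ hη hpη hτ v hv Λ hΛ j => ?_⟩
  have hp0 : 0 < p := by linarith
  set W := gag v η (-(n + τ * η)) (ball 0 1) ^ (1 / η)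
  have a1 := h η τ hη hpη hτ v hv Λ hΛ (dl j) (dl_pos j) (dl_le j)
  have a2 := h η τ hη hpη hτ v hv Λ hΛ (dl (j+1)) (dl_pos _) (dl_le _)
  have hmono : dl (j+1) ^ τ ≤ dl j ^ τ := by
    apply Real.rpow_le_rpow (dl_pos _).le _ hτ
    unfold dl; rw [pow_succ]
    have : (0:ℝ) < (1/2)^j := by positivity
    linarith
  have m1 := PP_meas (n := n) (δ := dl j) hv
  have m2 := PP_meas (n := n) (δ := dl (j+1)) hv
  have key : ∫⁻ x in ball (0 : En n) (3/4), ‖PP n (dl (j+1)) v x - PP n (dl j) v x‖ₑ ^ (p/2) ≤ (3 ^ (p/2) * (2 * C)) * (ENNReal.ofReal (dl j ^ τ) * W) ^ (p/2) := by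
    calc _ ≤ ∫⁻ x in ball (0 : En n) (3/4), 3 ^ (p/2) * (‖PP n (dl (j+1)) v x - v x‖ₑ ^ (p/2) + ‖PP n (dl j) v x - v x‖ₑ ^ (p/2)) := by
          apply lintegral_mono; intro x
          simp only []
          have := three_pow (a := ‖PP n (dl (j+1)) v x - v x‖ₑ) (b := ‖PP n (dl j) v x - v x‖ₑ) (c := 0) (r := p/2) (by linarith)
          rw [ENNReal.zero_rpow_of_pos (by positivity), add_zero, add_zero] at this
          refine le_trans (ENNReal.rpow_le_rpow ?_ (by positivity)) this
          rw [show PP n (dl (j+1)) v x - PP n (dl j) v x = (PP n (dl (j+1)) v x - v x) - (PP n (dl j) v x - v x) by ring]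
          exact enorm_sub_le
      _ = 3 ^ (p/2) * ((∫⁻ x in ball (0 : En n) (3/4), ‖PP n (dl (j+1)) v x - v x‖ₑ ^ (p/2)) + ∫⁻ x in ball (0 : En n) (3/4), ‖PP n (dl j) v x - v x‖ₑ ^ (p/2)) := by
          rw [lintegral_const_mul' _ _ (by finiteness), lintegral_add_left (by fun_prop)]
      _ ≤ 3 ^ (p/2) * (C * (ENNReal.ofReal (dl j ^ τ) * W) ^ (p/2) + C * (ENNReal.ofReal (dl j ^ τ) * W) ^ (p/2)) := by
          apply mul_le_mul_right
          apply add_le_add (a2.trans ?_) a1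
          gcongr
      _ = _ := by ring
  refine (ENNReal.rpow_le_rpow key (by positivity)).trans (le_of_eq ?_)
  rw [ENNReal.mul_rpow_of_nonneg _ _ (by positivity), ← ENNReal.rpow_mul (_ * W), show p/2 * (2/p) = 1 by field_simp, ENNReal.rpow_one]

section

open Filter

lemma PP_adj {n : ℕ} {δ : ℝ} (h : 0 < δ) {g w : En n → ℝ} (hg : Integrable g) (hw : Measurable w) {K : ℝ} (hK : ∀ x, |w x| ≤ K) :
    ∫ x, PP n δ g x * w x = ∫ y, g y * PP n δ w y := by
  have hi : Integrable (fun z : En n × En n => rho n δ (z.1 - z.2) * g z.2 * w z.1) (volume.prod volume) := by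
    have := Integrable.convolution_integrand (ContinuousLinearMap.mul ℝ ℝ) hg (rho_integrable n h)
    apply Integrable.mul_bdd (c := K) (this.congr (Eventually.of_forall fun z => by simp [mul_comm])) (Measurable.aestronglyMeasurable (by fun_prop))
    exact Eventually.of_forall fun z => hK _
  unfold PP
  simp_rw [← integral_mul_const, ← integral_const_mul]
  rw [integral_integral_swap hi]
  congr 1; ext y; congr 1; ext x
  rw [← rho_even n δ (y - x), neg_sub]; ring

lemma PP_comm {n : ℕ} {δ δ' : ℝ} (h : 0 < δ) (h' : 0 < δ') {v : En n → ℝ} (hv : Measurable v) {K : ℝ} (hK : ∀ x, |v x| ≤ K) (x : En n) :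
    PP n δ (PP n δ' v) x = PP n δ' (PP n δ v) x := by
  simp only [PP_eq]
  simp_rw [← integral_const_mul]
  rw [integral_integral_swap]
  · congr 1; ext w; congr 1; ext w'
    rw [sub_right_comm]; ring
  · have := (rho_integrable n h).mul_prod (rho_integrable n h')
    have h2 := this.mul_bdd (c := K) (g := fun z : En n × En n => v (x - z.1 - z.2)) (Measurable.aestronglyMeasurable (by fun_prop)) (Eventually.of_forall fun z => hK _)
    refine h2.congr (Eventually.of_forall fun z => ?_)
    simp [Function.uncurry]; ring

lemma PP_int {n : ℕ} {δ : ℝ} (h : 0 < δ) (_h1 : δ ≤ 1/4) {g : En n → ℝ} (hg : Measurable g) {Q : ℝ} (hQ : ∀ x, |g x| ≤ Q)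
    (hz : ∀ x, x ∉ ball (0 : En n) (1/2) → g x = 0) {w : En n → ℝ} (hw : Measurable w) {K : ℝ} (hK : ∀ x, |w x| ≤ K) : 
    Integrable (fun x => PP n δ g x * w x) := by
  have h2 : IntegrableOn (PP n δ g) (ball 0 (1/2+δ)) := bdd_intOn (PP_meas hg) (PP_bdd h hQ) measure_ball_lt_top.ne
  have h3 : Integrable (PP n δ g) := by
    rwa [integrableOn_iff_integrable_of_support_subset] at h2
    intro x hx
    by_contra hc
    exact hx (PP_zero h hz x hc)
  exact h3.mul_bdd (c := K) hw.aestronglyMeasurable (Eventually.of_forall fun x => hK x)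

lemma PP_cross {n : ℕ} {δ δ' : ℝ} (h : 0 < δ) (h' : 0 < δ') {g v : En n → ℝ} (hg : Integrable g) (hv : Measurable v) {K : ℝ} (hK : ∀ x, |v x| ≤ K) :
    ∫ x, PP n δ g x * PP n δ' v x = ∫ x, PP n δ' g x * PP n δ v x := by
  rw [PP_adj h hg (PP_meas hv) (PP_bdd h' hK), PP_adj h' hg (PP_meas hv) (PP_bdd h hK)]
  congr 1; ext y; rw [PP_comm h h' hv hK]

lemma tele {n : ℕ} (hn : 1 ≤ n) {g v : En n → ℝ} (hg : Measurable g) {Q : ℝ} (hQ : ∀ x, |g x| ≤ Q)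
    (hz : ∀ x, x ∉ ball (0 : En n) (1/2) → g x = 0) (hv : Measurable v) {K : ℝ} (hK : ∀ x, |v x| ≤ K) :
    ‖∫ x, g x * v x‖ₑ ≤ (∫⁻ x in ball (0 : En n) (3/4), ‖PP n (dl 0) g x‖ₑ * ‖PP n (dl 0) v x‖ₑ) + 
      ∑' j, ∫⁻ x in ball (0 : En n) (3/4), (‖PP n (dl (j+1)) g x‖ₑ + ‖PP n (dl j) g x‖ₑ) * ‖PP n (dl (j+1)) v x - PP n (dl j) v x‖ₑ := by
  set T : ℕ → ℝ := fun j => ∫ x, PP n (dl j) g x * PP n (dl j) v x with hT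
  have hgi : Integrable g := by
    have h2 : IntegrableOn g (ball 0 (1/2)) := bdd_intOn hg hQ measure_ball_lt_top.ne
    rwa [integrableOn_iff_integrable_of_support_subset] at h2
    intro x hx
    by_contra hc
    exact hx (hz x hc)
  have hz3 : ∀ j x, x ∉ ball (0 : En n) (3/4) → PP n (dl j) g x = 0 := by
    intro j x hx
    apply PP_zero (dl_pos j) hz
    intro hc; exact hx (ball_subset_ball (by linarith [dl_le j]) hc)
  have hlim : Tendsto T atTop (nhds (∫ x, g x * v x)) := by
    apply tendsto_integral_of_dominated_convergence ((ball (0 : En n) (3/4)).indicator (fun _ => Q * K))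
    · intro j; exact ((PP_meas hg).mul (PP_meas hv)).aestronglyMeasurable
    · rw [integrable_indicator_iff measurableSet_ball]
      exact integrableOn_const measure_ball_lt_top.ne
    · intro j; refine Eventually.of_forall fun x => ?_
      by_cases hx : x ∈ ball (0 : En n) (3/4)
      · rw [indicator_of_mem hx, norm_mul]
        exact mul_le_mul (PP_bdd (dl_pos j) hQ x) (PP_bdd (dl_pos j) hK x) (norm_nonneg _) ((abs_nonneg _).trans (hQ x))
      · rw [indicator_of_notMem hx, hz3 j x hx]; simp
    · filter_upwards [PP_tendsto hn hg hQ, PP_tendsto hn hv hK] with x h1 h2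
      exact h1.mul h2
  set d : ℕ → ℝ≥0∞ := fun j => ∫⁻ x in ball (0 : En n) (3/4), (‖PP n (dl (j+1)) g x‖ₑ + ‖PP n (dl j) g x‖ₑ) * ‖PP n (dl (j+1)) v x - PP n (dl j) v x‖ₑ with hd
  have hT0 : ‖T 0‖ₑ ≤ ∫⁻ x in ball (0 : En n) (3/4), ‖PP n (dl 0) g x‖ₑ * ‖PP n (dl 0) v x‖ₑ := by
    refine (enorm_integral_le_lintegral_enorm _).trans ?_
    rw [← lintegral_indicator measurableSet_ball]
    apply lintegral_mono; intro x; simp only []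
    by_cases hx : x ∈ ball (0 : En n) (3/4)
    · rw [indicator_of_mem hx, enorm_mul]
    · rw [indicator_of_notMem hx, hz3 0 x hx]; simp
  have hstep : ∀ j, ‖T (j+1) - T j‖ₑ ≤ d j := by
    intro j
    have p1 := dl_pos j
    have p2 := dl_pos (j+1)
    have l1 := dl_le j
    have l2 := dl_le (j+1)
    have e : T (j+1) - T j = ∫ x, (PP n (dl (j+1)) g x + PP n (dl j) g x) * (PP n (dl (j+1)) v x - PP n (dl j) v x) := by
      have hc := PP_cross p2 p1 hgi hv hK
      have i1 := PP_int p2 l2 hg hQ hz (PP_meas (δ := dl (j+1)) hv) (PP_bdd p2 hK)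
      have i2 := PP_int p2 l2 hg hQ hz (PP_meas (δ := dl (j)) hv) (PP_bdd p1 hK)
      have i3 := PP_int p1 l1 hg hQ hz (PP_meas (δ := dl (j+1)) hv) (PP_bdd p2 hK)
      have i4 := PP_int p1 l1 hg hQ hz (PP_meas (δ := dl (j)) hv) (PP_bdd p1 hK)
      have : ∀ x, (PP n (dl (j+1)) g x + PP n (dl j) g x) * (PP n (dl (j+1)) v x - PP n (dl j) v x) = 
        (PP n (dl (j+1)) g x * PP n (dl (j+1)) v x - PP n (dl (j+1)) g x * PP n (dl j) v x) + 
         (PP n (dl j) g x * PP n (dl (j+1)) v x - PP n (dl j) g x * PP n (dl j) v x) := by intro x; ring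
      simp_rw [this]
      have I := integral_add (i1.sub i2) (i3.sub i4)
      simp only [Pi.sub_apply] at I
      rw [I, integral_sub i1 i2, integral_sub i3 i4, hc]
      simp only [hT]; ring
    rw [e]
    refine (enorm_integral_le_lintegral_enorm _).trans ?_
    rw [hd]; simp only []
    rw [← lintegral_indicator measurableSet_ball]
    apply lintegral_mono; intro x; simp only []
    by_cases hx : x ∈ ball (0 : En n) (3/4)
    · rw [indicator_of_mem hx, enorm_mul]
      gcongr
      exact enorm_add_le _ _
    · rw [indicator_of_notMem hx, hz3 j x hx, hz3 (j+1) x hx]; simp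
  have hN : ∀ N, ‖T N‖ₑ ≤ ‖T 0‖ₑ + ∑ j ∈ Finset.range N, d j := by
    intro N
    induction N with
    | zero => simp
    | succ N ih =>
      rw [Finset.sum_range_succ, ← add_assoc]
      calc ‖T (N+1)‖ₑ = ‖T N + (T (N+1) - T N)‖ₑ := by congr 1; ring
        _ ≤ _ := (enorm_add_le _ _).trans (add_le_add ih (hstep N))
  refine le_of_tendsto hlim.enorm (Eventually.of_forall fun N => ?_)
  refine (hN N).trans (add_le_add hT0 (ENNReal.sum_le_tsum _))

def tz (n : ℕ) (η τ : ℝ) (u : En n → ℝ) : ℝ≥0∞ := gag u η (-(n + τ * η)) (ball (0 : En n) 1) ^ (1 / η)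

lemma holderH {n : ℕ} {p : ℝ} (hp : 2 ≤ p) {G D : En n → ℝ≥0∞} (hG : Measurable G) (hD : Measurable D) {Q : ℝ≥0∞}
    (hQ : ∀ x, G x ≤ Q) (A : Set (En n)) :
    ∫⁻ x in A, G x * D x ≤ Q ^ (1 / (p - 1)) * ((∫⁻ x, G x ^ (p / (p - 1))) ^ ((p - 2) / p) * (∫⁻ x in A, D x ^ (p/2)) ^ (2/p)) := by
  have hp1 : 0 < p - 1 := by linarith
  have hp0 : 0 < p := by linarith
  have e1 : ∀ x, G x ≤ Q ^ (1 / (p - 1)) * (G x ^ (p / (p-1))) ^ ((p-2)/p) := by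
    intro x
    calc G x = G x ^ (1 / (p-1) + (p-2)/(p-1)) := by
          rw [← add_div, show (1 + (p-2))/(p-1) = 1 by field_simp; ring, ENNReal.rpow_one]
      _ = G x ^ (1/(p-1)) * G x ^ ((p-2)/(p-1)) := ENNReal.rpow_add_of_nonneg _ _ (by positivity) (div_nonneg (by linarith) hp1.le)
      _ ≤ Q ^ (1 / (p - 1)) * G x ^ ((p-2)/(p-1)) := by gcongr; exact hQ x
      _ = _ := by
        rw [← ENNReal.rpow_mul]; congr 2; field_simp
  have e2 : ∀ x, D x = (D x ^ (p/2)) ^ (2/p) := by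
    intro x; rw [← ENNReal.rpow_mul, show p/2 * (2/p) = 1 by field_simp, ENNReal.rpow_one]
  have h3 := ENNReal.lintegral_mul_norm_pow_le (μ := volume.restrict A) (f := fun x => G x ^ (p / (p-1))) (g := fun x => D x ^ (p/2)) (p := (p-2)/p) (q := 2/p)
     (by fun_prop) (by fun_prop) (div_nonneg (by linarith) hp0.le) (by positivity) (by field_simp; ring)
  calc _ ≤ ∫⁻ x in A, Q ^ (1 / (p - 1)) * ((G x ^ (p / (p-1))) ^ ((p-2)/p) * (D x ^ (p/2)) ^ (2/p)) := by
        apply lintegral_mono; intro x; simp only []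
        rw [← e2 x, ← mul_assoc]
        exact mul_le_mul_left (e1 x) _
    _ = Q ^ (1 / (p - 1)) * ∫⁻ x in A, ((G x ^ (p / (p-1))) ^ ((p-2)/p) * (D x ^ (p/2)) ^ (2/p)) := by
        rw [lintegral_const_mul _ (by fun_prop)]
    _ ≤ Q ^ (1 / (p - 1)) * ((∫⁻ x in A, G x ^ (p / (p - 1))) ^ ((p - 2) / p) * (∫⁻ x in A, D x ^ (p/2)) ^ (2/p)) := by
        gcongr
    _ ≤ _ := by
        gcongr
        exact Measure.restrict_le_self

lemma VV_sp {n : ℕ} {p : ℝ} (hn : 1 ≤ n) (hp : 2 ≤ p) : ∃ C : ℝ≥0∞, C < ⊤ ∧ ∀ η τ : ℝ, 1 ≤ η → η ≤ p → 0 ≤ τ → (n:ℝ) / η = τ + n / p → 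
    ∀ u : En n → ℝ, Measurable u → ∀ Λ : ℝ, (∀ x, |u x| ≤ Λ) → VV n p u (avu u 1) ≤ C * tz n η τ u ^ p := by
  obtain ⟨C, hC1, h⟩ := SP n hn p (by linarith)
  refine ⟨ENNReal.ofReal C, by simp, fun η τ h1 h2 h3 h4 u hu Λ hΛ => ?_⟩
  refine (h η τ h1 h2 h3 h4 u hu Λ hΛ 0 1 one_pos).trans (le_of_eq ?_)
  unfold tz
  rw [← ENNReal.rpow_mul]; congr 2; ring

lemma P0v {n : ℕ} {p : ℝ} (hn : 1 ≤ n) (hp : 2 ≤ p) : ∃ C : ℝ≥0∞, C < ⊤ ∧ ∀ η τ : ℝ, 1 ≤ η → η ≤ p → 0 ≤ τ → (n:ℝ) / η = τ + n / p → 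
    ∀ u : En n → ℝ, Measurable u → ∀ Λ : ℝ, (∀ x, |u x| ≤ Λ) → 
     (∫⁻ x in ball (0 : En n) (3/4), ‖PP n (dl 0) (fun y => u y - avu u 1) x‖ₑ ^ (p/2)) ^ (2/p) ≤ C * tz n η τ u := by
  obtain ⟨C, hC, h⟩ := VV_sp hn hp
  obtain ⟨Lr, hL1, hL, -⟩ := exists_Lr n
  set V := volume (ball (0 : En n) 1) with hV
  have hV0 : V ≠ 0 := (measure_ball_pos volume _ (by norm_num)).ne'
  have hVt : V ≠ ⊤ := measure_ball_lt_top.ne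
  set W := volume (ball (0 : En n) (3/4)) with hW
  have hWt : W ≠ ⊤ := measure_ball_lt_top.ne
  have hp0 : 0 < p := by linarith
  set k := ENNReal.ofReal (Lr * dl 0 ^ (-(n:ℝ)))
  refine ⟨(k * V * (V⁻¹ * C) ^ (1/p)) * W ^ (2/p), by finiteness, fun η τ h1 h2 h3 h4 u hu Λ hΛ => ?_⟩
  set c := avu u 1
  have b0 : ∫⁻ y in ball (0 : En n) 1, ‖u y - c‖ₑ ≤ V * (V⁻¹ * C) ^ (1/p) * tz n η τ u := by
    have := mean_le (μ := volume) (f := fun y => ‖u y - c‖ₑ) (by fun_prop) (ball (0 : En n) 1) hV0 hVt (r := p) (by linarith)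
    calc _ = V * (V⁻¹ * ∫⁻ y in ball (0 : En n) 1, ‖u y - c‖ₑ) := by
          rw [← mul_assoc, ENNReal.mul_inv_cancel hV0 hVt, one_mul]
      _ ≤ V * (V⁻¹ * (C * tz n η τ u ^ p)) ^ (1/p) := by
          gcongr
          refine this.trans ?_
          gcongr
          exact h η τ h1 h2 h3 h4 u hu Λ hΛ
      _ = _ := by
          rw [← mul_assoc V⁻¹, ENNReal.mul_rpow_of_nonneg _ (tz n η τ u ^ p) (by positivity), ← ENNReal.rpow_mul, show p * (1/p) = 1 by field_simp, ENNReal.rpow_one, mul_assoc]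
  have b1 : ∀ x ∈ ball (0 : En n) (3/4), ‖PP n (dl 0) (fun y => u y - c) x‖ₑ ≤ (k * V * (V⁻¹ * C) ^ (1/p)) * tz n η τ u := by
    intro x hx
    have := PP_sub_le (n := n) (dl_pos 0) hL (g := fun y => u y - c) (by fun_prop) (K := Λ + |c|) (fun y => (abs_sub _ _).trans (by linarith [hΛ y])) x 0
    simp only [sub_zero] at this
    refine this.trans ?_
    rw [mul_assoc, mul_assoc]
    apply mul_le_mul_right
    rw [← mul_assoc]
    refine le_trans (lintegral_mono_set ?_) b0
    apply ball_subset_ball'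
    rw [dist_zero_right]
    have := mem_ball_zero_iff.1 hx
    have := dl_le 0
    linarith
  calc _ ≤ (∫⁻ x in ball (0 : En n) (3/4), ((k * V * (V⁻¹ * C) ^ (1/p)) * tz n η τ u) ^ (p/2)) ^ (2/p) := by
        gcongr 1
        apply setLIntegral_mono' measurableSet_ball
        intro x hx
        exact ENNReal.rpow_le_rpow (b1 x hx) (by positivity)
    _ = _ := by
        rw [setLIntegral_const, ENNReal.mul_rpow_of_nonneg _ _ (by positivity), ← ENNReal.rpow_mul, show p/2 * (2/p) = 1 by field_simp, ENNReal.rpow_one]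
        ring

lemma exists_s' {n : ℕ} {p q s t M Λ : ℝ} (H : Par n p q s t M Λ) : ∃ s', s < s' ∧ s' < 1 ∧ s' * ((p - 2) / (p - 1)) < s * n / (n + s) := by
  have hp := H.hp
  have hs := H.hs0
  have hs1 := H.hs1
  have hn : (0:ℝ) < n := by have := H.hn; exact_mod_cast (by omega : 0 < n)
  have hspn := H.hspn
  rcases hp.eq_or_lt with h | h
  · refine ⟨(s+1)/2, by linarith, by linarith, ?_⟩
    rw [← h]; simp; positivity
  · have hk : 0 < (p-2)/(p-1) := div_pos (by linarith) (by linarith)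
    have : s < (s * n / (n + s)) / ((p-2)/(p-1)) := by
      rw [lt_div_iff₀ hk, mul_div_assoc', div_lt_div_iff₀ (by linarith) (by linarith)]
      have : (p-2) * (n+s) < n * (p-1) := by nlinarith
      nlinarith
    obtain ⟨s', h1, h2⟩ := exists_between (lt_min hs1 this)
    refine ⟨s', h1, h2.trans_le (min_le_left _ _), ?_⟩
    rw [← lt_div_iff₀ hk]
    exact h2.trans_le (min_le_right _ _)

lemma geo_dl {γ : ℝ} (hγ : 0 < γ) : ∑' j, ENNReal.ofReal (dl j ^ γ) < ⊤ := by
  have h1 : ∀ j, ENNReal.ofReal (dl j ^ γ) ≤ ENNReal.ofReal ((1/2) ^ γ) ^ j := by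
    intro j
    rw [← ENNReal.ofReal_pow (by positivity)]
    apply ENNReal.ofReal_le_ofReal
    rw [← Real.rpow_natCast, ← Real.rpow_mul (by norm_num), mul_comm γ, Real.rpow_mul (by norm_num), Real.rpow_natCast]
    apply Real.rpow_le_rpow (dl_pos j).le _ hγ.le
    unfold dl
    have : (0:ℝ) < (1/2)^j := by positivity
    linarith
  refine (ENNReal.tsum_le_tsum h1).trans_lt ?_
  rw [ENNReal.tsum_geometric]
  have : ENNReal.ofReal ((1/2) ^ γ) < 1 := by
    rw [← ENNReal.ofReal_one]
    apply (ENNReal.ofReal_lt_ofReal_iff one_pos).2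
    exact Real.rpow_lt_one (by norm_num) (by norm_num) hγ
  have : 1 - ENNReal.ofReal ((1/2) ^ γ) ≠ 0 := (tsub_pos_of_lt this).ne'
  finiteness

lemma Hv_bound {n : ℕ} {p q s t M Λ : ℝ} (H : Par n p q s t M Λ) {ψ : En n → ℝ} {L : ℝ} (K : Cut n ψ L) {m : ℕ} (hm : q ≤ m)
    {Ch : ℝ} (hCh : 0 ≤ Ch) :
    ∃ C : ℝ≥0∞, C < ⊤ ∧ ∀ η τ : ℝ, 1 ≤ η → p / 2 ≤ η → η ≤ p → s * n / (n + s) ≤ τ → (n:ℝ) / η = τ + n / p → 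
     ∀ (a : En n × En n → ℝ) (u f : En n → ℝ), Sol n p q s t M Λ a u f → 
     ∀ h1 : En n → ℝ, Measurable h1 → (∀ x, |h1 x| ≤ Ch * (tailA n p (t * q) u (avu u 1)).toReal) → 
      (∀ x, ‖x‖ ≤ 3 / 4 → |hh n p q s t a u x - h1 x| ≤ Ch * |u x - avu u 1| ^ (p - 1)) →
      ‖∫ x, (h1 x * ψ x ^ m) * (u x - avu u 1)‖ₑ ≤ C * (tz n η τ u * STl n p (t * q) η τ u * 
       (EE n p s m ψ u + VV n p u (avu u 1) + Fn n p s f ^ (p / (p - 1))) ^ ((p - 2) / p)) := by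
  have hp := H.hp
  have hs := H.hs0
  have hp0 : 0 < p := by linarith
  have hp1 : 0 < p - 1 := by linarith
  have hnR : (0:ℝ) < n := by have := H.hn; exact_mod_cast (by omega : 0 < n)
  have hn2 := H.hn
  have hn1 : 1 ≤ n := by omega
  have hm0 : m ≠ 0 := by
    intro h; rw [h] at hm; have := H.hpq; norm_num at hm; linarith
  have hb : 0 < t * q := mul_pos H.ht0 (by linarith [H.hp, H.hpq])
  obtain ⟨s', hs', hs1', hκ⟩ := exists_s' H
  obtain ⟨C1, hC1, hN⟩ := N_bound H K hm hs' hs1' hCh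
  obtain ⟨C2, hC2, hD⟩ := Dj_bound (n := n) hp
  obtain ⟨C3, hC3, h0v⟩ := P0v (p := p) hn1 hp
  obtain ⟨C4, hC4, htail⟩ := tail_sum (n := n) H.hn hp hb
  set r := (p - 2) / p with hr
  have hr0 : 0 ≤ r := div_nonneg (by linarith) hp0.le
  set κ := (p-2)/(p-1) with hκd
  have hκ0 : 0 ≤ κ := div_nonneg (by linarith) hp1.le
  have hκ1 : κ ≤ 1 := by rw [hκd, div_le_one hp1]; linarith
  set γ := s * n / (n + s) - s' * κ with hγ
  have hγ0 : 0 < γ := by linarith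
  set Sg := ∑' j, ENNReal.ofReal (dl j ^ γ) with hSg
  have hSgt : Sg < ⊤ := geo_dl hγ0
  set k := ENNReal.ofReal (dl 0 ^ (-(s' * κ)))
  refine ⟨(ENNReal.ofReal Ch * C4) ^ (1/(p-1)) * C1 ^ r * (k * C3 + 3 * C2 * Sg), by finiteness, fun η τ hη hpη hηp hτ0 hητ a u f S h1 h1m hQ hd => ?_⟩
  have hτ : 0 ≤ τ := le_trans (by positivity) hτ0
  have hum := S.um
  have hub := S.ub
  have hψ := K.meas
  set c := avu u 1 with hc
  set Q := Ch * (tailA n p (t * q) u c).toReal with hQd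
  set F := EE n p s m ψ u + VV n p u c + Fn n p s f ^ (p / (p - 1)) with hF
  set v : En n → ℝ := fun y => u y - c with hv
  have hvm : Measurable v := by fun_prop
  have hvb : ∀ x, |v x| ≤ Λ + |c| := fun y => (abs_sub _ _).trans (by linarith [hub y])
  set g : En n → ℝ := fun y => h1 y * ψ y ^ m with hg
  have hgm : Measurable g := by fun_prop
  have hgb : ∀ x, |g x| ≤ Q := by
    intro x
    simp only [hg]
    rw [abs_mul, abs_of_nonneg (pow_nonneg (K.nn x) m)]
    exact (mul_le_of_le_one_right (abs_nonneg _) (pow_le_one₀ (K.nn x) (K.le x))).trans (hQ x)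
  have hgz : ∀ x, x ∉ ball (0 : En n) (1/2) → g x = 0 := by
    intro x hx; simp [hg, K.zero x hx, hm0]
  set Qe := ENNReal.ofReal Q
  have hQe : Qe ^ (1/(p-1)) ≤ (ENNReal.ofReal Ch * C4) ^ (1/(p-1)) * STl n p (t * q) η τ u := by
    have h1 : Qe ≤ ENNReal.ofReal Ch * C4 * STl n p (t*q) η τ u ^ (p-1) := by
      have h2 : tailA n p (t*q) u c ≤ C4 * STl n p (t*q) η τ u ^ (p-1) := htail η τ hη hηp hτ hητ u hum Λ hub
      calc Qe = ENNReal.ofReal Ch * ENNReal.ofReal (tailA n p (t * q) u c).toReal := ENNReal.ofReal_mul hCh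
        _ ≤ ENNReal.ofReal Ch * tailA n p (t * q) u c := by gcongr; exact ENNReal.ofReal_toReal_le
        _ ≤ _ := by rw [mul_assoc]; gcongr
    refine (ENNReal.rpow_le_rpow h1 (by positivity)).trans (le_of_eq ?_)
    rw [ENNReal.mul_rpow_of_nonneg _ _ (by positivity), ← ENNReal.rpow_mul, mul_one_div_cancel hp1.ne', ENNReal.rpow_one]
  have hPQ : ∀ i x, ‖PP n (dl i) g x‖ₑ ≤ Qe := by
    intro i x
    rw [Real.enorm_eq_ofReal_abs]
    exact ENNReal.ofReal_le_ofReal (PP_bdd (dl_pos i) hgb x)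
  have hNi : ∀ i, (∫⁻ x, ‖PP n (dl i) g x‖ₑ ^ (p / (p-1))) ^ r ≤ C1 ^ r * (ENNReal.ofReal (dl i ^ (-(s' * κ))) * F ^ r) := by
    intro i
    have hdi := dl_pos i
    refine (ENNReal.rpow_le_rpow (hN a u f S c h1 h1m Q hQ hd (dl i) (dl_pos i) ((dl_le i).trans (by norm_num))) hr0).trans (le_of_eq ?_)
    rw [ENNReal.mul_rpow_of_nonneg _ _ hr0, ENNReal.mul_rpow_of_nonneg _ _ hr0, ENNReal.ofReal_rpow_of_nonneg (by positivity) hr0, ← Real.rpow_mul hdi.le]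
    congr 5
    rw [hr, hκd]; field_simp
  have hmain : ∀ i (D : En n → ℝ≥0∞), Measurable D → ∫⁻ x in ball (0 : En n) (3/4), ‖PP n (dl i) g x‖ₑ * D x ≤ 
      Qe ^ (1/(p-1)) * (C1 ^ r * (ENNReal.ofReal (dl i ^ (-(s' * κ))) * F ^ r) * (∫⁻ x in ball (0 : En n) (3/4), D x ^ (p/2)) ^ (2/p)) := by
    intro i D hDm
    have m1 := PP_meas (n := n) (δ := dl i) hgm
    refine (holderH hp (G := fun x => ‖PP n (dl i) g x‖ₑ) (by fun_prop) hDm (hPQ i) _).trans ?_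
    gcongr
    exact hNi i
  have hgag : gag v η (-(n + τ * η)) (ball 0 1) ^ (1 / η) = tz n η τ u := by
    unfold tz gag; simp only [hv, sub_sub_sub_cancel_right]
  have hA : ∫⁻ x in ball (0 : En n) (3/4), ‖PP n (dl 0) g x‖ₑ * ‖PP n (dl 0) v x‖ₑ ≤ 
      Qe ^ (1/(p-1)) * (C1 ^ r * (k * F ^ r) * (C3 * tz n η τ u)) := by
    have m1 := PP_meas (n := n) (δ := dl 0) hvm
    refine (hmain 0 (fun x => ‖PP n (dl 0) v x‖ₑ) (by fun_prop)).trans ?_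
    exact mul_le_mul_right (mul_le_mul_right (h0v η τ hη hηp hτ hητ u hum Λ hub) _) _
  have hB : ∀ j, ∫⁻ x in ball (0 : En n) (3/4), (‖PP n (dl (j+1)) g x‖ₑ + ‖PP n (dl j) g x‖ₑ) * ‖PP n (dl (j+1)) v x - PP n (dl j) v x‖ₑ ≤ 
      Qe ^ (1/(p-1)) * (C1 ^ r * F ^ r * (3 * C2 * tz n η τ u)) * ENNReal.ofReal (dl j ^ γ) := by
    intro j
    have m1 := PP_meas (n := n) (δ := dl j) hvm
    have m2 := PP_meas (n := n) (δ := dl (j+1)) hvm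
    have m3 := PP_meas (n := n) (δ := dl j) hgm
    have m4 := PP_meas (n := n) (δ := dl (j+1)) hgm
    have hdj := dl_pos j
    have hDj := hD η τ hη hpη hτ v hvm _ hvb j
    rw [hgag] at hDj
    have x1 := (hmain (j+1) (fun x => ‖PP n (dl (j+1)) v x - PP n (dl j) v x‖ₑ) (by fun_prop)).trans (mul_le_mul_right (mul_le_mul_right hDj _) _)
    have x2 := (hmain j (fun x => ‖PP n (dl (j+1)) v x - PP n (dl j) v x‖ₑ) (by fun_prop)).trans (mul_le_mul_right (mul_le_mul_right hDj _) _)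
    simp_rw [add_mul]
    rw [lintegral_add_left (by fun_prop)]
    refine (add_le_add x1 x2).trans ?_
    have y1 : ENNReal.ofReal (dl (j+1) ^ (-(s' * κ))) ≤ 2 * ENNReal.ofReal (dl j ^ (-(s' * κ))) := by
      rw [← ENNReal.ofReal_ofNat, ← ENNReal.ofReal_mul (by norm_num)]
      apply ENNReal.ofReal_le_ofReal
      have : dl (j+1) = dl j * 2⁻¹ := by unfold dl; rw [pow_succ]; ring
      rw [this, Real.mul_rpow hdj.le (by norm_num), mul_comm, Real.inv_rpow (by norm_num), Real.rpow_neg (by norm_num), inv_inv]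
      gcongr
      calc (2:ℝ) ^ (s' * κ) ≤ 2 ^ (1:ℝ) := Real.rpow_le_rpow_of_exponent_le (by norm_num) (by nlinarith)
        _ = 2 := by norm_num
    have y2 : ENNReal.ofReal (dl j ^ (-(s' * κ))) * ENNReal.ofReal (dl j ^ τ) ≤ ENNReal.ofReal (dl j ^ γ) := by
      rw [← ENNReal.ofReal_mul (by positivity), ← Real.rpow_add hdj]
      apply ENNReal.ofReal_le_ofReal
      exact Real.rpow_le_rpow_of_exponent_ge hdj ((dl_le j).trans (by norm_num)) (by linarith)
    set E := ENNReal.ofReal (dl j ^ (-(s' * κ)))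
    set T := ENNReal.ofReal (dl j ^ τ)
    set z := tz n η τ u
    calc _ ≤ Qe ^ (1 / (p - 1)) * (C1 ^ r * (2 * E * F ^ r) * (C2 * (T * z))) + Qe ^ (1 / (p - 1)) * (C1 ^ r * (E * F ^ r) * (C2 * (T * z))) := by gcongr
      _ = Qe ^ (1/(p-1)) * (C1 ^ r * F ^ r * (3 * C2 * z)) * (E * T) := by ring
      _ ≤ _ := mul_le_mul_right y2 _
  refine (tele hn1 hgm hgb hgz hvm hvb).trans ?_
  refine (add_le_add hA (ENNReal.tsum_le_tsum hB)).trans ?_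
  rw [ENNReal.tsum_mul_left, ← hSg]
  set z := tz n η τ u
  set W := STl n p (t * q) η τ u
  calc _ = Qe ^ (1/(p-1)) * (C1 ^ r * (k * C3 + 3 * C2 * Sg) * (z * F ^ r)) := by ring
    _ ≤ ((ENNReal.ofReal Ch * C4) ^ (1/(p-1)) * W) * (C1 ^ r * (k * C3 + 3 * C2 * Sg) * (z * F ^ r)) := mul_le_mul_left hQe _
    _ = _ := by ring

lemma absorb {p : ℝ} (hp : 2 ≤ p) {C A : ℝ≥0∞} (hC : C < ⊤) (hA : A < ⊤) : ∃ C' : ℝ≥0∞, C' < ⊤ ∧ ∀ E V Fn t0 S : ℝ≥0∞, E < ⊤ → 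
    V ≤ A * t0 ^ p → t0 ≤ S → E ≤ C * (V + Fn * (E + V) ^ (1/p) + t0 * S * (E + V + Fn ^ (p/(p-1))) ^ ((p-2)/p)) → 
    E ^ (1/p) ≤ C' * ((t0 * S) ^ ((1:ℝ)/2) + Fn ^ (1/(p-1))) := by
  have hp0 : 0 < p := by linarith
  have hp1 : 0 < p - 1 := by linarith
  have hr0 : 0 ≤ (p-2)/p := div_nonneg (by linarith) hp0.le
  set C1 := C * (A + (1+A) ^ (1/p) + (2 + A) ^ ((p-2)/p)) with hC1
  have hC1t : C1 < ⊤ := by simp only [hC1]; finiteness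
  refine ⟨1 + C1, by finiteness, fun E V Fn t0 S hE hV htS h => ?_⟩
  set y := (t0 * S) ^ ((1:ℝ)/2) with hy
  set f := Fn ^ (1/(p-1)) with hf
  set X := y + f with hX
  set e := E ^ (1/p) with he
  have hEe : E = e ^ p := by rw [he, ← ENNReal.rpow_mul, one_div_mul_cancel hp0.ne', ENNReal.rpow_one]
  have hFf : Fn = f ^ (p-1) := by rw [hf, ← ENNReal.rpow_mul, one_div_mul_cancel hp1.ne', ENNReal.rpow_one]
  have hyy : t0 * S = y ^ (2:ℝ) := by rw [hy, ← ENNReal.rpow_mul]; norm_num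
  have ht0y : t0 ≤ y := by
    rw [hy]
    calc t0 = (t0 * t0) ^ ((1:ℝ)/2) := by
          rw [← sq, ← ENNReal.rpow_natCast, ← ENNReal.rpow_mul]; norm_num
      _ ≤ _ := by gcongr
  rcases le_or_gt e X with hle | hlt
  · exact hle.trans (le_mul_of_one_le_left zero_le le_self_add)
  have he0 : e ≠ 0 := (zero_le.trans_lt hlt).ne'
  have het : e ≠ ⊤ := by simp only [he]; finiteness
  have hyX : y ≤ X := le_self_add
  have hfX : f ≤ X := le_add_self
  have pa : ∀ a b : ℝ, e ^ (a + b) = e ^ a * e ^ b := fun a b => ENNReal.rpow_add _ _ he0 het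
  have v1 : V ≤ A * e ^ p := hV.trans (by gcongr; exact (ht0y.trans hyX).trans hlt.le)
  have w1 : V ≤ A * (X * e ^ (p-1)) := by
    refine hV.trans ?_
    apply mul_le_mul_right
    calc t0 ^ p = t0 ^ (1 + (p-1)) := by congr 1; ring
      _ = t0 * t0 ^ (p-1) := by rw [ENNReal.rpow_add_of_nonneg _ _ zero_le_one hp1.le, ENNReal.rpow_one]
      _ ≤ X * e ^ (p-1) := by gcongr
                              · exact ht0y.trans hyX
                              · exact (ht0y.trans hyX).trans hlt.le
  have w2 : Fn * (E + V) ^ (1/p) ≤ (1+A) ^ (1/p) * (X * e ^ (p-1)) := by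
    have : (E + V) ^ (1/p) ≤ (1+A)^(1/p) * e := by
      calc (E + V) ^ (1/p) ≤ ((1 + A) * e ^ p) ^ (1/p) := by
            gcongr; rw [add_mul, one_mul, ← hEe]; rw [← hEe] at v1; gcongr
        _ = _ := by rw [ENNReal.mul_rpow_of_nonneg _ _ (by positivity), ← ENNReal.rpow_mul, mul_one_div_cancel hp0.ne', ENNReal.rpow_one]
    have h2 : Fn ≤ X * e ^ (p-2) := by
      rw [hFf]
      calc f ^ (p-1) = f ^ (1 + (p-2)) := by congr 1; ring
        _ = f * f ^ (p-2) := by rw [ENNReal.rpow_add_of_nonneg _ _ zero_le_one (by linarith), ENNReal.rpow_one]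
        _ ≤ _ := mul_le_mul' hfX (ENNReal.rpow_le_rpow (hfX.trans hlt.le) (by linarith))
    calc _ ≤ (X * e ^ (p-2)) * ((1+A)^(1/p) * e) := by gcongr
      _ = (1+A)^(1/p) * (X * (e ^ (p-2) * e ^ (1:ℝ))) := by rw [ENNReal.rpow_one]; ring
      _ = _ := by rw [← pa]; congr 3; ring
  have w3 : t0 * S * (E + V + Fn ^ (p/(p-1))) ^ ((p-2)/p) ≤ (2 + A) ^ ((p-2)/p) * (X * e ^ (p-1)) := by
    have h1 : Fn ^ (p/(p-1)) ≤ e ^ p := by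
      rw [hFf, ← ENNReal.rpow_mul, mul_div_cancel₀ _ hp1.ne']
      gcongr; exact hfX.trans hlt.le
    have h2 : (E + V + Fn ^ (p/(p-1))) ^ ((p-2)/p) ≤ (2 + A) ^ ((p-2)/p) * e ^ (p-2) := by
      calc _ ≤ ((2 + A) * e ^ p) ^ ((p-2)/p) := by
            gcongr
            calc E + V + Fn ^ (p/(p-1)) ≤ e ^ p + A * e ^ p + e ^ p := by
                  exact add_le_add (add_le_add hEe.le v1) h1
              _ = _ := by ring
        _ = _ := by rw [ENNReal.mul_rpow_of_nonneg _ _ hr0, ← ENNReal.rpow_mul]; congr 2; field_simp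
    have h3 : t0 * S ≤ X * e := by
      rw [hyy, show (2:ℝ) = 1 + 1 by norm_num, ENNReal.rpow_add_of_nonneg _ _ zero_le_one zero_le_one, ENNReal.rpow_one]
      exact mul_le_mul' hyX (hyX.trans hlt.le)
    calc _ ≤ (X * e) * ((2 + A) ^ ((p-2)/p) * e ^ (p-2)) := mul_le_mul' h3 h2
      _ = (2 + A) ^ ((p-2)/p) * (X * (e ^ (1:ℝ) * e ^ (p-2))) := by rw [ENNReal.rpow_one]; ring
      _ = _ := by rw [← pa]; congr 3; ring
  have h4 : e * e ^ (p-1) ≤ C1 * X * e ^ (p-1) := by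
    calc e * e ^ (p-1) = e ^ p := by nth_rewrite 1 [← ENNReal.rpow_one e]; rw [← pa]; congr 1; ring
      _ = E := hEe.symm
      _ ≤ _ := h
      _ ≤ C * (A * (X * e ^ (p-1)) + (1+A) ^ (1/p) * (X * e ^ (p-1)) + (2 + A) ^ ((p-2)/p) * (X * e ^ (p-1))) := by
          apply mul_le_mul_right
          exact add_le_add (add_le_add w1 w2) w3
      _ = _ := by simp only [hC1]; ring
  have h5 : e ≤ C1 * X := by
    have q0 : e ^ (p-1) ≠ 0 := by simp [he0, het]
    have q1 : e ^ (p-1) ≠ ⊤ := by finiteness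
    exact (ENNReal.mul_le_mul_iff_left q0 q1).1 h4
  exact h5.trans (mul_le_mul_left le_add_self _)

lemma tz_le {n : ℕ} (p b η τ : ℝ) (u : En n → ℝ) : tz n η τ u ≤ STl n p b η τ u := by
  unfold STl
  refine le_trans (le_of_eq ?_) (ENNReal.le_tsum 0)
  unfold eT tz; simp

lemma core {n : ℕ} {p q s t M Λ : ℝ} (H : Par n p q s t M Λ) {ψ : En n → ℝ} {L : ℝ} (K : Cut n ψ L) {m : ℕ} (hm : q ≤ m) :
    ∃ C : ℝ≥0∞, C < ⊤ ∧ ∀ η τ : ℝ, 1 ≤ η → p / 2 ≤ η → η ≤ p → s * n / (n + s) ≤ τ → (n:ℝ) / η = τ + n / p → 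
     ∀ (a : En n × En n → ℝ) (u f : En n → ℝ), Sol n p q s t M Λ a u f → 
      EE n p s m ψ u ^ (1/p) ≤ C * ((tz n η τ u * STl n p (t * q) η τ u) ^ ((1:ℝ)/2) + Fn n p s f ^ (1/(p-1))) := by
  have hp := H.hp
  have hs := H.hs0
  have hp0 : 0 < p := by linarith
  have hp1 : 0 < p - 1 := by linarith
  have hnR : (0:ℝ) < n := by have := H.hn; exact_mod_cast (by omega : 0 < n)
  have hn2 := H.hn
  have hn1 : 1 ≤ n := by omega
  have hm1 : 1 ≤ m := by
    have : (1:ℝ) ≤ m := by linarith [H.hpq]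
    exact_mod_cast this
  obtain ⟨Ch, hCh, hsp⟩ := hsplit H
  obtain ⟨C1, hC1, hcac⟩ := cac_int H K hm
  obtain ⟨C2, hC2, hft⟩ := fterm H K hm1
  obtain ⟨C3, hC3, hHv⟩ := Hv_bound H K hm hCh
  obtain ⟨C4, hC4, hVV⟩ := VV_sp (p := p) hn1 hp
  obtain ⟨C', hC', hab⟩ := absorb hp (C := C1 * (1 + ENNReal.ofReal Ch + C2 + C3)) (A := C4) (by finiteness) hC4
  refine ⟨C', hC', fun η τ hη hpη hηp hτ0 hητ a u f S => ?_⟩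
  have hτ : 0 ≤ τ := le_trans (by positivity) hτ0
  have hum := S.um
  have hub := S.ub
  have hψ := K.meas
  set c := avu u 1 with hc
  have hcΛ : |c| ≤ Λ := by
    rw [hc]; unfold avu
    have hV0 : volume (ball (0 : En n) 1) ≠ 0 := (measure_ball_pos volume _ (by norm_num)).ne'
    have hVt : volume (ball (0 : En n) 1) ≠ ⊤ := measure_ball_lt_top.ne
    rw [setAverage_eq, smul_eq_mul, abs_mul, abs_of_nonneg (by positivity)]
    have h1 : ‖∫ y in ball (0 : En n) 1, u y‖ ≤ Λ * volume.real (ball (0 : En n) 1) := 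
      norm_setIntegral_le_of_norm_le_const hVt.lt_top (fun x _ => hub x)
    have h2 : 0 < volume.real (ball (0 : En n) 1) := ENNReal.toReal_pos hV0 hVt
    rw [inv_mul_le_iff₀ h2, mul_comm]; exact h1
  obtain ⟨hQt, h1, h1m, hQ, hd⟩ := hsp a u f S c hcΛ
  apply hab _ (VV n p u c) _ _ _ (EE_fin K m S) (hVV η τ hη hηp hτ hητ u hum Λ hub) (tz_le _ _ _ _ _)
  have k1 := hcac a u f S c hcΛ
  have k2 := hft a u f S c hcΛ
  have k3 := hHv η τ hη hpη hηp hτ0 hητ a u f S h1 h1m hQ hd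
  have k4 : ENNReal.ofReal (∫ x, hh n p q s t a u x * phi m ψ u c x) ≤ 
    ‖∫ x, (h1 x * ψ x ^ m) * (u x - c)‖ₑ + ENNReal.ofReal Ch * VV n p u c := by
    have hm0 : m ≠ 0 := by omega
    have hvb : ∀ x, |u x - c| ≤ 2 * Λ := fun y => (abs_sub _ _).trans (by linarith [hub y])
    have hpz : ∀ x, x ∉ ball (0 : En n) (1/2) → phi m ψ u c x = 0 := by
      intro x hx; simp [phi, K.zero x hx, hm0]
    have hpm : Measurable (phi m ψ u c) := by unfold phi; fun_prop
    have hpb : ∀ x, |phi m ψ u c x| ≤ |u x - c| := by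
      intro x; unfold phi
      rw [abs_mul, abs_of_nonneg (pow_nonneg (K.nn x) m)]
      exact mul_le_of_le_one_right (abs_nonneg _) (pow_le_one₀ (K.nn x) (K.le x))
    have hpi : Integrable (phi m ψ u c) := by
      have h2 : IntegrableOn (phi m ψ u c) (ball 0 (1/2)) := bdd_intOn hpm (fun x => (hpb x).trans (hvb x)) measure_ball_lt_top.ne
      rwa [integrableOn_iff_integrable_of_support_subset] at h2
      intro x hx
      by_contra hc
      exact hx (hpz x hc)
    obtain ⟨Kb, hKb0, hKb⟩ := hh_bound H S
    have i1 : Integrable (fun x => h1 x * phi m ψ u c x) := 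
      hpi.bdd_mul (c := Ch * (tailA n p (t * q) u c).toReal) h1m.aestronglyMeasurable (Filter.Eventually.of_forall fun y => hQ y)
    have i2 : Integrable (fun y => hh n p q s t a u y * phi m ψ u c y) := by
      refine (hpi.norm.const_mul Kb).mono' ((hh_meas S.am S.um).mul hpm).aestronglyMeasurable (Filter.Eventually.of_forall fun y => ?_)
      rw [norm_mul]
      by_cases hy : y ∈ ball (0 : En n) (1/2)
      · gcongr
        exact hKb y (by have := mem_ball_zero_iff.1 hy; linarith)
      · simp [hpz y hy]
    have e : (∫ x, hh n p q s t a u x * phi m ψ u c x) = (∫ x, (h1 x * ψ x ^ m) * (u x - c)) + ∫ x, (hh n p q s t a u x - h1 x) * phi m ψ u c x := by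
      have : ∀ x, (h1 x * ψ x ^ m) * (u x - c) = h1 x * phi m ψ u c x := by intro x; unfold phi; ring
      simp_rw [this]
      rw [← integral_add i1 ((i2.sub i1).congr (Eventually.of_forall fun x => by simp; ring))]
      congr 1; ext x; ring
    calc _ ≤ ‖∫ x, hh n p q s t a u x * phi m ψ u c x‖ₑ := by rw [Real.enorm_eq_ofReal_abs]; exact ENNReal.ofReal_le_ofReal (le_abs_self _)
      _ ≤ _ := by
        rw [e]
        refine (enorm_add_le _ _).trans (add_le_add le_rfl ?_)
        refine (enorm_integral_le_lintegral_enorm _).trans ?_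
        unfold VV
        rw [← lintegral_const_mul' _ _ (by simp), ← lintegral_indicator measurableSet_ball]
        apply lintegral_mono; intro x; simp only []
        by_cases hx : x ∈ ball (0 : En n) (1/2)
        · rw [indicator_of_mem (ball_subset_ball (by norm_num) hx), Real.enorm_eq_ofReal_abs, ← ofReal_abs_rpow hp0.le, ← ENNReal.ofReal_mul hCh]
          apply ENNReal.ofReal_le_ofReal
          rw [abs_mul]
          calc _ ≤ (Ch * |u x - c| ^ (p-1)) * |u x - c| := by
                have hx2 := mem_ball_zero_iff.1 hx
                exact mul_le_mul (hd x (by linarith)) (hpb x) (abs_nonneg _) (by positivity)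
            _ = _ := by rw [mul_assoc, rp_mul (abs_nonneg _) hp0]
        · rw [hpz x hx]; simp
  refine k1.trans ?_
  refine (mul_le_mul_right (add_le_add (add_le_add le_rfl (k4.trans (add_le_add k3 le_rfl))) k2) _).trans ?_
  rw [mul_assoc C1 (1 + ENNReal.ofReal Ch + C2 + C3)]
  apply mul_le_mul_right
  set V := VV n p u c
  set X := Fn n p s f * (EE n p s m ψ u + V) ^ (1/p)
  set Y := tz n η τ u * STl n p (t * q) η τ u * (EE n p s m ψ u + V + Fn n p s f ^ (p / (p - 1))) ^ ((p - 2) / p)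
  set ch := ENNReal.ofReal Ch
  set A := 1 + ch + C2 + C3 with hA
  calc V + (C3 * Y + ch * V) + C2 * X = (1 + ch) * V + C2 * X + C3 * Y := by ring
    _ ≤ A * V + A * X + A * Y := by
      gcongr
      · rw [hA, add_assoc]; exact le_self_add
      · rw [hA, add_comm (1 + ch), add_assoc]; exact le_self_add
      · exact le_add_self
    _ = _ := by ring

lemma sc_lint {E : Type*} [NormedAddCommGroup E] [NormedSpace ℝ E] [MeasurableSpace E] [BorelSpace E]
    [FiniteDimensional ℝ E] (μ : Measure E) [μ.IsAddHaarMeasure] (g : E → ℝ≥0∞) (x₀ : E) {R : ℝ} (hR : 0 < R) :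
    ∫⁻ x, g (x₀ + R • x) ∂μ = ENNReal.ofReal ((R ^ Module.finrank ℝ E)⁻¹) * ∫⁻ x, g x ∂μ := by
  have h1 : ∫⁻ x, g (x₀ + R • x) ∂μ = ∫⁻ x, g (x₀ + x) ∂(Measure.map (R • ·) μ) := by
    have := lintegral_map_equiv (μ := μ) (fun x => g (x₀ + x)) (Homeomorph.smulOfNeZero R hR.ne').toMeasurableEquiv
    simpa using this.symm
  rw [h1, Measure.map_addHaar_smul _ hR.ne', lintegral_smul_measure, lintegral_add_left_eq_self, abs_of_pos (by positivity), smul_eq_mul]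

lemma sc_int {E : Type*} [NormedAddCommGroup E] [NormedSpace ℝ E] [MeasurableSpace E] [BorelSpace E]
    [FiniteDimensional ℝ E] (μ : Measure E) [μ.IsAddHaarMeasure] (g : E → ℝ) (x₀ : E) {R : ℝ} (hR : 0 < R) :
    ∫ x, g (x₀ + R • x) ∂μ = (R ^ Module.finrank ℝ E)⁻¹ * ∫ x, g x ∂μ := by
  have := Measure.integral_comp_smul μ (fun x => g (x₀ + x)) R
  rw [this, integral_add_left_eq_self, abs_of_pos (by positivity), smul_eq_mul]

lemma haar2 (n : ℕ) : (volume : Measure (En n × En n)).IsAddHaarMeasure :=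
  inferInstanceAs ((volume : Measure (En n)).prod volume).IsAddHaarMeasure

lemma sc_mem {n : ℕ} (x₀ x : En n) {R : ℝ} (hR : 0 < R) (r : ℝ) : x₀ + R • x ∈ ball x₀ (R * r) ↔ x ∈ ball (0 : En n) r := by
  rw [mem_ball, mem_ball, dist_eq_norm, dist_zero_right, add_sub_cancel_left, norm_smul, Real.norm_of_nonneg hR.le]
  exact mul_lt_mul_iff_right₀ hR

lemma sc_ball {n : ℕ} (g : En n → ℝ≥0∞) (x₀ : En n) {R : ℝ} (hR : 0 < R) (r : ℝ) :
    ∫⁻ x in ball 0 r, g (x₀ + R • x) = ENNReal.ofReal (R ^ (-(n:ℝ))) * ∫⁻ x in ball x₀ (R * r), g x := by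
  rw [← lintegral_indicator measurableSet_ball, ← lintegral_indicator measurableSet_ball]
  have := sc_lint volume ((ball x₀ (R * r)).indicator g) x₀ hR
  rw [finrank_euclideanSpace_fin] at this
  rw [Real.rpow_neg hR.le, Real.rpow_natCast, ← this]
  apply lintegral_congr; intro x
  by_cases hx : x ∈ ball (0 : En n) r
  · rw [indicator_of_mem hx, indicator_of_mem ((sc_mem x₀ x hR r).2 hx)]
  · rw [indicator_of_notMem hx, indicator_of_notMem (fun h => hx ((sc_mem x₀ x hR r).1 h))]

lemma sc_norm {n : ℕ} (x₀ x y : En n) {R : ℝ} (hR : 0 < R) : ‖(x₀ + R • x) - (x₀ + R • y)‖ = R * ‖x - y‖ := by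
  rw [add_sub_add_left_eq_sub, ← smul_sub, norm_smul, Real.norm_of_nonneg hR.le]

lemma sc_kk {n : ℕ} (b : ℝ) (x₀ x y : En n) {R : ℝ} (hR : 0 < R) :
    kk b x y = ENNReal.ofReal (R ^ (-b)) * kk b (x₀ + R • x) (x₀ + R • y) := by
  unfold kk
  rw [sc_norm _ _ _ hR, ← ENNReal.ofReal_mul (by positivity), Real.mul_rpow hR.le (norm_nonneg _), ← mul_assoc, ← Real.rpow_add hR]
  simp

lemma sc_gag {n : ℕ} (u : En n → ℝ) (η b : ℝ) (x₀ : En n) {R : ℝ} (hR : 0 < R) (r : ℝ) :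
    gag (fun x => u (x₀ + R • x)) η b (ball 0 r) = ENNReal.ofReal (R ^ (-(2 * n + b))) * gag u η b (ball x₀ (R * r)) := by
  unfold gag
  have e1 : ∀ x : En n, ∫⁻ y in ball 0 r, ‖u (x₀ + R • x) - u (x₀ + R • y)‖ₑ ^ η * kk b x y =
      ENNReal.ofReal (R ^ (-b)) * ENNReal.ofReal (R ^ (-(n:ℝ))) * ∫⁻ y in ball x₀ (R * r), ‖u (x₀ + R • x) - u y‖ₑ ^ η * kk b (x₀ + R • x) y := by
    intro x
    have := sc_ball (fun y => ‖u (x₀ + R • x) - u y‖ₑ ^ η * kk b (x₀ + R • x) y) x₀ hR r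
    rw [mul_assoc, ← this, ← lintegral_const_mul' _ _ (by simp)]
    apply lintegral_congr; intro y
    rw [sc_kk b x₀ x y hR]; ring
  simp_rw [e1]
  rw [lintegral_const_mul' _ _ (by finiteness), sc_ball (fun x => ∫⁻ y in ball x₀ (R * r), ‖u x - u y‖ₑ ^ η * kk b x y) x₀ hR r, ← mul_assoc]
  congr 1
  rw [← ENNReal.ofReal_mul (by positivity), ← ENNReal.ofReal_mul (by positivity), ← Real.rpow_add hR, ← Real.rpow_add hR]
  congr 2; ring

lemma sc_form {n : ℕ} (p q s t : ℝ) (a : En n × En n → ℝ) (u φ : En n → ℝ) (x₀ : En n) {R : ℝ} (hR : 0 < R) (z : En n × En n) :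
    formIntegrand n p q s t (fun z => R ^ (s * p - t * q) * a ((x₀, x₀) + R • z)) (fun x => u (x₀ + R • x)) (fun x => φ (x₀ + R • x)) z
     = R ^ (n + s * p) * formIntegrand n p q s t a u φ ((x₀, x₀) + R • z) := by
  have e : R ^ (n + s * p) = R ^ (s * p - t * q) * R ^ (n + t * q) := by rw [← Real.rpow_add hR]; congr 1; ring
  have hx : ∀ b : ℝ, ‖z.1 - z.2‖ ^ b = (R ^ b)⁻¹ * ‖(x₀ + R • z.1) - (x₀ + R • z.2)‖ ^ b := by
    intro b
    rw [sc_norm _ _ _ hR, Real.mul_rpow hR.le (norm_nonneg _), ← mul_assoc, inv_mul_cancel₀ (by positivity), one_mul]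
  simp only [formIntegrand, Prod.fst_add, Prod.snd_add, Prod.smul_fst, Prod.smul_snd]
  rw [hx, hx, mul_add]
  congr 1
  · simp only [div_eq_mul_inv, mul_inv, inv_inv]; ring
  · rw [e]
    simp only [div_eq_mul_inv, mul_inv, inv_inv]; ring

lemma sc_energy {n : ℕ} (p q s t : ℝ) (a : En n × En n → ℝ) (u : En n → ℝ) (x₀ : En n) {R : ℝ} (hR : 0 < R) (z : En n × En n) :
    energyIntegrand n p q s t (fun z => R ^ (s * p - t * q) * a ((x₀, x₀) + R • z)) (fun x => u (x₀ + R • x)) z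
     = R ^ (n + s * p) * energyIntegrand n p q s t a u ((x₀, x₀) + R • z) := by
  have e : R ^ (n + s * p) = R ^ (s * p - t * q) * R ^ (n + t * q) := by rw [← Real.rpow_add hR]; congr 1; ring
  have hx : ∀ b : ℝ, ‖z.1 - z.2‖ ^ b = (R ^ b)⁻¹ * ‖(x₀ + R • z.1) - (x₀ + R • z.2)‖ ^ b := by
    intro b
    rw [sc_norm _ _ _ hR, Real.mul_rpow hR.le (norm_nonneg _), ← mul_assoc, inv_mul_cancel₀ (by positivity), one_mul]
  simp only [energyIntegrand, Prod.fst_add, Prod.snd_add, Prod.smul_fst, Prod.smul_snd]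
  rw [hx, hx, mul_add]
  congr 1
  · simp only [div_eq_mul_inv, mul_inv, inv_inv]; ring
  · rw [e]
    simp only [div_eq_mul_inv, mul_inv, inv_inv]; ring

lemma sc_weak {n : ℕ} {p q s t : ℝ} {a : En n × En n → ℝ} {u f : En n → ℝ} 
    (hw : ∀ φ : En n → ℝ, ContDiff ℝ (⊤ : ℕ∞) φ → HasCompactSupport φ →
    (∫ z : En n × En n, formIntegrand n p q s t a u φ z) = ∫ x, f x * φ x) (x₀ : En n) {R : ℝ} (hR : 0 < R) 
    (φ : En n → ℝ) (h1 : ContDiff ℝ (⊤ : ℕ∞) φ) (h2 : HasCompactSupport φ) :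
    (∫ z : En n × En n, formIntegrand n p q s t (fun z => R ^ (s * p - t * q) * a ((x₀, x₀) + R • z)) (fun x => u (x₀ + R • x)) φ z)
      = ∫ x, (R ^ (s * p) * f (x₀ + R • x)) * φ x := by
  have := haar2 n
  set φ' : En n → ℝ := fun y => φ (R⁻¹ • (y - x₀)) with hφ'
  have hφ : φ = fun x => φ' (x₀ + R • x) := by
    ext x; simp [hφ', smul_smul, hR.ne']
  have c1 : ContDiff ℝ (⊤ : ℕ∞) φ' := h1.comp (by fun_prop)
  have c2 : HasCompactSupport φ' := by
    have := h2.comp_homeomorph ((Homeomorph.addRight (-x₀)).trans (Homeomorph.smulOfNeZero R⁻¹ (inv_ne_zero hR.ne')))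
    have e : φ' = φ ∘ ((Homeomorph.addRight (-x₀)).trans (Homeomorph.smulOfNeZero R⁻¹ (inv_ne_zero hR.ne'))) := by
      ext y; simp [hφ', sub_eq_add_neg]
    rw [e]; exact this
  have h := hw φ' c1 c2
  rw [hφ]
  simp_rw [sc_form p q s t a u φ' x₀ hR, mul_assoc]
  rw [integral_const_mul, integral_const_mul, sc_int volume (formIntegrand n p q s t a u φ') (x₀, x₀) hR,
    sc_int volume (fun x => f x * φ' x) x₀ hR, h, Module.finrank_prod, finrank_euclideanSpace_fin, pow_add, Real.rpow_add hR, Real.rpow_natCast]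
  field_simp

lemma sc_Sol {n : ℕ} {p q s t M Λ : ℝ} (H : Par n p q s t M Λ) {a : En n × En n → ℝ} {u f : En n → ℝ} 
    (am : Measurable a) (a0 : ∀ z, 0 ≤ a z) (aM : ∀ z, a z ≤ M) (asym : ∀ x y, a (x, y) = a (y, x))
    (fm : Measurable f) (ff : ∀ x₀ R, 0 < R → ∫⁻ x in ball (x₀ : En n) R, ‖f x‖ₑ ^ pStar n p s < ⊤)
    (hu : MemWsp n s p u) (ub : ∀ x, |u x| ≤ Λ) (hw : IsBoundedWeakSolution n p q s t a u f)
    (x₀ : En n) {R : ℝ} (hR : 0 < R) (hR1 : R ≤ 1) :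
    Sol n p q s t M Λ (fun z => R ^ (s * p - t * q) * a ((x₀, x₀) + R • z)) (fun x => u (x₀ + R • x)) (fun x => R ^ (s * p) * f (x₀ + R • x)) := by
  have hp0 : 0 < p := by linarith [H.hp]
  have um := hu.1
  have htq := H.htq
  have hps := pStar_gt H
  have := haar2 n
  have f3 : ∫⁻ x in ball (0 : En n) 1, ‖R ^ (s * p) * f (x₀ + R • x)‖ₑ ^ pStar n p s < ⊤ := by
    simp_rw [enorm_mul]
    simp_rw [ENNReal.mul_rpow_of_nonneg _ _ (by linarith : 0 ≤ pStar n p s)]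
    rw [lintegral_const_mul' _ _ (by finiteness), sc_ball (fun x => ‖f x‖ₑ ^ pStar n p s) x₀ hR]
    refine ENNReal.mul_lt_top (by finiteness) (ENNReal.mul_lt_top (by finiteness) ?_)
    exact ff _ _ (by positivity)
  have fm' : Measurable (fun x => R ^ (s * p) * f (x₀ + R • x)) := by fun_prop
  refine ⟨by fun_prop, fun z => by have := a0 ((x₀, x₀) + R • z); positivity, fun z => ?_, fun x y => ?_, by fun_prop, fun x => ub _, fm', f3, ?_, ?_, ?_, ?_⟩
  · calc _ ≤ 1 * a ((x₀, x₀) + R • z) := by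
          gcongr
          · exact a0 _
          · exact Real.rpow_le_one hR.le hR1 (by linarith)
      _ ≤ M := by rw [one_mul]; exact aM _
  · simp only [Prod.smul_mk, Prod.mk_add_mk]
    rw [asym]
  · refine ⟨fm'.aestronglyMeasurable, ?_⟩
    unfold HasFiniteIntegral
    calc ∫⁻ x in ball (0 : En n) 1, ‖R ^ (s * p) * f (x₀ + R • x)‖ₑ ≤ ∫⁻ x in ball (0 : En n) 1, (1 + ‖R ^ (s * p) * f (x₀ + R • x)‖ₑ ^ pStar n p s) := by
          apply lintegral_mono; intro x; simp only []
          set v := ‖R ^ (s * p) * f (x₀ + R • x)‖ₑ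
          rcases le_total v 1 with h | h
          · exact h.trans le_self_add
          · refine le_trans ?_ le_add_self
            calc v = v ^ (1:ℝ) := (ENNReal.rpow_one _).symm
              _ ≤ _ := ENNReal.rpow_le_rpow_of_exponent_le h hps.le
      _ < ⊤ := by
          rw [lintegral_add_left measurable_const]
          refine ENNReal.add_lt_top.2 ⟨?_, f3⟩
          simp [measure_ball_lt_top]
  · have h := hu.2.2
    have e : ∀ z : En n × En n, ‖u (x₀ + R • z.1) - u (x₀ + R • z.2)‖ₑ ^ p * kk (-(n + s * p)) z.1 z.2 =
        ENNReal.ofReal (R ^ (n + s * p)) * (fun z : En n × En n => ENNReal.ofReal (|u z.1 - u z.2| ^ p / ‖z.1 - z.2‖ ^ ((n : ℝ) + s * p))) ((x₀, x₀) + R • z) := by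
      intro z
      simp only [Prod.fst_add, Prod.snd_add, Prod.smul_fst, Prod.smul_snd]
      rw [sc_kk _ x₀ _ _ hR, ← ofReal_abs_rpow hp0.le, neg_neg]
      unfold kk
      rw [Real.rpow_neg (norm_nonneg _), div_eq_mul_inv, ENNReal.ofReal_mul (p := |_| ^ p) (by positivity)]
      ring
    simp_rw [e]
    rw [lintegral_const_mul' _ _ (by finiteness), sc_lint volume (fun z : En n × En n => ENNReal.ofReal (|u z.1 - u z.2| ^ p / ‖z.1 - z.2‖ ^ ((n : ℝ) + s * p))) (x₀, x₀) hR]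
    exact ENNReal.mul_lt_top (by finiteness) (ENNReal.mul_lt_top (by finiteness) h)
  · have h := hw.1
    simp_rw [sc_energy p q s t a u x₀ hR]
    have : ∀ z : En n × En n, ENNReal.ofReal (R ^ (n + s * p) * energyIntegrand n p q s t a u ((x₀, x₀) + R • z)) =
       ENNReal.ofReal (R ^ (n + s * p)) * (fun z => ENNReal.ofReal (energyIntegrand n p q s t a u z)) ((x₀, x₀) + R • z) := by
      intro z; rw [ENNReal.ofReal_mul (by positivity)]
    simp_rw [this]
    rw [lintegral_const_mul' _ _ (by finiteness), sc_lint volume (fun z => ENNReal.ofReal (energyIntegrand n p q s t a u z)) (x₀, x₀) hR]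
    exact ENNReal.mul_lt_top (by finiteness) (ENNReal.mul_lt_top (by finiteness) h)
  · exact sc_weak hw.2 x₀ hR

lemma nu_lint {n : ℕ} {p ε : ℝ} (x₀ : En n) (ρ : ℝ) {g : En n × En n → ℝ≥0∞} (hg : Measurable g) :
    ∫⁻ z in bB n x₀ ρ, g z ∂nu n p ε = ∫⁻ x in ball x₀ ρ, ∫⁻ y in ball x₀ ρ, kk (ε * p - n) x y * g (x, y) := by
  unfold nu bB
  have hm : Measurable fun z : En n × En n => ENNReal.ofReal (‖z.1 - z.2‖ ^ (ε * p - n)) := by fun_prop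
  rw [restrict_withDensity (measurableSet_ball.prod measurableSet_ball), lintegral_withDensity_eq_lintegral_mul _ hm hg]
  exact lint_prod_set (F := fun z => kk (ε * p - n) z.1 z.2 * g z) (by fun_prop)

lemma nu_bB {n : ℕ} {p ε : ℝ} (x₀ : En n) (ρ : ℝ) :
    nu n p ε (bB n x₀ ρ) = ∫⁻ x in ball x₀ ρ, ∫⁻ y in ball x₀ ρ, kk (ε * p - n) x y := by
  have := nu_lint (p := p) (ε := ε) x₀ ρ (g := fun _ => 1) measurable_const
  simpa using this

def c1 (n : ℕ) (p : ℝ) : ℝ := n * m0 n ^ 2 * 2 ^ (-(n + 1 : ℝ)) / p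
def c2 (n : ℕ) (p : ℝ) : ℝ := 2 * n * m0 n ^ 2 / p

lemma nu_up {n : ℕ} (hn : 2 ≤ n) {p ε : ℝ} (hp : 0 < p) (hε : 0 < ε) (h1 : ε * p ≤ 1) (x₀ : En n) {ρ : ℝ} (hρ : 0 < ρ) :
    nu n p ε (bB n x₀ ρ) ≤ ENNReal.ofReal (c2 n p * ρ ^ (n + ε * p) / ε) := by
  have hm := m0_pos n
  rw [nu_bB]
  have e : ∀ x ∈ ball x₀ ρ, ∫⁻ y in ball x₀ ρ, kk (ε * p - n) x y ≤ ENNReal.ofReal (n * m0 n * (2 * ρ) ^ (ε * p) / (ε * p)) := by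
    intro x hx
    rw [← kk_integral_ball (by omega) x (by positivity) (by positivity)]
    apply lintegral_mono_set
    intro y hy
    rw [mem_ball] at *
    calc dist y x ≤ dist y x₀ + dist x x₀ := dist_triangle_right _ _ _
      _ < 2 * ρ := by linarith
  calc _ ≤ ∫⁻ x in ball x₀ ρ, ENNReal.ofReal (n * m0 n * (2 * ρ) ^ (ε * p) / (ε * p)) := setLIntegral_mono' measurableSet_ball e
    _ = ENNReal.ofReal (n * m0 n * (2 * ρ) ^ (ε * p) / (ε * p) * (m0 n * ρ ^ (n : ℝ))) := by
      rw [setLIntegral_const, vol_ball _ hρ, ENNReal.ofReal_mul (p := _ / _) (by positivity)]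
    _ ≤ _ := by
      apply ENNReal.ofReal_le_ofReal
      rw [Real.mul_rpow (by norm_num) hρ.le, Real.rpow_add hρ]
      have : (2:ℝ) ^ (ε * p) ≤ 2 := by
        calc (2:ℝ) ^ (ε * p) ≤ 2 ^ (1:ℝ) := Real.rpow_le_rpow_of_exponent_le (by norm_num) h1
          _ = 2 := Real.rpow_one _
      unfold c2
      calc _ = n * m0 n ^ 2 / (ε * p) * (ρ ^ (n:ℝ) * ρ ^ (ε * p)) * 2 ^ (ε * p) := by field_simp
        _ ≤ n * m0 n ^ 2 / (ε * p) * (ρ ^ (n:ℝ) * ρ ^ (ε * p)) * 2 := by gcongr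
        _ = _ := by field_simp

lemma nu_lo_aux {n : ℕ} (hn : 2 ≤ n) {p ε : ℝ} (hp : 0 < p) (hε : 0 < ε) (h1 : ε * p ≤ 1) (x₀ : En n) {ρ : ℝ} (hρ : 0 < ρ) 
    {x : En n} (hx : x ∈ ball x₀ (ρ / 2)) : 
    ENNReal.ofReal (n * m0 n * ρ ^ (ε * p) / (2 * ε * p)) ≤ ∫⁻ y in ball x₀ ρ, kk (ε * p - n) x y := by
  have hm := m0_pos n
  calc _ ≤ ENNReal.ofReal (n * m0 n * (ρ / 2) ^ (ε * p) / (ε * p)) := by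
        apply ENNReal.ofReal_le_ofReal
        have : (2:ℝ) ^ (ε * p) ≤ 2 := by
          calc (2:ℝ) ^ (ε * p) ≤ 2 ^ (1:ℝ) := Real.rpow_le_rpow_of_exponent_le (by norm_num) h1
            _ = 2 := Real.rpow_one _
        rw [Real.div_rpow hρ.le (by norm_num)]
        calc _ = n * m0 n * (ρ ^ (ε * p) / 2) / (ε * p) := by field_simp
          _ ≤ _ := by gcongr
    _ = _ := (kk_integral_ball (by omega) x (by positivity) (by positivity)).symm
    _ ≤ _ := by
      apply lintegral_mono_set
      intro y hy
      rw [mem_ball] at *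
      calc dist y x₀ ≤ dist y x + dist x x₀ := dist_triangle _ _ _
        _ < ρ := by linarith

lemma nu_lo {n : ℕ} (hn : 2 ≤ n) {p ε : ℝ} (hp : 0 < p) (hε : 0 < ε) (h1 : ε * p ≤ 1) (x₀ : En n) {ρ : ℝ} (hρ : 0 < ρ) :
    ENNReal.ofReal (c1 n p * ρ ^ (n + ε * p) / ε) ≤ nu n p ε (bB n x₀ ρ) := by
  have hm := m0_pos n
  rw [nu_bB]
  calc _ = ∫⁻ x in ball x₀ (ρ / 2), ENNReal.ofReal (n * m0 n * ρ ^ (ε * p) / (2 * ε * p)) := by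
        rw [setLIntegral_const, vol_ball _ (by positivity), ← ENNReal.ofReal_mul (p := _ / _) (by positivity)]
        congr 1
        unfold c1
        rw [Real.rpow_neg (by norm_num), Real.rpow_add (by norm_num), Real.rpow_one, Real.div_rpow hρ.le (by norm_num), Real.rpow_add hρ]
        field_simp
    _ ≤ ∫⁻ x in ball x₀ (ρ / 2), ∫⁻ y in ball x₀ ρ, kk (ε * p - n) x y := setLIntegral_mono' measurableSet_ball fun x hx => nu_lo_aux hn hp hε h1 x₀ hρ hx
    _ ≤ _ := lintegral_mono_set (ball_subset_ball (by linarith))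

/-- real average as a lower integral -/
lemma avg_eq {n : ℕ} {p ε : ℝ} {g : En n × En n → ℝ} (hg : Measurable g) (h0 : ∀ z, 0 ≤ g z) (D : Set (En n × En n)) :
    ⨍ z in D, g z ∂nu n p ε = ((nu n p ε D)⁻¹ * ∫⁻ z in D, ENNReal.ofReal (g z) ∂nu n p ε).toReal := by
  rw [setAverage_eq, integral_eq_lintegral_of_nonneg_ae (Eventually.of_forall h0) hg.aestronglyMeasurable, smul_eq_mul, ENNReal.toReal_mul, ENNReal.toReal_inv]
  rfl

lemma U_pt {n : ℕ} {p s ε η : ℝ} (hη : 0 < η) (u : En n → ℝ) (x y : En n) :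
    kk (ε * p - n) x y * ENNReal.ofReal (Ufun n s ε u (x, y) ^ η) = ‖u x - u y‖ₑ ^ η * kk (ε * p - n - (s + ε) * η) x y := by
  unfold Ufun; simp only []
  rw [← ofReal_abs_rpow hη.le]
  unfold kk
  rcases eq_or_ne x y with rfl | h
  · simp [Real.zero_rpow hη.ne']
  · have hn : 0 < ‖x - y‖ := norm_pos_iff.2 (sub_ne_zero.2 h)
    rw [← ENNReal.ofReal_mul (by positivity), ← ENNReal.ofReal_mul (by positivity), Real.div_rpow (abs_nonneg _) (by positivity),
      ← Real.rpow_mul hn.le, Real.rpow_sub hn (ε * p - n)]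
    congr 1; ring

lemma Ufun_meas {n : ℕ} {s ε : ℝ} {u : En n → ℝ} (hu : Measurable u) : Measurable (Ufun n s ε u) := by
  unfold Ufun; fun_prop
lemma Ufun_nn {n : ℕ} (s ε : ℝ) (u : En n → ℝ) (z) : 0 ≤ Ufun n s ε u z := by
  unfold Ufun; positivity

lemma U_lint {n : ℕ} {p s ε η : ℝ} (hη : 0 < η) {u : En n → ℝ} (hu : Measurable u) (x₀ : En n) (ρ : ℝ) :
    ∫⁻ z in bB n x₀ ρ, ENNReal.ofReal (Ufun n s ε u z ^ η) ∂nu n p ε = gag u η (ε * p - n - (s + ε) * η) (ball x₀ ρ) := by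
  rw [nu_lint _ _ (by have := Ufun_meas (s := s) (ε := ε) hu; fun_prop)]
  simp_rw [U_pt hη]; rfl

lemma G_pt {n : ℕ} {p q s t M Λ ε : ℝ} (H : Par n p q s t M Λ) {a : En n × En n → ℝ} {u : En n → ℝ}
    (a0 : ∀ z, 0 ≤ a z) (aM : ∀ z, a z ≤ M) (ub : ∀ x, |u x| ≤ Λ) {x y : En n} (hxy : ‖x - y‖ ≤ 1) :
    kk (ε * p - n) x y * ENNReal.ofReal (Gfun n p q s t ε a u (x, y)) ≤
     ENNReal.ofReal (1 + M * (2 * Λ) ^ (q - p)) * (‖u x - u y‖ₑ ^ p * kk (-(n + s * p)) x y) := by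
  have hp0 : 0 < p := by linarith [H.hp]
  have hq0 : 0 < q := by linarith [H.hpq]
  have hM := H.hM
  have hΛ := H.hΛ
  have hpq := H.hpq
  have htq := H.htq
  rw [← ofReal_abs_rpow hp0.le]
  unfold kk
  rw [← ENNReal.ofReal_mul (by positivity), ← ENNReal.ofReal_mul (by positivity), ← ENNReal.ofReal_mul (by positivity)]
  apply ENNReal.ofReal_le_ofReal
  unfold Gfun Ufun Afun; simp only []
  rcases eq_or_ne x y with rfl | h
  · simp [Real.zero_rpow hp0.ne', Real.zero_rpow hq0.ne']
  · have hn : 0 < ‖x - y‖ := norm_pos_iff.2 (sub_ne_zero.2 h)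
    set r := ‖x - y‖
    set d := |u x - u y| with hd
    have hd0 : 0 ≤ d := abs_nonneg _
    have hdL : d ≤ 2 * Λ := by
      have := abs_sub (u x) (u y)
      linarith [ub x, ub y]
    rw [Real.div_rpow hd0 (by positivity), Real.div_rpow hd0 (by positivity), ← Real.rpow_mul hn.le, ← Real.rpow_mul hn.le]
    have e1 : r ^ (ε * p - n) * (d ^ p / r ^ ((s + ε) * p)) = d ^ p * r ^ (-(n + s * p)) := by
      rw [show (-(n + s * p) : ℝ) = (ε * p - n) - (s + ε) * p by ring, Real.rpow_sub hn (ε * p - n)]; ring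
    have e2 : r ^ (ε * p - n) * (a (x, y) * r ^ ((s - t) * q + ε * (q - p)) * (d ^ q / r ^ ((s + ε) * q))) = a (x,y) * d ^ q * (r ^ (s * p - t * q) * r ^ (-(n + s * p))) := by
      rw [← Real.rpow_add hn, show (s * p - t * q + -(n + s * p) : ℝ) = (ε * p - n) + ((s - t) * q + ε * (q - p)) - (s + ε) * q by ring, Real.rpow_sub hn ((ε * p - n) + ((s - t) * q + ε * (q - p))), Real.rpow_add hn (ε * p - n)]; ring
    have e3 : d ^ q ≤ (2 * Λ) ^ (q - p) * d ^ p := by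
      rw [show q = (q - p) + p by ring, Real.rpow_add_of_nonneg hd0 (by linarith) hp0.le, show q - p + p - p = q - p by ring]
      gcongr
    have e4 : r ^ (s * p - t * q) ≤ 1 := Real.rpow_le_one hn.le hxy (by linarith)
    rw [mul_add, e1, e2, add_mul, one_mul]
    refine add_le_add le_rfl ?_
    calc _ ≤ M * ((2 * Λ) ^ (q - p) * d ^ p) * (1 * r ^ (-(n + s * p))) := by
          gcongr
          exact aM _
      _ = _ := by ring

lemma G_lint {n : ℕ} {p q s t M Λ ε : ℝ} (H : Par n p q s t M Λ) {a : En n × En n → ℝ} {u : En n → ℝ} (am : Measurable a)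
    (a0 : ∀ z, 0 ≤ a z) (aM : ∀ z, a z ≤ M) (um : Measurable u) (ub : ∀ x, |u x| ≤ Λ) (x₀ : En n) {ρ : ℝ} (hρ : ρ ≤ 1 / 2) :
    ∫⁻ z in bB n x₀ ρ, ENNReal.ofReal (Gfun n p q s t ε a u z) ∂nu n p ε ≤ 
      ENNReal.ofReal (1 + M * (2 * Λ) ^ (q - p)) * gag u p (-(n + s * p)) (ball x₀ ρ) := by
  have := Ufun_meas (s := s) (ε := ε) um
  rw [nu_lint _ _ (by unfold Gfun Afun; fun_prop)]
  unfold gag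
  rw [← lintegral_const_mul' _ _ (by simp)]
  refine setLIntegral_mono' measurableSet_ball fun x hx => ?_
  rw [← lintegral_const_mul' _ _ (by simp)]
  refine setLIntegral_mono' measurableSet_ball fun y hy => ?_
  apply G_pt H a0 aM ub
  rw [← dist_eq_norm]
  rw [mem_ball] at *
  linarith [dist_triangle_right x y x₀]

lemma G_nn {n : ℕ} {p q s t ε : ℝ} {a : En n × En n → ℝ} (u : En n → ℝ)
    (a0 : ∀ z, 0 ≤ a z) (z) : 0 ≤ Gfun n p q s t ε a u z := by
  have := Ufun_nn s ε u z
  have := a0 z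
  unfold Gfun Afun; positivity

lemma EE_ge {n : ℕ} {p s L : ℝ} {ψ : En n → ℝ} (K : Cut n ψ L) (m : ℕ) {u : En n → ℝ} (um : Measurable u) :
    gag u p (-(n + s * p)) (ball 0 (1/4)) ≤ EE n p s m ψ u := by
  unfold gag EE
  have hψ := K.meas
  rw [lint_prod_set (F := fun z => ‖u z.1-u z.2‖ₑ^p*kk (-(n+s*p)) z.1 z.2*ENNReal.ofReal (max (ψ z.1) (ψ z.2)^m)) (by fun_prop)]
  refine le_trans ?_ (lintegral_mono_set (ball_subset_ball (by norm_num : (1/4:ℝ) ≤ 1)))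
  refine setLIntegral_mono' measurableSet_ball fun x hx => ?_
  refine le_trans ?_ (lintegral_mono_set (ball_subset_ball (by norm_num : (1/4:ℝ) ≤ 1)))
  refine setLIntegral_mono' measurableSet_ball fun y hy => ?_
  simp [K.one x hx, K.one y hy]

lemma F_lint {n : ℕ} (hn : 2 ≤ n) {p ε r : ℝ} (hr : 0 ≤ r) (hp : 0 < p) (hε : 0 < ε) (h1 : ε * p ≤ 1) {f : En n → ℝ} (fm : Measurable f) (x₀ : En n) {ρ : ℝ} (hρ : 0 < ρ) :
    ENNReal.ofReal (n * m0 n * ρ ^ (ε * p) / (2 * ε * p)) * ∫⁻ x in ball x₀ (ρ / 2), ‖f x‖ₑ ^ r ≤ 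
     ∫⁻ z in bB n x₀ ρ, ENNReal.ofReal (|f z.1| ^ r) ∂nu n p ε := by
  rw [nu_lint _ _ (by fun_prop), ← lintegral_const_mul' _ _ (by simp)]
  refine le_trans ?_ (lintegral_mono_set (ball_subset_ball (by linarith : ρ / 2 ≤ ρ)))
  refine setLIntegral_mono' measurableSet_ball fun x hx => ?_
  simp only [ofReal_abs_rpow hr]
  rw [lintegral_mul_const _ (by fun_prop)]
  gcongr
  exact nu_lo_aux hn hp hε h1 x₀ hρ hx

lemma F_fin {n : ℕ} (hn : 2 ≤ n) {p ε r : ℝ} (hr : 0 ≤ r) (hp : 0 < p) (hε : 0 < ε) {f : En n → ℝ} (fm : Measurable f) (x₀ : En n) {ρ : ℝ} (hρ : 0 < ρ) 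
    (hf : ∫⁻ x in ball x₀ ρ, ‖f x‖ₑ ^ r < ⊤) :
     ∫⁻ z in bB n x₀ ρ, ENNReal.ofReal (|f z.1| ^ r) ∂nu n p ε < ⊤ := by
  rw [nu_lint _ _ (by fun_prop)]
  have e : ∀ x ∈ ball x₀ ρ, ∫⁻ y in ball x₀ ρ, kk (ε * p - n) x y * ENNReal.ofReal (|f x| ^ r) ≤ ENNReal.ofReal (n * m0 n * (2 * ρ) ^ (ε * p) / (ε * p)) * ‖f x‖ₑ ^ r := by
    intro x hx
    simp only [ofReal_abs_rpow hr]
    rw [lintegral_mul_const _ (by fun_prop)]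
    gcongr
    rw [← kk_integral_ball (by omega) x (by positivity) (by positivity)]
    apply lintegral_mono_set
    intro y hy
    rw [mem_ball] at *
    calc dist y x ≤ dist y x₀ + dist x x₀ := dist_triangle_right _ _ _
      _ < 2 * ρ := by linarith
  refine (setLIntegral_mono' measurableSet_ball e).trans_lt ?_
  rw [lintegral_const_mul' _ _ (by simp)]
  exact ENNReal.mul_lt_top (by simp) hf

lemma eps_par {n : ℕ} {p q s t M Λ ε : ℝ} (H : Par n p q s t M Λ) (hε : 0 < ε) (hεs : ε < s / p) :
    1 ≤ etaEx n p s ε ∧ p / 2 ≤ etaEx n p s ε ∧ etaEx n p s ε ≤ p ∧ s * n / (n + s) ≤ s * n / (n + ε * p) ∧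
     (n:ℝ) / etaEx n p s ε = s * n / (n + ε * p) + n / p ∧ 
     ε * p - n - (s + ε) * etaEx n p s ε = -(n + s * n / (n + ε * p) * etaEx n p s ε) ∧
     (n + ε * p) / etaEx n p s ε = n / p + s + ε := by
  have hp := H.hp
  have hp0 : 0 < p := by linarith
  have hs := H.hs0
  have hsn := H.hspn
  have hn : (0:ℝ) < n := by have := H.hn; exact_mod_cast (by omega : 0 < n)
  have he : ε * p < s := by rwa [lt_div_iff₀ hp0] at hεs
  have hep : 0 < ε * p := by positivity
  have hd : 0 < (n:ℝ) + s * p + ε * p := by positivity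
  have hd2 : 0 < (n:ℝ) + ε * p := by positivity
  have hE : etaEx n p s ε = p * (n + ε * p) / (n + s * p + ε * p) := by unfold etaEx; congr 1; ring
  have h2 : p / 2 ≤ etaEx n p s ε := by
    rw [hE, div_le_div_iff₀ (by norm_num) hd]
    nlinarith
  refine ⟨by linarith, h2, ?_, ?_, ?_, ?_, ?_⟩
  · rw [hE, div_le_iff₀ hd]; nlinarith [mul_pos hs hp0]
  · gcongr
  · rw [hE]; field_simp; ring
  · rw [hE]; field_simp; ring
  · rw [hE]; field_simp

lemma gag_fin {n : ℕ} {p s : ℝ} {u : En n → ℝ} (um : Measurable u) (B : Set (En n)) :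
    gag u p (-(n + s * p)) B ≤ ∫⁻ z : En n × En n, ‖u z.1 - u z.2‖ₑ ^ p * kk (-(n + s * p)) z.1 z.2 := by
  unfold gag
  rw [← lint_prod_set (A := B) (B := B) (F := fun z => ‖u z.1 - u z.2‖ₑ ^ p * kk (-(n + s * p)) z.1 z.2) (by fun_prop)]
  exact lintegral_mono' Measure.restrict_le_self le_rfl

lemma U_le {n : ℕ} {p s ε η : ℝ} (hη : 0 < η) (hp : η ≤ p) {u : En n → ℝ} (um : Measurable u) (x₀ : En n) (ρ : ℝ) :
    ∫⁻ z in bB n x₀ ρ, ENNReal.ofReal (Ufun n s ε u z ^ η) ∂nu n p ε ≤ nu n p ε (bB n x₀ ρ) + 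
      ∫⁻ z : En n × En n, ‖u z.1 - u z.2‖ₑ ^ p * kk (-(n + s * p)) z.1 z.2 := by
  have h := U_lint (p := p) (s := s) (ε := ε) (hη.trans_le hp) um x₀ ρ
  calc _ ≤ ∫⁻ z in bB n x₀ ρ, (1 + ENNReal.ofReal (Ufun n s ε u z ^ p)) ∂nu n p ε := by
        apply lintegral_mono; intro z; simp only []
        rw [← ENNReal.ofReal_one, ← ENNReal.ofReal_add (by norm_num) (by have := Ufun_nn s ε u z; positivity)]
        apply ENNReal.ofReal_le_ofReal
        have h0 := Ufun_nn s ε u z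
        rcases le_total (Ufun n s ε u z) 1 with h | h
        · have := Real.rpow_le_one h0 h hη.le
          have : 0 ≤ Ufun n s ε u z ^ p := by positivity
          linarith
        · have := Real.rpow_le_rpow_of_exponent_le h hp
          linarith
    _ = nu n p ε (bB n x₀ ρ) + gag u p (ε * p - n - (s + ε) * p) (ball x₀ ρ) := by
        rw [lintegral_add_left measurable_const, h]; simp
    _ ≤ _ := by
        gcongr
        rw [show ε * p - n - (s + ε) * p = -(n + s * p) by ring]
        exact gag_fin um _

/-- the averages on the right-hand side -/
def TT (n : ℕ) (p s ε : ℝ) (u : En n → ℝ) (x₀ : En n) (ρ : ℝ) : ℝ :=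
  (⨍ z in bB n x₀ ρ, Ufun n s ε u z ^ etaEx n p s ε ∂nu n p ε) ^ (1 / etaEx n p s ε)

lemma TT_nn (n : ℕ) (p s ε : ℝ) (u : En n → ℝ) (x₀ : En n) (ρ : ℝ) : 0 ≤ TT n p s ε u x₀ ρ := by
  unfold TT
  apply Real.rpow_nonneg
  rw [setAverage_eq, smul_eq_mul]
  have : 0 ≤ ∫ z in bB n x₀ ρ, Ufun n s ε u z ^ etaEx n p s ε ∂nu n p ε := integral_nonneg fun z => by
    have := Ufun_nn s ε u z
    simp only [Pi.zero_apply]; positivity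
  positivity

lemma c1_pos {n : ℕ} (hn : 2 ≤ n) {p : ℝ} (hp : 0 < p) : 0 < c1 n p := by
  have := m0_pos n
  have : 0 < n := by omega
  unfold c1; positivity
lemma c2_pos {n : ℕ} (hn : 2 ≤ n) {p : ℝ} (hp : 0 < p) : 0 < c2 n p := by
  have := m0_pos n
  have : 0 < n := by omega
  unfold c2; positivity

lemma TT_bdd {n : ℕ} {p q s t M Λ ε : ℝ} (H : Par n p q s t M Λ) (hε : 0 < ε) (hεs : ε < s / p) {u : En n → ℝ} (um : Measurable u)
    (gf : ∫⁻ z : En n × En n, ‖u z.1 - u z.2‖ₑ ^ p * kk (-(n + s * p)) z.1 z.2 < ⊤) (x₀ : En n) {R : ℝ} (hR : 0 < R) :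
    ∃ B : ℝ, ∀ k : ℕ, TT n p s ε u x₀ (2 ^ k * R) ≤ B := by
  obtain ⟨g1, g2, g3, g4, g5, g6, g7⟩ := eps_par H hε hεs
  have hp := H.hp
  have hp0 : 0 < p := by linarith
  have he : ε * p < s := by rwa [lt_div_iff₀ hp0] at hεs
  have he1 : ε * p ≤ 1 := by linarith [H.hs1]
  set Γ := ∫⁻ z : En n × En n, ‖u z.1 - u z.2‖ₑ ^ p * kk (-(n + s * p)) z.1 z.2
  set N := nu n p ε (bB n x₀ R) with hN
  have hN0 : N ≠ 0 := by
    have := nu_lo H.hn hp0 hε he1 x₀ hR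
    have h2 := c1_pos H.hn hp0
    refine (lt_of_lt_of_le ?_ this).ne'
    rw [ENNReal.ofReal_pos]; positivity
  refine ⟨(1 + N⁻¹ * Γ).toReal ^ (1 / etaEx n p s ε), fun k => ?_⟩
  unfold TT
  have hUm := Ufun_meas (s := s) (ε := ε) um
  rw [avg_eq (by fun_prop) (fun z => by have := Ufun_nn s ε u z; positivity)]
  have hk : R ≤ 2 ^ k * R := by
    have : (1:ℝ) ≤ 2 ^ k := one_le_pow₀ (by norm_num)
    nlinarith
  have hsub : N ≤ nu n p ε (bB n x₀ (2 ^ k * R)) := measure_mono (prod_mono (ball_subset_ball hk) (ball_subset_ball hk))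
  have hNt : nu n p ε (bB n x₀ (2 ^ k * R)) ≠ ⊤ := ((nu_up H.hn hp0 hε he1 x₀ (by positivity)).trans_lt ENNReal.ofReal_lt_top).ne
  gcongr
  · exact ENNReal.add_ne_top.2 ⟨by simp, ENNReal.mul_ne_top (by simpa using hN0) gf.ne⟩
  · refine (mul_le_mul_right (U_le (by linarith) g3 um x₀ _) _).trans ?_
    rw [mul_add, ENNReal.inv_mul_cancel (fun h => hN0 (by rw [h] at hsub; exact le_antisymm hsub bot_le)) hNt]
    gcongr

lemma TT_sum {n : ℕ} {p q s t M Λ ε : ℝ} (H : Par n p q s t M Λ) (hε : 0 < ε) (hεs : ε < s / p) {u : En n → ℝ} (um : Measurable u)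
    (gf : ∫⁻ z : En n × En n, ‖u z.1 - u z.2‖ₑ ^ p * kk (-(n + s * p)) z.1 z.2 < ⊤) (x₀ : En n) {R : ℝ} (hR : 0 < R) 
    {g : ℝ} (hg : 0 < g) : Summable fun k : ℕ => (2:ℝ) ^ (-(k:ℝ) * g) * TT n p s ε u x₀ (2 ^ k * R) := by
  obtain ⟨B, hB⟩ := TT_bdd H hε hεs um gf x₀ hR
  have hgeo : Summable fun k : ℕ => ((2:ℝ) ^ (-g)) ^ k := summable_geometric_of_lt_one (by positivity) (Real.rpow_lt_one_of_one_lt_of_neg (by norm_num) (by linarith))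
  refine Summable.of_nonneg_of_le (fun k => mul_nonneg (by positivity) (TT_nn _ _ _ _ _ _ _)) (fun k => ?_) (hgeo.mul_right B)
  rw [← Real.rpow_natCast (2 ^ (-g)), ← Real.rpow_mul (by norm_num), show -g * (k:ℝ) = -(k:ℝ) * g by ring]
  gcongr
  exact hB k

lemma TT_gag {n : ℕ} {p q s t M Λ ε : ℝ} (H : Par n p q s t M Λ) (hε : 0 < ε) (hεs : ε < s / p) {u : En n → ℝ} (um : Measurable u)
    (gf : ∫⁻ z : En n × En n, ‖u z.1 - u z.2‖ₑ ^ p * kk (-(n + s * p)) z.1 z.2 < ⊤) (x₀ : En n) {ρ : ℝ} (hρ : 0 < ρ) :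
    gag u (etaEx n p s ε) (-(n + s * n / (n + ε * p) * etaEx n p s ε)) (ball x₀ ρ) ^ (1 / etaEx n p s ε) ≤
     ENNReal.ofReal ((c2 n p / ε) ^ (1 / etaEx n p s ε) * ρ ^ (n / p + s + ε) * TT n p s ε u x₀ ρ) := by
  obtain ⟨g1, g2, g3, g4, g5, g6, g7⟩ := eps_par H hε hεs
  have hp := H.hp
  have hp0 : 0 < p := by linarith
  have he : ε * p < s := by rwa [lt_div_iff₀ hp0] at hεs
  have he1 : ε * p ≤ 1 := by linarith [H.hs1]
  have hUm := Ufun_meas (s := s) (ε := ε) um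
  have hc2 := c2_pos H.hn hp0
  set η := etaEx n p s ε with hη
  have hη0 : 0 < η := by linarith
  rw [← g6, ← U_lint hη0 um]
  set N := nu n p ε (bB n x₀ ρ) with hN
  set J := ∫⁻ z in bB n x₀ ρ, ENNReal.ofReal (Ufun n s ε u z ^ η) ∂nu n p ε with hJ
  have hup := nu_up H.hn hp0 hε he1 x₀ hρ
  have hNt : N ≠ ⊤ := (hup.trans_lt ENNReal.ofReal_lt_top).ne
  have hN0 : N ≠ 0 := by
    have := nu_lo H.hn hp0 hε he1 x₀ hρ
    have h2 := c1_pos H.hn hp0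
    refine (lt_of_lt_of_le ?_ this).ne'
    rw [ENNReal.ofReal_pos]; positivity
  have hJt : J ≠ ⊤ := ((U_le hη0 g3 um x₀ ρ).trans_lt (ENNReal.add_lt_top.2 ⟨hNt.lt_top, gf⟩)).ne
  have hT : ENNReal.ofReal (TT n p s ε u x₀ ρ) = (N⁻¹ * J) ^ (1 / η) := by
    unfold TT
    rw [← hη, avg_eq (by fun_prop) (fun z => by have := Ufun_nn s ε u z; positivity), ← hN, ← hJ, ENNReal.toReal_rpow, ENNReal.ofReal_toReal]
    have : N⁻¹ * J ≠ ⊤ := ENNReal.mul_ne_top (by simpa using hN0) hJt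
    finiteness
  have e1 : J = N * (N⁻¹ * J) := by rw [← mul_assoc, ENNReal.mul_inv_cancel hN0 hNt, one_mul]
  rw [e1, ENNReal.mul_rpow_of_nonneg _ _ (by positivity), ← hT, ENNReal.ofReal_mul (by positivity)]
  gcongr
  calc N ^ (1 / η) ≤ ENNReal.ofReal (c2 n p * ρ ^ (n + ε * p) / ε) ^ (1 / η) := by gcongr
    _ = ENNReal.ofReal ((c2 n p * ρ ^ (n + ε * p) / ε) ^ (1 / η)) := ENNReal.ofReal_rpow_of_nonneg (by positivity) (by positivity)
    _ = _ := by
      rw [show c2 n p * ρ ^ (n + ε * p) / ε = (c2 n p / ε) * ρ ^ (n + ε * p) by ring, Real.mul_rpow (by positivity) (by positivity), ← Real.rpow_mul hρ.le, mul_one_div, g7]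

lemma sc_eT {n : ℕ} {p q s t M Λ ε : ℝ} (H : Par n p q s t M Λ) (hε : 0 < ε) (hεs : ε < s / p) {u : En n → ℝ} (um : Measurable u)
    (gf : ∫⁻ z : En n × En n, ‖u z.1 - u z.2‖ₑ ^ p * kk (-(n + s * p)) z.1 z.2 < ⊤) (x₀ : En n) {R : ℝ} (hR : 0 < R) (k : ℕ) :
    eT n p (etaEx n p s ε) (s * n / (n + ε * p)) (fun x => u (x₀ + R • x)) k ≤ 
      ENNReal.ofReal (R ^ (s + ε) * (c2 n p / ε) ^ (1 / etaEx n p s ε) * (2 ^ ((k:ℝ) * (s + ε)) * TT n p s ε u x₀ (2 ^ k * R))) := by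
  obtain ⟨g1, g2, g3, g4, g5, g6, g7⟩ := eps_par H hε hεs
  have h := TT_gag H hε hεs um gf x₀ (ρ := 2 ^ k * R) (by positivity)
  have hp := H.hp
  have hp0 : 0 < p := by linarith
  have hT := TT_nn n p s ε u x₀ (2 ^ k * R)
  have hc2 := c2_pos H.hn hp0
  set η := etaEx n p s ε with hη
  set τ := s * n / (n + ε * p) with hτ
  have hη0 : 0 < η := by linarith
  unfold eT
  rw [sc_gag u η _ x₀ hR, mul_comm R, ENNReal.mul_rpow_of_nonneg _ _ (by positivity), ENNReal.ofReal_rpow_of_nonneg (by positivity) (by positivity),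
    ← Real.rpow_mul hR.le, show -(2 * n + -(n + τ * η)) * (1 / η) = - (n / p) by
      have : -(2 * n + -(n + τ * η)) * (1 / η) = τ - n / η := by field_simp; ring
      rw [this, g5]; ring]
  refine (mul_le_mul_right (mul_le_mul_right h _) _).trans ?_
  rw [← ENNReal.ofReal_mul (by positivity), ← ENNReal.ofReal_mul (by positivity)]
  apply ENNReal.ofReal_le_ofReal
  apply le_of_eq
  have e1 : R ^ (s + ε) = R ^ (-(n / p)) * R ^ (n / p + s + ε) := by rw [← Real.rpow_add hR]; congr 1; ring
  have e2 : (2:ℝ) ^ ((k:ℝ) * (s + ε)) = 2 ^ (-(k:ℝ) * (n / p)) * (2 ^ k) ^ (n / p + s + ε) := by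
    rw [← Real.rpow_natCast, ← Real.rpow_mul (by norm_num), ← Real.rpow_add (by norm_num)]; congr 1; ring
  rw [e1, e2, Real.mul_rpow (by positivity) hR.le]; ring

lemma sc_tz {n : ℕ} {p q s t M Λ ε : ℝ} (H : Par n p q s t M Λ) (hε : 0 < ε) (hεs : ε < s / p) {u : En n → ℝ} (um : Measurable u)
    (gf : ∫⁻ z : En n × En n, ‖u z.1 - u z.2‖ₑ ^ p * kk (-(n + s * p)) z.1 z.2 < ⊤) (x₀ : En n) {R : ℝ} (hR : 0 < R) :
    tz n (etaEx n p s ε) (s * n / (n + ε * p)) (fun x => u (x₀ + R • x)) ≤ 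
      ENNReal.ofReal (R ^ (s + ε) * (c2 n p / ε) ^ (1 / etaEx n p s ε) * TT n p s ε u x₀ R) := by
  have := sc_eT H hε hεs um gf x₀ hR 0
  simpa [eT, tz] using this

lemma sc_ST {n : ℕ} {p q s t M Λ ε : ℝ} (H : Par n p q s t M Λ) (hε : 0 < ε) (hεs : ε < s / p) {u : En n → ℝ} (um : Measurable u)
    (gf : ∫⁻ z : En n × En n, ‖u z.1 - u z.2‖ₑ ^ p * kk (-(n + s * p)) z.1 z.2 < ⊤) (x₀ : En n) {R : ℝ} (hR : 0 < R) 
    (hg1 : 0 < s * p / (p - 1) - s - ε) (hg : 0 < t * q / (p - 1) - s - ε) :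
    STl n p (t * q) (etaEx n p s ε) (s * n / (n + ε * p)) (fun x => u (x₀ + R • x)) ≤ 
      ENNReal.ofReal (R ^ (s + ε) * (c2 n p / ε) ^ (1 / etaEx n p s ε) * ∑' k : ℕ, ((2 : ℝ) ^ (-(k : ℝ) * (s * p / (p - 1) - s - ε))
                      + (2 : ℝ) ^ (-(k : ℝ) * (t * q / (p - 1) - s - ε))) * TT n p s ε u x₀ (2 ^ k * R)) := by
  have hp0 : 0 < p := by linarith [H.hp]
  have hc2 := c2_pos H.hn hp0
  have hs : Summable fun k : ℕ => ((2 : ℝ) ^ (-(k : ℝ) * (s * p / (p - 1) - s - ε))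
                      + (2 : ℝ) ^ (-(k : ℝ) * (t * q / (p - 1) - s - ε))) * TT n p s ε u x₀ (2 ^ k * R) := by
    simp_rw [add_mul]
    exact (TT_sum H hε hεs um gf x₀ hR hg1).add (TT_sum H hε hεs um gf x₀ hR hg)
  have hT := fun k : ℕ => TT_nn n p s ε u x₀ (2 ^ k * R)
  rw [ENNReal.ofReal_mul (by positivity), ENNReal.ofReal_tsum_of_nonneg (fun k => mul_nonneg (by positivity) (hT k)) hs, ← ENNReal.tsum_mul_left]
  unfold STl
  refine ENNReal.tsum_le_tsum fun k => ?_
  refine (mul_le_mul_right (sc_eT H hε hεs um gf x₀ hR k) _).trans ?_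
  rw [← ENNReal.ofReal_mul (by positivity), ← ENNReal.ofReal_mul (by positivity)]
  apply ENNReal.ofReal_le_ofReal
  have := hT k
  have e : (2:ℝ) ^ (-(k : ℝ) * (t * q / (p - 1) - s - ε)) = 2 ^ (-(k:ℝ) * (t * q / (p-1))) * 2 ^ ((k:ℝ) * (s + ε)) := by
    rw [← Real.rpow_add (by norm_num)]; congr 1; ring
  rw [e]
  have : 0 ≤ R ^ (s + ε) * (c2 n p / ε) ^ (1 / etaEx n p s ε) * (2 ^ (-(k:ℝ) * (s * p / (p - 1) - s - ε)) * TT n p s ε u x₀ (2 ^ k * R)) := by positivity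
  refine le_trans (le_add_of_nonneg_left this) (le_of_eq ?_)
  ring

lemma sc_Fn {n : ℕ} {p q s t M Λ ε : ℝ} (H : Par n p q s t M Λ) (hε : 0 < ε) (hεs : ε < s / p) {f : En n → ℝ} (fm : Measurable f)
    (x₀ : En n) {R : ℝ} (hR : 0 < R) (hf : ∫⁻ x in ball x₀ R, ‖f x‖ₑ ^ pStar n p s < ⊤) :
    Fn n p s (fun x => R ^ (s * p) * f (x₀ + R • x)) ≤ ENNReal.ofReal (R ^ (s * p) * ((4 * m0 n) ^ (1 / pStar n p s) * 
      (⨍ z in bB n x₀ R, |f z.1| ^ pStar n p s ∂nu n p ε) ^ (1 / pStar n p s))) := by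
  have hp := H.hp
  have hp0 : 0 < p := by linarith
  have he : ε * p < s := by rwa [lt_div_iff₀ hp0] at hεs
  have he1 : ε * p ≤ 1 := by linarith [H.hs1]
  have hc2 := c2_pos H.hn hp0
  have hm := m0_pos n
  have hn : (0:ℝ) < n := by have := H.hn; exact_mod_cast (by omega : 0 < n)
  have hps := pStar_gt H
  set r := pStar n p s with hr
  have hr0 : 0 < r := by linarith
  have hup := nu_up H.hn hp0 hε he1 x₀ hR
  have hl := F_lint H.hn hr0.le hp0 hε he1 fm x₀ hR
  have hJt := F_fin (p := p) H.hn hr0.le hp0 hε fm x₀ hR hf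
  have hav := avg_eq (p := p) (ε := ε) (g := fun z : En n × En n => |f z.1| ^ r) (by fun_prop) (fun z => by positivity) (bB n x₀ R)
  set Φ := ⨍ z in bB n x₀ R, |f z.1| ^ r ∂nu n p ε with hΦ
  have hΦ0 : 0 ≤ Φ := by rw [hav]; exact ENNReal.toReal_nonneg
  set N := nu n p ε (bB n x₀ R) with hN
  set J := ∫⁻ z in bB n x₀ R, ENNReal.ofReal (|f z.1| ^ r) ∂nu n p ε with hJ
  set I := ∫⁻ x in ball x₀ (R / 2), ‖f x‖ₑ ^ r with hI
  have hNt : N ≠ ⊤ := (hup.trans_lt ENNReal.ofReal_lt_top).ne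
  have hN0 : N ≠ 0 := by
    have := nu_lo H.hn hp0 hε he1 x₀ hR
    have h2 := c1_pos H.hn hp0
    refine (lt_of_lt_of_le ?_ this).ne'
    rw [ENNReal.ofReal_pos]; positivity
  have hΦe : ENNReal.ofReal Φ = N⁻¹ * J := by
    rw [hav, ENNReal.ofReal_toReal (ENNReal.mul_ne_top (by simpa using hN0) hJt.ne)]
  have e1 : J = N * ENNReal.ofReal Φ := by rw [hΦe, ← mul_assoc, ENNReal.mul_inv_cancel hN0 hNt, one_mul]
  set κ : ℝ := n * m0 n * R ^ (ε * p) / (2 * ε * p) with hκ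
  have hκ0 : 0 < κ := by positivity
  have hI2 : ENNReal.ofReal (R ^ (-(n:ℝ))) * I ≤ ENNReal.ofReal (4 * m0 n * Φ) := by
    have : I = ENNReal.ofReal κ⁻¹ * (ENNReal.ofReal κ * I) := by
      rw [← mul_assoc, ← ENNReal.ofReal_mul (by positivity), inv_mul_cancel₀ hκ0.ne', ENNReal.ofReal_one, one_mul]
    rw [this]
    calc _ ≤ ENNReal.ofReal (R ^ (-(n:ℝ))) * (ENNReal.ofReal κ⁻¹ * (ENNReal.ofReal (c2 n p * R ^ (n + ε * p) / ε) * ENNReal.ofReal Φ)) := by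
          apply mul_le_mul_right; apply mul_le_mul_right
          refine hl.trans ?_
          rw [e1]; gcongr
      _ = ENNReal.ofReal (4 * m0 n * Φ) := by
          rw [← ENNReal.ofReal_mul (by positivity), ← ENNReal.ofReal_mul (by positivity), ← ENNReal.ofReal_mul (by positivity)]
          congr 1
          rw [hκ, Real.rpow_add hR, Real.rpow_neg hR.le, c2]
          field_simp; ring
  unfold Fn
  rw [← hr]
  simp_rw [enorm_mul]
  simp_rw [ENNReal.mul_rpow_of_nonneg _ _ hr0.le]
  rw [lintegral_const_mul' _ _ (by finiteness), sc_ball (fun x => ‖f x‖ₑ ^ r) x₀ hR, mul_one_div, ENNReal.mul_rpow_of_nonneg _ _ (by positivity), ← ENNReal.rpow_mul, 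
    mul_one_div_cancel hr0.ne', ENNReal.rpow_one, ENNReal.ofReal_mul (by positivity), Real.enorm_of_nonneg (by positivity)]
  gcongr
  refine (ENNReal.rpow_le_rpow hI2 (by positivity)).trans ?_
  rw [ENNReal.ofReal_rpow_of_nonneg (by positivity) (by positivity), Real.mul_rpow (by positivity) hΦ0]

lemma sc_G {n : ℕ} {p q s t M Λ ε : ℝ} (H : Par n p q s t M Λ) (hε : 0 < ε) (hεs : ε < s / p) {a : En n × En n → ℝ} {u : En n → ℝ} (am : Measurable a)
    (a0 : ∀ z, 0 ≤ a z) (aM : ∀ z, a z ≤ M) (um : Measurable u) (ub : ∀ x, |u x| ≤ Λ) (x₀ : En n) {R : ℝ} (hR : 0 < R) (hR1 : R ≤ 1)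
    {ψ : En n → ℝ} {L : ℝ} (K : Cut n ψ L) (m : ℕ) :
    ENNReal.ofReal ((⨍ z in bB n x₀ (R / 4), Gfun n p q s t ε a u z ∂nu n p ε) ^ (1 / p)) ≤
     ENNReal.ofReal (((1 + M * (2 * Λ) ^ (q - p)) * 4 ^ (n + 1 : ℝ) / c1 n p) ^ (1 / p) * ε ^ (1 / p) * R ^ (-(s + ε))) * EE n p s m ψ (fun x => u (x₀ + R • x)) ^ (1 / p) := by
  have hp := H.hp
  have hp0 : 0 < p := by linarith
  have he : ε * p < s := by rwa [lt_div_iff₀ hp0] at hεs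
  have he1 : ε * p ≤ 1 := by linarith [H.hs1]
  have hc1 := c1_pos H.hn hp0
  have hM := H.hM
  have hΛ := H.hΛ
  have hlo := nu_lo H.hn hp0 hε he1 x₀ (ρ := R / 4) (by positivity)
  have hGm : Measurable (Gfun n p q s t ε a u) := by
    have := Ufun_meas (s := s) (ε := ε) um
    unfold Gfun Afun; fun_prop
  have hav := avg_eq (p := p) (ε := ε) hGm (G_nn u a0) (bB n x₀ (R / 4))
  have hG := G_lint (ε := ε) H am a0 aM um ub x₀ (ρ := R / 4) (by linarith)
  set N := nu n p ε (bB n x₀ (R / 4)) with hN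
  set KK : ℝ := 1 + M * (2 * Λ) ^ (q - p) with hKK
  have hKK0 : 0 ≤ KK := by positivity
  set E := EE n p s m ψ (fun x => u (x₀ + R • x)) with hE
  have hEg : gag u p (-(n + s * p)) (ball x₀ (R / 4)) ≤ ENNReal.ofReal (R ^ (n - s * p)) * E := by
    have h1 := EE_ge (p := p) (s := s) K m (u := fun x => u (x₀ + R • x)) (by fun_prop)
    rw [sc_gag u p _ x₀ hR, show R * (1 / 4) = R / 4 by ring, show -(2 * n + -(n + s * p)) = -(n - s * p) by ring] at h1
    calc _ = ENNReal.ofReal (R ^ (n - s * p)) * (ENNReal.ofReal (R ^ (-(n - s * p))) * gag u p (-(n + s * p)) (ball x₀ (R / 4))) := by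
          rw [← mul_assoc, ← ENNReal.ofReal_mul (by positivity), ← Real.rpow_add hR]; simp
      _ ≤ _ := mul_le_mul_right h1 _
  have key : ENNReal.ofReal (⨍ z in bB n x₀ (R / 4), Gfun n p q s t ε a u z ∂nu n p ε) ≤ 
      ENNReal.ofReal (KK * 4 ^ (n + 1 : ℝ) / c1 n p * ε * R ^ (-(s + ε) * p)) * E := by
    rw [hav]
    refine ENNReal.ofReal_toReal_le.trans ?_
    calc _ ≤ (ENNReal.ofReal (c1 n p * (R / 4) ^ (n + ε * p) / ε))⁻¹ * (ENNReal.ofReal KK * (ENNReal.ofReal (R ^ (n - s * p)) * E)) := by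
          refine mul_le_mul' (ENNReal.inv_le_inv.2 hlo) (hG.trans (mul_le_mul_right hEg _))
      _ = ENNReal.ofReal ((c1 n p * (R / 4) ^ (n + ε * p) / ε)⁻¹ * KK * R ^ (n - s * p)) * E := by
          rw [← ENNReal.ofReal_inv_of_pos (by positivity), ENNReal.ofReal_mul (by positivity), ENNReal.ofReal_mul (by positivity)]; ring
      _ ≤ _ := by
          apply mul_le_mul_left
          apply ENNReal.ofReal_le_ofReal
          have h4 : (4:ℝ) ^ (n + ε * p) ≤ 4 ^ (n + 1 : ℝ) := Real.rpow_le_rpow_of_exponent_le (by norm_num) (by linarith)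
          rw [Real.div_rpow hR.le (by norm_num), show -(s + ε) * p = (n - s * p) - (n + ε * p) by ring, Real.rpow_sub hR (n - s * p)]
          calc _ = KK * 4 ^ (n + ε * p) / c1 n p * ε * (R ^ (n - s * p) / R ^ (n + ε * p)) := by field_simp
            _ ≤ _ := by gcongr
  have hav0 : 0 ≤ ⨍ z in bB n x₀ (R / 4), Gfun n p q s t ε a u z ∂nu n p ε := by rw [hav]; exact ENNReal.toReal_nonneg
  rw [← ENNReal.ofReal_rpow_of_nonneg hav0 (by positivity)]
  refine (ENNReal.rpow_le_rpow key (by positivity)).trans ?_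
  rw [ENNReal.mul_rpow_of_nonneg _ _ (by positivity), ENNReal.ofReal_rpow_of_nonneg (by positivity) (by positivity)]
  apply le_of_eq
  congr 2
  rw [Real.mul_rpow (by positivity) (by positivity), Real.mul_rpow (by positivity) (by positivity), ← Real.rpow_mul hR.le]
  congr 2
  field_simp

lemma memW_gf {n : ℕ} {p s : ℝ} (hp : 0 < p) {u : En n → ℝ} (hu : MemWsp n s p u) :
    ∫⁻ z : En n × En n, ‖u z.1 - u z.2‖ₑ ^ p * kk (-(n + s * p)) z.1 z.2 < ⊤ := by
  have h := hu.2.2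
  convert h using 2
  ext z
  rw [← ofReal_abs_rpow hp.le, div_eq_mul_inv, ENNReal.ofReal_mul (by positivity), kk, Real.rpow_neg (norm_nonneg _)]

lemma loc_ff {n : ℕ} {r δ : ℝ} (hr : 0 ≤ r) (hδ : 0 < δ) {f : En n → ℝ} {x₀ : En n} {R : ℝ}
    (hf : (∫⁻ x in ball x₀ R, ENNReal.ofReal (|f x| ^ (r + δ))) < ⊤) : ∫⁻ x in ball x₀ R, ‖f x‖ₑ ^ r < ⊤ := by
  calc _ ≤ ∫⁻ x in ball x₀ R, (1 + ENNReal.ofReal (|f x| ^ (r + δ))) := by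
        apply lintegral_mono; intro x; simp only []
        rw [ofReal_abs_rpow (by linarith)]
        rcases le_total ‖f x‖ₑ 1 with h | h
        · exact (ENNReal.rpow_le_one h hr).trans le_self_add
        · exact (ENNReal.rpow_le_rpow_of_exponent_le h (by linarith)).trans le_add_self
    _ < ⊤ := by
        rw [lintegral_add_left measurable_const]
        exact ENNReal.add_lt_top.2 ⟨by simp [measure_ball_lt_top], hf⟩

/-- The final real-variable computation. -/
lemma fin_alg {K1 c ε R s p η c1' c2' D1 X Y N θ δ θn : ℝ} (hK1 : 0 ≤ K1) (hc : 0 ≤ c) (hε : 0 < ε) (hε1 : ε ≤ 1) (hR : 0 < R)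
    (hp : 2 ≤ p) (hη : 1 ≤ η) (hc1 : 0 < c1') (hc2 : 0 < c2') (hD1 : 0 ≤ D1) (hX : 0 ≤ X) (hY : 0 ≤ Y) 
    (hδ : 0 ≤ δ) (hθ0 : 0 ≤ θ) (hθ1 : θ ≤ 1) (hN : c1' * R ^ θn ≤ ε * N) (hθn : θn * (θ / (p-1)) = s * p / (p-1) - (s + ε)) :
    K1 * ε ^ (1/p) * R ^ (-(s+ε)) * (c * (R ^ (s + ε) * (c2' / ε) ^ (1/η) * X + (R ^ (s * p) * (D1 * Y)) ^ (1/(p-1)))) ≤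
     (K1 * c * (max 1 c2' + D1 ^ (1/(p-1)) / min 1 c1') + 1) / ε ^ (1/η - 1/p) * X + 
      (K1 * c * (max 1 c2' + D1 ^ (1/(p-1)) / min 1 c1') + 1) * (ε * N) ^ (θ/(p-1)) / ε ^ δ * Y ^ (1/(p-1)) := by
  have hp1 : 0 < p - 1 := by linarith
  set Ct := K1 * c * (max 1 c2' + D1 ^ (1/(p-1)) / min 1 c1') + 1 with hCt
  have hmin : 0 < min 1 c1' := lt_min one_pos hc1
  have hmax : 0 < max 1 c2' := lt_max_of_lt_left one_pos
  have hD : 0 ≤ D1 ^ (1/(p-1)) / min 1 c1' := by positivity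
  have hA : K1 * c * max 1 c2' ≤ Ct := by
    have : 0 ≤ K1 * c * (D1 ^ (1/(p-1)) / min 1 c1') := by positivity
    rw [hCt]; linarith
  have hB : K1 * c * (D1 ^ (1/(p-1)) / min 1 c1') ≤ Ct := by
    have : 0 ≤ K1 * c * max 1 c2' := by positivity
    rw [hCt]; linarith
  have hCt0 : 0 ≤ Ct := by positivity
  have hRR : R ^ (-(s+ε)) * R ^ (s+ε) = 1 := by rw [← Real.rpow_add hR]; simp
  have t1 : K1 * ε ^ (1/p) * R ^ (-(s+ε)) * (c * (R ^ (s + ε) * (c2' / ε) ^ (1/η) * X)) ≤ Ct / ε ^ (1/η - 1/p) * X := by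
    have h2 : c2' ^ (1/η) ≤ max 1 c2' := by
      have e1 : 1/η ≤ 1 := by rw [div_le_one (by linarith)]; exact hη
      have e0 : 0 ≤ 1/η := by positivity
      calc c2' ^ (1/η) ≤ (max 1 c2') ^ (1/η) := by gcongr; exact le_max_right _ _
        _ ≤ (max 1 c2') ^ (1:ℝ) := Real.rpow_le_rpow_of_exponent_le (le_max_left _ _) e1
        _ = _ := Real.rpow_one _
    rw [Real.div_rpow hc2.le hε.le, Real.rpow_sub hε]
    calc _ = (R ^ (-(s+ε)) * R ^ (s+ε)) * (K1 * c * c2' ^ (1/η)) / (ε ^ (1/η) / ε ^ (1/p)) * X := by field_simp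
      _ ≤ 1 * (K1 * c * max 1 c2') / (ε ^ (1/η) / ε ^ (1/p)) * X := by rw [hRR]; gcongr
      _ ≤ _ := by rw [one_mul]; gcongr
  have t2 : K1 * ε ^ (1/p) * R ^ (-(s+ε)) * (c * (R ^ (s * p) * (D1 * Y)) ^ (1/(p-1))) ≤ Ct * (ε * N) ^ (θ/(p-1)) / ε ^ δ * Y ^ (1/(p-1)) := by
    have hq0 : 0 ≤ θ / (p-1) := by positivity
    have hq1 : θ / (p-1) ≤ 1 := by rw [div_le_one hp1]; linarith
    have h1 : min 1 c1' * R ^ (s * p / (p-1) - (s+ε)) ≤ (ε * N) ^ (θ/(p-1)) := by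
      calc min 1 c1' * R ^ (s * p / (p-1) - (s+ε)) ≤ c1' ^ (θ/(p-1)) * R ^ (s * p / (p-1) - (s+ε)) := by
            gcongr
            calc min 1 c1' = (min 1 c1') ^ (1:ℝ) := (Real.rpow_one _).symm
              _ ≤ (min 1 c1') ^ (θ/(p-1)) := Real.rpow_le_rpow_of_exponent_ge hmin (min_le_left _ _) hq1
              _ ≤ _ := by gcongr; exact min_le_right _ _
        _ = (c1' * R ^ θn) ^ (θ/(p-1)) := by rw [Real.mul_rpow hc1.le (by positivity), ← Real.rpow_mul hR.le, hθn]
        _ ≤ _ := by gcongr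
    have h2 : ε ^ (1/p) ≤ 1 := Real.rpow_le_one hε.le hε1 (by positivity)
    have h3 : 1 ≤ 1 / ε ^ δ := by
      rw [le_div_iff₀ (by positivity), one_mul]; exact Real.rpow_le_one hε.le hε1 hδ
    have hN0 : 0 ≤ (ε * N) ^ (θ/(p-1)) := le_trans (by positivity) h1
    rw [Real.mul_rpow (by positivity) (by positivity), Real.mul_rpow hD1 hY, ← Real.rpow_mul hR.le, mul_one_div]
    have e : R ^ (s * p / (p-1) - (s+ε)) = R ^ (-(s+ε)) * R ^ (s * p / (p-1)) := by rw [← Real.rpow_add hR]; congr 1; ring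
    calc _ = K1 * c * (D1 ^ (1/(p-1)) / min 1 c1') * (min 1 c1' * R ^ (s * p / (p-1) - (s+ε))) * ε ^ (1/p) * Y ^ (1/(p-1)) := by
          rw [e]; field_simp
      _ ≤ Ct * (ε * N) ^ (θ/(p-1)) * 1 * Y ^ (1/(p-1)) := by gcongr
      _ ≤ Ct * (ε * N) ^ (θ/(p-1)) * (1 / ε ^ δ) * Y ^ (1/(p-1)) := by gcongr
      _ = _ := by ring
  linarith

set_option maxHeartbeats 1600000 in
lemma main_pos {n : ℕ} {p q s t M Λ : ℝ} (H : Par n p q s t M Λ) : ∃ C : ℝ, 0 < C ∧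
      ∀ ε : ℝ, 0 < ε → ε < 1 - s → ε < s * (t * q / (s * p) - 1 / pC p) → ε < s / p →
      ∀ a : En n × En n → ℝ, Measurable a →
        (∀ z, 0 ≤ a z) → (∀ z, a z ≤ M) → (∀ x y, a (x, y) = a (y, x)) →
      ∀ δ₀ : ℝ, 0 < δ₀ →
      ∀ f : En n → ℝ, Measurable f →
        (∀ (x₀ : En n) (R : ℝ), 0 < R →
          (∫⁻ x in ball x₀ R, ENNReal.ofReal (|f x| ^ (pStar n p s + δ₀))) < ⊤) →
      ∀ u : En n → ℝ, MemWsp n s p u → (∀ x, |u x| ≤ Λ) →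
        IsBoundedWeakSolution n p q s t a u f →
      ∀ (x₀ : En n) (R : ℝ), 0 < R → R ≤ 1 →
      ∀ σ : ℝ, 0 < σ → σ < 1 →
        (⨍ z in bB n x₀ (R / 4), Gfun n p q s t ε a u z ∂nu n p ε) ^ (1 / p) ≤
          C / ε ^ (1 / etaEx n p s ε - 1 / p) *
            ((1 / σ) * TT n p s ε u x₀ R
              + σ * ∑' k : ℕ,
                  ((2 : ℝ) ^ (-(k : ℝ) * (s * p / (p - 1) - s - ε))
                      + (2 : ℝ) ^ (-(k : ℝ) * (t * q / (p - 1) - s - ε))) *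
                    TT n p s ε u x₀ (2 ^ k * R))
          + C * (ε * (nu n p ε (bB n x₀ R)).toReal) ^ (thetaEx n p s ε / (p - 1))
              / ε ^ ((1 / pStar n p s - 1 / pC p) / (p - 1)) *
              ((⨍ z in bB n x₀ R, |f z.1| ^ pStar n p s ∂nu n p ε) ^
                  (1 / pStar n p s)) ^ (1 / (p - 1)) := by
  obtain ⟨ψ, L, K⟩ := exists_cut n
  obtain ⟨C, hC, hcore⟩ := core H K (m := ⌈q⌉₊) (Nat.le_ceil q)
  have hp := H.hp
  have hp0 : 0 < p := by linarith
  have hp1 : 0 < p - 1 := by linarith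
  have hs := H.hs0
  have hs1 := H.hs1
  have hn := H.hn
  have hnR : (2:ℝ) ≤ n := by exact_mod_cast hn
  have hc1 := c1_pos hn hp0
  have hc2 := c2_pos hn hp0
  have hm := m0_pos n
  have hps := pStar_gt H
  have hpi := pStar_inv H
  have hM := H.hM
  have hΛ := H.hΛ
  set K1 : ℝ := ((1 + M * (2 * Λ) ^ (q - p)) * 4 ^ (n + 1 : ℝ) / c1 n p) ^ (1 / p) with hK1
  have hK10 : 0 ≤ K1 := by positivity
  set D1 : ℝ := (4 * m0 n) ^ (1 / pStar n p s) with hD1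
  have hD10 : 0 ≤ D1 := by positivity
  have hmin : 0 < min 1 (c1 n p) := lt_min one_pos hc1
  have hmax : 0 < max 1 (c2 n p) := lt_max_of_lt_left one_pos
  refine ⟨K1 * C.toReal * (max 1 (c2 n p) + D1 ^ (1/(p-1)) / min 1 (c1 n p)) + 1, by positivity, ?_⟩
  intro ε hε _ hε2 hεs a am a0 aM asym δ₀ hδ₀ f fm hf u hu ub hw x₀ R hR hR1 σ hσ hσ1
  have he : ε * p < s := by rwa [lt_div_iff₀ hp0] at hεs
  have he1 : ε * p ≤ 1 := by linarith
  have hεle : ε ≤ 1 := by nlinarith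
  have um := hu.1
  have gf := memW_gf hp0 hu
  have ff : ∀ x₀ R, 0 < R → ∫⁻ x in ball (x₀ : En n) R, ‖f x‖ₑ ^ pStar n p s < ⊤ := fun x R hR => loc_ff (by linarith) hδ₀ (hf x R hR)
  have hSol := sc_Sol H am a0 aM asym fm ff hu ub hw x₀ hR hR1
  obtain ⟨g1, g2, g3, g4, g5, g6, g7⟩ := eps_par H hε hεs
  have hco := hcore _ _ g1 g2 g3 g4 g5 _ _ _ hSol
  have hg1 : 0 < s * p / (p - 1) - s - ε := by
    have : s * p / (p - 1) - s - ε = (s - ε * (p - 1)) / (p - 1) := by field_simp; ring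
    rw [this]; apply div_pos _ hp1; linarith
  have hg2 : 0 < t * q / (p - 1) - s - ε := by
    have e1 : s * (t * q / (s * p) - 1 / pC p) = (t * q - s * (p - 1)) / p := by unfold pC; field_simp
    rw [e1, lt_div_iff₀ hp0] at hε2
    have : t * q / (p - 1) - s - ε = (t * q - s * (p - 1) - ε * (p - 1)) / (p - 1) := by field_simp
    rw [this]; apply div_pos _ hp1; linarith
  have h1 := sc_tz H hε hεs um gf x₀ hR
  have h2 := sc_ST H hε hεs um gf x₀ hR hg1 hg2
  have h3 := sc_Fn H hε hεs fm x₀ hR (ff x₀ R hR)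
  have h4 := sc_G H hε hεs am a0 aM um ub x₀ hR hR1 K ⌈q⌉₊
  have hT0 := TT_nn n p s ε u x₀ R
  have hS0 : 0 ≤ ∑' k : ℕ, ((2 : ℝ) ^ (-(k : ℝ) * (s * p / (p - 1) - s - ε))
                      + (2 : ℝ) ^ (-(k : ℝ) * (t * q / (p - 1) - s - ε))) * TT n p s ε u x₀ (2 ^ k * R) :=
    tsum_nonneg fun k => mul_nonneg (by positivity) (TT_nn _ _ _ _ _ _ _)
  set T0 := TT n p s ε u x₀ R with hT0d
  set S := ∑' k : ℕ, ((2 : ℝ) ^ (-(k : ℝ) * (s * p / (p - 1) - s - ε))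
                      + (2 : ℝ) ^ (-(k : ℝ) * (t * q / (p - 1) - s - ε))) * TT n p s ε u x₀ (2 ^ k * R) with hSd
  set Y := (⨍ z in bB n x₀ R, |f z.1| ^ pStar n p s ∂nu n p ε) ^ (1 / pStar n p s) with hYd
  have hY0 : 0 ≤ Y := by
    rw [hYd]
    apply Real.rpow_nonneg
    rw [avg_eq (by fun_prop) (fun z => by positivity)]; exact ENNReal.toReal_nonneg
  set W : ℝ := R ^ (s + ε) * (c2 n p / ε) ^ (1 / etaEx n p s ε) with hWd
  have hW0 : 0 ≤ W := by positivity
  set X := (1 / σ) * T0 + σ * S with hXd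
  have hX0 : 0 ≤ X := by positivity
  have b1 : (tz n (etaEx n p s ε) (s * n / (n + ε * p)) (fun x => u (x₀ + R • x)) * STl n p (t * q) (etaEx n p s ε) (s * n / (n + ε * p)) (fun x => u (x₀ + R • x))) ^ ((1:ℝ)/2) 
      ≤ ENNReal.ofReal (W * X) := by
    calc _ ≤ (ENNReal.ofReal ((W * X) ^ (2:ℝ))) ^ ((1:ℝ)/2) := by
          apply ENNReal.rpow_le_rpow _ (by norm_num)
          refine (mul_le_mul' h1 h2).trans ?_
          rw [← ENNReal.ofReal_mul (by positivity)]
          apply ENNReal.ofReal_le_ofReal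
          rw [Real.rpow_two, mul_pow]
          have : T0 * S ≤ X ^ 2 := by
            have e : T0 * S = ((1 / σ) * T0) * (σ * S) := by field_simp
            have a1 : 0 ≤ (1 / σ) * T0 := by positivity
            have a2 : 0 ≤ σ * S := by positivity
            rw [e, hXd]; nlinarith
          calc W * T0 * (W * S) = W ^ 2 * (T0 * S) := by ring
            _ ≤ _ := by gcongr
      _ = _ := by
          rw [ENNReal.ofReal_rpow_of_nonneg (by positivity) (by norm_num), ← Real.rpow_mul (by positivity)]; norm_num
  have b2 : Fn n p s (fun x => R ^ (s * p) * f (x₀ + R • x)) ^ (1/(p-1)) ≤ ENNReal.ofReal ((R ^ (s * p) * (D1 * Y)) ^ (1/(p-1))) := by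
    rw [← ENNReal.ofReal_rpow_of_nonneg (by positivity) (by positivity)]
    exact ENNReal.rpow_le_rpow h3 (by positivity)
  have b3 : ENNReal.ofReal ((⨍ z in bB n x₀ (R / 4), Gfun n p q s t ε a u z ∂nu n p ε) ^ (1 / p)) ≤ 
     ENNReal.ofReal (K1 * ε ^ (1/p) * R ^ (-(s+ε)) * (C.toReal * (W * X + (R ^ (s * p) * (D1 * Y)) ^ (1/(p-1))))) := by
    refine h4.trans ?_
    rw [ENNReal.ofReal_mul (q := C.toReal * _) (by positivity), ENNReal.ofReal_mul (p := C.toReal) (by positivity), ENNReal.ofReal_add (by positivity) (by positivity), ENNReal.ofReal_toReal hC.ne]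
    exact mul_le_mul_right (hco.trans (mul_le_mul_right (add_le_add b1 b2) _)) _
  rw [ENNReal.ofReal_le_ofReal_iff (by positivity)] at b3
  refine b3.trans ?_
  have hnR0 : (0:ℝ) < n + ε * p := by positivity
  have hθ : 0 ≤ thetaEx n p s ε := by
    unfold thetaEx; apply div_nonneg _ hnR0.le; linarith
  have hθ1 : thetaEx n p s ε ≤ 1 := by
    unfold thetaEx; rw [div_le_one hnR0]; nlinarith
  have hNt : nu n p ε (bB n x₀ R) ≠ ⊤ := ((nu_up hn hp0 hε he1 x₀ hR).trans_lt ENNReal.ofReal_lt_top).ne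
  have hlo := nu_lo hn hp0 hε he1 x₀ hR
  refine fin_alg (θn := n + ε * p) hK10 ENNReal.toReal_nonneg hε hεle hR hp g1 hc1 hc2 hD10 hX0 hY0 ?_ hθ hθ1 ?_ ?_
  · rw [hpi]
    have : (p - 1) / p + s / n - 1 / pC p = s / n := by unfold pC; field_simp; ring
    rw [this]; positivity
  · have := (ENNReal.ofReal_le_iff_le_toReal hNt).1 hlo
    rw [div_le_iff₀ hε] at this
    linarith
  · unfold thetaEx; field_simp; ring

end

/-- **Proposition 3.5, reverse Hölder-type inequality**: under (A1)–(A3),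
for `ε < 1−s` with `ε ∈ (0, min{s(tq/(sp) − 1/p'), s/p})`, `η` as above, and any ball
`B = B_R(x₀)` with `R ≤ 1`, there is `C` (depending only on `n,p,q,s,t,M,‖u‖_∞`) such that
for any bounded weak solution `u` and any `σ ∈ (0,1)`:
`(⨍_{(1/4)𝓑} G dν)^{1/p} ≤ C ε^{−(1/η−1/p)}[σ^{−1}(⨍_𝓑 U^η dν)^{1/η}
  + σ Σ_k (2^{−k(sp/(p−1)−s−ε)} + 2^{−k(tq/(p−1)−s−ε)}) (⨍_{2^k𝓑} U^η dν)^{1/η}]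
  + C [εν(𝓑)]^{θ/(p−1)} ε^{−(1/p_*−1/p')/(p−1)} [(⨍_𝓑 F^{p_*} dν)^{1/p_*}]^{1/(p−1)}`. -/
theorem stmt_9 (n : ℕ) (hn : 2 ≤ n) (p q s t M Λ : ℝ)
    (hp : 2 ≤ p) (hpq : p ≤ q)
    (hs0 : 0 < s) (hs1 : s < 1) (ht0 : 0 < t) (ht1 : t < 1) (hts : t ≤ s)
    (hlow : 1 / pC p ≤ t * q / (s * p)) (hhigh : t * q / (s * p) ≤ 1)
    (hspn : s * p < n) :
    ∃ C : ℝ, 0 < C ∧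
      ∀ ε : ℝ, 0 < ε → ε < 1 - s → ε < s * (t * q / (s * p) - 1 / pC p) → ε < s / p →
      ∀ a : En n × En n → ℝ, Measurable a →
        (∀ z, 0 ≤ a z) → (∀ z, a z ≤ M) → (∀ x y, a (x, y) = a (y, x)) →
      ∀ δ₀ : ℝ, 0 < δ₀ →
      ∀ f : En n → ℝ, Measurable f →
        (∀ (x₀ : En n) (R : ℝ), 0 < R →
          (∫⁻ x in ball x₀ R, ENNReal.ofReal (|f x| ^ (pStar n p s + δ₀))) < ⊤) →
      ∀ u : En n → ℝ, MemWsp n s p u → (∀ x, |u x| ≤ Λ) →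
        IsBoundedWeakSolution n p q s t a u f →
      ∀ (x₀ : En n) (R : ℝ), 0 < R → R ≤ 1 →
      ∀ σ : ℝ, 0 < σ → σ < 1 →
        (⨍ z in bB n x₀ (R / 4), Gfun n p q s t ε a u z ∂nu n p ε) ^ (1 / p) ≤
          C / ε ^ (1 / etaEx n p s ε - 1 / p) *
            ((1 / σ) *
                (⨍ z in bB n x₀ R, Ufun n s ε u z ^ etaEx n p s ε ∂nu n p ε) ^
                  (1 / etaEx n p s ε)
              + σ * ∑' k : ℕ,
                  ((2 : ℝ) ^ (-(k : ℝ) * (s * p / (p - 1) - s - ε))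
                      + (2 : ℝ) ^ (-(k : ℝ) * (t * q / (p - 1) - s - ε))) *
                    (⨍ z in bB n x₀ (2 ^ k * R),
                        Ufun n s ε u z ^ etaEx n p s ε ∂nu n p ε) ^ (1 / etaEx n p s ε))
          + C * (ε * (nu n p ε (bB n x₀ R)).toReal) ^ (thetaEx n p s ε / (p - 1))
              / ε ^ ((1 / pStar n p s - 1 / pC p) / (p - 1)) *
              ((⨍ z in bB n x₀ R, |f z.1| ^ pStar n p s ∂nu n p ε) ^
                  (1 / pStar n p s)) ^ (1 / (p - 1)) := by
  have hp0 : 0 < p := by linarith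
  have htq : t * q ≤ s * p := by rwa [div_le_one (by positivity)] at hhigh
  by_cases hM : 0 ≤ M ∧ 0 ≤ Λ
  · exact main_pos ⟨hn, hp, hpq, hs0, hs1, ht0, ht1, htq, hspn, hM.1, hM.2⟩
  · refine ⟨1, one_pos, ?_⟩
    intro ε _ _ _ _ a _ a0 aM _ δ₀ _ f _ _ u _ ub
    exact absurd ⟨(a0 0).trans (aM 0), (abs_nonneg _).trans (ub 0)⟩ hM

end
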